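/- Suppose the correlation length condition (CL) holds. If at least one of the critical exponents γ, ν, Δ is well-defined, then all three are well-defined and satisfy the scaling relations γ = (2−η)ν and Δ = ν·d_f, where 2−η = α and d_f = min{(d+α)/2, 2α}. -/

import Mathlib

open MeasureTheory ENNReal Filter
open scoped Classical

namespace LRP

/-! ## Generic Bernoulli bond percolation -/

/-- The probability that an edge with rate `t ≥ 0` is open: `1 - e^{-t}`. -/
noncomputable def edgeProb (t : ℝ) : ℝ := 1 - Real.exp (-t)

/-- `μ` is the law of Bernoulli bond percolation in which every unordered pair `e`
of vertices is open independently with probability `p e`: every finite cylinder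
event has the corresponding product probability.  (This characterises `μ` uniquely.) -/
def IsPerc {Vt : Type*} (μ : Measure (Sym2 Vt → Bool)) (p : Sym2 Vt → ℝ) : Prop :=
  IsProbabilityMeasure μ ∧
    ∀ (s : Finset (Sym2 Vt)) (f : Sym2 Vt → Bool),
      μ {ω | ∀ e ∈ s, ω e = f e} =
        ∏ e ∈ s, ENNReal.ofReal (if f e then p e else 1 - p e)

/-- Two vertices are connected if they are joined by a path of open edges. -/
def Conn {Vt : Type*} (ω : Sym2 Vt → Bool) (x y : Vt) : Prop :=
  Relation.ReflTransGen (fun a b => ω s(a, b) = true) x y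

/-- The open cluster of a vertex. -/
def cluster {Vt : Type*} (ω : Sym2 Vt → Bool) (x : Vt) : Set Vt := {y | Conn ω x y}

/-- The number of points of a set, as an extended nonnegative real. -/
noncomputable def eCard {Vt : Type*} (s : Set Vt) : ℝ≥0∞ :=
  if s.Finite then (s.ncard : ℝ≥0∞) else ∞

/-! ## Long-range percolation on `ℤ^d` -/

abbrev V (d : ℕ) := Fin d → ℤ

abbrev Config (d : ℕ) := Sym2 (V d) → Bool

noncomputable def toR {d : ℕ} (x : V d) : Fin d → ℝ := fun i => (x i : ℝ)

/-- The Euclidean norm of a lattice point. -/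
noncomputable def enorm2 {d : ℕ} (x : V d) : ℝ := Real.sqrt (∑ i, ((x i : ℝ)) ^ 2)

/-- The `p`-th moment of the volume of the cluster of the origin. -/
noncomputable def clMom {d : ℕ} (μ : Measure (Config d)) (p : ℕ) : ℝ≥0∞ :=
  ∫⁻ ω, (eCard (cluster ω (0 : V d))) ^ p ∂μ

/-- `E Σ_{x ∈ K} ‖x‖₂^p`. -/
noncomputable def gyr {d : ℕ} (μ : Measure (Config d)) (p : ℝ) : ℝ≥0∞ :=
  ∫⁻ ω, ∑' x : cluster ω (0 : V d), ENNReal.ofReal (enorm2 (x : V d) ^ p) ∂μ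

/-- The `L^p` radius of gyration. -/
noncomputable def xi {d : ℕ} (μ : Measure (Config d)) (p : ℝ) : ℝ≥0∞ :=
  (gyr μ p / clMom μ 1) ^ (1 / p)

/-- A decreasing function `(0, ∞) → (0, 1]` decaying faster than any power. -/
def RapidDecay (h : ℝ → ℝ) : Prop :=
  AntitoneOn h (Set.Ioi (0 : ℝ)) ∧ (∀ t : ℝ, 0 < t → 0 < h t ∧ h t ≤ 1) ∧
    ∀ p : ℝ, 0 < p → Tendsto (fun t => h t * t ^ p) atTop (nhds 0)

/-- The data of a long-range percolation kernel `J(x,y) = 𝟙(x ≠ y) J(‖x - y‖)` on `ℤ^d`,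
together with the standing regularity and normalisation assumptions: `‖⋅‖` is a norm
whose unit ball has unit Lebesgue measure, `J` is decreasing and differentiable with
`|J'(r)| = (1 + δ_r) r^{-d-α-1}`, `δ_r → 0`, and `∫_{r₀}^∞ |δ_r| dr/r < ∞`. -/
structure Kernel (d : ℕ) (α : ℝ) where
  N : Seminorm ℝ (Fin d → ℝ)
  N_pos : ∀ x : Fin d → ℝ, x ≠ 0 → 0 < N x
  N_ball : volume {x : Fin d → ℝ | N x ≤ 1} = 1
  J : ℝ → ℝ
  J' : ℝ → ℝ
  δ : ℝ → ℝ
  J_nonneg : ∀ r : ℝ, 0 < r → 0 ≤ J r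
  J_anti : AntitoneOn J (Set.Ioi (0 : ℝ))
  J_hasDeriv : ∀ r : ℝ, 0 < r → HasDerivAt J (J' r) r
  J'_eq : ∀ r : ℝ, 0 < r → |J' r| = (1 + δ r) * r ^ (-(d : ℝ) - α - 1)
  δ_lim : Tendsto δ atTop (nhds 0)
  δ_int : ∃ r₀ : ℝ, 0 < r₀ ∧ IntegrableOn (fun r => |δ r| / r) (Set.Ioi r₀)

namespace Kernel

variable {d : ℕ} {α : ℝ} (κ : Kernel d α)

/-- The distance between two lattice points in the norm `N`. -/
noncomputable def nd (x y : V d) : ℝ := κ.N (toR x - toR y)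

theorem nd_symm (x y : V d) : κ.nd x y = κ.nd y x := by
  show κ.N (toR x - toR y) = κ.N (toR y - toR x)
  rw [show toR y - toR x = -(toR x - toR y) by abel, map_neg_eq_map]

/-- The kernel `J(x, y)`. -/
noncomputable def ker (x y : V d) : ℝ := if x = y then 0 else κ.J (κ.nd x y)

theorem ker_symm (x y : V d) : κ.ker x y = κ.ker y x := by
  show (if x = y then 0 else κ.J (κ.nd x y)) = (if y = x then 0 else κ.J (κ.nd y x))
  rw [κ.nd_symm x y]
  exact if_congr eq_comm rfl rfl

/-- The cut-off kernel `J_r(x, y)`. -/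
noncomputable def kerCut (r : ℝ) (x y : V d) : ℝ :=
  if x ≠ y ∧ κ.nd x y ≤ r then ∫ s in Set.Ioc (κ.nd x y) r, |κ.J' s| else 0

theorem kerCut_symm (r : ℝ) (x y : V d) : κ.kerCut r x y = κ.kerCut r y x := by
  show (if x ≠ y ∧ κ.nd x y ≤ r then ∫ s in Set.Ioc (κ.nd x y) r, |κ.J' s| else 0) =
    (if y ≠ x ∧ κ.nd y x ≤ r then ∫ s in Set.Ioc (κ.nd y x) r, |κ.J' s| else 0)
  rw [κ.nd_symm x y]
  exact if_congr (and_congr_left' ne_comm) rfl rfl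

/-- Edge probabilities at inverse temperature `β` for the kernel `J`. -/
noncomputable def edgeP (β : ℝ) : Sym2 (V d) → ℝ :=
  Sym2.lift ⟨fun x y => edgeProb (β * κ.ker x y), fun x y => by
    show edgeProb (β * κ.ker x y) = edgeProb (β * κ.ker y x)
    rw [κ.ker_symm x y]⟩

/-- Edge probabilities at inverse temperature `β` for the cut-off kernel `J_r`. -/
noncomputable def edgePCut (β r : ℝ) : Sym2 (V d) → ℝ :=
  Sym2.lift ⟨fun x y => edgeProb (β * κ.kerCut r x y), fun x y => by
    show edgeProb (β * κ.kerCut r x y) = edgeProb (β * κ.kerCut r y x)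
    rw [κ.kerCut_symm r x y]⟩

/-- The ball of radius `r` about the origin of `ℤ^d`, in the norm `N`. -/
def ball (r : ℝ) : Set (V d) := {x : V d | κ.N (toR x) ≤ r}

/-- There is an infinite cluster with positive probability at `β`. -/
def percolates (β : ℝ) : Prop :=
  ∀ μ : Measure (Config d), IsPerc μ (κ.edgeP β) →
    0 < μ {ω | ∃ x : V d, (cluster ω x).Infinite}

/-- The critical point `β_c`. -/
noncomputable def betaC : ℝ := sInf {β : ℝ | 0 ≤ β ∧ κ.percolates β}

/-- The correlation length condition for effectively long-range critical behaviour: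
`β_c < ∞` and for every `p > 0` the `L^p` radius of gyration of the cut-off model
at `β_c` satisfies `ξ_p(β_c, r) ≤ C_p r`. -/
def CL : Prop :=
  (∃ β : ℝ, 0 ≤ β ∧ κ.percolates β) ∧
    ∀ p : ℝ, 0 < p → ∃ C : ℝ, 0 < C ∧
      ∀ r : ℝ, 1 ≤ r → ∀ μ : Measure (Config d), IsPerc μ (κ.edgePCut κ.betaC r) →
        xi μ p ≤ ENNReal.ofReal (C * r)

/-- The weak correlation length condition: `β_c < ∞` and for each `ε > 0` there is
`C` with `E_{β_c,r}|K|^p ≤ (1+ε) E_{β_c,r}|K ∩ B_{Cr}|^p` for all `r ≥ 1`, `p = 1,2,3,4`. -/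
def wCL : Prop :=
  (∃ β : ℝ, 0 ≤ β ∧ κ.percolates β) ∧
    ∀ ε : ℝ, 0 < ε → ∃ C : ℝ, 0 < C ∧
      ∀ r : ℝ, 1 ≤ r → ∀ p : ℕ, p ∈ ({1, 2, 3, 4} : Finset ℕ) →
        ∀ μ : Measure (Config d), IsPerc μ (κ.edgePCut κ.betaC r) →
          (∫⁻ ω, (eCard (cluster ω (0 : V d))) ^ p ∂μ) ≤
            ENNReal.ofReal (1 + ε) *
              ∫⁻ ω, (eCard (cluster ω (0 : V d) ∩ κ.ball (C * r))) ^ p ∂μ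

/-- The `p`-th moment `E_β |K|^p` (for the full kernel). -/
noncomputable def mom (β : ℝ) (p : ℕ) : ℝ≥0∞ :=
  ⨆ μ ∈ {μ : Measure (Config d) | IsPerc μ (κ.edgeP β)}, clMom μ p

/-- The susceptibility `χ(β) = E_β |K|`. -/
noncomputable def chi (β : ℝ) : ℝ≥0∞ := κ.mom β 1

/-- `ζ(β) = E_β|K|² / E_β|K|`. -/
noncomputable def zeta (β : ℝ) : ℝ≥0∞ := κ.mom β 2 / κ.mom β 1

/-- The tail `P_β(|K| ≥ n)` of the cluster volume. -/
noncomputable def tailP (β : ℝ) (n : ℕ) : ℝ≥0∞ :=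
  ⨆ μ ∈ {μ : Measure (Config d) | IsPerc μ (κ.edgeP β)},
    μ {ω | (n : ℝ≥0∞) ≤ eCard (cluster ω (0 : V d))}

/-- The `L^p` radius of gyration `ξ_p(β)` (for the full kernel). -/
noncomputable def xiFull (β : ℝ) (p : ℝ) : ℝ≥0∞ :=
  ⨆ μ ∈ {μ : Measure (Config d) | IsPerc μ (κ.edgeP β)}, xi μ p

/-- The `p`-th moment `E_{β,r} |K|^p` for the cut-off kernel. -/
noncomputable def momCut (β r : ℝ) (p : ℕ) : ℝ≥0∞ :=
  ⨆ μ ∈ {μ : Measure (Config d) | IsPerc μ (κ.edgePCut β r)}, clMom μ p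

/-- `ξ*(β) = χ(β)^{1/α}`. -/
noncomputable def xiStar (β : ℝ) : ℝ := (κ.chi β).toReal ^ α⁻¹

/-- `ζ*(β) = ζ(β_c, ξ*(β))`, where `ζ(β,r) = E_{β,r}|K|²/E_{β,r}|K|`. -/
noncomputable def zetaStar (β : ℝ) : ℝ :=
  (κ.momCut κ.betaC (κ.xiStar β) 2 / κ.momCut κ.betaC (κ.xiStar β) 1).toReal

/-- The edian `M_r` of the maximal cluster volume in `B_r` under `P_{β_c, r}`. -/
noncomputable def MrCut (r : ℝ) : ℕ :=
  sInf {n : ℕ | ∀ μ : Measure (Config d), IsPerc μ (κ.edgePCut κ.betaC r) →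
    μ {ω | ∃ x : V d, (n : ℝ≥0∞) ≤ eCard (cluster ω x ∩ κ.ball r)} ≤
      ENNReal.ofReal (Real.exp (-1))}

/-- The edian `M_r^*` of the maximal cluster volume in `B_r` under `P_{β_c}`. -/
noncomputable def MrFull (r : ℝ) : ℕ :=
  sInf {n : ℕ | ∀ μ : Measure (Config d), IsPerc μ (κ.edgeP κ.betaC) →
    μ {ω | ∃ x : V d, (n : ℝ≥0∞) ≤ eCard (cluster ω x ∩ κ.ball r)} ≤
      ENNReal.ofReal (Real.exp (-1))}

/-- `f(β) = |β - β_c|^{-c ± o(1)}` as `β ↑ β_c`, i.e. the critical exponent of `f`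
at `β_c` is well-defined and equal to `c`. -/
def HasExp (f : ℝ → ℝ≥0∞) (c : ℝ) : Prop :=
  Tendsto (fun β => Real.log (f β).toReal / Real.log (1 / (κ.betaC - β)))
    (nhdsWithin κ.betaC (Set.Iio κ.betaC)) (nhds c)

end Kernel

end LRP

set_option linter.unusedSectionVars false
set_option linter.unusedVariables false

namespace LRP
section Bernoulli
variable {ι : Type*} [DecidableEq ι]

/-- Expectation of `f` of the open set under Bernoulli percolation on the finite set `s`. -/
noncomputable def bE (s : Finset ι) (p : ι → ℝ) (f : Finset ι → ℝ) : ℝ :=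
  ∑ ω ∈ s.powerset, (∏ e ∈ ω, p e) * (∏ e ∈ s \ ω, (1 - p e)) * f ω

theorem bE_empty (p : ι → ℝ) (f : Finset ι → ℝ) : bE ∅ p f = f ∅ := by
  simp [bE]

theorem bE_insert {s : Finset ι} {e : ι} (he : e ∉ s) (p : ι → ℝ) (f : Finset ι → ℝ) :
    bE (insert e s) p f = (1 - p e) * bE s p f + p e * bE s p (fun ω => f (insert e ω)) := by
  unfold bE
  rw [Finset.sum_powerset_insert he, Finset.mul_sum, Finset.mul_sum]
  congr 1
  · refine Finset.sum_congr rfl fun ω hω => ?_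
    have h1 : e ∉ ω := fun h => he (Finset.mem_powerset.1 hω h)
    rw [Finset.insert_sdiff_of_notMem _ h1, Finset.prod_insert (by simp [he])]
    ring
  · refine Finset.sum_congr rfl fun ω hω => ?_
    have h1 : e ∉ ω := fun h => he (Finset.mem_powerset.1 hω h)
    rw [Finset.prod_insert h1, Finset.insert_sdiff_insert, Finset.sdiff_insert_of_notMem he]
    ring

theorem bE_congr {s : Finset ι} {p : ι → ℝ} {f g : Finset ι → ℝ} (h : ∀ ω ⊆ s, f ω = g ω) :
    bE s p f = bE s p g :=
  Finset.sum_congr rfl fun ω hω => by rw [h ω (Finset.mem_powerset.1 hω)]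

theorem bE_congr_p {s : Finset ι} {p q : ι → ℝ} {f : Finset ι → ℝ} (h : ∀ e ∈ s, p e = q e) :
    bE s p f = bE s q f := by
  refine Finset.sum_congr rfl fun ω hω => ?_
  have h1 : ∏ e ∈ ω, p e = ∏ e ∈ ω, q e :=
    Finset.prod_congr rfl fun e he => h e (Finset.mem_powerset.1 hω he)
  have h2 : ∏ e ∈ s \ ω, (1 - p e) = ∏ e ∈ s \ ω, (1 - q e) :=
    Finset.prod_congr rfl fun e he => by rw [h e (Finset.mem_sdiff.1 he).1]
  rw [h1, h2]

theorem bE_add (s : Finset ι) (p : ι → ℝ) (f g : Finset ι → ℝ) :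
    bE s p (fun ω => f ω + g ω) = bE s p f + bE s p g := by
  simp only [bE, mul_add, Finset.sum_add_distrib]

theorem bE_sub (s : Finset ι) (p : ι → ℝ) (f g : Finset ι → ℝ) :
    bE s p (fun ω => f ω - g ω) = bE s p f - bE s p g := by
  simp only [bE, mul_sub, Finset.sum_sub_distrib]

theorem bE_const_mul (s : Finset ι) (p : ι → ℝ) (c : ℝ) (f : Finset ι → ℝ) :
    bE s p (fun ω => c * f ω) = c * bE s p f := by
  simp only [bE, Finset.mul_sum]
  exact Finset.sum_congr rfl fun _ _ => by ring

theorem bE_mul_const (s : Finset ι) (p : ι → ℝ) (c : ℝ) (f : Finset ι → ℝ) :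
    bE s p (fun ω => f ω * c) = bE s p f * c := by
  rw [mul_comm, ← bE_const_mul]; simp only [mul_comm]

theorem bE_sum {κ : Type*} (s : Finset ι) (p : ι → ℝ) (t : Finset κ) (f : κ → Finset ι → ℝ) :
    bE s p (fun ω => ∑ i ∈ t, f i ω) = ∑ i ∈ t, bE s p (f i) := by
  simp only [bE, Finset.mul_sum]
  exact Finset.sum_comm

theorem bE_const (s : Finset ι) (p : ι → ℝ) (c : ℝ) : bE s p (fun _ => c) = c := by
  induction s using Finset.induction_on with
  | empty => simp [bE_empty]
  | insert e s he ih => rw [bE_insert he, ih]; ring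

theorem bE_mono {s : Finset ι} {p : ι → ℝ} {f g : Finset ι → ℝ}
    (hp : ∀ e, p e ∈ Set.Icc (0 : ℝ) 1) (h : ∀ ω ⊆ s, f ω ≤ g ω) : bE s p f ≤ bE s p g := by
  refine Finset.sum_le_sum fun ω hω => mul_le_mul_of_nonneg_left (h ω (Finset.mem_powerset.1 hω)) ?_
  exact mul_nonneg (Finset.prod_nonneg fun e _ => (hp e).1)
    (Finset.prod_nonneg fun e _ => by linarith [(hp e).2])

theorem bE_nonneg {s : Finset ι} {p : ι → ℝ} {f : Finset ι → ℝ}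
    (hp : ∀ e, p e ∈ Set.Icc (0 : ℝ) 1) (h : ∀ ω ⊆ s, 0 ≤ f ω) : 0 ≤ bE s p f := by
  simpa [bE_const] using bE_mono (f := fun _ => 0) hp h

theorem mono_insert {f : Finset ι → ℝ} (hf : Monotone f) (e : ι) :
    Monotone fun ω => f (insert e ω) :=
  fun _ _ h => hf (Finset.insert_subset_insert e h)

theorem bE_le_insert {s : Finset ι} {p : ι → ℝ} {f : Finset ι → ℝ}
    (hp : ∀ e, p e ∈ Set.Icc (0 : ℝ) 1) (hf : Monotone f) (e : ι) :
    bE s p f ≤ bE s p (fun ω => f (insert e ω)) :=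
  bE_mono hp fun ω _ => hf (Finset.subset_insert e ω)

theorem bE_mono_set {s t : Finset ι} {p : ι → ℝ} {f : Finset ι → ℝ}
    (hp : ∀ e, p e ∈ Set.Icc (0 : ℝ) 1) (hf : Monotone f) (h : s ⊆ t) :
    bE s p f ≤ bE t p f := by
  obtain ⟨u, rfl⟩ : ∃ u, t = u ∪ s := ⟨t, by simp [h]⟩
  clear h
  induction u using Finset.induction_on with
  | empty => simp
  | insert e u he ih =>
    rw [Finset.insert_union]
    by_cases h : e ∈ u ∪ s
    · rwa [Finset.insert_eq_of_mem h]
    · rw [bE_insert h]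
      nlinarith [bE_le_insert (s := u ∪ s) hp hf e, (hp e).1, (hp e).2]

theorem bE_mono_p {s : Finset ι} {p q : ι → ℝ} {f : Finset ι → ℝ}
    (hp : ∀ e, p e ∈ Set.Icc (0 : ℝ) 1) (hq : ∀ e, q e ∈ Set.Icc (0 : ℝ) 1)
    (hpq : ∀ e, p e ≤ q e) (hf : Monotone f) :
    bE s p f ≤ bE s q f := by
  induction s using Finset.induction_on generalizing f with
  | empty => simp [bE_empty]
  | insert e s he ih =>
    rw [bE_insert he, bE_insert he]
    nlinarith [ih hf, ih (mono_insert hf e), bE_le_insert (s := s) hq hf e, (hp e).1, (hp e).2,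
      hpq e, mul_nonneg (sub_nonneg.2 (hpq e)) (sub_nonneg.2 (bE_le_insert (s := s) hq hf e)),
      mul_nonneg (hp e).1 (sub_nonneg.2 (ih (mono_insert hf e))),
      mul_nonneg (sub_nonneg.2 (hp e).2) (sub_nonneg.2 (ih hf))]

theorem bE_harris {s : Finset ι} {p : ι → ℝ} {f g : Finset ι → ℝ}
    (hp : ∀ e, p e ∈ Set.Icc (0 : ℝ) 1) (hf : Monotone f) (hg : Monotone g) :
    bE s p f * bE s p g ≤ bE s p (fun ω => f ω * g ω) := by
  induction s using Finset.induction_on generalizing f g with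
  | empty => simp [bE_empty]
  | insert e s he ih =>
    rw [bE_insert he, bE_insert he, bE_insert he]
    have h1 := ih hf hg
    have h2 := ih (mono_insert hf e) (mono_insert hg e)
    have h3 := bE_le_insert (s := s) hp hf e
    have h4 := bE_le_insert (s := s) hp hg e
    have h0 := (hp e).1
    have h0' := (hp e).2
    nlinarith [mul_nonneg h0 (sub_nonneg.2 h2), mul_nonneg (sub_nonneg.2 h0') (sub_nonneg.2 h1),
      mul_nonneg (mul_nonneg h0 (sub_nonneg.2 h0')) (mul_nonneg (sub_nonneg.2 h3) (sub_nonneg.2 h4))]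

theorem bE_merge (s : Finset ι) (p q : ι → ℝ) (f : Finset ι → ℝ) :
    bE s (fun e => p e + q e - p e * q e) f =
      bE s p (fun ω => bE s q (fun η => f (ω ∪ η))) := by
  induction s using Finset.induction_on generalizing f with
  | empty => simp [bE_empty]
  | insert e s he ih =>
    rw [bE_insert he, bE_insert he, ih, ih]
    simp only [bE_insert he, bE_add, bE_const_mul, Finset.insert_union, Finset.union_insert,
      Finset.insert_idem]
    ring

theorem bE_union {s t : Finset ι} (h : Disjoint s t) (p : ι → ℝ) (f : Finset ι → ℝ) :
    bE (s ∪ t) p f = bE s p (fun ω => bE t p (fun η => f (ω ∪ η))) := by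
  induction s using Finset.induction_on generalizing f with
  | empty => simp [bE_empty]
  | insert e s he ih =>
    rw [Finset.disjoint_insert_left] at h
    rw [Finset.insert_union, bE_insert (by simp [he, h.1]), bE_insert he, ih h.2, ih h.2]
    simp only [Finset.insert_union]

theorem bE_map {ι' : Type*} [DecidableEq ι'] (φ : ι ↪ ι') (s : Finset ι) (p : ι' → ℝ)
    (f : Finset ι' → ℝ) :
    bE (s.map φ) p f = bE s (fun e => p (φ e)) (fun ω => f (ω.map φ)) := by
  induction s using Finset.induction_on generalizing f with
  | empty => simp [bE_empty]
  | insert e s he ih =>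
    rw [Finset.map_insert, bE_insert (by simpa using he), bE_insert he, ih, ih]
    simp only [Finset.map_insert]

theorem bE_cauchy_schwarz {s : Finset ι} {p : ι → ℝ} (hp : ∀ e, p e ∈ Set.Icc (0 : ℝ) 1)
    (f g : Finset ι → ℝ) :
    bE s p (fun ω => f ω * g ω) ^ 2 ≤ bE s p (fun ω => f ω ^ 2) * bE s p (fun ω => g ω ^ 2) := by
  have h : ∀ t : ℝ, 0 ≤ bE s p (fun ω => f ω ^ 2) * (t * t) +
      (2 * bE s p (fun ω => f ω * g ω)) * t + bE s p (fun ω => g ω ^ 2) := fun t => by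
    have : bE s p (fun ω => (t * f ω + g ω) ^ 2) = bE s p (fun ω => f ω ^ 2) * (t * t) +
      (2 * bE s p (fun ω => f ω * g ω)) * t + bE s p (fun ω => g ω ^ 2) := by
      rw [← bE_mul_const, ← bE_const_mul, ← bE_mul_const, ← bE_add, ← bE_add]
      exact bE_congr fun _ _ => by ring
    rw [← this]
    exact bE_nonneg hp fun _ _ => sq_nonneg _
  have := discrim_le_zero h
  rw [discrim] at this
  nlinarith

/-- Russo's formula. -/
theorem bE_hasDerivAt (s : Finset ι) (p : ℝ → ι → ℝ) (u : ι → ℝ) (t : ℝ)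
    (hp : ∀ e, HasDerivAt (fun t => p t e) (u e * (1 - p t e)) t) (f : Finset ι → ℝ) :
    HasDerivAt (fun t => bE s (p t) f)
      (∑ e ∈ s, u e * bE s (p t) (fun ω => f (insert e ω) - f ω)) t := by
  induction s using Finset.induction_on generalizing f with
  | empty => simpa [bE_empty] using hasDerivAt_const t (f ∅)
  | insert e s he ih =>
    simp only [bE_insert he]
    refine ((((hp e).const_sub 1).mul (ih f)).add ((hp e).mul
      (ih (fun ω => f (insert e ω))))).congr_deriv ?_
    rw [Finset.sum_insert he]
    simp only [Finset.insert_idem, sub_self, bE_const, bE_sub]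
    have : ∀ e' ∈ s, u e' * ((1 - p t e) * (bE s (p t) (fun ω => f (insert e' ω)) - bE s (p t) f)
        + p t e * (bE s (p t) (fun ω => f (insert e' (insert e ω)))
          - bE s (p t) (fun ω => f (insert e ω)))) =
        (1 - p t e) * (u e' * (bE s (p t) (fun ω => f (insert e' ω)) - bE s (p t) f)) +
        p t e * (u e' * (bE s (p t) (fun ω => f (insert e (insert e' ω)))
          - bE s (p t) (fun ω => f (insert e ω)))) := fun e' _ => by
      simp only [Finset.insert_comm e e']; ring
    rw [Finset.sum_congr rfl this, Finset.sum_add_distrib, ← Finset.mul_sum, ← Finset.mul_sum]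
    ring

/-- The indicator of a proposition. -/
noncomputable def ind (P : Prop) : ℝ := if P then 1 else 0

theorem ind_nonneg (P : Prop) : 0 ≤ ind P := by unfold ind; split_ifs <;> norm_num

theorem ind_le_one (P : Prop) : ind P ≤ 1 := by unfold ind; split_ifs <;> norm_num

theorem ind_mono {P Q : Prop} (h : P → Q) : ind P ≤ ind Q := by
  unfold ind; split_ifs <;> first | (exfalso; tauto) | norm_num

theorem ind_and (P Q : Prop) : ind (P ∧ Q) = ind P * ind Q := by
  unfold ind; split_ifs <;> first | (exfalso; tauto) | norm_num

theorem ind_or_add (P Q : Prop) : ind (P ∨ Q) + ind (P ∧ Q) = ind P + ind Q := by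
  unfold ind; split_ifs <;> first | (exfalso; tauto) | norm_num

theorem ind_not (P : Prop) : ind (¬ P) = 1 - ind P := by
  by_cases h : P <;> simp [ind, h]

theorem ind_true {P : Prop} (h : P) : ind P = 1 := if_pos h

theorem ind_false {P : Prop} (h : ¬ P) : ind P = 0 := if_neg h

theorem ind_congr {P Q : Prop} (h : P ↔ Q) : ind P = ind Q := by rw [propext h]

/-- Two disjoint open witnesses `I`, `J` with `W I J`. -/
def DisjOcc (W : Finset ι → Finset ι → Prop) (ω : Finset ι) : Prop :=
  ∃ I J, I ⊆ ω ∧ J ⊆ ω ∧ Disjoint I J ∧ W I J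

theorem disjOcc_insert {W : Finset ι → Finset ι → Prop} {ω : Finset ι} {e : ι} (he : e ∉ ω) :
    DisjOcc W (insert e ω) ↔
      DisjOcc (fun I J => W I J ∨ W (insert e I) J ∨ W I (insert e J)) ω := by
  constructor
  · rintro ⟨I, J, hI, hJ, hd, hW⟩
    by_cases h1 : e ∈ I
    · have h2 : e ∉ J := Finset.disjoint_left.1 hd h1
      refine ⟨I.erase e, J, ?_, ?_, hd.mono_left (Finset.erase_subset _ _), Or.inr (Or.inl ?_)⟩
      · rwa [← Finset.subset_insert_iff]
      · rwa [Finset.subset_insert_iff_of_notMem h2] at hJ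
      · rwa [Finset.insert_erase h1]
    · rw [Finset.subset_insert_iff_of_notMem h1] at hI
      by_cases h2 : e ∈ J
      · refine ⟨I, J.erase e, hI, ?_, hd.mono_right (Finset.erase_subset _ _), Or.inr (Or.inr ?_)⟩
        · rwa [← Finset.subset_insert_iff]
        · rwa [Finset.insert_erase h2]
      · rw [Finset.subset_insert_iff_of_notMem h2] at hJ
        exact ⟨I, J, hI, hJ, hd, Or.inl hW⟩
  · rintro ⟨I, J, hI, hJ, hd, hW⟩
    rcases hW with hW | hW | hW
    · exact ⟨I, J, hI.trans (Finset.subset_insert _ _), hJ.trans (Finset.subset_insert _ _), hd, hW⟩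
    · exact ⟨insert e I, J, Finset.insert_subset_insert _ hI, hJ.trans (Finset.subset_insert _ _),
        Finset.disjoint_insert_left.2 ⟨fun h => he (hJ h), hd⟩, hW⟩
    · exact ⟨I, insert e J, hI.trans (Finset.subset_insert _ _), Finset.insert_subset_insert _ hJ,
        Finset.disjoint_insert_right.2 ⟨fun h => he (hI h), hd⟩, hW⟩

theorem bE_disjOcc_le {s : Finset ι} {p : ι → ℝ} (hp : ∀ e, p e ∈ Set.Icc (0 : ℝ) 1)
    (W : Finset ι → Finset ι → Prop) :
    bE s p (fun ω => ind (DisjOcc W ω)) ≤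
      bE s p (fun ω => bE s p (fun η => ind (∃ I J, I ⊆ ω ∧ J ⊆ η ∧ W I J))) := by
  induction s using Finset.induction_on generalizing W with
  | empty =>
    simp only [bE_empty]
    refine ind_mono ?_
    rintro ⟨I, J, hI, hJ, -, hW⟩
    exact ⟨I, J, hI, hJ, hW⟩
  | insert e s he ih =>
    have key : ∀ (W' : Finset ι → Finset ι → Prop) (Q : Finset ι → Finset ι → Prop),
        (∀ ω η I J, I ⊆ ω → J ⊆ η → W' I J → Q ω η) →
        bE s p (fun ω => ind (DisjOcc W' ω)) ≤
          bE s p (fun ω => bE s p (fun η => ind (Q ω η))) := fun W' Q h =>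
      (ih W').trans (bE_mono hp fun ω _ => bE_mono hp fun η _ => ind_mono <| by
        rintro ⟨I, J, hI, hJ, hW⟩
        exact h ω η I J hI hJ hW)
    have h1 := key W (fun ω η => ∃ I J, I ⊆ ω ∧ J ⊆ η ∧ W I J)
      fun ω η I J hI hJ hW => ⟨I, J, hI, hJ, hW⟩
    have h2 := key (fun I J => W I J ∨ W (insert e I) J)
      (fun ω η => ∃ I J, I ⊆ insert e ω ∧ J ⊆ η ∧ W I J) fun ω η I J hI hJ hW => by
        rcases hW with hW | hW
        · exact ⟨I, J, hI.trans (Finset.subset_insert _ _), hJ, hW⟩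
        · exact ⟨_, J, Finset.insert_subset_insert _ hI, hJ, hW⟩
    have h3 := key (fun I J => W I J ∨ W I (insert e J))
      (fun ω η => ∃ I J, I ⊆ ω ∧ J ⊆ insert e η ∧ W I J) fun ω η I J hI hJ hW => by
        rcases hW with hW | hW
        · exact ⟨I, J, hI, hJ.trans (Finset.subset_insert _ _), hW⟩
        · exact ⟨I, _, hI, Finset.insert_subset_insert _ hJ, hW⟩
    have h4 := key (fun I J => W I J ∨ W (insert e I) J ∨ W I (insert e J))
      (fun ω η => ∃ I J, I ⊆ insert e ω ∧ J ⊆ insert e η ∧ W I J) fun ω η I J hI hJ hW => by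
        rcases hW with hW | hW | hW
        · exact ⟨I, J, hI.trans (Finset.subset_insert _ _), hJ.trans (Finset.subset_insert _ _), hW⟩
        · exact ⟨_, J, Finset.insert_subset_insert _ hI, hJ.trans (Finset.subset_insert _ _), hW⟩
        · exact ⟨I, _, hI.trans (Finset.subset_insert _ _), Finset.insert_subset_insert _ hJ, hW⟩
    have h5 : bE s p (fun ω => ind (DisjOcc (fun I J => W I J ∨ W (insert e I) J ∨
          W I (insert e J)) ω)) + bE s p (fun ω => ind (DisjOcc W ω)) ≤
        bE s p (fun ω => ind (DisjOcc (fun I J => W I J ∨ W (insert e I) J) ω)) +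
        bE s p (fun ω => ind (DisjOcc (fun I J => W I J ∨ W I (insert e J)) ω)) := by
      rw [← bE_add, ← bE_add]
      refine bE_mono hp fun ω _ => ?_
      refine le_trans ?_ (ind_or_add _ _).le
      refine add_le_add (ind_mono ?_) (ind_mono ?_)
      · rintro ⟨I, J, hI, hJ, hd, hW | hW | hW⟩
        · exact Or.inl ⟨I, J, hI, hJ, hd, Or.inl hW⟩
        · exact Or.inl ⟨I, J, hI, hJ, hd, Or.inr hW⟩
        · exact Or.inr ⟨I, J, hI, hJ, hd, Or.inr hW⟩
      · rintro ⟨I, J, hI, hJ, hd, hW⟩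
        exact ⟨⟨I, J, hI, hJ, hd, Or.inl hW⟩, ⟨I, J, hI, hJ, hd, Or.inl hW⟩⟩
    have h6 : bE s p (fun ω => ind (DisjOcc W (insert e ω))) =
        bE s p (fun ω => ind (DisjOcc (fun I J => W I J ∨ W (insert e I) J ∨
          W I (insert e J)) ω)) :=
      bE_congr fun ω hω => ind_congr (disjOcc_insert fun h => he (hω h))
    rw [bE_insert he, h6, bE_insert he]
    simp only [bE_insert he, bE_add, bE_const_mul]
    have h0 := (hp e).1
    have h0' := sub_nonneg.2 (hp e).2
    nlinarith [mul_le_mul_of_nonneg_left h1 (mul_nonneg h0' h0'),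
      mul_le_mul_of_nonneg_left h2 (mul_nonneg h0 h0'),
      mul_le_mul_of_nonneg_left h3 (mul_nonneg h0 h0'),
      mul_le_mul_of_nonneg_left h5 (mul_nonneg h0 h0'),
      mul_le_mul_of_nonneg_left h4 (mul_nonneg h0 h0)]

/-- The van den Berg–Kesten inequality for increasing events. -/
theorem bE_bk {s : Finset ι} {p : ι → ℝ} (hp : ∀ e, p e ∈ Set.Icc (0 : ℝ) 1)
    {A B : Finset ι → Prop} (hA : Monotone A) (hB : Monotone B) :
    bE s p (fun ω => ind (DisjOcc (fun I J => A I ∧ B J) ω)) ≤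
      bE s p (fun ω => ind (A ω)) * bE s p (fun ω => ind (B ω)) := by
  refine (bE_disjOcc_le hp _).trans ?_
  rw [← bE_mul_const]
  refine bE_mono hp fun ω _ => ?_
  rw [← bE_const_mul]
  refine bE_mono hp fun η _ => ?_
  rw [← ind_and]
  refine ind_mono ?_
  rintro ⟨I, J, hI, hJ, h1, h2⟩
  exact ⟨hA hI h1, hB hJ h2⟩

theorem ind_monotone {A : Finset ι → Prop} (hA : Monotone A) : Monotone fun ω => ind (A ω) :=
  fun _ _ h => ind_mono (hA h)

theorem edgeProb_mem {t : ℝ} (ht : 0 ≤ t) : edgeProb t ∈ Set.Icc (0 : ℝ) 1 := by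
  unfold edgeProb
  have := Real.exp_pos (-t)
  have h2 : Real.exp (-t) ≤ 1 := Real.exp_le_one_iff.2 (by linarith)
  exact ⟨by linarith, by linarith⟩

theorem edgeProb_mono {s t : ℝ} (h : s ≤ t) : edgeProb s ≤ edgeProb t := by
  unfold edgeProb
  have := Real.exp_le_exp.2 (neg_le_neg h)
  linarith

theorem edgeProb_add (s t : ℝ) :
    edgeProb (s + t) = edgeProb s + edgeProb t - edgeProb s * edgeProb t := by
  unfold edgeProb
  rw [neg_add, Real.exp_add]; ring

/-- Expectation with edge rates `w`: the edge `e` is open with probability `1 - e^{-w e}`. -/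
noncomputable def rE (s : Finset ι) (w : ι → ℝ) (f : Finset ι → ℝ) : ℝ :=
  bE s (fun e => edgeProb (w e)) f

/-- The mean value form of Russo's formula. -/
theorem rE_sub_eq (s : Finset ι) (w u : ι → ℝ) (f : Finset ι → ℝ) :
    ∃ t ∈ Set.Icc (0 : ℝ) 1, rE s (fun e => w e + u e) f - rE s w f =
      ∑ e ∈ s, u e * rE s (fun e => w e + t * u e) (fun ω => f (insert e ω) - f ω) := by
  have hd : ∀ t, HasDerivAt (fun t => rE s (fun e => w e + t * u e) f)
      (∑ e ∈ s, u e * rE s (fun e => w e + t * u e) (fun ω => f (insert e ω) - f ω)) t := by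
    intro t
    refine bE_hasDerivAt s (fun t e => edgeProb (w e + t * u e)) u t (fun e => ?_) f
    unfold edgeProb
    have : HasDerivAt (fun t => -(w e + t * u e)) (-(1 * u e)) t :=
      (((hasDerivAt_id t).mul_const (u e)).const_add (w e)).neg
    refine (this.exp.const_sub 1).congr_deriv ?_
    ring
  obtain ⟨c, hc, h⟩ := exists_hasDerivAt_eq_slope (fun t => rE s (fun e => w e + t * u e) f) _
    zero_lt_one (continuousOn_of_forall_continuousAt fun t _ => (hd t).continuousAt)
    fun t _ => hd t
  refine ⟨c, ⟨hc.1.le, hc.2.le⟩, ?_⟩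
  rw [h]
  simp

theorem rE_merge (s : Finset ι) (w u : ι → ℝ) (f : Finset ι → ℝ) :
    rE s (fun e => w e + u e) f = rE s w (fun ω => rE s u (fun η => f (ω ∪ η))) := by
  unfold rE
  rw [← bE_merge]
  simp only [edgeProb_add]

theorem rE_mono {s : Finset ι} {w : ι → ℝ} (hw : 0 ≤ w) {f g : Finset ι → ℝ}
    (h : ∀ ω ⊆ s, f ω ≤ g ω) : rE s w f ≤ rE s w g :=
  bE_mono (fun e => edgeProb_mem (hw e)) h

theorem rE_nonneg {s : Finset ι} {w : ι → ℝ} (hw : 0 ≤ w) {f : Finset ι → ℝ}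
    (h : ∀ ω ⊆ s, 0 ≤ f ω) : 0 ≤ rE s w f :=
  bE_nonneg (fun e => edgeProb_mem (hw e)) h

theorem rE_mono_rate {s : Finset ι} {w w' : ι → ℝ} (hw : 0 ≤ w) (h : w ≤ w')
    {f : Finset ι → ℝ} (hf : Monotone f) : rE s w f ≤ rE s w' f :=
  bE_mono_p (fun e => edgeProb_mem (hw e)) (fun e => edgeProb_mem ((hw e).trans (h e)))
    (fun e => edgeProb_mono (h e)) hf

theorem rE_mono_set {s t : Finset ι} {w : ι → ℝ} (hw : 0 ≤ w) (h : s ⊆ t)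
    {f : Finset ι → ℝ} (hf : Monotone f) : rE s w f ≤ rE t w f :=
  bE_mono_set (fun e => edgeProb_mem (hw e)) hf h

end Bernoulli

section Graph
variable {U : Type*}

/-- Connectivity through a set of open edges. -/
def Lk (O : Set (Sym2 U)) (x y : U) : Prop := Relation.ReflTransGen (fun a b => s(a, b) ∈ O) x y

theorem Lk.refl {O : Set (Sym2 U)} (x : U) : Lk O x x := Relation.ReflTransGen.refl

theorem Lk.trans {O : Set (Sym2 U)} {x y z : U} (h : Lk O x y) (h' : Lk O y z) : Lk O x z :=
  Relation.ReflTransGen.trans h h'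

theorem Lk.single {O : Set (Sym2 U)} {x y : U} (h : s(x, y) ∈ O) : Lk O x y :=
  Relation.ReflTransGen.single h

theorem Lk.symm {O : Set (Sym2 U)} {x y : U} (h : Lk O x y) : Lk O y x := by
  induction h with
  | refl => exact .refl _
  | tail _ h ih => exact (Lk.single (by rwa [Sym2.eq_swap])).trans ih

theorem Lk.mono {O O' : Set (Sym2 U)} (h : O ⊆ O') {x y : U} (hx : Lk O x y) : Lk O' x y :=
  Relation.ReflTransGen.mono (fun _ _ hab => h hab) _ _ hx

theorem Lk.iff_of_lk {O : Set (Sym2 U)} {x y z : U} (h : Lk O x y) : Lk O x z ↔ Lk O y z :=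
  ⟨fun h' => h.symm.trans h', fun h' => h.trans h'⟩

theorem lk_insert {O : Set (Sym2 U)} {a b x y : U} :
    Lk (insert s(a, b) O) x y ↔
      Lk O x y ∨ (Lk O x a ∧ Lk O b y) ∨ (Lk O x b ∧ Lk O a y) := by
  constructor
  · intro h
    induction h with
    | refl => exact Or.inl (.refl _)
    | @tail y z _ h ih =>
      rcases h with h | h
      · rcases Sym2.eq_iff.1 h with ⟨rfl, rfl⟩ | ⟨rfl, rfl⟩
        · rcases ih with h1 | h1 | h1
          · exact Or.inr (Or.inl ⟨h1, .refl _⟩)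
          · exact Or.inr (Or.inl ⟨h1.1, .refl _⟩)
          · exact Or.inl h1.1
        · rcases ih with h1 | h1 | h1
          · exact Or.inr (Or.inr ⟨h1, .refl _⟩)
          · exact Or.inl h1.1
          · exact Or.inr (Or.inr ⟨h1.1, .refl _⟩)
      · have h' : Lk O y z := .single h
        rcases ih with h1 | h1 | h1
        · exact Or.inl (h1.trans h')
        · exact Or.inr (Or.inl ⟨h1.1, h1.2.trans h'⟩)
        · exact Or.inr (Or.inr ⟨h1.1, h1.2.trans h'⟩)
  · have hs : O ⊆ insert s(a, b) O := Set.subset_insert _ _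
    have hab : Lk (insert s(a, b) O) a b := .single (Set.mem_insert _ _)
    rintro (h | h | h)
    · exact h.mono hs
    · exact (h.1.mono hs).trans (hab.trans (h.2.mono hs))
    · exact (h.1.mono hs).trans (hab.symm.trans (h.2.mono hs))

/-- A connection from `v` only uses edges inside the cluster of `v`. -/
theorem Lk.restrict {O : Set (Sym2 U)} {v x : U} (h : Lk O v x) :
    Lk {e ∈ O | ∀ y ∈ e, Lk O v y} v x := by
  induction h with
  | refl => exact .refl _
  | tail h1 h2 ih =>
    rename_i y z
    refine ih.trans (.single ⟨h2, fun t ht => ?_⟩)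
    rcases Sym2.mem_iff.1 ht with rfl | rfl
    · exact h1
    · exact Lk.trans h1 (.single h2)

/-- The last exit from a set of vertices. -/
theorem Lk.last_escape {O : Set (Sym2 U)} {C : Set U} {v x : U} (h : Lk O v x) (hv : v ∈ C)
    (hx : x ∉ C) :
    ∃ a ∈ C, ∃ b ∉ C, s(a, b) ∈ O ∧ Lk {e ∈ O | ∀ y ∈ e, y ∉ C} b x := by
  induction h with
  | refl => exact absurd hv hx
  | tail h1 h2 ih =>
    rename_i y z
    by_cases hy : y ∈ C
    · exact ⟨y, hy, z, hx, h2, .refl _⟩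
    · obtain ⟨a, ha, b, hb, hab, h⟩ := ih hy
      refine ⟨a, ha, b, hb, hab, h.trans (.single ⟨h2, fun t ht => ?_⟩)⟩
      rcases Sym2.mem_iff.1 ht with rfl | rfl
      · exact hy
      · exact hx

theorem lk_of_walk {O : Set (Sym2 U)} {x y : U} (p : (SimpleGraph.fromEdgeSet O).Walk x y) :
    Lk {e | e ∈ p.edges} x y := by
  induction p with
  | nil => exact .refl _
  | cons h p ih =>
    refine Lk.trans (.single ?_) (ih.mono fun e he => ?_)
    · simp
    · simp only [Set.mem_ofPred_eq] at he
      simp [he]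

theorem Lk.reachable {O : Set (Sym2 U)} {x y : U} (h : Lk O x y) :
    (SimpleGraph.fromEdgeSet O).Reachable x y := by
  induction h with
  | refl => exact .refl _
  | tail h1 h2 ih =>
    rename_i y z
    by_cases hyz : y = z
    · exact hyz ▸ ih
    · exact ih.trans (SimpleGraph.Adj.reachable ((SimpleGraph.fromEdgeSet_adj O).2 ⟨h2, hyz⟩))

variable [DecidableEq U]

theorem exists_path_split {ω : Finset (Sym2 U)} {v x : U} (h : Lk (ω : Set (Sym2 U)) v x) :
    ∃ S : Set U, v ∈ S ∧ ∀ z ∈ S, ∃ I₁ I₂ : Finset (Sym2 U), I₁ ⊆ ω ∧ I₂ ⊆ ω ∧ Disjoint I₁ I₂ ∧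
      (∀ e ∈ I₁ ∪ I₂, ∀ y ∈ e, y ∈ S) ∧ Lk (I₁ : Set (Sym2 U)) v z ∧
        Lk (I₂ : Set (Sym2 U)) z x := by
  obtain ⟨p, hp⟩ := h.reachable.exists_isPath
  have hsub : ∀ e ∈ p.edges, e ∈ ω := fun e he => by
    have := p.edges_subset_edgeSet he
    rw [SimpleGraph.edgeSet_fromEdgeSet] at this
    exact this.1
  refine ⟨{z | z ∈ p.support}, p.start_mem_support, fun z hz => ?_⟩
  have hz' : z ∈ p.support := hz
  have hsplit : (p.takeUntil z hz').edges ++ (p.dropUntil z hz').edges = p.edges := by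
    rw [← SimpleGraph.Walk.edges_append, SimpleGraph.Walk.take_spec]
  have hmem : ∀ e, e ∈ p.edges ↔ e ∈ (p.takeUntil z hz').edges ∨ e ∈ (p.dropUntil z hz').edges := by
    intro e; rw [← hsplit, List.mem_append]
  have hnd := hp.isTrail.edges_nodup
  rw [← hsplit, List.nodup_append] at hnd
  refine ⟨(p.takeUntil z hz').edges.toFinset, (p.dropUntil z hz').edges.toFinset, ?_, ?_, ?_, ?_,
    ?_, ?_⟩
  · intro e he; exact hsub e ((hmem e).2 (Or.inl (List.mem_toFinset.1 he)))
  · intro e he; exact hsub e ((hmem e).2 (Or.inr (List.mem_toFinset.1 he)))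
  · rw [Finset.disjoint_left]
    intro e h1 h2
    exact hnd.2.2 e (List.mem_toFinset.1 h1) e (List.mem_toFinset.1 h2) rfl
  · intro e he y hy
    have he' : e ∈ p.edges := by
      rw [hmem]; simpa using he
    induction e with
    | _ a b =>
    rcases Sym2.mem_iff.1 hy with rfl | rfl
    · exact p.fst_mem_support_of_mem_edges he'
    · exact p.snd_mem_support_of_mem_edges he'
  · simpa using lk_of_walk (p.takeUntil z hz')
  · simpa using lk_of_walk (p.dropUntil z hz')

/-- Two connections from `v` split at a common vertex. -/
theorem exists_tripod {ω : Finset (Sym2 U)} {v x y : U} (hx : Lk (ω : Set (Sym2 U)) v x)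
    (hy : Lk (ω : Set (Sym2 U)) v y) :
    ∃ z, ∃ I₁ I₂ I₃ : Finset (Sym2 U), I₁ ⊆ ω ∧ I₂ ⊆ ω ∧ I₃ ⊆ ω ∧ Disjoint I₁ I₂ ∧
      Disjoint (I₁ ∪ I₂) I₃ ∧ Lk (I₁ : Set (Sym2 U)) v z ∧ Lk (I₂ : Set (Sym2 U)) z x ∧
        Lk (I₃ : Set (Sym2 U)) z y := by
  obtain ⟨S, hv, hS⟩ := exists_path_split hx
  by_cases hyS : y ∈ S
  · obtain ⟨I₁, I₂, h1, h2, hd, -, h3, h4⟩ := hS y hyS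
    exact ⟨y, I₁, I₂, ∅, h1, h2, by simp, hd, by simp, h3, h4, .refl _⟩
  · obtain ⟨a, ha, b, hb, hab, h⟩ := hy.last_escape hv hyS
    obtain ⟨I₁, I₂, h1, h2, hd, hin, h3, h4⟩ := hS a ha
    have hkey : ∀ e, (∃ t ∈ e, t ∉ S) → e ∉ I₁ ∪ I₂ := fun e ⟨t, ht, htS⟩ he => htS (hin e he t ht)
    refine ⟨a, I₁, I₂, insert s(a, b) (ω.filter fun e => ∀ y ∈ e, y ∉ S), h1, h2, ?_, hd, ?_, h3,
      h4, ?_⟩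
    · exact Finset.insert_subset hab (Finset.filter_subset _ _)
    · rw [Finset.disjoint_right]
      intro e he
      rw [Finset.mem_insert, Finset.mem_filter] at he
      rcases he with rfl | he
      · exact hkey _ ⟨b, by simp, hb⟩
      · exact hkey _ ⟨e.out.1, Sym2.out_fst_mem e, he.2 _ (Sym2.out_fst_mem e)⟩
    · refine Lk.trans (.single (by simp)) (h.mono fun e he => ?_)
      simp only [Finset.coe_insert, Finset.coe_filter]
      exact Or.inr he

theorem sum_sym2 (Λ : Finset U) (h : U → U → ℝ) (F : Sym2 U → ℝ)
    (hF : ∀ a b, a ≠ b → F s(a, b) = h a b + h b a) (hd : ∀ a, F s(a, a) = h a a) :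
    ∑ e ∈ Λ.sym2, F e = ∑ a ∈ Λ, ∑ b ∈ Λ, h a b := by
  induction Λ using Finset.induction_on with
  | empty => simp
  | insert v Λ hv ih =>
    rw [Finset.sym2_insert, Finset.sum_union, ih, Finset.sum_image, Finset.sum_insert hv,
      Finset.sum_insert hv, Finset.sum_insert hv, hd]
    · simp only [Finset.sum_insert hv]
      have : ∑ x ∈ Λ, F s(v, x) = ∑ x ∈ Λ, h v x + ∑ x ∈ Λ, h x v := by
        rw [← Finset.sum_add_distrib]
        exact Finset.sum_congr rfl fun x hx => hF v x (by rintro rfl; exact hv hx)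
      rw [this, Finset.sum_add_distrib]
      ring
    · intro x _ y _ hxy
      rcases Sym2.eq_iff.1 hxy with h | h
      · exact h.2
      · exact h.2.trans h.1
    · rw [Finset.disjoint_left]
      intro e he he'
      obtain ⟨x, hx, rfl⟩ := Finset.mem_image.1 he
      exact hv (Finset.mem_sym2_iff.1 he' v (by simp))

end Graph

section FiniteVolume
variable {U : Type*} [DecidableEq U]

/-- Indicator that `x` and `y` are connected in `ω`. -/
noncomputable def ci (ω : Finset (Sym2 U)) (x y : U) : ℝ := ind (Lk (ω : Set (Sym2 U)) x y)

/-- Sum of `φ` over the part of the cluster of `o` in `Λ`. -/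
noncomputable def cw (φ : U → ℝ) (Λ : Finset U) (ω : Finset (Sym2 U)) (o : U) : ℝ :=
  ∑ x ∈ Λ, φ x * ci ω o x

/-- Number of points of the cluster of `o` in `Λ`. -/
noncomputable def cs (Λ : Finset U) (ω : Finset (Sym2 U)) (o : U) : ℝ := ∑ x ∈ Λ, ci ω o x

theorem cw_one (Λ : Finset U) : cw (fun _ => 1) Λ = cs Λ := by
  ext ω o; simp [cw, cs]

theorem ci_nonneg (ω : Finset (Sym2 U)) (x y : U) : 0 ≤ ci ω x y := ind_nonneg _
theorem ci_le_one (ω : Finset (Sym2 U)) (x y : U) : ci ω x y ≤ 1 := ind_le_one _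
theorem ci_self (ω : Finset (Sym2 U)) (x : U) : ci ω x x = 1 := ind_true (.refl _)
theorem ci_comm (ω : Finset (Sym2 U)) (x y : U) : ci ω x y = ci ω y x :=
  ind_congr ⟨Lk.symm, Lk.symm⟩
theorem ci_mul_self (ω : Finset (Sym2 U)) (x y : U) : ci ω x y * ci ω x y = ci ω x y := by
  rw [ci, ← ind_and, and_self]
theorem ci_mono (x y : U) : Monotone fun ω : Finset (Sym2 U) => ci ω x y :=
  fun _ _ h => ind_mono (Lk.mono (by exact_mod_cast h))

theorem cw_nonneg {φ : U → ℝ} (hφ : 0 ≤ φ) (Λ : Finset U) (ω : Finset (Sym2 U)) (o : U) :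
    0 ≤ cw φ Λ ω o := Finset.sum_nonneg fun x _ => mul_nonneg (hφ x) (ci_nonneg _ _ _)
theorem cs_nonneg (Λ : Finset U) (ω : Finset (Sym2 U)) (o : U) :
    0 ≤ cs Λ ω o := Finset.sum_nonneg fun x _ => ci_nonneg _ _ _
theorem cw_mono {φ : U → ℝ} (hφ : 0 ≤ φ) (Λ : Finset U) (o : U) :
    Monotone fun ω => cw φ Λ ω o :=
  fun _ _ h => Finset.sum_le_sum fun x _ => mul_le_mul_of_nonneg_left (ci_mono _ _ h) (hφ x)
theorem cs_mono (Λ : Finset U) (o : U) : Monotone fun ω => cs Λ ω o :=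
  fun _ _ h => Finset.sum_le_sum fun x _ => ci_mono _ _ h

theorem ci_mul_cs (Λ : Finset U) (ω : Finset (Sym2 U)) (o b : U) :
    ci ω o b * cs Λ ω b = ci ω o b * cs Λ ω o := by
  by_cases h : Lk (ω : Set (Sym2 U)) o b
  · congr 1
    exact Finset.sum_congr rfl fun x _ => ind_congr (Lk.iff_of_lk h).symm
  · rw [ci, ind_false h]; simp

theorem ci_insert (ω : Finset (Sym2 U)) (a b o x : U) :
    ci (insert s(a, b) ω) o x = ci ω o x + ci ω o a * (1 - ci ω o b) * ci ω b x +
      ci ω o b * (1 - ci ω o a) * ci ω a x := by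
  have h : ci (insert s(a, b) ω) o x = ind (Lk (ω : Set (Sym2 U)) o x ∨
      (Lk (ω : Set (Sym2 U)) o a ∧ Lk (ω : Set (Sym2 U)) b x) ∨
      (Lk (ω : Set (Sym2 U)) o b ∧ Lk (ω : Set (Sym2 U)) a x)) := by
    rw [ci, Finset.coe_insert]
    exact ind_congr lk_insert
  rw [h]
  unfold ci
  have t1 : ∀ {y z}, Lk (ω : Set (Sym2 U)) o y → Lk (ω : Set (Sym2 U)) y z →
    Lk (ω : Set (Sym2 U)) o z := fun h h' => h.trans h'
  have t2 : ∀ {y z}, Lk (ω : Set (Sym2 U)) o z → Lk (ω : Set (Sym2 U)) y z →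
    Lk (ω : Set (Sym2 U)) o y := fun h h' => h.trans h'.symm
  have t3 : ∀ {y z}, Lk (ω : Set (Sym2 U)) o z → Lk (ω : Set (Sym2 U)) o y →
    Lk (ω : Set (Sym2 U)) y z := fun h h' => h'.symm.trans h
  by_cases ha : Lk (ω : Set (Sym2 U)) o a <;> by_cases hb : Lk (ω : Set (Sym2 U)) o b <;>
    by_cases hx : Lk (ω : Set (Sym2 U)) o x
  · simp [ind_true, ha, hb, hx]
  · have h1 : ¬ Lk (ω : Set (Sym2 U)) a x := fun h => hx (t1 ha h)
    have h2 : ¬ Lk (ω : Set (Sym2 U)) b x := fun h => hx (t1 hb h)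
    simp [ind, ha, hb, hx, h1, h2]
  · have h1 : ¬ Lk (ω : Set (Sym2 U)) b x := fun h => hb (t2 hx h)
    simp [ind, ha, hb, hx, h1]
  · simp [ind, ha, hb, hx]
  · have h1 : ¬ Lk (ω : Set (Sym2 U)) a x := fun h => ha (t2 hx h)
    simp [ind, ha, hb, hx, h1]
  · simp [ind, ha, hb, hx]
  · simp [ind, ha, hb, hx]
  · simp [ind, ha, hb, hx]

theorem cw_insert (φ : U → ℝ) (Λ : Finset U) (ω : Finset (Sym2 U)) (a b o : U) :
    cw φ Λ (insert s(a, b) ω) o - cw φ Λ ω o = ci ω o a * (1 - ci ω o b) * cw φ Λ ω b +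
      ci ω o b * (1 - ci ω o a) * cw φ Λ ω a := by
  simp only [cw, ci_insert, Finset.mul_sum, ← Finset.sum_add_distrib, ← Finset.sum_sub_distrib]
  exact Finset.sum_congr rfl fun x _ => by ring

theorem cs_sq_insert (Λ : Finset U) (ω : Finset (Sym2 U)) (a b o : U) :
    cs Λ (insert s(a, b) ω) o ^ 2 - cs Λ ω o ^ 2 =
      ci ω o a * (1 - ci ω o b) * (2 * cs Λ ω o * cs Λ ω b + cs Λ ω b ^ 2) +
      ci ω o b * (1 - ci ω o a) * (2 * cs Λ ω o * cs Λ ω a + cs Λ ω a ^ 2) := by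
  have h := cw_insert (fun _ => 1) Λ ω a b o
  rw [cw_one] at h
  rw [sub_eq_iff_eq_add.1 h]
  unfold ci ind
  split_ifs <;> ring

theorem pair_bk {s : Finset (Sym2 U)} {w : Sym2 U → ℝ} (hw : 0 ≤ w) (o a x b y z : U) :
    rE s w (fun ω => ci ω o a * (1 - ci ω o b) * (ci ω o x * (ci ω b y * ci ω b z))) ≤
      rE s w (fun ω => ci ω o a * ci ω o x) * rE s w (fun ω => ci ω b y * ci ω b z) := by
  have h := bE_bk (s := s) (p := fun e => edgeProb (w e)) (fun e => edgeProb_mem (hw e))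
    (A := fun ω => Lk (ω : Set (Sym2 U)) o a ∧ Lk (ω : Set (Sym2 U)) o x)
    (B := fun ω => Lk (ω : Set (Sym2 U)) b y ∧ Lk (ω : Set (Sym2 U)) b z)
    (fun _ _ h h' => ⟨h'.1.mono (by exact_mod_cast h), h'.2.mono (by exact_mod_cast h)⟩)
    (fun _ _ h h' => ⟨h'.1.mono (by exact_mod_cast h), h'.2.mono (by exact_mod_cast h)⟩)
  simp only [ind_and] at h
  refine le_trans (rE_mono hw fun ω _ => ?_) h
  unfold ci
  rw [← ind_not, ← ind_and, ← ind_and, ← ind_and, ← ind_and]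
  refine ind_mono ?_
  rintro ⟨⟨h1, h2⟩, h3, h4, h5⟩
  refine ⟨ω.filter fun e => ∀ y ∈ e, Lk (ω : Set (Sym2 U)) o y,
    ω.filter fun e => ∀ y ∈ e, Lk (ω : Set (Sym2 U)) b y, Finset.filter_subset _ _,
    Finset.filter_subset _ _, ?_, ⟨?_, ?_⟩, ?_, ?_⟩
  · rw [Finset.disjoint_left]
    intro e he he'
    exact h2 (((Finset.mem_filter.1 he).2 _ (Sym2.out_fst_mem e)).trans
      ((Finset.mem_filter.1 he').2 _ (Sym2.out_fst_mem e)).symm)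
  · simpa [Finset.coe_filter] using h1.restrict
  · simpa [Finset.coe_filter] using h3.restrict
  · simpa [Finset.coe_filter] using h4.restrict
  · simpa [Finset.coe_filter] using h5.restrict

theorem rE_sum {κ : Type*} {ι : Type*} [DecidableEq ι] (s : Finset ι) (w : ι → ℝ) (t : Finset κ)
    (f : κ → Finset ι → ℝ) :
    rE s w (fun ω => ∑ i ∈ t, f i ω) = ∑ i ∈ t, rE s w (f i) := bE_sum _ _ _ _

theorem rE_const_mul {ι : Type*} [DecidableEq ι] (s : Finset ι) (w : ι → ℝ) (c : ℝ)
    (f : Finset ι → ℝ) : rE s w (fun ω => c * f ω) = c * rE s w f := bE_const_mul _ _ _ _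

theorem rE_add {ι : Type*} [DecidableEq ι] (s : Finset ι) (w : ι → ℝ) (f g : Finset ι → ℝ) :
    rE s w (fun ω => f ω + g ω) = rE s w f + rE s w g := bE_add _ _ _ _

theorem rE_sub {ι : Type*} [DecidableEq ι] (s : Finset ι) (w : ι → ℝ) (f g : Finset ι → ℝ) :
    rE s w (fun ω => f ω - g ω) = rE s w f - rE s w g := bE_sub _ _ _ _

theorem rE_harris {ι : Type*} [DecidableEq ι] {s : Finset ι} {w : ι → ℝ} (hw : 0 ≤ w)
    {f g : Finset ι → ℝ} (hf : Monotone f) (hg : Monotone g) :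
    rE s w f * rE s w g ≤ rE s w (fun ω => f ω * g ω) :=
  bE_harris (fun e => edgeProb_mem (hw e)) hf hg

/-- Mean value form of Russo's formula for edges of a finite box, as a sum over ordered pairs. -/
theorem russo_pairs (Λ : Finset U) {w u : Sym2 U → ℝ} (hw : 0 ≤ w) (hu : 0 ≤ u)
    (f : Finset (Sym2 U) → ℝ) (o : U) (h : Finset (Sym2 U) → U → ℝ)
    (hf : ∀ ω a b, f (insert s(a, b) ω) - f ω = ci ω o a * (1 - ci ω o b) * h ω b +
      ci ω o b * (1 - ci ω o a) * h ω a) :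
    ∃ v : Sym2 U → ℝ, 0 ≤ v ∧ w ≤ v ∧ v ≤ w + u ∧
      rE Λ.sym2 (w + u) f - rE Λ.sym2 w f = ∑ a ∈ Λ, ∑ b ∈ Λ, u s(a, b) *
        rE Λ.sym2 v (fun ω => ci ω o a * (1 - ci ω o b) * h ω b) := by
  obtain ⟨t, ht, heq⟩ := rE_sub_eq Λ.sym2 w u f
  refine ⟨fun e => w e + t * u e, fun e => add_nonneg (hw e) (mul_nonneg ht.1 (hu e)),
    fun e => le_add_of_nonneg_right (mul_nonneg ht.1 (hu e)),
    fun e => add_le_add_right (mul_le_of_le_one_left (hu e) ht.2) _, ?_⟩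
  refine heq.trans (sum_sym2 Λ _ _ (fun a b hab => ?_) fun a => ?_)
  · simp only [hf]
    rw [rE_add, mul_add, Sym2.eq_swap (a := b)]
  · congr 1
    refine congrArg _ (funext fun ω => ?_)
    rw [hf]
    unfold ci ind
    split_ifs <;> ring

theorem cw_add_le (Λ : Finset U) {w u : Sym2 U → ℝ} (hw : 0 ≤ w) (hu : 0 ≤ u) {φ : U → ℝ}
    (hφ : 0 ≤ φ) (o : U) :
    rE Λ.sym2 (w + u) (fun ω => cw φ Λ ω o) ≤ rE Λ.sym2 w (fun ω => cw φ Λ ω o) +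
      ∑ a ∈ Λ, ∑ b ∈ Λ, u s(a, b) * (rE Λ.sym2 (w + u) (fun ω => ci ω o a) *
        rE Λ.sym2 (w + u) (fun ω => cw φ Λ ω b)) := by
  obtain ⟨v, hv, -, hvu, heq⟩ := russo_pairs Λ hw hu (fun ω => cw φ Λ ω o) o
    (fun ω b => cw φ Λ ω b) (fun ω a b => cw_insert φ Λ ω a b o)
  rw [← sub_le_iff_le_add', heq]
  refine Finset.sum_le_sum fun a _ => Finset.sum_le_sum fun b _ =>
    mul_le_mul_of_nonneg_left ?_ (hu _)
  calc _ = ∑ x ∈ Λ, φ x * rE Λ.sym2 v (fun ω => ci ω o a * (1 - ci ω o b) *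
        (ci ω o o * (ci ω b x * ci ω b x))) := by
        simp only [← rE_const_mul, ← rE_sum]
        refine congrArg _ (funext fun ω => ?_)
        rw [cw, Finset.mul_sum]
        refine Finset.sum_congr rfl fun x _ => ?_
        rw [ci_mul_self, ci_self]; ring
    _ ≤ ∑ x ∈ Λ, φ x * (rE Λ.sym2 v (fun ω => ci ω o a) * rE Λ.sym2 v (fun ω => ci ω b x)) := by
        refine Finset.sum_le_sum fun x _ => mul_le_mul_of_nonneg_left ?_ (hφ x)
        refine (pair_bk hv o a o b x x).trans_eq ?_
        simp only [ci_mul_self, ci_self, mul_one]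
    _ = rE Λ.sym2 v (fun ω => ci ω o a) * rE Λ.sym2 v (fun ω => cw φ Λ ω b) := by
        simp only [cw, rE_sum, rE_const_mul, Finset.mul_sum]
        exact Finset.sum_congr rfl fun x _ => by ring
    _ ≤ _ := mul_le_mul (rE_mono_rate hv hvu (ci_mono _ _))
        (rE_mono_rate hv hvu (cw_mono hφ _ _)) (rE_nonneg hv fun _ _ => cw_nonneg hφ _ _ _)
        (rE_nonneg (add_nonneg hw hu) fun _ _ => ci_nonneg _ _ _)

theorem cs_sq_add_le (Λ : Finset U) {w u : Sym2 U → ℝ} (hw : 0 ≤ w) (hu : 0 ≤ u) (o : U) :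
    rE Λ.sym2 (w + u) (fun ω => cs Λ ω o ^ 2) ≤ rE Λ.sym2 w (fun ω => cs Λ ω o ^ 2) +
      ∑ a ∈ Λ, ∑ b ∈ Λ, u s(a, b) *
        (2 * (rE Λ.sym2 (w + u) (fun ω => ci ω o a * cs Λ ω o) *
          rE Λ.sym2 (w + u) (fun ω => cs Λ ω b)) +
        rE Λ.sym2 (w + u) (fun ω => ci ω o a) *
          rE Λ.sym2 (w + u) (fun ω => cs Λ ω b ^ 2)) := by
  obtain ⟨v, hv, -, hvu, heq⟩ := russo_pairs Λ hw hu (fun ω => cs Λ ω o ^ 2) o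
    (fun ω b => 2 * cs Λ ω o * cs Λ ω b + cs Λ ω b ^ 2) (fun ω a b => cs_sq_insert Λ ω a b o)
  rw [← sub_le_iff_le_add', heq]
  refine Finset.sum_le_sum fun a _ => Finset.sum_le_sum fun b _ =>
    mul_le_mul_of_nonneg_left ?_ (hu _)
  have hwu : 0 ≤ w + u := add_nonneg hw hu
  have h1 : rE Λ.sym2 v (fun ω => ci ω o a * (1 - ci ω o b) * (cs Λ ω o * cs Λ ω b)) ≤
      rE Λ.sym2 (w + u) (fun ω => ci ω o a * cs Λ ω o) *
          rE Λ.sym2 (w + u) (fun ω => cs Λ ω b) := by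
    calc _ = ∑ x ∈ Λ, ∑ y ∈ Λ, rE Λ.sym2 v (fun ω => ci ω o a * (1 - ci ω o b) *
          (ci ω o x * (ci ω b y * ci ω b y))) := by
          simp only [← rE_sum, ci_mul_self]
          refine congrArg _ (funext fun ω => ?_)
          rw [cs, cs, Finset.sum_mul_sum, Finset.mul_sum]
          exact Finset.sum_congr rfl fun x _ => by rw [Finset.mul_sum]
      _ ≤ ∑ x ∈ Λ, ∑ y ∈ Λ, rE Λ.sym2 v (fun ω => ci ω o a * ci ω o x) *
            rE Λ.sym2 v (fun ω => ci ω b y * ci ω b y) :=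
          Finset.sum_le_sum fun x _ => Finset.sum_le_sum fun y _ => pair_bk hv o a x b y y
      _ = rE Λ.sym2 v (fun ω => ci ω o a * cs Λ ω o) * rE Λ.sym2 v (fun ω => cs Λ ω b) := by
          simp only [cs, Finset.mul_sum, rE_sum, ci_mul_self]
          rw [Finset.sum_comm]
          refine Finset.sum_congr rfl fun x _ => ?_
          rw [Finset.sum_mul]
      _ ≤ _ := mul_le_mul (rE_mono_rate hv hvu fun ω ω' h => mul_le_mul (ci_mono _ _ h)
            (cs_mono _ _ h) (cs_nonneg _ _ _) (ci_nonneg _ _ _))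
          (rE_mono_rate hv hvu (cs_mono _ _)) (rE_nonneg hv fun _ _ => cs_nonneg _ _ _)
          (rE_nonneg hwu fun _ _ => mul_nonneg (ci_nonneg _ _ _) (cs_nonneg _ _ _))
  have h2 : rE Λ.sym2 v (fun ω => ci ω o a * (1 - ci ω o b) * (cs Λ ω b ^ 2)) ≤
      rE Λ.sym2 (w + u) (fun ω => ci ω o a) * rE Λ.sym2 (w + u) (fun ω => cs Λ ω b ^ 2) := by
    calc _ = ∑ x ∈ Λ, ∑ y ∈ Λ, rE Λ.sym2 v (fun ω => ci ω o a * (1 - ci ω o b) *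
          (ci ω o o * (ci ω b x * ci ω b y))) := by
          simp only [← rE_sum, ci_self, one_mul]
          refine congrArg _ (funext fun ω => ?_)
          rw [sq, cs, Finset.sum_mul_sum, Finset.mul_sum]
          exact Finset.sum_congr rfl fun x _ => by rw [Finset.mul_sum]
      _ ≤ ∑ x ∈ Λ, ∑ y ∈ Λ, rE Λ.sym2 v (fun ω => ci ω o a * ci ω o o) *
            rE Λ.sym2 v (fun ω => ci ω b x * ci ω b y) :=
          Finset.sum_le_sum fun x _ => Finset.sum_le_sum fun y _ => pair_bk hv o a o b x y
      _ = rE Λ.sym2 v (fun ω => ci ω o a) * rE Λ.sym2 v (fun ω => cs Λ ω b ^ 2) := by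
          simp only [← Finset.mul_sum, ← rE_sum, ci_self, mul_one, sq, cs, Finset.sum_mul_sum]
      _ ≤ _ := mul_le_mul (rE_mono_rate hv hvu (ci_mono _ _))
          (rE_mono_rate hv hvu fun ω ω' h => pow_le_pow_left₀ (cs_nonneg _ _ _) (cs_mono _ _ h) 2)
          (rE_nonneg hv fun _ _ => sq_nonneg _)
          (rE_nonneg hwu fun _ _ => ci_nonneg _ _ _)
  calc _ = 2 * rE Λ.sym2 v (fun ω => ci ω o a * (1 - ci ω o b) * (cs Λ ω o * cs Λ ω b)) +
        rE Λ.sym2 v (fun ω => ci ω o a * (1 - ci ω o b) * (cs Λ ω b ^ 2)) := by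
        rw [← rE_const_mul, ← rE_add]
        exact congrArg _ (funext fun ω => by ring)
    _ ≤ _ := by linarith

theorem cs_add_ge (Λ : Finset U) {w u : Sym2 U → ℝ} (hw : 0 ≤ w) (hu : 0 ≤ u) (o : U) {M : ℝ}
    (hM : ∀ e, u e ≤ M) :
    rE Λ.sym2 w (fun ω => cs Λ ω o) +
      ∑ a ∈ Λ, ∑ b ∈ Λ, u s(a, b) * (rE Λ.sym2 w (fun ω => ci ω o a) *
        rE Λ.sym2 w (fun ω => cs Λ ω b)) ≤
      rE Λ.sym2 (w + u) (fun ω => cs Λ ω o) +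
        M * rE Λ.sym2 (w + u) (fun ω => cs Λ ω o ^ 3) := by
  obtain ⟨v, hv, hwv, hvu, heq⟩ := russo_pairs Λ hw hu (fun ω => cs Λ ω o) o
    (fun ω b => cs Λ ω b) (fun ω a b => by rw [← cw_one]; exact cw_insert _ Λ ω a b o)
  have hM0 : 0 ≤ M := by
    exact (hu s(o, o)).trans (hM _)
  have h3 : ∑ a ∈ Λ, ∑ b ∈ Λ, rE Λ.sym2 v (fun ω => ci ω o a * ci ω o b * cs Λ ω b) ≤
      rE Λ.sym2 (w + u) (fun ω => cs Λ ω o ^ 3) := by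
    simp only [← rE_sum]
    refine le_trans (le_of_eq (congrArg _ (funext fun ω => ?_)))
      (rE_mono_rate hv hvu fun ω ω' h => pow_le_pow_left₀ (cs_nonneg _ _ _) (cs_mono _ _ h) 3)
    simp only [mul_assoc, ci_mul_cs]
    simp only [← Finset.mul_sum, ← Finset.sum_mul]
    rw [← cs]; ring
  have h4 : ∑ a ∈ Λ, ∑ b ∈ Λ, u s(a, b) * (rE Λ.sym2 w (fun ω => ci ω o a) *
        rE Λ.sym2 w (fun ω => cs Λ ω b)) ≤
      ∑ a ∈ Λ, ∑ b ∈ Λ, (u s(a, b) *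
        rE Λ.sym2 v (fun ω => ci ω o a * (1 - ci ω o b) * cs Λ ω b) +
        M * rE Λ.sym2 v (fun ω => ci ω o a * ci ω o b * cs Λ ω b)) := by
    refine Finset.sum_le_sum fun a _ => Finset.sum_le_sum fun b _ => ?_
    have h5 : rE Λ.sym2 w (fun ω => ci ω o a) * rE Λ.sym2 w (fun ω => cs Λ ω b) ≤
        rE Λ.sym2 v (fun ω => ci ω o a * (1 - ci ω o b) * cs Λ ω b) +
        rE Λ.sym2 v (fun ω => ci ω o a * ci ω o b * cs Λ ω b) := by
      refine (rE_harris hw (ci_mono _ _) (cs_mono _ _)).trans ?_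
      refine (rE_mono_rate hw hwv fun ω ω' h => mul_le_mul (ci_mono _ _ h)
            (cs_mono _ _ h) (cs_nonneg _ _ _) (ci_nonneg _ _ _)).trans_eq ?_
      rw [← rE_add]
      exact congrArg _ (funext fun ω => by ring)
    have h6 : 0 ≤ rE Λ.sym2 v (fun ω => ci ω o a * ci ω o b * cs Λ ω b) := rE_nonneg hv
      fun _ _ => mul_nonneg (mul_nonneg (ci_nonneg _ _ _) (ci_nonneg _ _ _)) (cs_nonneg _ _ _)
    have := mul_le_mul_of_nonneg_left h5 (hu s(a, b))
    have := mul_le_mul_of_nonneg_right (hM s(a, b)) h6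
    linarith
  simp only [Finset.sum_add_distrib, ← Finset.mul_sum] at h4
  have := mul_le_mul_of_nonneg_left h3 hM0
  simp only [Finset.mul_sum] at h4 this heq ⊢
  linarith

theorem cs_sq_add_ge (Λ : Finset U) {w u : Sym2 U → ℝ} (hw : 0 ≤ w) (hu : 0 ≤ u) (o : U) {M : ℝ}
    (hM : ∀ e, u e ≤ M) :
    rE Λ.sym2 w (fun ω => cs Λ ω o ^ 2) +
      ∑ a ∈ Λ, ∑ b ∈ Λ, u s(a, b) * (2 * (rE Λ.sym2 w (fun ω => ci ω o a * cs Λ ω o) *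
        rE Λ.sym2 w (fun ω => cs Λ ω b)) +
        rE Λ.sym2 w (fun ω => ci ω o a) * rE Λ.sym2 w (fun ω => cs Λ ω b ^ 2)) ≤
      rE Λ.sym2 (w + u) (fun ω => cs Λ ω o ^ 2) +
        3 * M * rE Λ.sym2 (w + u) (fun ω => cs Λ ω o ^ 4) := by
  obtain ⟨v, hv, hwv, hvu, heq⟩ := russo_pairs Λ hw hu (fun ω => cs Λ ω o ^ 2) o
    (fun ω b => 2 * cs Λ ω o * cs Λ ω b + cs Λ ω b ^ 2) (fun ω a b => cs_sq_insert Λ ω a b o)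
  have hM0 : 0 ≤ M := by
    exact (hu s(o, o)).trans (hM _)
  have h3 : ∑ a ∈ Λ, ∑ b ∈ Λ, rE Λ.sym2 v (fun ω => ci ω o a * ci ω o b * cs Λ ω o ^ 2) ≤
      rE Λ.sym2 (w + u) (fun ω => cs Λ ω o ^ 4) := by
    simp only [← rE_sum]
    refine le_trans (le_of_eq (congrArg _ (funext fun ω => ?_)))
      (rE_mono_rate hv hvu fun ω ω' h => pow_le_pow_left₀ (cs_nonneg _ _ _) (cs_mono _ _ h) 4)
    simp only [← Finset.mul_sum, ← Finset.sum_mul, mul_assoc]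
    rw [← cs]; ring
  have hm2 : ∀ x : U, Monotone fun ω => cs Λ ω x ^ 2 :=
    fun x ω ω' h => pow_le_pow_left₀ (cs_nonneg _ _ _) (cs_mono _ _ h) 2
  have hm1 : ∀ a x : U, Monotone fun ω => ci ω a x * cs Λ ω a := fun a x ω ω' h =>
    mul_le_mul (ci_mono _ _ h) (cs_mono _ _ h) (cs_nonneg _ _ _) (ci_nonneg _ _ _)
  have h4 : ∑ a ∈ Λ, ∑ b ∈ Λ, u s(a, b) * (2 * (rE Λ.sym2 w (fun ω => ci ω o a * cs Λ ω o) *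
        rE Λ.sym2 w (fun ω => cs Λ ω b)) +
        rE Λ.sym2 w (fun ω => ci ω o a) * rE Λ.sym2 w (fun ω => cs Λ ω b ^ 2)) ≤
      ∑ a ∈ Λ, ∑ b ∈ Λ, (u s(a, b) *
        rE Λ.sym2 v (fun ω => ci ω o a * (1 - ci ω o b) *
          (2 * cs Λ ω o * cs Λ ω b + cs Λ ω b ^ 2)) +
        3 * M * rE Λ.sym2 v (fun ω => ci ω o a * ci ω o b * cs Λ ω o ^ 2)) := by
    refine Finset.sum_le_sum fun a _ => Finset.sum_le_sum fun b _ => ?_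
    have h5 : 2 * (rE Λ.sym2 w (fun ω => ci ω o a * cs Λ ω o) *
        rE Λ.sym2 w (fun ω => cs Λ ω b)) +
        rE Λ.sym2 w (fun ω => ci ω o a) * rE Λ.sym2 w (fun ω => cs Λ ω b ^ 2) ≤
        rE Λ.sym2 v (fun ω => ci ω o a * (1 - ci ω o b) *
          (2 * cs Λ ω o * cs Λ ω b + cs Λ ω b ^ 2)) +
        3 * rE Λ.sym2 v (fun ω => ci ω o a * ci ω o b * cs Λ ω o ^ 2) := by
      have h7 := (rE_harris (s := Λ.sym2) hw (hm1 o a) (cs_mono Λ b)).trans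
        (rE_mono_rate hw hwv fun ω ω' h => mul_le_mul (hm1 o a h)
            (cs_mono _ _ h) (cs_nonneg _ _ _) (mul_nonneg (ci_nonneg _ _ _) (cs_nonneg _ _ _)))
      have h8 := (rE_harris (s := Λ.sym2) hw (ci_mono o a) (hm2 b)).trans
        (rE_mono_rate hw hwv fun ω ω' h => mul_le_mul (ci_mono o a h)
            (hm2 _ h) (sq_nonneg _) (ci_nonneg _ _ _))
      refine (add_le_add (mul_le_mul_of_nonneg_left h7 zero_le_two) h8).trans_eq ?_
      rw [← rE_const_mul, ← rE_add, ← rE_const_mul, ← rE_add]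
      refine congrArg _ (funext fun ω => ?_)
      have := ci_mul_cs Λ ω o b
      have h9 : ci ω o b * cs Λ ω b ^ 2 = ci ω o b * cs Λ ω o ^ 2 := by
        rw [sq, ← mul_assoc, this, mul_right_comm, this]; ring
      linear_combination (2 * ci ω o a * cs Λ ω o) * this + ci ω o a * h9
    have h6 : 0 ≤ rE Λ.sym2 v (fun ω => ci ω o a * ci ω o b * cs Λ ω o ^ 2) := rE_nonneg hv
      fun _ _ => mul_nonneg (mul_nonneg (ci_nonneg _ _ _) (ci_nonneg _ _ _)) (sq_nonneg _)
    have := mul_le_mul_of_nonneg_left h5 (hu s(a, b))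
    have := mul_le_mul_of_nonneg_right (hM s(a, b)) h6
    linarith
  simp only [Finset.sum_add_distrib, ← Finset.mul_sum] at h4
  have := mul_le_mul_of_nonneg_left h3 (mul_nonneg zero_le_three hM0)
  simp only [Finset.mul_sum] at h4 this heq ⊢
  linarith

end FiniteVolume

section TreeGraph
variable {U : Type*} [DecidableEq U]

theorem rE_bk {ι : Type*} [DecidableEq ι] {s : Finset ι} {w : ι → ℝ} (hw : 0 ≤ w)
    {A B : Finset ι → Prop} (hA : Monotone A) (hB : Monotone B) :
    rE s w (fun ω => ind (DisjOcc (fun I J => A I ∧ B J) ω)) ≤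
      rE s w (fun ω => ind (A ω)) * rE s w (fun ω => ind (B ω)) :=
  bE_bk (fun e => edgeProb_mem (hw e)) hA hB

theorem lk_monotone (x y : U) : Monotone fun ω : Finset (Sym2 U) => Lk (ω : Set (Sym2 U)) x y :=
  fun _ _ h => Lk.mono (by exact_mod_cast h)

theorem disjOcc_monotone {ι : Type*} [DecidableEq ι] (W : Finset ι → Finset ι → Prop) :
    Monotone (DisjOcc W) :=
  fun _ _ h ⟨I, J, hI, hJ, hd, hW⟩ => ⟨I, J, hI.trans h, hJ.trans h, hd, hW⟩

theorem lk_mem_of_sym2 {Λ : Finset U} {ω : Finset (Sym2 U)} (hω : ω ⊆ Λ.sym2) {x y : U}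
    (hx : x ∈ Λ) (h : Lk (ω : Set (Sym2 U)) x y) : y ∈ Λ := by
  induction h with
  | refl => exact hx
  | tail _ h _ => exact (Finset.mk_mem_sym2_iff.1 (hω h)).2

/-- The tree graph inequality for the second moment. -/
theorem tree_graph (Λ : Finset U) {w : Sym2 U → ℝ} (hw : 0 ≤ w) {o : U} (ho : o ∈ Λ) :
    rE Λ.sym2 w (fun ω => cs Λ ω o ^ 2) ≤ ∑ z ∈ Λ, rE Λ.sym2 w (fun ω => ci ω o z) *
      rE Λ.sym2 w (fun ω => cs Λ ω z) * rE Λ.sym2 w (fun ω => cs Λ ω z) := by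
  have hpt : ∀ x y, rE Λ.sym2 w (fun ω => ci ω o x * ci ω o y) ≤ ∑ z ∈ Λ,
      rE Λ.sym2 w (fun ω => ci ω o z) * rE Λ.sym2 w (fun ω => ci ω z x) *
        rE Λ.sym2 w (fun ω => ci ω z y) := by
    intro x y
    have h1 : rE Λ.sym2 w (fun ω => ci ω o x * ci ω o y) ≤ rE Λ.sym2 w (fun ω => ∑ z ∈ Λ,
        ind (DisjOcc (fun I J => DisjOcc (fun I J => Lk (I : Set (Sym2 U)) o z ∧
          Lk (J : Set (Sym2 U)) z x) I ∧ Lk (J : Set (Sym2 U)) z y) ω)) := by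
      refine rE_mono hw fun ω hω => ?_
      by_cases h : Lk (ω : Set (Sym2 U)) o x ∧ Lk (ω : Set (Sym2 U)) o y
      · obtain ⟨z, I₁, I₂, I₃, h1, h2, h3, hd, hd', h4, h5, h6⟩ := exists_tripod h.1 h.2
        have hz : z ∈ Λ := lk_mem_of_sym2 hω ho (h4.mono (by exact_mod_cast h1))
        refine le_trans ?_ (Finset.single_le_sum (fun i _ => ind_nonneg _) hz)
        rw [ind_true]
        · exact mul_le_one₀ (ci_le_one _ _ _) (ci_nonneg _ _ _) (ci_le_one _ _ _)
        · exact ⟨I₁ ∪ I₂, I₃, Finset.union_subset h1 h2, h3, hd',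
            ⟨I₁, I₂, Finset.subset_union_left, Finset.subset_union_right, hd, h4, h5⟩, h6⟩
      · unfold ci
        rw [← ind_and, ind_false h]
        exact Finset.sum_nonneg fun i _ => ind_nonneg _
    rw [rE_sum] at h1
    refine h1.trans (Finset.sum_le_sum fun z _ => ?_)
    refine (rE_bk hw (disjOcc_monotone _) (lk_monotone z y)).trans ?_
    exact mul_le_mul_of_nonneg_right (rE_bk hw (lk_monotone o z) (lk_monotone z x))
      (rE_nonneg hw fun _ _ => ind_nonneg _)
  calc _ = ∑ x ∈ Λ, ∑ y ∈ Λ, rE Λ.sym2 w (fun ω => ci ω o x * ci ω o y) := by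
        simp only [← rE_sum, sq, cs, Finset.sum_mul_sum]
    _ ≤ ∑ x ∈ Λ, ∑ y ∈ Λ, ∑ z ∈ Λ,
      rE Λ.sym2 w (fun ω => ci ω o z) * rE Λ.sym2 w (fun ω => ci ω z x) *
        rE Λ.sym2 w (fun ω => ci ω z y) :=
        Finset.sum_le_sum fun x _ => Finset.sum_le_sum fun y _ => hpt x y
    _ = _ := by
        simp only [cs, rE_sum]
        have h : ∀ (g : ℝ) (a : U → ℝ), g * (∑ x ∈ Λ, a x) * (∑ y ∈ Λ, a y) =
            ∑ x ∈ Λ, ∑ y ∈ Λ, g * a x * a y := fun g a => by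
          rw [Finset.mul_sum (a := g), Finset.sum_mul_sum]
        simp only [h]
        rw [Finset.sum_congr rfl fun x _ => Finset.sum_comm, Finset.sum_comm]

end TreeGraph

section Volume
variable {U : Type*} [DecidableEq U]

/-- Functionals of a finite box and a configuration that increase in both arguments. -/
structure VM (F : Finset U → Finset (Sym2 U) → ℝ) : Prop where
  mono : ∀ Λ, Monotone (F Λ)
  mono_vol : ∀ ω, Monotone fun Λ => F Λ ω
  nonneg : ∀ Λ ω, 0 ≤ F Λ ω

/-- Infinite volume expectation of an increasing functional. -/
noncomputable def EV (w : Sym2 U → ℝ) (F : Finset U → Finset (Sym2 U) → ℝ) : ℝ≥0∞ :=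
  ⨆ Λ : Finset U, ENNReal.ofReal (rE Λ.sym2 w (F Λ))

theorem le_EV (w : Sym2 U → ℝ) (F : Finset U → Finset (Sym2 U) → ℝ) (Λ : Finset U) :
    ENNReal.ofReal (rE Λ.sym2 w (F Λ)) ≤ EV w F :=
  le_iSup (fun Λ : Finset U => ENNReal.ofReal (rE Λ.sym2 w (F Λ))) Λ

theorem VM.monotone_rE {w : Sym2 U → ℝ} (hw : 0 ≤ w) {F : Finset U → Finset (Sym2 U) → ℝ}
    (hF : VM F) : Monotone fun Λ : Finset U => rE Λ.sym2 w (F Λ) := fun Λ Λ' h =>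
  (rE_mono hw fun ω _ => hF.mono_vol ω h).trans (rE_mono_set hw (Finset.sym2_mono h) (hF.mono Λ'))

theorem VM.monotone_ofReal {w : Sym2 U → ℝ} (hw : 0 ≤ w) {F : Finset U → Finset (Sym2 U) → ℝ}
    (hF : VM F) : Monotone fun Λ : Finset U => ENNReal.ofReal (rE Λ.sym2 w (F Λ)) :=
  fun _ _ h => ENNReal.ofReal_le_ofReal (hF.monotone_rE hw h)

theorem EV_mono {w : Sym2 U → ℝ} (hw : 0 ≤ w) {F G : Finset U → Finset (Sym2 U) → ℝ}
    (h : ∀ Λ, ∀ ω ⊆ Λ.sym2, F Λ ω ≤ G Λ ω) : EV w F ≤ EV w G :=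
  iSup_mono fun Λ => ENNReal.ofReal_le_ofReal (rE_mono hw (h Λ))

theorem EV_mono_rate {w w' : Sym2 U → ℝ} (hw : 0 ≤ w) (h : w ≤ w')
    {F : Finset U → Finset (Sym2 U) → ℝ} (hF : VM F) : EV w F ≤ EV w' F :=
  iSup_mono fun Λ => ENNReal.ofReal_le_ofReal (rE_mono_rate hw h (hF.mono Λ))

theorem EV_add {w : Sym2 U → ℝ} (hw : 0 ≤ w) {F G : Finset U → Finset (Sym2 U) → ℝ}
    (hF : VM F) (hG : VM G) : EV w (fun Λ ω => F Λ ω + G Λ ω) = EV w F + EV w G := by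
  unfold EV
  rw [ENNReal.iSup_add_iSup_of_monotone (hF.monotone_ofReal hw) (hG.monotone_ofReal hw)]
  refine iSup_congr fun Λ => ?_
  rw [rE_add, ENNReal.ofReal_add (rE_nonneg hw fun _ _ => hF.nonneg _ _)
    (rE_nonneg hw fun _ _ => hG.nonneg _ _)]

theorem EV_const_mul (w : Sym2 U → ℝ) {c : ℝ} (hc : 0 ≤ c) (F : Finset U → Finset (Sym2 U) → ℝ) :
    EV w (fun Λ ω => c * F Λ ω) = ENNReal.ofReal c * EV w F := by
  unfold EV
  rw [ENNReal.mul_iSup]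
  exact iSup_congr fun Λ => by rw [rE_const_mul, ENNReal.ofReal_mul hc]

theorem tsum_iSup_le {F : Finset U → U → ℝ≥0∞} (hF : ∀ i, Monotone fun Λ => F Λ i) :
    ∑' i, ⨆ Λ, F Λ i ≤ ⨆ Λ : Finset U, ∑ i ∈ Λ, F Λ i := by
  rw [ENNReal.tsum_eq_iSup_sum]
  refine iSup_le fun s => ?_
  rw [ENNReal.finsetSum_iSup_of_monotone hF]
  refine iSup_le fun Λ => le_iSup_of_le (Λ ∪ s) ?_
  exact (Finset.sum_le_sum fun i _ => hF i Finset.subset_union_left).trans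
    (Finset.sum_le_sum_of_subset Finset.subset_union_right)

theorem tsum_tsum_iSup_le {F : Finset U → U → U → ℝ≥0∞} (hF : ∀ i j, Monotone fun Λ => F Λ i j) :
    ∑' i, ∑' j, ⨆ Λ, F Λ i j ≤ ⨆ Λ : Finset U, ∑ i ∈ Λ, ∑ j ∈ Λ, F Λ i j := by
  refine le_trans (ENNReal.tsum_le_tsum fun i => tsum_iSup_le (hF i)) (tsum_iSup_le ?_)
  intro i Λ Λ' h
  exact (Finset.sum_le_sum fun j _ => hF i j h).trans (Finset.sum_le_sum_of_subset h)

theorem vm_ci (o x : U) : VM fun (_ : Finset U) ω => ci ω o x :=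
  ⟨fun _ => ci_mono o x, fun _ _ _ _ => le_rfl, fun _ _ => ci_nonneg _ _ _⟩

theorem vm_cw {φ : U → ℝ} (hφ : 0 ≤ φ) (o : U) : VM fun Λ ω => cw φ Λ ω o :=
  ⟨fun Λ => cw_mono hφ Λ o, fun ω _ _ h => Finset.sum_le_sum_of_subset_of_nonneg h
    fun x _ _ => mul_nonneg (hφ x) (ci_nonneg _ _ _), fun _ _ => cw_nonneg hφ _ _ _⟩

theorem vm_cs (o : U) : VM fun Λ ω => cs Λ ω o := by
  simp only [← cw_one]; exact vm_cw (fun _ => zero_le_one) o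

theorem VM.mul {F G : Finset U → Finset (Sym2 U) → ℝ} (hF : VM F) (hG : VM G) :
    VM fun Λ ω => F Λ ω * G Λ ω :=
  ⟨fun Λ ω ω' h => mul_le_mul (hF.mono Λ h) (hG.mono Λ h) (hG.nonneg _ _) (hF.nonneg _ _),
    fun ω Λ Λ' h => mul_le_mul (hF.mono_vol ω h) (hG.mono_vol ω h) (hG.nonneg _ _) (hF.nonneg _ _),
    fun _ _ => mul_nonneg (hF.nonneg _ _) (hG.nonneg _ _)⟩

theorem VM.pow {F : Finset U → Finset (Sym2 U) → ℝ} (hF : VM F) (k : ℕ) :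
    VM fun Λ ω => F Λ ω ^ k :=
  ⟨fun Λ ω ω' h => pow_le_pow_left₀ (hF.nonneg _ _) (hF.mono Λ h) k,
    fun ω Λ Λ' h => pow_le_pow_left₀ (hF.nonneg _ _) (hF.mono_vol ω h) k,
    fun _ _ => pow_nonneg (hF.nonneg _ _) k⟩

theorem EV_sum {w : Sym2 U → ℝ} (hw : 0 ≤ w) {φ : U → ℝ} (hφ : 0 ≤ φ)
    {F : U → Finset U → Finset (Sym2 U) → ℝ} (hF : ∀ x, VM (F x)) :
    EV w (fun Λ ω => ∑ x ∈ Λ, φ x * F x Λ ω) = ∑' x, ENNReal.ofReal (φ x) * EV w (F x) := by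
  have h : ∀ Λ : Finset U, ENNReal.ofReal (rE Λ.sym2 w (fun ω => ∑ x ∈ Λ, φ x * F x Λ ω)) =
      ∑ x ∈ Λ, ENNReal.ofReal (φ x) * ENNReal.ofReal (rE Λ.sym2 w (F x Λ)) := fun Λ => by
    rw [rE_sum, ENNReal.ofReal_sum_of_nonneg]
    · refine Finset.sum_congr rfl fun x _ => ?_
      rw [rE_const_mul, ENNReal.ofReal_mul (hφ x)]
    · intro x _
      exact rE_nonneg hw fun _ _ => mul_nonneg (hφ x) ((hF x).nonneg _ _)
  apply le_antisymm
  · refine iSup_le fun Λ => ?_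
    rw [h]
    refine le_trans ?_ (ENNReal.sum_le_tsum Λ)
    exact Finset.sum_le_sum fun x _ => by gcongr; exact le_EV _ _ _
  · unfold EV
    simp only [ENNReal.mul_iSup, h]
    exact tsum_iSup_le fun x Λ Λ' hΛ => by
      dsimp only
      gcongr
      exact (hF x).monotone_rE hw hΛ

end Volume

section Translation
variable {U : Type*} [DecidableEq U] [AddCommGroup U]

/-- Translation of vertices. -/
def tr (z : U) : U ↪ U := (Equiv.addRight z).toEmbedding

theorem tr_apply (z x : U) : tr z x = x + z := rfl

/-- Translation invariance of edge rates. -/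
def TI (w : Sym2 U → ℝ) : Prop := ∀ z a b, w s(a + z, b + z) = w s(a, b)

theorem TI.add {w u : Sym2 U → ℝ} (hw : TI w) (hu : TI u) : TI (w + u) := fun z a b => by
  simp [hw z a b, hu z a b]

theorem TI.smul {w : Sym2 U → ℝ} (c : ℝ) (hw : TI w) : TI (c • w) := fun z a b => by
  simp [hw z a b]

theorem TI.sub_left {w : Sym2 U → ℝ} (hw : TI w) (a b : U) : w s(a, b) = w s(0, b - a) := by
  rw [← hw a 0 (b - a)]; simp

theorem rE_tr {w : Sym2 U → ℝ} (hw : TI w) (z : U) (Λ : Finset U) (f : Finset (Sym2 U) → ℝ) :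
    rE (Λ.map (tr z)).sym2 w f = rE Λ.sym2 w (fun ω => f (ω.map (tr z).sym2Map)) := by
  rw [Finset.sym2_map]
  unfold rE
  rw [bE_map]
  refine bE_congr_p fun e _ => ?_
  induction e with
  | _ a b => exact congrArg edgeProb (hw z a b)

theorem lk_tr (z : U) (ω : Finset (Sym2 U)) (x y : U) :
    Lk ((ω.map (tr z).sym2Map : Finset (Sym2 U)) : Set (Sym2 U)) (x + z) (y + z) ↔
      Lk (ω : Set (Sym2 U)) x y := by
  have hmem : ∀ a b : U, s(a, b) ∈ ((ω.map (tr z).sym2Map : Finset (Sym2 U)) : Set (Sym2 U)) ↔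
      s(a - z, b - z) ∈ (ω : Set (Sym2 U)) := by
    intro a b
    have h : s(a, b) = (tr z).sym2Map s(a - z, b - z) := by
      show _ = s((a - z) + z, (b - z) + z)
      simp
    rw [h, Finset.coe_map, Set.mem_image]
    exact ⟨fun ⟨e, he, h⟩ => (tr z).sym2Map.injective h ▸ he, fun h => ⟨_, h, rfl⟩⟩
  constructor
  · intro h
    have := Relation.ReflTransGen.lift (r := fun a b => s(a, b) ∈
      ((ω.map (tr z).sym2Map : Finset (Sym2 U)) : Set (Sym2 U)))
      (p := fun a b => s(a, b) ∈ (ω : Set (Sym2 U))) (fun a => a - z)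
      (fun a b hab => (hmem a b).1 hab) _ _ h
    simp only [Function.onFun, add_sub_cancel_right] at this
    exact this
  · intro h
    exact Relation.ReflTransGen.lift (fun a => a + z)
      (fun a b hab => (hmem _ _).2 (by simpa using hab)) _ _ h

theorem ci_tr (z : U) (ω : Finset (Sym2 U)) (x y : U) :
    ci (ω.map (tr z).sym2Map) (x + z) (y + z) = ci ω x y := ind_congr (lk_tr z ω x y)

theorem cw_tr (φ : U → ℝ) (z : U) (Λ : Finset U) (ω : Finset (Sym2 U)) (x : U) :
    cw φ (Λ.map (tr z)) (ω.map (tr z).sym2Map) (x + z) = cw (fun y => φ (y + z)) Λ ω x := by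
  unfold cw
  rw [Finset.sum_map]
  exact Finset.sum_congr rfl fun y _ => by rw [tr_apply, ci_tr]

theorem cs_tr (z : U) (Λ : Finset U) (ω : Finset (Sym2 U)) (x : U) :
    cs (Λ.map (tr z)) (ω.map (tr z).sym2Map) (x + z) = cs Λ ω x := by
  simp only [← cw_one, cw_tr]

theorem EV_tr {w : Sym2 U → ℝ} (hw : TI w) (z : U) (F G : Finset U → Finset (Sym2 U) → ℝ)
    (h : ∀ Λ ω, G (Λ.map (tr z)) (ω.map (tr z).sym2Map) = F Λ ω) : EV w G = EV w F := by
  have key : ∀ Λ : Finset U, rE (Λ.map (tr z)).sym2 w (G (Λ.map (tr z))) = rE Λ.sym2 w (F Λ) := by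
    intro Λ
    rw [rE_tr hw]
    exact bE_congr fun ω _ => h Λ ω
  apply le_antisymm
  · refine iSup_le fun Λ => ?_
    have : Λ = (Λ.map (tr (-z))).map (tr z) := by
      rw [Finset.map_map]
      convert (Finset.map_refl).symm
      ext x; simp [tr]
    rw [this, key]
    exact le_EV _ _ _
  · refine iSup_le fun Λ => ?_
    rw [← key]
    exact le_EV _ _ _

end Translation

section InfVol

theorem iSup_mul_iSup_of_monotone {ι : Type*} [SemilatticeSup ι] {f g : ι → ℝ≥0∞}
    (hf : Monotone f) (hg : Monotone g) : (⨆ i, f i) * (⨆ i, g i) = ⨆ i, f i * g i := by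
  rw [ENNReal.iSup_mul]
  simp only [ENNReal.mul_iSup]
  refine le_antisymm (iSup_le fun i => iSup_le fun j => ?_)
    (iSup_le fun i => le_iSup_of_le i (le_iSup_of_le i le_rfl))
  exact le_iSup_of_le (i ⊔ j) (mul_le_mul' (hf le_sup_left) (hg le_sup_right))

variable {U : Type*} [DecidableEq U] [AddCommGroup U]

/-- Moments of the cluster size of the origin. -/
noncomputable def Am (k : ℕ) (w : Sym2 U → ℝ) : ℝ≥0∞ := EV w (fun Λ ω => cs Λ ω 0 ^ k)

/-- Expected `φ`-weight of the cluster of the origin. -/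
noncomputable def gy (φ : U → ℝ) (w : Sym2 U → ℝ) : ℝ≥0∞ := EV w (fun Λ ω => cw φ Λ ω 0)

/-- Total rate at a vertex. -/
noncomputable def rs (u : Sym2 U → ℝ) : ℝ≥0∞ := ∑' b, ENNReal.ofReal (u s(0, b))

/-- Total weighted rate at a vertex. -/
noncomputable def rsw (φ : U → ℝ) (u : Sym2 U → ℝ) : ℝ≥0∞ :=
  ∑' b, ENNReal.ofReal (φ b) * ENNReal.ofReal (u s(0, b))

theorem EV_cs_base {w : Sym2 U → ℝ} (hw : TI w) (b : U) (k : ℕ) :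
    EV w (fun Λ ω => cs Λ ω b ^ k) = Am k w :=
  EV_tr hw b _ _ fun Λ ω => by simpa using congrArg (· ^ k) (cs_tr b Λ ω 0)

theorem EV_cs_base_one {w : Sym2 U → ℝ} (hw : TI w) (b : U) :
    EV w (fun Λ ω => cs Λ ω b) = Am 1 w := by
  simpa using EV_cs_base hw b 1

theorem Am_one (w : Sym2 U → ℝ) : EV w (fun Λ ω => cs Λ ω 0) = Am 1 w := by simp [Am]

theorem rs_row {u : Sym2 U → ℝ} (hu : TI u) (a : U) :
    ∑' b, ENNReal.ofReal (u s(a, b)) = rs u := by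
  unfold rs
  rw [← (Equiv.addRight a).tsum_eq]
  refine tsum_congr fun b => ?_
  rw [hu.sub_left a]; simp

theorem Am_mono_rate {w w' : Sym2 U → ℝ} (hw : 0 ≤ w) (h : w ≤ w') (k : ℕ) : Am k w ≤ Am k w' :=
  EV_mono_rate hw h ((vm_cs 0).pow k)

theorem gy_mono_rate {w w' : Sym2 U → ℝ} (hw : 0 ≤ w) (h : w ≤ w') {φ : U → ℝ} (hφ : 0 ≤ φ) :
    gy φ w ≤ gy φ w' :=
  EV_mono_rate hw h (vm_cw hφ 0)

theorem pair_sum_le {u : Sym2 U → ℝ} (hu0 : 0 ≤ u) (hu : TI u) (Λ : Finset U) {f g : U → ℝ}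
    (hf : 0 ≤ f) (hg : 0 ≤ g) {F G : ℝ≥0∞} (hF : ENNReal.ofReal (∑ a ∈ Λ, f a) ≤ F)
    (hG : ∀ b, ENNReal.ofReal (g b) ≤ G) :
    ENNReal.ofReal (∑ a ∈ Λ, ∑ b ∈ Λ, u s(a, b) * (f a * g b)) ≤ rs u * (F * G) := by
  rw [ENNReal.ofReal_sum_of_nonneg fun a _ => Finset.sum_nonneg fun b _ =>
    mul_nonneg (hu0 _) (mul_nonneg (hf _) (hg _))]
  calc _ ≤ ∑ a ∈ Λ, rs u * (ENNReal.ofReal (f a) * G) := by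
        refine Finset.sum_le_sum fun a _ => ?_
        rw [ENNReal.ofReal_sum_of_nonneg fun b _ => mul_nonneg (hu0 _) (mul_nonneg (hf _) (hg _)),
          ← rs_row hu a, ← ENNReal.tsum_mul_right]
        refine le_trans (Finset.sum_le_sum fun b _ => ?_) (ENNReal.sum_le_tsum Λ)
        rw [ENNReal.ofReal_mul (hu0 _), ENNReal.ofReal_mul (hf _)]
        gcongr
        exact hG b
    _ = rs u * (ENNReal.ofReal (∑ a ∈ Λ, f a) * G) := by
        rw [ENNReal.ofReal_sum_of_nonneg fun a _ => hf a, Finset.sum_mul, Finset.mul_sum]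
    _ ≤ _ := by gcongr

theorem pair_sum_ge {u w : Sym2 U → ℝ} (hw : 0 ≤ w) (hu0 : 0 ≤ u) (hu : TI u)
    {f g : U → Finset U → Finset (Sym2 U) → ℝ} (hf : ∀ a, VM (f a)) (hg : ∀ a, VM (g a))
    {G : ℝ≥0∞} (hG : ∀ b, EV w (g b) = G) :
    rs u * (EV w (fun Λ ω => ∑ a ∈ Λ, f a Λ ω) * G) ≤
      ⨆ Λ : Finset U, ENNReal.ofReal (∑ a ∈ Λ, ∑ b ∈ Λ, u s(a, b) *
        (rE Λ.sym2 w (f a Λ) * rE Λ.sym2 w (g b Λ))) := by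
  have h1 := EV_sum hw (φ := fun _ => (1 : ℝ)) (fun _ => zero_le_one) hf
  simp only [one_mul, ENNReal.ofReal_one] at h1
  rw [h1, ← ENNReal.tsum_mul_right, ← ENNReal.tsum_mul_left]
  have h2 : ∀ Λ : Finset U, ENNReal.ofReal (∑ a ∈ Λ, ∑ b ∈ Λ, u s(a, b) *
        (rE Λ.sym2 w (f a Λ) * rE Λ.sym2 w (g b Λ))) =
      ∑ a ∈ Λ, ∑ b ∈ Λ, ENNReal.ofReal (u s(a, b)) *
        (ENNReal.ofReal (rE Λ.sym2 w (f a Λ)) * ENNReal.ofReal (rE Λ.sym2 w (g b Λ))) := by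
    intro Λ
    have hf' : ∀ a, 0 ≤ rE Λ.sym2 w (f a Λ) := fun a => rE_nonneg hw fun _ _ => (hf a).nonneg _ _
    have hg' : ∀ a, 0 ≤ rE Λ.sym2 w (g a Λ) := fun a => rE_nonneg hw fun _ _ => (hg a).nonneg _ _
    rw [ENNReal.ofReal_sum_of_nonneg fun a _ => Finset.sum_nonneg fun b _ =>
      mul_nonneg (hu0 _) (mul_nonneg (hf' _) (hg' _))]
    refine Finset.sum_congr rfl fun a _ => ?_
    rw [ENNReal.ofReal_sum_of_nonneg fun b _ => mul_nonneg (hu0 _) (mul_nonneg (hf' _) (hg' _))]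
    refine Finset.sum_congr rfl fun b _ => ?_
    rw [ENNReal.ofReal_mul (hu0 _), ENNReal.ofReal_mul (hf' _)]
  simp only [h2]
  refine le_trans (ENNReal.tsum_le_tsum fun a => ?_) (tsum_tsum_iSup_le fun a b Λ Λ' h => ?_)
  · rw [← rs_row hu a, ← ENNReal.tsum_mul_right]
    refine ENNReal.tsum_le_tsum fun b => ?_
    rw [← ENNReal.mul_iSup, ← iSup_mul_iSup_of_monotone ((hf a).monotone_ofReal hw)
      ((hg b).monotone_ofReal hw), ← hG b]
    exact le_rfl
  · exact mul_le_mul' le_rfl (mul_le_mul' ((hf a).monotone_ofReal hw h)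
      ((hg b).monotone_ofReal hw h))

theorem VM.sum_ci_mul {F : Finset U → Finset (Sym2 U) → ℝ} (hF : VM F) (o : U) (w : Sym2 U → ℝ) :
    EV w (fun Λ ω => ∑ a ∈ Λ, ci ω o a * F Λ ω) = EV w (fun Λ ω => cs Λ ω o * F Λ ω) := by
  simp only [cs, Finset.sum_mul]

/-- Upper differential inequality for the susceptibility. -/
theorem chi_add_le {w u : Sym2 U → ℝ} (hw : 0 ≤ w) (hu : 0 ≤ u) (tw : TI w) (tu : TI u) :
    Am 1 (w + u) ≤ Am 1 w + rs u * (Am 1 (w + u) * Am 1 (w + u)) := by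
  have hwu : 0 ≤ w + u := add_nonneg hw hu
  rw [← Am_one, ← Am_one]
  refine iSup_le fun Λ => ?_
  have h := cw_add_le Λ hw hu (φ := fun _ => 1) (fun _ => zero_le_one) 0
  simp only [cw_one] at h
  refine (ENNReal.ofReal_le_ofReal h).trans (ENNReal.ofReal_add_le.trans ?_)
  refine add_le_add (le_EV w (fun Λ ω => cs Λ ω 0) Λ) ?_
  refine pair_sum_le hu tu Λ (fun a => rE_nonneg hwu fun _ _ => ci_nonneg _ _ _)
    (fun a => rE_nonneg hwu fun _ _ => cs_nonneg _ _ _) ?_ fun b => ?_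
  · rw [← rE_sum]
    exact le_EV (w + u) (fun Λ ω => cs Λ ω 0) Λ
  · rw [Am_one, ← EV_cs_base_one (tw.add tu) b]
    exact le_EV (w + u) (fun Λ ω => cs Λ ω b) Λ

theorem Am_two_add_le {w u : Sym2 U → ℝ} (hw : 0 ≤ w) (hu : 0 ≤ u) (tw : TI w) (tu : TI u) :
    Am 2 (w + u) ≤ Am 2 w + 3 * (rs u * (Am 2 (w + u) * Am 1 (w + u))) := by
  have hwu : 0 ≤ w + u := add_nonneg hw hu
  refine iSup_le fun Λ => ?_
  refine (ENNReal.ofReal_le_ofReal (cs_sq_add_le Λ hw hu 0)).trans (ENNReal.ofReal_add_le.trans ?_)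
  refine add_le_add (le_EV w (fun Λ ω => cs Λ ω 0 ^ 2) Λ) ?_
  simp only [mul_add, Finset.sum_add_distrib]
  refine ENNReal.ofReal_add_le.trans ?_
  rw [show (3 : ℝ≥0∞) = 2 + 1 by norm_num, add_mul, one_mul]
  refine add_le_add ?_ ?_
  · have : ∀ a b : U, u s(a, b) * (2 * (rE Λ.sym2 (w + u) (fun ω => ci ω 0 a * cs Λ ω 0) *
          rE Λ.sym2 (w + u) (fun ω => cs Λ ω b))) =
        2 * (u s(a, b) * (rE Λ.sym2 (w + u) (fun ω => ci ω 0 a * cs Λ ω 0) *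
          rE Λ.sym2 (w + u) (fun ω => cs Λ ω b))) := fun a b => by ring
    simp only [this, ← Finset.mul_sum]
    rw [ENNReal.ofReal_mul zero_le_two, ENNReal.ofReal_ofNat]
    gcongr
    refine pair_sum_le hu tu Λ (fun a => rE_nonneg hwu fun _ _ =>
      mul_nonneg (ci_nonneg _ _ _) (cs_nonneg _ _ _))
      (fun a => rE_nonneg hwu fun _ _ => cs_nonneg _ _ _) ?_ fun b => ?_
    · rw [← rE_sum]
      refine le_trans (le_of_eq ?_) (le_EV (w + u) (fun Λ ω => cs Λ ω 0 ^ 2) Λ)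
      congr 2; ext ω
      rw [← Finset.sum_mul, sq]; rfl
    · rw [← EV_cs_base_one (tw.add tu) b]
      exact le_EV (w + u) (fun Λ ω => cs Λ ω b) Λ
  · rw [mul_comm (Am 2 _)]
    refine pair_sum_le hu tu Λ (fun a => rE_nonneg hwu fun _ _ => ci_nonneg _ _ _)
      (fun a => rE_nonneg hwu fun _ _ => pow_nonneg (cs_nonneg _ _ _) 2) ?_ fun b => ?_
    · rw [← rE_sum, ← Am_one]
      exact le_EV (w + u) (fun Λ ω => cs Λ ω 0) Λ
    · rw [← EV_cs_base (tw.add tu) b]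
      exact le_EV (w + u) (fun Λ ω => cs Λ ω b ^ 2) Λ

/-- Lower differential inequality for the susceptibility. -/
theorem chi_add_ge {w u : Sym2 U → ℝ} (hw : 0 ≤ w) (hu : 0 ≤ u) (tw : TI w) (tu : TI u) {M : ℝ}
    (hM : ∀ e, u e ≤ M) :
    Am 1 w + rs u * (Am 1 w * Am 1 w) ≤ Am 1 (w + u) + ENNReal.ofReal M * Am 3 (w + u) := by
  have hwu : 0 ≤ w + u := add_nonneg hw hu
  have hM0 : 0 ≤ M := (hu s(0, 0)).trans (hM _)
  have h1 := pair_sum_ge hw hu tu (f := fun a _ ω => ci ω 0 a) (g := fun b Λ ω => cs Λ ω b)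
    (fun a => vm_ci 0 a) (fun b => vm_cs b) (EV_cs_base_one tw)
  rw [show EV w (fun Λ ω => ∑ a ∈ Λ, ci ω 0 a) = Am 1 w from Am_one w] at h1
  refine (add_le_add le_rfl h1).trans ?_
  rw [← Am_one, ← Am_one, Am, ← EV_const_mul _ hM0, ← EV_add hwu (vm_cs 0)]
  swap
  · exact ⟨fun Λ ω ω' h => mul_le_mul_of_nonneg_left (((vm_cs 0).pow 3).mono Λ h) hM0,
      fun ω Λ Λ' h => mul_le_mul_of_nonneg_left (((vm_cs 0).pow 3).mono_vol ω h) hM0,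
      fun Λ ω => mul_nonneg hM0 (((vm_cs 0).pow 3).nonneg Λ ω)⟩
  rw [EV, ENNReal.iSup_add_iSup_of_monotone ((vm_cs 0).monotone_ofReal hw)]
  · refine iSup_mono fun Λ => ?_
    rw [← ENNReal.ofReal_add (rE_nonneg hw fun _ _ => cs_nonneg _ _ _)
      (Finset.sum_nonneg fun a _ => Finset.sum_nonneg fun b _ => mul_nonneg (hu _) (mul_nonneg
      (rE_nonneg hw fun _ _ => ci_nonneg _ _ _) (rE_nonneg hw fun _ _ => cs_nonneg _ _ _)))]
    refine ENNReal.ofReal_le_ofReal ((cs_add_ge Λ hw hu 0 hM).trans (le_of_eq ?_))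
    rw [rE_add, rE_const_mul]
  · intro Λ Λ' h
    refine ENNReal.ofReal_le_ofReal ?_
    have hnn : ∀ (Λ : Finset U) a b, 0 ≤ u s(a, b) * (rE Λ.sym2 w (fun ω => ci ω 0 a) *
        rE Λ.sym2 w (fun ω => cs Λ ω b)) := fun Λ a b => mul_nonneg (hu _) (mul_nonneg
      (rE_nonneg hw fun _ _ => ci_nonneg _ _ _) (rE_nonneg hw fun _ _ => cs_nonneg _ _ _))
    calc _ ≤ ∑ a ∈ Λ, ∑ b ∈ Λ, u s(a, b) * (rE Λ'.sym2 w (fun ω => ci ω 0 a) *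
          rE Λ'.sym2 w (fun ω => cs Λ' ω b)) :=
          Finset.sum_le_sum fun a _ => Finset.sum_le_sum fun b _ =>
            mul_le_mul_of_nonneg_left (mul_le_mul ((vm_ci 0 a).monotone_rE hw h)
              ((vm_cs b).monotone_rE hw h) (rE_nonneg hw fun _ _ => cs_nonneg _ _ _)
              (rE_nonneg hw fun _ _ => ci_nonneg _ _ _)) (hu _)
      _ ≤ ∑ a ∈ Λ, ∑ b ∈ Λ', _ := Finset.sum_le_sum fun a _ =>
          Finset.sum_le_sum_of_subset_of_nonneg h fun b _ _ => hnn _ _ _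
      _ ≤ _ := Finset.sum_le_sum_of_subset_of_nonneg h fun a _ _ =>
          Finset.sum_nonneg fun b _ => hnn _ _ _

end InfVol

section InfVolTwo
variable {U : Type*} [DecidableEq U] [AddCommGroup U]

theorem pair_sum_monotone {u w : Sym2 U → ℝ} (hw : 0 ≤ w) (hu0 : 0 ≤ u)
    {f g : U → Finset U → Finset (Sym2 U) → ℝ} (hf : ∀ a, VM (f a)) (hg : ∀ a, VM (g a)) :
    Monotone fun Λ : Finset U => ∑ a ∈ Λ, ∑ b ∈ Λ, u s(a, b) *
        (rE Λ.sym2 w (f a Λ) * rE Λ.sym2 w (g b Λ)) := by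
  intro Λ Λ' h
  have hf' : ∀ (Λ : Finset U) a, 0 ≤ rE Λ.sym2 w (f a Λ) :=
    fun Λ a => rE_nonneg hw fun _ _ => (hf a).nonneg _ _
  have hg' : ∀ (Λ : Finset U) a, 0 ≤ rE Λ.sym2 w (g a Λ) :=
    fun Λ a => rE_nonneg hw fun _ _ => (hg a).nonneg _ _
  have hnn : ∀ (Λ : Finset U) a b, 0 ≤ u s(a, b) * (rE Λ.sym2 w (f a Λ) * rE Λ.sym2 w (g b Λ)) :=
    fun Λ a b => mul_nonneg (hu0 _) (mul_nonneg (hf' _ _) (hg' _ _))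
  calc _ ≤ ∑ a ∈ Λ, ∑ b ∈ Λ, u s(a, b) * (rE Λ'.sym2 w (f a Λ') * rE Λ'.sym2 w (g b Λ')) :=
        Finset.sum_le_sum fun a _ => Finset.sum_le_sum fun b _ =>
          mul_le_mul_of_nonneg_left (mul_le_mul ((hf a).monotone_rE hw h)
            ((hg b).monotone_rE hw h) (hg' _ _) (hf' _ _)) (hu0 _)
    _ ≤ ∑ a ∈ Λ, ∑ b ∈ Λ', _ := Finset.sum_le_sum fun a _ =>
        Finset.sum_le_sum_of_subset_of_nonneg h fun b _ _ => hnn _ _ _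
    _ ≤ _ := Finset.sum_le_sum_of_subset_of_nonneg h fun a _ _ =>
        Finset.sum_nonneg fun b _ => hnn _ _ _

theorem pair_sum_nonneg {u w : Sym2 U → ℝ} (hw : 0 ≤ w) (hu0 : 0 ≤ u)
    {f g : U → Finset U → Finset (Sym2 U) → ℝ} (hf : ∀ a, VM (f a)) (hg : ∀ a, VM (g a))
    (Λ : Finset U) : 0 ≤ ∑ a ∈ Λ, ∑ b ∈ Λ, u s(a, b) *
        (rE Λ.sym2 w (f a Λ) * rE Λ.sym2 w (g b Λ)) :=
  Finset.sum_nonneg fun a _ => Finset.sum_nonneg fun b _ => mul_nonneg (hu0 _) (mul_nonneg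
    (rE_nonneg hw fun _ _ => (hf a).nonneg _ _) (rE_nonneg hw fun _ _ => (hg b).nonneg _ _))

theorem VM.const_mul {c : ℝ} (hc : 0 ≤ c) {F : Finset U → Finset (Sym2 U) → ℝ} (hF : VM F) :
    VM fun Λ ω => c * F Λ ω :=
  ⟨fun Λ ω ω' h => mul_le_mul_of_nonneg_left (hF.mono Λ h) hc,
    fun ω Λ Λ' h => mul_le_mul_of_nonneg_left (hF.mono_vol ω h) hc,
    fun Λ ω => mul_nonneg hc (hF.nonneg Λ ω)⟩

theorem Am_two_add_ge {w u : Sym2 U → ℝ} (hw : 0 ≤ w) (hu : 0 ≤ u) (tw : TI w) (tu : TI u) {M : ℝ}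
    (hM : ∀ e, u e ≤ M) :
    Am 2 w + 3 * (rs u * (Am 2 w * Am 1 w)) ≤
      Am 2 (w + u) + 3 * (ENNReal.ofReal M * Am 4 (w + u)) := by
  have hwu : 0 ≤ w + u := add_nonneg hw hu
  have hM0 : 0 ≤ M := (hu s(0, 0)).trans (hM _)
  have vf1 : ∀ a : U, VM fun Λ ω => ci ω 0 a * cs Λ ω 0 := fun a => (vm_ci 0 a).mul (vm_cs 0)
  have vg2 : ∀ b : U, VM fun Λ ω => cs Λ ω b ^ 2 := fun b => (vm_cs b).pow 2
  have h1 := pair_sum_ge hw hu tu (f := fun a Λ ω => ci ω 0 a * cs Λ ω 0)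
    (g := fun b Λ ω => cs Λ ω b) vf1 (fun b => vm_cs b) (EV_cs_base_one tw)
  rw [VM.sum_ci_mul (vm_cs 0)] at h1
  simp only [← sq] at h1
  have h2 := pair_sum_ge hw hu tu (f := fun a _ ω => ci ω 0 a) (g := fun b Λ ω => cs Λ ω b ^ 2)
    (fun a => vm_ci 0 a) vg2 (fun b => EV_cs_base tw b 2)
  rw [show EV w (fun Λ ω => ∑ a ∈ Λ, ci ω 0 a) = Am 1 w from Am_one w] at h2
  have e3 : (3 : ℝ≥0∞) * (rs u * (Am 2 w * Am 1 w)) =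
      2 * (rs u * (Am 2 w * Am 1 w)) + rs u * (Am 1 w * Am 2 w) := by
    rw [show (3 : ℝ≥0∞) = 2 + 1 by norm_num, add_mul, one_mul, mul_comm (Am 1 w)]
  rw [e3]
  refine (add_le_add le_rfl (add_le_add (mul_le_mul' (le_refl (2 : ℝ≥0∞)) h1) h2)).trans ?_
  have e4 : (3 : ℝ≥0∞) * (ENNReal.ofReal M * Am 4 (w + u)) =
      ENNReal.ofReal (3 * M) * Am 4 (w + u) := by
    rw [ENNReal.ofReal_mul (by norm_num), ENNReal.ofReal_ofNat, mul_assoc]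
  rw [e4, Am, Am, Am, ← EV_const_mul _ (by positivity : (0 : ℝ) ≤ 3 * M),
    ← EV_add hwu ((vm_cs 0).pow 2) (((vm_cs 0).pow 4).const_mul (by positivity)), ENNReal.mul_iSup]
  have m1 := pair_sum_monotone hw hu vf1 (fun b => vm_cs b)
  have m2 := pair_sum_monotone hw hu (fun a => vm_ci 0 a) vg2
  rw [ENNReal.iSup_add_iSup_of_monotone
    (fun Λ Λ' h => mul_le_mul' le_rfl (ENNReal.ofReal_le_ofReal (m1 h)))
    (fun Λ Λ' h => ENNReal.ofReal_le_ofReal (m2 h)), EV,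
    ENNReal.iSup_add_iSup_of_monotone (((vm_cs 0).pow 2).monotone_ofReal hw)
    (fun Λ Λ' h => add_le_add (mul_le_mul' le_rfl (ENNReal.ofReal_le_ofReal (m1 h)))
      (ENNReal.ofReal_le_ofReal (m2 h)))]
  refine iSup_mono fun Λ => ?_
  have n1 := pair_sum_nonneg hw hu vf1 (fun b => vm_cs b) Λ
  have n2 := pair_sum_nonneg hw hu (fun a => vm_ci 0 a) vg2 Λ
  rw [← ENNReal.ofReal_ofNat, ← ENNReal.ofReal_mul (by norm_num), ← ENNReal.ofReal_add
    (by exact mul_nonneg (by norm_num) n1) n2, ← ENNReal.ofReal_add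
    (rE_nonneg hw fun _ _ => pow_nonneg (cs_nonneg _ _ _) 2)
    (add_nonneg (mul_nonneg (by norm_num) n1) n2)]
  refine ENNReal.ofReal_le_ofReal (le_trans (le_of_eq ?_)
    ((cs_sq_add_ge Λ hw hu 0 hM).trans (le_of_eq ?_)))
  · congr 1
    simp only [Finset.mul_sum, ← Finset.sum_add_distrib]
    refine Finset.sum_congr rfl fun a _ => Finset.sum_congr rfl fun b _ => ?_
    ring
  · rw [rE_add, rE_const_mul]

theorem EV_cw_base {w : Sym2 U → ℝ} (hw : TI w) (φ : U → ℝ) (b : U) :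
    EV w (fun Λ ω => cw φ Λ ω b) = gy (fun x => φ (x + b)) w :=
  EV_tr hw b _ _ fun Λ ω => by simpa using cw_tr φ b Λ ω 0

theorem gy_add {w : Sym2 U → ℝ} (hw : 0 ≤ w) {φ ψ : U → ℝ} (hφ : 0 ≤ φ) (hψ : 0 ≤ ψ) :
    gy (fun x => φ x + ψ x) w = gy φ w + gy ψ w := by
  rw [gy, gy, gy, ← EV_add hw (vm_cw hφ 0) (vm_cw hψ 0)]
  congr 1; ext Λ ω
  simp [cw, add_mul, Finset.sum_add_distrib]

theorem gy_const_mul {w : Sym2 U → ℝ} {c : ℝ} (hc : 0 ≤ c) (φ : U → ℝ) :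
    gy (fun x => c * φ x) w = ENNReal.ofReal c * gy φ w := by
  rw [gy, gy, ← EV_const_mul _ hc]
  congr 1; ext Λ ω
  simp [cw, Finset.mul_sum, mul_assoc]

theorem gy_const {w : Sym2 U → ℝ} {c : ℝ} (hc : 0 ≤ c) :
    gy (fun _ => c) w = ENNReal.ofReal c * Am 1 w := by
  have := gy_const_mul (w := w) hc (fun _ => 1)
  simp only [mul_one] at this
  rw [this, gy]
  simp only [cw_one, Am_one]

theorem gy_mono {w : Sym2 U → ℝ} (hw : 0 ≤ w) {φ ψ : U → ℝ} (h : φ ≤ ψ) : gy φ w ≤ gy ψ w :=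
  EV_mono hw fun Λ ω _ => Finset.sum_le_sum fun x _ =>
    mul_le_mul_of_nonneg_right (h x) (ci_nonneg _ _ _)

theorem gy_eq_tsum {w : Sym2 U → ℝ} (hw : 0 ≤ w) {φ : U → ℝ} (hφ : 0 ≤ φ) :
    gy φ w = ∑' x, ENNReal.ofReal (φ x) * EV w (fun _ ω => ci ω 0 x) :=
  EV_sum hw hφ (vm_ci 0)

/-- Upper differential inequality for weighted cluster sizes with subadditive weight. -/
theorem gy_add_le {w u : Sym2 U → ℝ} (hw : 0 ≤ w) (hu : 0 ≤ u) (tw : TI w) (tu : TI u)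
    {φ : U → ℝ} (hφ : 0 ≤ φ) (hsub : ∀ x y, φ (x + y) ≤ φ x + φ y) :
    gy φ (w + u) ≤ gy φ w + (2 * (rs u * (Am 1 (w + u) * gy φ (w + u))) +
      Am 1 (w + u) * (Am 1 (w + u) * rsw φ u)) := by
  have hwu : 0 ≤ w + u := add_nonneg hw hu
  set X := Am 1 (w + u) with hX
  set Y := gy φ (w + u) with hY
  have hb : ∀ Λ b, ENNReal.ofReal (rE Λ.sym2 (w + u) (fun ω => cw φ Λ ω b)) ≤
      Y + ENNReal.ofReal (φ b) * X := by
    intro Λ b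
    refine (le_EV (w + u) (fun Λ ω => cw φ Λ ω b) Λ).trans ?_
    rw [EV_cw_base (tw.add tu)]
    refine (gy_mono hwu fun x => hsub x b).trans ?_
    rw [gy_add hwu hφ (ψ := fun _ => φ b) (fun _ => hφ b), gy_const (hφ b)]
  refine iSup_le fun Λ => ?_
  refine (ENNReal.ofReal_le_ofReal (cw_add_le Λ hw hu hφ 0)).trans (ENNReal.ofReal_add_le.trans ?_)
  refine add_le_add (le_EV w (fun Λ ω => cw φ Λ ω 0) Λ) ?_
  have hg : ∀ a, 0 ≤ rE Λ.sym2 (w + u) (fun ω => ci ω 0 a) := fun a =>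
    rE_nonneg hwu fun _ _ => ci_nonneg _ _ _
  have hc : ∀ b, 0 ≤ rE Λ.sym2 (w + u) (fun ω => cw φ Λ ω b) := fun a =>
    rE_nonneg hwu fun _ _ => cw_nonneg hφ _ _ _
  have hrow : ∀ a, ∑' b, ENNReal.ofReal (u s(a, b)) * (Y + ENNReal.ofReal (φ b) * X) ≤
      rs u * Y + (rs u * ENNReal.ofReal (φ a) + rsw φ u) * X := by
    intro a
    rw [← (Equiv.addRight a).tsum_eq]
    have : ∀ b, ENNReal.ofReal (u s(a, (Equiv.addRight a) b)) *
        (Y + ENNReal.ofReal (φ ((Equiv.addRight a) b)) * X) ≤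
        ENNReal.ofReal (u s(0, b)) * Y + (ENNReal.ofReal (u s(0, b)) * ENNReal.ofReal (φ a) +
          ENNReal.ofReal (φ b) * ENNReal.ofReal (u s(0, b))) * X := by
      intro b
      rw [tu.sub_left a]
      simp only [Equiv.coe_addRight, add_sub_cancel_right]
      calc _ ≤ ENNReal.ofReal (u s(0, b)) * (Y + (ENNReal.ofReal (φ b) +
            ENNReal.ofReal (φ a)) * X) := by
            gcongr
            exact (ENNReal.ofReal_le_ofReal (hsub _ _)).trans ENNReal.ofReal_add_le
        _ = _ := by ring
    refine (ENNReal.tsum_le_tsum this).trans (le_of_eq ?_)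
    rw [ENNReal.tsum_add, ENNReal.tsum_mul_right, ENNReal.tsum_mul_right, ENNReal.tsum_add,
      ENNReal.tsum_mul_right]
    rfl
  have hS1 : ∑ a ∈ Λ, ENNReal.ofReal (rE Λ.sym2 (w + u) (fun ω => ci ω 0 a)) ≤ X := by
    rw [← ENNReal.ofReal_sum_of_nonneg fun a _ => hg a, ← rE_sum, hX, ← Am_one]
    exact le_EV (w + u) (fun Λ ω => cs Λ ω 0) Λ
  have hS2 : ∑ a ∈ Λ, ENNReal.ofReal (φ a) *
      ENNReal.ofReal (rE Λ.sym2 (w + u) (fun ω => ci ω 0 a)) ≤ Y := by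
    rw [hY, gy_eq_tsum hwu hφ]
    refine le_trans (Finset.sum_le_sum fun a _ => ?_) (ENNReal.sum_le_tsum Λ)
    gcongr
    exact le_EV (w + u) (fun _ ω => ci ω 0 a) Λ
  rw [ENNReal.ofReal_sum_of_nonneg fun a _ => Finset.sum_nonneg fun b _ =>
    mul_nonneg (hu _) (mul_nonneg (hg _) (hc _))]
  calc _ ≤ ∑ a ∈ Λ, ENNReal.ofReal (rE Λ.sym2 (w + u) (fun ω => ci ω 0 a)) *
        (rs u * Y + (rs u * ENNReal.ofReal (φ a) + rsw φ u) * X) := by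
        refine Finset.sum_le_sum fun a _ => ?_
        rw [ENNReal.ofReal_sum_of_nonneg fun b _ => mul_nonneg (hu _) (mul_nonneg (hg _) (hc _))]
        refine le_trans ?_ (mul_le_mul' le_rfl (hrow a))
        rw [← ENNReal.tsum_mul_left]
        refine le_trans (Finset.sum_le_sum fun b _ => ?_) (ENNReal.sum_le_tsum Λ)
        rw [ENNReal.ofReal_mul (hu _), ENNReal.ofReal_mul (hg _), mul_left_comm]
        gcongr
        exact hb Λ b
    _ = (∑ a ∈ Λ, ENNReal.ofReal (rE Λ.sym2 (w + u) (fun ω => ci ω 0 a))) *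
          (rs u * Y + rsw φ u * X) + (∑ a ∈ Λ, ENNReal.ofReal (φ a) *
          ENNReal.ofReal (rE Λ.sym2 (w + u) (fun ω => ci ω 0 a))) * (rs u * X) := by
        rw [Finset.sum_mul, Finset.sum_mul, ← Finset.sum_add_distrib]
        exact Finset.sum_congr rfl fun a _ => by ring
    _ ≤ X * (rs u * Y + rsw φ u * X) + Y * (rs u * X) := by gcongr
    _ = _ := by ring

theorem Am_two_le {w : Sym2 U → ℝ} (hw : 0 ≤ w) (tw : TI w) : Am 2 w ≤ Am 1 w ^ 3 := by
  refine iSup_le fun Λ => ?_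
  have hle : Λ ⊆ insert 0 Λ := Finset.subset_insert _ _
  refine (((vm_cs 0).pow 2).monotone_ofReal hw hle).trans ?_
  set L := insert 0 Λ
  refine (ENNReal.ofReal_le_ofReal (tree_graph L hw (Finset.mem_insert_self _ _))).trans ?_
  have hc : ∀ z, ENNReal.ofReal (rE L.sym2 w (fun ω => cs L ω z)) ≤ Am 1 w := fun z => by
    rw [← EV_cs_base_one tw z]
    exact le_EV w (fun Λ ω => cs Λ ω z) L
  have hg : ∀ a, 0 ≤ rE L.sym2 w (fun ω => ci ω 0 a) := fun a =>
    rE_nonneg hw fun _ _ => ci_nonneg _ _ _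
  have hs : ∀ a, 0 ≤ rE L.sym2 w (fun ω => cs L ω a) := fun a =>
    rE_nonneg hw fun _ _ => cs_nonneg _ _ _
  rw [ENNReal.ofReal_sum_of_nonneg fun a _ => mul_nonneg (mul_nonneg (hg _) (hs _)) (hs _)]
  calc _ ≤ ∑ a ∈ L, ENNReal.ofReal (rE L.sym2 w (fun ω => ci ω 0 a)) * Am 1 w * Am 1 w := by
        refine Finset.sum_le_sum fun a _ => ?_
        rw [ENNReal.ofReal_mul (mul_nonneg (hg _) (hs _)), ENNReal.ofReal_mul (hg _)]
        gcongr <;> exact hc _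
    _ ≤ Am 1 w * Am 1 w * Am 1 w := by
        rw [← Finset.sum_mul, ← Finset.sum_mul, ← ENNReal.ofReal_sum_of_nonneg fun a _ => hg a,
          ← rE_sum]
        gcongr
        exact hc 0
    _ = _ := by ring

theorem one_le_Am {w : Sym2 U → ℝ} (hw : 0 ≤ w) (k : ℕ) : 1 ≤ Am k w := by
  refine le_trans ?_ (le_EV w (fun Λ ω => cs Λ ω 0 ^ k) {0})
  have : ∀ ω : Finset (Sym2 U), cs {0} ω 0 = 1 := fun ω => by simp [cs, ci_self]
  simp only [this, one_pow]
  rw [show rE _ w (fun _ => (1 : ℝ)) = 1 from bE_const _ _ _]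
  simp

end InfVolTwo

section Inverse
variable {U : Type*} [DecidableEq U] [AddCommGroup U]

theorem Am_one_sq_le {w : Sym2 U → ℝ} (hw : 0 ≤ w) : Am 1 w ^ 2 ≤ Am 2 w := by
  rw [← Am_one, sq, EV, iSup_mul_iSup_of_monotone ((vm_cs 0).monotone_ofReal hw)
    ((vm_cs 0).monotone_ofReal hw)]
  refine iSup_mono fun Λ => ?_
  rw [← ENNReal.ofReal_mul (rE_nonneg hw fun _ _ => cs_nonneg _ _ _)]
  refine ENNReal.ofReal_le_ofReal ?_
  have := bE_cauchy_schwarz (s := Λ.sym2) (fun e => edgeProb_mem (hw e)) (fun ω => cs Λ ω (0 : U))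
    (fun _ => 1)
  simp only [mul_one, one_pow, bE_const] at this
  rw [← sq]
  exact this

theorem inv_step {A B : ℝ≥0∞} {t : ℝ} (ht0 : 0 ≤ t) (hA : A ≠ ∞) (hB : B ≠ ∞) (hA1 : 1 ≤ A)
    (hB1 : 1 ≤ B) (htb : t * B.toReal ≤ 1 / 2) (h : B ≤ A + ENNReal.ofReal t * (B * B)) :
    A.toReal⁻¹ ≤ B.toReal⁻¹ + 2 * t := by
  have ha1 : 1 ≤ A.toReal := by simpa using ENNReal.toReal_mono hA hA1
  have hb1 : 1 ≤ B.toReal := by simpa using ENNReal.toReal_mono hB hB1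
  have h2 : B.toReal ≤ A.toReal + t * (B.toReal * B.toReal) := by
    have := ENNReal.toReal_mono (by finiteness) h
    rwa [ENNReal.toReal_add hA (by finiteness), ENNReal.toReal_mul, ENNReal.toReal_mul,
      ENNReal.toReal_ofReal ht0] at this
  generalize A.toReal = a at *
  generalize B.toReal = b at *
  have hbb : 0 < b * (1 - t * b) := mul_pos (by linarith) (by linarith)
  have : a⁻¹ ≤ (b * (1 - t * b))⁻¹ := inv_anti₀ hbb (by nlinarith)
  refine this.trans ?_
  rw [inv_le_iff_one_le_mul₀ hbb]
  have hb' : b⁻¹ * b = 1 := inv_mul_cancel₀ (by linarith)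
  have : (b⁻¹ + 2 * t) * (b * (1 - t * b)) = (1 + 2 * (t * b)) * (1 - t * b) := by
    linear_combination (1 - t * b) * hb'
  rw [this]
  nlinarith [mul_nonneg ht0 (zero_le_one.trans hb1)]

theorem inv_chi_le {w u : Sym2 U → ℝ} (hw : 0 ≤ w) (hu : 0 ≤ u) (tw : TI w) (tu : TI u)
    (hfin : Am 1 (w + u) ≠ ∞) (hs : rs u ≠ ∞) :
    (Am 1 w).toReal⁻¹ ≤ (Am 1 (w + u)).toReal⁻¹ + 2 * (rs u).toReal := by
  set X := (Am 1 (w + u)).toReal with hX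
  set s := (rs u).toReal with hsd
  have hs0 : 0 ≤ s := ENNReal.toReal_nonneg
  obtain ⟨n, hn⟩ := exists_nat_gt (2 * s * X)
  have hX1 : 1 ≤ X := by
    have := ENNReal.toReal_mono hfin (one_le_Am (add_nonneg hw hu) 1)
    simpa using this
  have hn0 : (0 : ℝ) < n := lt_of_le_of_lt (by positivity) hn
  set v : ℕ → Sym2 U → ℝ := fun k => w + ((k : ℝ) / n) • u with hv
  have hv0 : ∀ k, 0 ≤ v k := fun k => add_nonneg hw (smul_nonneg (by positivity) hu)
  have hvt : ∀ k, TI (v k) := fun k => tw.add (tu.smul _)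
  have hstep : ∀ k, v (k + 1) = v k + ((1 : ℝ) / n) • u := fun k => by
    simp only [hv, add_assoc, ← add_smul]
    congr 2; push_cast; field_simp
  have hle : ∀ k ≤ n, v k ≤ w + u := fun k hk e => by
    simp only [hv, Pi.add_apply, Pi.smul_apply, smul_eq_mul]
    have : (k : ℝ) / n ≤ 1 := by rw [div_le_one hn0]; exact_mod_cast hk
    have := mul_le_mul_of_nonneg_right this (hu e)
    linarith
  have hfk : ∀ k ≤ n, Am 1 (v k) ≠ ∞ := fun k hk =>
    ne_top_of_le_ne_top hfin (Am_mono_rate (hv0 k) (hle k hk) 1)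
  have hrs : rs (((1 : ℝ) / n) • u) = ENNReal.ofReal (s / n) := by
    unfold rs
    simp only [Pi.smul_apply, smul_eq_mul]
    simp_rw [ENNReal.ofReal_mul (by positivity : (0 : ℝ) ≤ 1 / n)]
    rw [ENNReal.tsum_mul_left, show ∑' b, ENNReal.ofReal (u s(0, b)) = ENNReal.ofReal s from
      (ENNReal.ofReal_toReal hs).symm, ← ENNReal.ofReal_mul (by positivity)]
    congr 1; ring
  have key : ∀ k ≤ n, (Am 1 w).toReal⁻¹ ≤ (Am 1 (v k)).toReal⁻¹ + 2 * (s * k / n) := by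
    intro k
    induction k with
    | zero => intro _; simp [hv]
    | succ k ih =>
      intro hk
      refine (ih (by omega)).trans ?_
      have h1 := chi_add_le (hv0 k) (smul_nonneg (by positivity) hu : 0 ≤ ((1 : ℝ) / n) • u)
        (hvt k) (tu.smul _)
      rw [← hstep, hrs] at h1
      have hbX : (Am 1 (v (k + 1))).toReal ≤ X :=
        ENNReal.toReal_mono hfin (Am_mono_rate (hv0 _) (hle _ hk) 1)
      have ht0 : 0 ≤ s / n := by positivity
      have htX : s / n * X ≤ 1 / 2 := by
        rw [div_mul_eq_mul_div, div_le_iff₀ hn0]; linarith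
      have h3 := inv_step ht0 (hfk k (by omega)) (hfk _ hk) (one_le_Am (hv0 k) 1)
        (one_le_Am (hv0 (k + 1)) 1) ((mul_le_mul_of_nonneg_left hbX ht0).trans htX) h1
      refine (add_le_add h3 le_rfl).trans (le_of_eq ?_)
      push_cast; ring
  have := key n le_rfl
  have hvn : v n = w + u := by
    simp only [hv, div_self hn0.ne', one_smul]
  rw [hvn] at this
  rwa [mul_div_assoc, div_self hn0.ne', mul_one] at this

end Inverse

section Transfer
variable {U : Type*} [DecidableEq U]

/-- The open edges of `ω` inside a finite set. -/
noncomputable def opn (s : Finset (Sym2 U)) (ω : Sym2 U → Bool) : Finset (Sym2 U) :=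
  s.filter fun e => ω e = true

theorem opn_mono {s t : Finset (Sym2 U)} (h : s ⊆ t) (ω : Sym2 U → Bool) : opn s ω ⊆ opn t ω :=
  Finset.filter_subset_filter _ h

theorem opn_subset (s : Finset (Sym2 U)) (ω : Sym2 U → Bool) : opn s ω ⊆ s :=
  Finset.filter_subset _ _

theorem opn_eq_set {s A : Finset (Sym2 U)} (hA : A ⊆ s) :
    {ω : Sym2 U → Bool | opn s ω = A} = {ω | ∀ e ∈ s, ω e = decide (e ∈ A)} := by
  ext ω
  simp only [Set.mem_ofPred_eq, opn]
  constructor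
  · rintro rfl e he
    simp [he]
  · intro h
    ext e
    simp only [Finset.mem_filter]
    constructor
    · rintro ⟨he, h1⟩
      rw [h e he] at h1
      simpa using h1
    · intro he
      exact ⟨hA he, by rw [h e (hA he)]; simpa using he⟩

theorem measurableSet_opn (s A : Finset (Sym2 U)) :
    MeasurableSet {ω : Sym2 U → Bool | opn s ω = A} := by
  by_cases hA : A ⊆ s
  · rw [opn_eq_set hA]
    have : {ω : Sym2 U → Bool | ∀ e ∈ s, ω e = decide (e ∈ A)} =
        ⋂ e ∈ s, (fun ω : Sym2 U → Bool => ω e) ⁻¹' {decide (e ∈ A)} := by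
      ext ω; simp
    rw [this]
    exact Finset.measurableSet_biInter _ fun e _ => measurable_pi_apply e (MeasurableSet.singleton _)
  · convert MeasurableSet.empty
    ext ω
    simp only [Set.mem_ofPred_eq, Set.mem_empty_iff_false, iff_false]
    rintro rfl
    exact hA (opn_subset _ _)

theorem comp_opn_eq_sum (s : Finset (Sym2 U)) (f : Finset (Sym2 U) → ℝ≥0∞) :
    (fun ω => f (opn s ω)) = fun ω => ∑ A ∈ s.powerset,
      ({ω : Sym2 U → Bool | opn s ω = A}.indicator (fun _ => f A)) ω := by
  ext ω
  rw [Finset.sum_eq_single (opn s ω)]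
  · simp
  · intro A _ hA
    simp [hA.symm]
  · intro h
    exact absurd (Finset.mem_powerset.2 (opn_subset s ω)) h

theorem measurable_comp_opn (s : Finset (Sym2 U)) (f : Finset (Sym2 U) → ℝ≥0∞) :
    Measurable fun ω : Sym2 U → Bool => f (opn s ω) := by
  rw [comp_opn_eq_sum]
  exact Finset.measurable_sum _ fun A _ => measurable_const.indicator (measurableSet_opn s A)

theorem lintegral_opn {μ : Measure (Sym2 U → Bool)} {w : Sym2 U → ℝ} (hw : 0 ≤ w)
    (hμ : IsPerc μ fun e => edgeProb (w e)) (s : Finset (Sym2 U)) {f : Finset (Sym2 U) → ℝ}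
    (hf : ∀ A, 0 ≤ f A) :
    ∫⁻ ω, ENNReal.ofReal (f (opn s ω)) ∂μ = ENNReal.ofReal (rE s w f) := by
  rw [comp_opn_eq_sum s fun A => ENNReal.ofReal (f A), lintegral_finsetSum _ fun A _ =>
    measurable_const.indicator (measurableSet_opn s A)]
  have hp : ∀ e, 0 ≤ edgeProb (w e) := fun e => (edgeProb_mem (hw e)).1
  have hq : ∀ e, 0 ≤ 1 - edgeProb (w e) := fun e => sub_nonneg.2 (edgeProb_mem (hw e)).2
  rw [rE, bE, ENNReal.ofReal_sum_of_nonneg fun A _ => mul_nonneg (mul_nonneg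
    (Finset.prod_nonneg fun e _ => hp e) (Finset.prod_nonneg fun e _ => hq e)) (hf A)]
  refine Finset.sum_congr rfl fun A hA => ?_
  have hA := Finset.mem_powerset.1 hA
  rw [lintegral_indicator_const (measurableSet_opn s A), opn_eq_set hA,
    hμ.2 s fun e => decide (e ∈ A), ENNReal.ofReal_mul (mul_nonneg
    (Finset.prod_nonneg fun e _ => hp e) (Finset.prod_nonneg fun e _ => hq e)), mul_comm]
  congr 1
  rw [← ENNReal.ofReal_prod_of_nonneg]
  · congr 1
    rw [← Finset.prod_sdiff hA, mul_comm]
    congr 1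
    · exact Finset.prod_congr rfl fun e he => by simp [he]
    · exact Finset.prod_congr rfl fun e he => by simp [(Finset.mem_sdiff.1 he).2]
  · intro e _
    split_ifs
    exacts [hp e, hq e]

theorem lintegral_EV [Countable U] {μ : Measure (Sym2 U → Bool)} {w : Sym2 U → ℝ} (hw : 0 ≤ w)
    (hμ : IsPerc μ fun e => edgeProb (w e)) {F : Finset U → Finset (Sym2 U) → ℝ} (hF : VM F) :
    ∫⁻ ω, ⨆ Λ : Finset U, ENNReal.ofReal (F Λ (opn Λ.sym2 ω)) ∂μ = EV w F := by
  rw [lintegral_iSup_directed_of_measurable]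
  · exact iSup_congr fun Λ => lintegral_opn hw hμ _ (hF.nonneg Λ)
  · exact fun Λ => measurable_comp_opn Λ.sym2 fun A => ENNReal.ofReal (F Λ A)
  · refine Monotone.directed_le fun Λ Λ' h ω => ENNReal.ofReal_le_ofReal ?_
    exact (hF.mono_vol _ h).trans (hF.mono _ (opn_mono (Finset.sym2_mono h) ω))

theorem conn_iff_exists (ω : Sym2 U → Bool) (x y : U) :
    Conn ω x y ↔ ∃ Λ : Finset U, Lk ((opn Λ.sym2 ω : Finset (Sym2 U)) : Set (Sym2 U)) x y := by
  constructor
  · intro h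
    induction h with
    | refl => exact ⟨∅, .refl _⟩
    | @tail y z _ hyz ih =>
      obtain ⟨Λ, hΛ⟩ := ih
      refine ⟨Λ ∪ {y, z}, Lk.trans (hΛ.mono ?_) (.single ?_)⟩
      · exact_mod_cast opn_mono (Finset.sym2_mono Finset.subset_union_left) ω
      · simp only [opn, Finset.coe_filter, Set.mem_ofPred_eq]
        exact ⟨by simp, hyz⟩
  · rintro ⟨Λ, h⟩
    refine Relation.ReflTransGen.mono (fun a b hab => ?_) _ _ h
    exact (Finset.mem_filter.1 hab).2

theorem ind_conn_eq (ω : Sym2 U → Bool) (x y : U) :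
    ENNReal.ofReal (ind (Conn ω x y)) = ⨆ Λ : Finset U, ENNReal.ofReal (ci (opn Λ.sym2 ω) x y) := by
  apply le_antisymm
  · by_cases h : Conn ω x y
    · obtain ⟨Λ, hΛ⟩ := (conn_iff_exists ω x y).1 h
      refine le_iSup_of_le Λ ?_
      rw [ci, ind_true hΛ]
      exact ENNReal.ofReal_le_ofReal (ind_le_one _)
    · simp [ind_false h]
  · refine iSup_le fun Λ => ENNReal.ofReal_le_ofReal (ind_mono fun h => ?_)
    exact (conn_iff_exists ω x y).2 ⟨Λ, h⟩

theorem tsum_cluster {φ : U → ℝ} (hφ : 0 ≤ φ) (ω : Sym2 U → Bool) (o : U) :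
    ∑' x : cluster ω o, ENNReal.ofReal (φ x) =
      ⨆ Λ : Finset U, ENNReal.ofReal (cw φ Λ (opn Λ.sym2 ω) o) := by
  rw [tsum_subtype (cluster ω o) fun x => ENNReal.ofReal (φ x)]
  have h1 : ∀ x, (cluster ω o).indicator (fun x => ENNReal.ofReal (φ x)) x =
      ENNReal.ofReal (φ x) * ENNReal.ofReal (ind (Conn ω o x)) := by
    intro x
    by_cases h : Conn ω o x
    · rw [Set.indicator_of_mem (by exact h), ind_true h]; simp
    · rw [Set.indicator_of_notMem (by exact h), ind_false h]; simp
  have h2 : ∀ Λ : Finset U, ENNReal.ofReal (cw φ Λ (opn Λ.sym2 ω) o) =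
      ∑ x ∈ Λ, ENNReal.ofReal (φ x) * ENNReal.ofReal (ci (opn Λ.sym2 ω) o x) := fun Λ => by
    rw [cw, ENNReal.ofReal_sum_of_nonneg fun x _ => mul_nonneg (hφ x) (ci_nonneg _ _ _)]
    exact Finset.sum_congr rfl fun x _ => ENNReal.ofReal_mul (hφ x)
  simp only [h1, h2]
  apply le_antisymm
  · simp only [ind_conn_eq, ENNReal.mul_iSup]
    refine tsum_iSup_le fun x Λ Λ' h => ?_
    dsimp only
    gcongr
    exact ci_mono o x (opn_mono (Finset.sym2_mono h) ω)
  · refine iSup_le fun Λ => le_trans (Finset.sum_le_sum fun x _ => ?_) (ENNReal.sum_le_tsum Λ)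
    rw [ind_conn_eq]
    gcongr
    exact le_iSup (fun Λ : Finset U => ENNReal.ofReal (ci (opn Λ.sym2 ω) o x)) Λ

theorem eCard_eq_tsum (s : Set U) : eCard s = ∑' _ : s, (1 : ℝ≥0∞) := by
  rw [ENNReal.tsum_const, mul_one, eCard, ENat.card_coe_set_eq]
  split_ifs with h
  · rw [h.encard_eq_coe_toFinset_card, Set.ncard_eq_toFinset_card _ h]; simp
  · rw [Set.Infinite.encard_eq h]; simp

theorem eCard_cluster (ω : Sym2 U → Bool) (o : U) :
    eCard (cluster ω o) = ⨆ Λ : Finset U, ENNReal.ofReal (cs Λ (opn Λ.sym2 ω) o) := by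
  have := tsum_cluster (φ := fun _ => 1) (fun _ => zero_le_one) ω o
  simp only [cw_one, ENNReal.ofReal_one] at this
  rw [eCard_eq_tsum, this]

theorem iSup_pow_of_monotone {ι : Type*} [SemilatticeSup ι] [Nonempty ι] {f : ι → ℝ≥0∞}
    (hf : Monotone f) (k : ℕ) : (⨆ i, f i) ^ k = ⨆ i, f i ^ k := by
  induction k with
  | zero => simp
  | succ k ih =>
    simp only [pow_succ]
    rw [ih, iSup_mul_iSup_of_monotone (fun i j h => pow_le_pow_left' (hf h) k) hf]

theorem eCard_pow (ω : Sym2 U → Bool) (o : U) (k : ℕ) :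
    eCard (cluster ω o) ^ k =
      ⨆ Λ : Finset U, ENNReal.ofReal (cs Λ (opn Λ.sym2 ω) o ^ k) := by
  rw [eCard_cluster, iSup_pow_of_monotone]
  · exact iSup_congr fun Λ => (ENNReal.ofReal_pow (cs_nonneg _ _ _) k).symm
  · intro Λ Λ' h
    exact ENNReal.ofReal_le_ofReal (((vm_cs o).mono_vol _ h).trans
      ((vm_cs o).mono _ (opn_mono (Finset.sym2_mono h) ω)))

theorem lintegral_eCard_pow [Countable U] {μ : Measure (Sym2 U → Bool)} {w : Sym2 U → ℝ}
    (hw : 0 ≤ w) (hμ : IsPerc μ fun e => edgeProb (w e)) (o : U) (k : ℕ) :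
    ∫⁻ ω, eCard (cluster ω o) ^ k ∂μ = EV w (fun Λ ω => cs Λ ω o ^ k) := by
  simp only [eCard_pow]
  exact lintegral_EV hw hμ ((vm_cs o).pow k)

theorem lintegral_tsum_cluster [Countable U] {μ : Measure (Sym2 U → Bool)} {w : Sym2 U → ℝ}
    (hw : 0 ≤ w) (hμ : IsPerc μ fun e => edgeProb (w e)) {φ : U → ℝ} (hφ : 0 ≤ φ) (o : U) :
    ∫⁻ ω, ∑' x : cluster ω o, ENNReal.ofReal (φ x) ∂μ = EV w (fun Λ ω => cw φ Λ ω o) := by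
  simp only [tsum_cluster hφ]
  exact lintegral_EV hw hμ (vm_cw hφ o)

theorem exists_isPerc [Countable U] {w : Sym2 U → ℝ} (hw : 0 ≤ w) :
    ∃ μ : Measure (Sym2 U → Bool), IsPerc μ fun e => edgeProb (w e) := by
  let ν : Sym2 U → Measure Bool := fun e => ENNReal.ofReal (edgeProb (w e)) • Measure.dirac true +
    ENNReal.ofReal (1 - edgeProb (w e)) • Measure.dirac false
  have hν : ∀ e, IsProbabilityMeasure (ν e) := fun e => ⟨by
    have := edgeProb_mem (hw e)
    simp only [ν, Measure.add_apply, Measure.smul_apply, measure_univ, smul_eq_mul, mul_one]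
    rw [← ENNReal.ofReal_add this.1 (sub_nonneg.2 this.2)]
    simp⟩
  refine ⟨Measure.infinitePi ν, inferInstance, fun s f => ?_⟩
  have h := Measure.infinitePi_pi ν (s := s) (t := fun e => {f e})
    (fun e _ => MeasurableSet.singleton _)
  have hset : {ω : Sym2 U → Bool | ∀ e ∈ s, ω e = f e} = Set.pi s fun e => {f e} := by
    ext ω; simp [Set.mem_pi]
  rw [hset, h]
  refine Finset.prod_congr rfl fun e _ => ?_
  cases hfe : f e <;> simp [ν]

end Transfer

section Marginal
variable {ι : Type*} [DecidableEq ι]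

theorem rE_congr {s : Finset ι} {w : ι → ℝ} {f g : Finset ι → ℝ} (h : ∀ ω ⊆ s, f ω = g ω) :
    rE s w f = rE s w g := bE_congr h

theorem rE_const (s : Finset ι) (w : ι → ℝ) (c : ℝ) : rE s w (fun _ => c) = c := bE_const s _ c

theorem rE_union {s t : Finset ι} (h : Disjoint s t) (w : ι → ℝ) (f : Finset ι → ℝ) :
    rE (s ∪ t) w f = rE s w (fun ω => rE t w fun η => f (ω ∪ η)) := bE_union h _ f

/-- A function of the edges of a subset has the law of percolation on the subset. -/
theorem rE_inter {s t : Finset ι} (h : t ⊆ s) (w : ι → ℝ) (f : Finset ι → ℝ) :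
    rE s w (fun ω => f (ω ∩ t)) = rE t w f := by
  rw [← Finset.union_sdiff_of_subset h, rE_union Finset.disjoint_sdiff]
  refine rE_congr fun ω hω => ?_
  refine (rE_congr (g := fun _ => f ω) fun η hη => ?_).trans (rE_const _ _ _)
  congr 1
  ext e
  have h1 := @hω e
  have h2 := @hη e
  simp only [Finset.mem_inter, Finset.mem_union, Finset.mem_sdiff] at *
  tauto

theorem rE_ind_mem_le (s : Finset ι) {w : ι → ℝ} (hw : 0 ≤ w) (e : ι) :
    rE s w (fun ω => ind (e ∈ ω)) ≤ edgeProb (w e) := by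
  refine (rE_mono_set hw (Finset.subset_insert e s) (ind_monotone fun ω ω' h he => h he)).trans ?_
  have := rE_inter (s := insert e s) (t := {e}) (by simp) w (fun ω => ind (e ∈ ω))
  rw [rE_congr (g := fun ω => ind (e ∈ ω ∩ {e})) (fun ω _ => by simp), this]
  rw [← insert_empty_eq, rE, bE_insert (by simp)]
  simp [bE_empty, ind]

theorem edgeProb_le_self (t : ℝ) : edgeProb t ≤ t := by
  have := Real.add_one_le_exp (-t)
  unfold edgeProb; linarith

end Marginal

section Sharp
variable {U : Type*} [DecidableEq U] [AddCommGroup U]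

/-- The expected rate of edges leaving `S` from a vertex connected to `0` inside `S`. -/
noncomputable def ph (w : Sym2 U → ℝ) (S : Finset U) : ℝ≥0∞ :=
  ∑ x ∈ S, ENNReal.ofReal (rE S.sym2 w fun ω => ci ω 0 x) *
    ∑' y, if y ∈ S then 0 else ENNReal.ofReal (w s(x, y))

theorem ph_tr {w : Sym2 U → ℝ} (tw : TI w) (S : Finset U) (v : U) :
    (∑ x ∈ S.map (tr v), ENNReal.ofReal (rE (S.map (tr v)).sym2 w fun ω => ci ω v x) *
      ∑' y, if y ∈ S.map (tr v) then 0 else ENNReal.ofReal (w s(x, y))) = ph w S := by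
  rw [Finset.sum_map]
  refine Finset.sum_congr rfl fun x _ => ?_
  rw [rE_tr tw]
  congr 1
  · congr 2
    funext ω
    have := lk_tr v ω 0 x
    simp only [ci, tr_apply]
    rw [zero_add] at this
    exact ind_congr this
  · rw [← (Equiv.addRight v).tsum_eq]
    refine tsum_congr fun y => ?_
    simp only [tr_apply, Equiv.coe_addRight, tw v x y]
    refine if_congr ?_ rfl rfl
    constructor
    · intro h
      obtain ⟨z, hz, h⟩ := Finset.mem_map.1 h
      rw [tr_apply] at h
      exact add_right_cancel h ▸ hz
    · exact fun h => Finset.mem_map.2 ⟨y, h, tr_apply v y⟩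

theorem ci_le_escape (Λ T : Finset U) {ω : Finset (Sym2 U)} (hω : ω ⊆ Λ.sym2) {v x : U} (hv : v ∈ T)
    (hx : x ∈ Λ) :
    ci ω v x ≤ ci (ω ∩ T.sym2) v x + ∑ a ∈ T, ∑ b ∈ Λ, if b ∈ T then 0 else
      ind (DisjOcc (fun I J => DisjOcc (fun I J => Lk ((I ∩ T.sym2 : Finset (Sym2 U)) : Set (Sym2 U)) v a ∧
          s(a, b) ∈ J) I ∧ Lk (J : Set (Sym2 U)) b x) ω) := by
  have h0 : ∀ a b, 0 ≤ if b ∈ T then 0 else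
      ind (DisjOcc (fun I J => DisjOcc (fun I J => Lk ((I ∩ T.sym2 : Finset (Sym2 U)) : Set (Sym2 U)) v a ∧
          s(a, b) ∈ J) I ∧ Lk (J : Set (Sym2 U)) b x) ω) := by
    intro a b; split_ifs
    · exact le_rfl
    · exact ind_nonneg _
  have h00 := Finset.sum_nonneg fun a (_ : a ∈ T) => Finset.sum_nonneg fun b (_ : b ∈ Λ) => h0 a b
  by_cases h1 : Lk ((ω ∩ T.sym2 : Finset (Sym2 U)) : Set (Sym2 U)) v x
  · have := ci_le_one ω v x
    unfold ci at this ⊢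
    rw [ind_true h1]; linarith
  by_cases h2 : Lk (ω : Set (Sym2 U)) v x
  swap
  · have := ci_nonneg (ω ∩ T.sym2) v x
    rw [show ci ω v x = 0 from ind_false h2]
    exact add_nonneg this h00
  obtain ⟨a, ha, b, hb, hab, hbx⟩ := h2.last_escape
    (C := {z | Lk ((ω ∩ T.sym2 : Finset (Sym2 U)) : Set (Sym2 U)) v z}) (Lk.refl v) h1
  have ha' : Lk ((ω ∩ T.sym2 : Finset (Sym2 U)) : Set (Sym2 U)) v a := ha
  have hb' : ¬ Lk ((ω ∩ T.sym2 : Finset (Sym2 U)) : Set (Sym2 U)) v b := hb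
  have haT : a ∈ T := lk_mem_of_sym2 Finset.inter_subset_right hv ha'
  have hbT : b ∉ T := by
    intro hbT
    exact hb' (ha'.trans (.single (by
      rw [Finset.mem_coe, Finset.mem_inter, Finset.mk_mem_sym2_iff]
      exact ⟨hab, haT, hbT⟩)))
  have hbΛ : b ∈ Λ := (Finset.mk_mem_sym2_iff.1 (hω hab)).2
  have h3 : ci ω v x ≤ if b ∈ T then 0 else
      ind (DisjOcc (fun I J => DisjOcc (fun I J => Lk ((I ∩ T.sym2 : Finset (Sym2 U)) : Set (Sym2 U)) v a ∧
          s(a, b) ∈ J) I ∧ Lk (J : Set (Sym2 U)) b x) ω) := by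
    rw [if_neg hbT, ind_true]
    · exact ci_le_one _ _ _
    let I₁ : Finset (Sym2 U) := {e ∈ ω ∩ T.sym2 | ∀ y ∈ e, Lk ((ω ∩ T.sym2 : Finset (Sym2 U)) : Set (Sym2 U)) v y}
    let I₃ : Finset (Sym2 U) := {e ∈ ω | ∀ y ∈ e, ¬ Lk ((ω ∩ T.sym2 : Finset (Sym2 U)) : Set (Sym2 U)) v y}
    have hI1 : s(a, b) ∉ I₁ := fun h => hb' ((Finset.mem_filter.1 h).2 b (Sym2.mem_mk_right a b))
    have hI3 : s(a, b) ∉ I₃ := fun h => (Finset.mem_filter.1 h).2 a (Sym2.mem_mk_left a b) ha'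
    have hI13 : Disjoint I₁ I₃ := by
      rw [Finset.disjoint_left]
      intro e h1 h3
      induction e with
      | _ p q =>
        exact absurd ((Finset.mem_filter.1 h1).2 p (Sym2.mem_mk_left _ _))
          ((Finset.mem_filter.1 h3).2 p (Sym2.mem_mk_left _ _))
    have hI1ω : I₁ ⊆ ω := fun e he => (Finset.mem_inter.1 (Finset.mem_filter.1 he).1).1
    refine ⟨I₁ ∪ {s(a, b)}, I₃, Finset.union_subset hI1ω (by simpa using hab),
      Finset.filter_subset _ _, ?_, ⟨I₁, {s(a, b)}, Finset.subset_union_left,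
        Finset.subset_union_right, by simpa using hI1, ?_, by simp⟩, ?_⟩
    · rw [Finset.disjoint_union_left]; exact ⟨hI13, by simpa using hI3⟩
    · refine ha'.restrict.mono fun e he => ?_
      obtain ⟨h1, h2⟩ := he
      have h1' := Finset.mem_coe.1 h1
      rw [Finset.mem_coe, Finset.mem_inter, Finset.mem_filter]
      exact ⟨⟨h1', h2⟩, (Finset.mem_inter.1 h1').2⟩
    · refine hbx.mono fun e he => ?_
      rw [Finset.mem_coe, Finset.mem_filter]
      exact ⟨he.1, he.2⟩
  have h4 := Finset.single_le_sum (f := fun b => if b ∈ T then 0 else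
      ind (DisjOcc (fun I J => DisjOcc (fun I J => Lk ((I ∩ T.sym2 : Finset (Sym2 U)) : Set (Sym2 U)) v a ∧
          s(a, b) ∈ J) I ∧ Lk (J : Set (Sym2 U)) b x) ω)) (fun b _ => h0 a b) hbΛ
  have h5 := Finset.single_le_sum (f := fun a => ∑ b ∈ Λ, if b ∈ T then 0 else
      ind (DisjOcc (fun I J => DisjOcc (fun I J => Lk ((I ∩ T.sym2 : Finset (Sym2 U)) : Set (Sym2 U)) v a ∧
          s(a, b) ∈ J) I ∧ Lk (J : Set (Sym2 U)) b x) ω))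
      (fun a _ => Finset.sum_nonneg fun b _ => h0 a b) haT
  have h6 := ci_nonneg (ω ∩ T.sym2) v x
  have h7 := h3.trans (h4.trans h5)
  linarith

theorem rE_cs_le_escape (Λ T : Finset U) {w : Sym2 U → ℝ} (hw : 0 ≤ w) {v : U} (hv : v ∈ T) :
    rE Λ.sym2 w (fun ω => cs Λ ω v) ≤ T.card + ∑ a ∈ T, ∑ b ∈ Λ, if b ∈ T then 0 else
      rE T.sym2 w (fun ω => ci ω v a) * w s(a, b) * rE Λ.sym2 w (fun ω => cs Λ ω b) := by
  have h1 : rE Λ.sym2 w (fun ω => cs Λ ω v) ≤ rE Λ.sym2 w (fun ω => T.card + ∑ x ∈ Λ, ∑ a ∈ T, ∑ b ∈ Λ,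
      if b ∈ T then 0 else
      ind (DisjOcc (fun I J => DisjOcc (fun I J => Lk ((I ∩ T.sym2 : Finset (Sym2 U)) : Set (Sym2 U)) v a ∧
          s(a, b) ∈ J) I ∧ Lk (J : Set (Sym2 U)) b x) ω)) := by
    refine rE_mono hw fun ω hω => ?_
    refine (Finset.sum_le_sum fun x hx => ci_le_escape Λ T hω hv hx).trans ?_
    rw [Finset.sum_add_distrib]
    refine add_le_add ?_ le_rfl
    calc ∑ x ∈ Λ, ci (ω ∩ T.sym2) v x ≤ ∑ x ∈ Λ, if x ∈ T then (1:ℝ) else 0 := by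
          refine Finset.sum_le_sum fun x _ => ?_
          split_ifs with h
          · exact ci_le_one _ _ _
          · exact (ind_false fun h' => h (lk_mem_of_sym2 Finset.inter_subset_right hv h')).le
      _ = ((Λ.filter (· ∈ T)).card : ℝ) := by rw [Finset.sum_boole]
      _ ≤ T.card := by
          exact_mod_cast Finset.card_le_card fun x hx => (Finset.mem_filter.1 hx).2
  rw [rE_add, rE_const] at h1
  refine h1.trans (add_le_add le_rfl ?_)
  rw [rE_sum]
  simp only [rE_sum]
  rw [Finset.sum_comm]
  refine Finset.sum_le_sum fun a ha => ?_
  rw [Finset.sum_comm]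
  refine Finset.sum_le_sum fun b hb => ?_
  split_ifs with hbT
  · simp [rE_const]
  simp only [cs]
  rw [rE_sum, Finset.mul_sum]
  refine Finset.sum_le_sum fun x _ => ?_
  have hm : Monotone fun I : Finset (Sym2 U) => Lk ((I ∩ T.sym2 : Finset (Sym2 U)) : Set (Sym2 U)) v a :=
    fun I J h hl => hl.mono (by exact_mod_cast Finset.inter_subset_inter_right h)
  refine (rE_bk hw (disjOcc_monotone _) (lk_monotone b x)).trans ?_
  refine mul_le_mul_of_nonneg_right ?_ (rE_nonneg hw fun _ _ => ind_nonneg _)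
  refine (rE_bk hw hm (fun I J h hl => h hl)).trans ?_
  refine mul_le_mul ?_ ((rE_ind_mem_le _ hw _).trans (edgeProb_le_self _))
    (rE_nonneg hw fun _ _ => ind_nonneg _) (rE_nonneg hw fun _ _ => ci_nonneg _ _ _)
  refine (rE_mono_set hw (Finset.sym2_mono (Finset.subset_union_left (s₂ := T)))
    (ind_monotone hm)).trans_eq ?_
  exact rE_inter (Finset.sym2_mono (Finset.subset_union_right (s₁ := Λ))) w (fun ω => ci ω v a)

/-- If `ph w S < 1` for some finite set then the susceptibility is finite. -/
theorem Am_one_lt_top_of_ph {w : Sym2 U → ℝ} (hw : 0 ≤ w) (tw : TI w) {S : Finset U}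
    (h0 : (0 : U) ∈ S) (hS : ph w S < 1) : Am 1 w < ∞ := by
  set q := (ph w S).toReal with hq
  have hq1 : q < 1 := by
    have := (ENNReal.toReal_lt_toReal (hS.trans one_lt_top).ne one_ne_top).2 hS
    simpa using this
  have hq0 : 0 ≤ q := ENNReal.toReal_nonneg
  have key : ∀ Λ : Finset U, ∀ v ∈ Λ, rE Λ.sym2 w (fun ω => cs Λ ω v) ≤ S.card / (1 - q) := by
    intro Λ v₀ hv₀
    obtain ⟨v, hv, hmax⟩ := Finset.exists_max_image Λ (fun v => rE Λ.sym2 w (fun ω => cs Λ ω v)) ⟨v₀, hv₀⟩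
    set X := rE Λ.sym2 w (fun ω => cs Λ ω v) with hX
    have hX0 : 0 ≤ X := rE_nonneg hw fun _ _ => cs_nonneg _ _ _
    have hvT : v ∈ S.map (tr v) := Finset.mem_map.2 ⟨0, h0, by rw [tr_apply, zero_add]⟩
    have h1 := rE_cs_le_escape Λ (S.map (tr v)) hw hvT
    rw [Finset.card_map] at h1
    have h2 : (∑ a ∈ S.map (tr v), ∑ b ∈ Λ, if b ∈ S.map (tr v) then 0 else
        rE (S.map (tr v)).sym2 w (fun ω => ci ω v a) * w s(a, b) * rE Λ.sym2 w (fun ω => cs Λ ω b))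
        ≤ (∑ a ∈ S.map (tr v), rE (S.map (tr v)).sym2 w (fun ω => ci ω v a) *
          ∑ b ∈ Λ, if b ∈ S.map (tr v) then 0 else w s(a, b)) * X := by
      simp only [Finset.mul_sum, Finset.sum_mul]
      refine Finset.sum_le_sum fun a _ => Finset.sum_le_sum fun b hb => ?_
      split_ifs
      · simp
      · exact mul_le_mul_of_nonneg_left (hmax b hb) (mul_nonneg (rE_nonneg hw fun _ _ => ci_nonneg _ _ _) (hw _))
    have h3 : (∑ a ∈ S.map (tr v), rE (S.map (tr v)).sym2 w (fun ω => ci ω v a) *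
          ∑ b ∈ Λ, if b ∈ S.map (tr v) then 0 else w s(a, b)) ≤ q := by
      have hn : ∀ a b, 0 ≤ if b ∈ S.map (tr v) then 0 else w s(a, b) := fun a b => by
        split_ifs
        · exact le_rfl
        · exact hw _
      rw [hq, ← ENNReal.ofReal_le_iff_le_toReal (hS.trans one_lt_top).ne, ← ph_tr tw S v,
        ENNReal.ofReal_sum_of_nonneg fun a _ => mul_nonneg (rE_nonneg hw fun _ _ => ci_nonneg _ _ _)
          (Finset.sum_nonneg fun b _ => hn a b)]
      refine Finset.sum_le_sum fun a _ => ?_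
      rw [ENNReal.ofReal_mul (rE_nonneg hw fun _ _ => ci_nonneg _ _ _),
        ENNReal.ofReal_sum_of_nonneg fun b _ => hn a b]
      refine mul_le_mul' le_rfl (le_trans (Finset.sum_le_sum fun b _ => ?_) (ENNReal.sum_le_tsum Λ))
      split_ifs <;> simp
    have h4 : X ≤ S.card + q * X := h1.trans (add_le_add le_rfl (h2.trans
      (mul_le_mul_of_nonneg_right h3 hX0)))
    refine (hmax v₀ hv₀).trans ?_
    rw [le_div_iff₀ (by linarith)]
    linarith
  refine lt_of_le_of_lt ?_ (ENNReal.ofReal_lt_top (r := S.card / (1 - q)))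
  rw [← Am_one w]
  refine iSup_le fun Λ => ENNReal.ofReal_le_ofReal ?_
  refine le_trans ?_ (key (insert 0 Λ) 0 (by simp))
  exact (vm_cs (U := U) 0).monotone_rE hw (Finset.subset_insert 0 Λ)

end Sharp

section Supercritical
variable {U : Type*} [DecidableEq U]

/-- The vertices of `M` that are not connected to `M \ Λ`. -/
noncomputable def inr (Λ M : Finset U) (ω : Finset (Sym2 U)) : Finset U :=
  M.filter fun z => ∀ y ∈ M \ Λ, ¬ Lk (ω : Set (Sym2 U)) z y

theorem mem_inr {Λ M : Finset U} {ω : Finset (Sym2 U)} {z : U} :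
    z ∈ inr Λ M ω ↔ z ∈ M ∧ ∀ y ∈ M \ Λ, ¬ Lk (ω : Set (Sym2 U)) z y := Finset.mem_filter

theorem inr_subset (Λ M : Finset U) (ω : Finset (Sym2 U)) : inr Λ M ω ⊆ Λ := by
  intro z hz
  rw [mem_inr] at hz
  by_contra h
  exact hz.2 z (Finset.mem_sdiff.2 ⟨hz.1, h⟩) (Lk.refl z)

theorem inr_eq_iff_sdiff {Λ M S : Finset U} {ω : Finset (Sym2 U)} (hω : ω ⊆ M.sym2) :
    inr Λ M ω = S ↔ inr Λ M (ω \ S.sym2) = S := by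
  have hsub : ((ω \ S.sym2 : Finset (Sym2 U)) : Set (Sym2 U)) ⊆ (ω : Set (Sym2 U)) := by
    exact_mod_cast Finset.sdiff_subset
  constructor
  · intro h
    ext z
    constructor
    · intro hz
      rw [mem_inr] at hz
      by_contra hzS
      rw [← h, mem_inr] at hzS
      push Not at hzS
      obtain ⟨y, hy, hzy⟩ := hzS hz.1
      refine hz.2 y hy (hzy.restrict.mono fun e he => ?_)
      rw [Finset.coe_sdiff]
      refine ⟨he.1, fun heS => ?_⟩
      induction e with
      | _ p q =>
        have hp : p ∈ S := (Finset.mk_mem_sym2_iff.1 (Finset.mem_coe.1 heS)).1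
        rw [← h, mem_inr] at hp
        exact hp.2 y hy (Lk.trans (he.2 p (Sym2.mem_mk_left _ _)).symm hzy)
    · intro hz
      rw [← h, mem_inr] at hz
      exact mem_inr.2 ⟨hz.1, fun y hy hl => hz.2 y hy (hl.mono hsub)⟩
  · intro h
    ext z
    constructor
    · intro hz
      rw [mem_inr] at hz
      rw [← h, mem_inr]
      exact ⟨hz.1, fun y hy hl => hz.2 y hy (hl.mono hsub)⟩
    · intro hz
      rw [mem_inr]
      have hz' := hz
      rw [← h, mem_inr] at hz'
      refine ⟨hz'.1, fun y hy hl => ?_⟩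
      have hyS : y ∉ S := by
        rw [← h, mem_inr]
        exact fun h' => h'.2 y hy (Lk.refl y)
      obtain ⟨a, ha, b, hb, hab, hby⟩ := hl.last_escape (C := (S : Set U)) (by simpa using hz)
        (by simpa using hyS)
      have ha' : a ∈ S := by simpa using ha
      have hb' : b ∉ S := by simpa using hb
      rw [← h, mem_inr] at ha'
      refine ha'.2 y hy (Lk.trans (.single ?_) (hby.mono fun e he => ?_))
      · rw [Finset.coe_sdiff]
        exact ⟨hab, fun h' => hb' (Finset.mk_mem_sym2_iff.1 (Finset.mem_coe.1 h')).2⟩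
      · rw [Finset.coe_sdiff]
        refine ⟨he.1, fun heS => ?_⟩
        induction e with
        | _ p q => exact he.2 p (Sym2.mem_mk_left _ _) (Finset.mem_coe.2
            (Finset.mk_mem_sym2_iff.1 (Finset.mem_coe.1 heS)).1)

theorem rE_inr_mul {Λ M S : Finset U} (hS : S ⊆ M) (w : Sym2 U → ℝ) (f : Finset (Sym2 U) → ℝ) :
    rE M.sym2 w (fun ω => ind (inr Λ M ω = S) * f (ω ∩ S.sym2)) =
      rE M.sym2 w (fun ω => ind (inr Λ M ω = S)) * rE S.sym2 w f := by
  have hsub := Finset.sym2_mono hS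
  have h1 : ∀ g : Finset (Sym2 U) → ℝ, rE M.sym2 w (fun ω => ind (inr Λ M ω = S) * g (ω ∩ S.sym2)) =
      rE (M.sym2 \ S.sym2) w (fun ω => ind (inr Λ M ω = S)) * rE S.sym2 w g := by
    intro g
    rw [rE_congr (g := fun ω => ind (inr Λ M (ω \ S.sym2) = S) * g (ω ∩ S.sym2))
      fun ω hω => by rw [ind_congr (inr_eq_iff_sdiff hω)]]
    rw [← Finset.union_sdiff_of_subset hsub, rE_union Finset.disjoint_sdiff,
      Finset.union_sdiff_of_subset hsub, ← rE_const_mul]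
    refine rE_congr fun ω hω => ?_
    rw [mul_comm, ← rE_const_mul]
    refine rE_congr fun η hη => ?_
    have e1 : (ω ∪ η) \ S.sym2 = η := by
      ext e
      have h1 := @hω e
      have h2 := @hη e
      simp only [Finset.mem_union, Finset.mem_sdiff] at *
      tauto
    have e2 : (ω ∪ η) ∩ S.sym2 = ω := by
      ext e
      have h1 := @hω e
      have h2 := @hη e
      simp only [Finset.mem_union, Finset.mem_sdiff, Finset.mem_inter] at *
      tauto
    rw [e1, e2, mul_comm]
  rw [h1 f]
  have := h1 (fun _ => 1)
  simp only [mul_one, rE_const] at this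
  rw [this]

/-- One step of the differential inequality for the probability of leaving `Λ`. -/
theorem rE_escape_step {Λ M : Finset U} (o : U) (ho : o ∈ Λ) (hΛM : Λ ⊆ M) {w : Sym2 U → ℝ}
    (hw : 0 ≤ w)
    (hM : ∀ S ⊆ Λ, o ∈ S → 1 / 2 ≤ ∑ a ∈ S, ∑ b ∈ M \ S,
      rE S.sym2 w (fun ω => ci ω o a) * w s(a, b)) {δ : ℝ} (hδ : 0 < δ) :
    (δ / 2) / (1 + δ / 2) ≤ rE M.sym2 (fun e => w e + δ * w e)
      (fun ω => ind (∃ y ∈ M \ Λ, Lk (ω : Set (Sym2 U)) o y)) := by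
  set f : Finset (Sym2 U) → ℝ := fun ω => ind (∃ y ∈ M \ Λ, Lk (ω : Set (Sym2 U)) o y) with hf
  have hfm : Monotone f := ind_monotone fun ω ω' h ⟨y, hy, hl⟩ =>
    ⟨y, hy, hl.mono (by exact_mod_cast h)⟩
  have hfz : ∀ ω, f ω = 0 ↔ o ∈ inr Λ M ω := by
    intro ω
    rw [mem_inr, hf]
    constructor
    · intro h
      refine ⟨hΛM ho, fun y hy hl => ?_⟩
      have h : ind (∃ y ∈ M \ Λ, Lk (ω : Set (Sym2 U)) o y) = 0 := h
      rw [ind_true ⟨y, hy, hl⟩] at h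
      exact one_ne_zero h
    · rintro ⟨-, h⟩
      exact ind_false fun ⟨y, hy, hl⟩ => h y hy hl
  have hf01 : ∀ ω, f ω = 0 ∨ f ω = 1 := fun ω => by
    simp only [hf, ind]; split_ifs <;> simp
  obtain ⟨t, ht, heq⟩ := rE_sub_eq M.sym2 w (fun e => δ * w e) f
  set v : Sym2 U → ℝ := fun e => w e + t * (δ * w e) with hv
  have hv0 : 0 ≤ v := fun e => add_nonneg (hw e) (mul_nonneg ht.1 (mul_nonneg hδ.le (hw e)))
  have hwv : w ≤ v := fun e => le_add_of_nonneg_right (mul_nonneg ht.1 (mul_nonneg hδ.le (hw e)))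
  have hvw : v ≤ fun e => w e + δ * w e := fun e =>
    add_le_add le_rfl (mul_le_of_le_one_left (mul_nonneg hδ.le (hw e)) ht.2)
  let 𝒮 := Λ.powerset.filter (o ∈ ·)
  let k : Finset (Sym2 U) → Finset U → U → U → ℝ := fun ω S a b =>
    ind (a ∈ S ∧ b ∉ S) * (ind (inr Λ M ω = S) * ci (ω ∩ S.sym2) o a)
  have hk0 : ∀ ω S a b, 0 ≤ k ω S a b := fun ω S a b =>
    mul_nonneg (ind_nonneg _) (mul_nonneg (ind_nonneg _) (ci_nonneg _ _ _))
  have hpt : ∀ ω, ∀ a ∈ M, ∀ b ∈ M, ∑ S ∈ 𝒮, (k ω S a b + k ω S b a) ≤ f (insert s(a, b) ω) - f ω := by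
    intro ω a ha b hb
    have hm := hfm (Finset.subset_insert s(a, b) ω)
    rcases hf01 ω with h0 | h1
    swap
    · refine le_trans (Finset.sum_nonpos fun S hS => ?_) (sub_nonneg.2 hm)
      have : inr Λ M ω ≠ S := by
        rintro rfl
        have := (hfz ω).2 (Finset.mem_filter.1 hS).2
        rw [h1] at this
        exact one_ne_zero this
      simp [k, ind_false this]
    have key : ∀ a ∈ M, ∀ b ∈ M, a ∈ inr Λ M ω → b ∉ inr Λ M ω → Lk (ω : Set (Sym2 U)) o a →
        f (insert s(a, b) ω) = 1 := by
      intro a _ b hbM ha hb hl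
      rw [mem_inr] at hb
      push Not at hb
      obtain ⟨y, hy, hby⟩ := hb hbM
      refine ind_true ⟨y, hy, ?_⟩
      rw [Finset.coe_insert]
      exact lk_insert.2 (Or.inr (Or.inl ⟨hl, hby⟩))
    have hsum : ∑ S ∈ 𝒮, (k ω S a b + k ω S b a) ≤
        k ω (inr Λ M ω) a b + k ω (inr Λ M ω) b a := by
      rw [← Finset.sum_filter_add_sum_filter_not 𝒮 (fun S => inr Λ M ω = S)]
      have z1 : ∑ S ∈ 𝒮 with ¬ inr Λ M ω = S, (k ω S a b + k ω S b a) = 0 :=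
        Finset.sum_eq_zero fun S hS => by
          simp [k, ind_false (Finset.mem_filter.1 hS).2]
      rw [z1, add_zero]
      refine (Finset.sum_le_sum_of_subset_of_nonneg (t := {inr Λ M ω}) (fun S hS => ?_)
        fun S _ _ => add_nonneg (hk0 _ _ _ _) (hk0 _ _ _ _)).trans_eq (Finset.sum_singleton _ _)
      exact Finset.mem_singleton.2 (Finset.mem_filter.1 hS).2.symm
    refine hsum.trans ?_
    rw [h0, sub_zero]
    have hci : ∀ a, ci (ω ∩ (inr Λ M ω).sym2) o a ≤ ind (Lk (ω : Set (Sym2 U)) o a) := fun a =>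
      ci_mono o a Finset.inter_subset_left
    have one : ∀ a ∈ M, ∀ b ∈ M, k ω (inr Λ M ω) a b ≤ f (insert s(a, b) ω) := by
      intro a ha b hb
      by_cases h : (a ∈ inr Λ M ω ∧ b ∉ inr Λ M ω) ∧ Lk (ω : Set (Sym2 U)) o a
      · rw [key a ha b hb h.1.1 h.1.2 h.2]
        exact mul_le_one₀ (ind_le_one _) (mul_nonneg (ind_nonneg _) (ci_nonneg _ _ _))
          (mul_le_one₀ (ind_le_one _) (ci_nonneg _ _ _) (ci_le_one _ _ _))
      · have : k ω (inr Λ M ω) a b = 0 := by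
          by_cases h1 : a ∈ inr Λ M ω ∧ b ∉ inr Λ M ω
          · have h2 : ¬ Lk (ω : Set (Sym2 U)) o a := fun h2 => h ⟨h1, h2⟩
            have := hci a
            rw [ind_false h2] at this
            simp only [k]
            rw [le_antisymm this (ci_nonneg _ _ _)]; simp
          · simp [k, ind_false h1]
        rw [this]; exact ind_nonneg _
    have h1 := one a ha b hb
    have h2 := one b hb a ha
    rw [Sym2.eq_swap] at h2
    by_cases h : a ∈ inr Λ M ω ∧ b ∉ inr Λ M ω
    · have : k ω (inr Λ M ω) b a = 0 := by
        simp only [k]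
        rw [ind_false fun h' => h'.2 h.1, zero_mul]
      linarith
    · have : k ω (inr Λ M ω) a b = 0 := by
        simp only [k]
        rw [ind_false h, zero_mul]
      linarith
  let h : U → U → ℝ := fun a b => δ * w s(a, b) * ∑ S ∈ 𝒮, rE M.sym2 v (fun ω => k ω S a b)
  have hsym : ∑ e ∈ M.sym2, Sym2.lift ⟨fun a b => h a b + h b a, fun a b => add_comm _ _⟩ e =
      ∑ a ∈ M, ∑ b ∈ M, h a b := by
    refine sum_sym2 M h _ (fun a b _ => rfl) fun a => ?_
    have : h a a = 0 := by
      simp only [h]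
      rw [Finset.sum_eq_zero, mul_zero]
      intro S _
      rw [← rE_const M.sym2 v 0]
      refine rE_congr fun ω _ => ?_
      simp only [k]
      rw [ind_false fun h => h.2 h.1, zero_mul]
    simp [this]
  have hge : ∑ a ∈ M, ∑ b ∈ M, h a b ≤ rE M.sym2 (fun e => w e + δ * w e) f - rE M.sym2 w f := by
    rw [heq, ← hsym]
    refine Finset.sum_le_sum fun e he => ?_
    induction e with
    | _ a b =>
    obtain ⟨ha, hb⟩ := Finset.mk_mem_sym2_iff.1 he
    simp only [Sym2.lift_mk, h]
    rw [Sym2.eq_swap (a := b), ← mul_add, ← Finset.sum_add_distrib]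
    refine mul_le_mul_of_nonneg_left ?_ (mul_nonneg hδ.le (hw _))
    simp only [← rE_add]
    rw [← rE_sum]
    exact rE_mono hv0 fun ω _ => hpt ω a ha b hb
  have hlow : (δ / 2) * rE M.sym2 v (fun ω => 1 - f ω) ≤ ∑ a ∈ M, ∑ b ∈ M, h a b := by
    have e1 : rE M.sym2 v (fun ω => 1 - f ω) ≤ ∑ S ∈ 𝒮, rE M.sym2 v (fun ω => ind (inr Λ M ω = S)) := by
      rw [← rE_sum]
      refine rE_mono hv0 fun ω _ => ?_
      rcases hf01 ω with h0 | h1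
      · have hm : inr Λ M ω ∈ 𝒮 := Finset.mem_filter.2
          ⟨Finset.mem_powerset.2 (inr_subset Λ M ω), (hfz ω).1 h0⟩
        refine le_trans ?_ (Finset.single_le_sum (fun S _ => ind_nonneg _) hm)
        rw [h0, ind_true rfl, sub_zero]
      · rw [h1, sub_self]
        exact Finset.sum_nonneg fun S _ => ind_nonneg _
    have e2 : ∀ S ∈ 𝒮, (δ / 2) * rE M.sym2 v (fun ω => ind (inr Λ M ω = S)) ≤
        ∑ a ∈ M, ∑ b ∈ M, δ * w s(a, b) * rE M.sym2 v (fun ω => k ω S a b) := by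
      intro S hS
      obtain ⟨hSΛ, hoS⟩ := Finset.mem_filter.1 hS
      rw [Finset.mem_powerset] at hSΛ
      set q := rE M.sym2 v (fun ω => ind (inr Λ M ω = S)) with hq
      have hq0 : 0 ≤ q := rE_nonneg hv0 fun _ _ => ind_nonneg _
      have hk : ∀ a b, rE M.sym2 v (fun ω => k ω S a b) =
          ind (a ∈ S ∧ b ∉ S) * (q * rE S.sym2 v (fun ω => ci ω o a)) := by
        intro a b
        simp only [k]
        rw [rE_const_mul, rE_inr_mul (hSΛ.trans hΛM) v (fun ω => ci ω o a)]
      have hnn : ∀ a ∈ M, ∀ b ∈ M, 0 ≤ δ * w s(a, b) * rE M.sym2 v (fun ω => k ω S a b) :=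
        fun a _ b _ => mul_nonneg (mul_nonneg hδ.le (hw _)) (rE_nonneg hv0 fun _ _ => hk0 _ _ _ _)
      calc δ / 2 * q = δ * q * (1 / 2) := by ring
        _ ≤ δ * q * ∑ a ∈ S, ∑ b ∈ M \ S, rE S.sym2 w (fun ω => ci ω o a) * w s(a, b) :=
            mul_le_mul_of_nonneg_left (hM S hSΛ hoS) (mul_nonneg hδ.le hq0)
        _ = ∑ a ∈ S, ∑ b ∈ M \ S, δ * q * (rE S.sym2 w (fun ω => ci ω o a) * w s(a, b)) := by
            simp only [Finset.mul_sum]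
        _ ≤ ∑ a ∈ S, ∑ b ∈ M \ S, δ * w s(a, b) * rE M.sym2 v (fun ω => k ω S a b) := by
            refine Finset.sum_le_sum fun a ha => Finset.sum_le_sum fun b hb => ?_
            rw [hk, ind_true ⟨ha, (Finset.mem_sdiff.1 hb).2⟩, one_mul]
            have := mul_le_mul_of_nonneg_left (rE_mono_rate (s := S.sym2) hw hwv (ci_mono o a))
              (mul_nonneg (mul_nonneg hδ.le hq0) (hw s(a, b)))
            calc _ = _ := by ring
              _ ≤ _ := this
              _ = _ := by ring
        _ ≤ ∑ a ∈ S, ∑ b ∈ M, δ * w s(a, b) * rE M.sym2 v (fun ω => k ω S a b) :=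
            Finset.sum_le_sum fun a ha => Finset.sum_le_sum_of_subset_of_nonneg
              Finset.sdiff_subset fun b hb _ => hnn a (hΛM (hSΛ ha)) b hb
        _ ≤ _ := Finset.sum_le_sum_of_subset_of_nonneg (hSΛ.trans hΛM) fun a ha _ =>
              Finset.sum_nonneg fun b hb => hnn a ha b hb
    calc _ ≤ (δ / 2) * ∑ S ∈ 𝒮, rE M.sym2 v (fun ω => ind (inr Λ M ω = S)) :=
          mul_le_mul_of_nonneg_left e1 (by positivity)
      _ ≤ ∑ S ∈ 𝒮, ∑ a ∈ M, ∑ b ∈ M, δ * w s(a, b) * rE M.sym2 v (fun ω => k ω S a b) := by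
          rw [Finset.mul_sum]; exact Finset.sum_le_sum e2
      _ = _ := by
          rw [Finset.sum_comm]
          refine Finset.sum_congr rfl fun a _ => ?_
          rw [Finset.sum_comm]
          exact Finset.sum_congr rfl fun b _ => by simp only [h, Finset.mul_sum]
  have h1 : rE M.sym2 v (fun ω => 1 - f ω) = 1 - rE M.sym2 v f := by
    have := rE_add M.sym2 v (fun ω => 1 - f ω) f
    simp only [sub_add_cancel, rE_const] at this
    linarith
  have h2 := rE_mono_rate (s := M.sym2) hv0 hvw hfm
  have h3 : 0 ≤ rE M.sym2 w f := rE_nonneg hw fun _ _ => ind_nonneg _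
  have h4 := hlow.trans hge
  rw [h1] at h4
  rw [div_le_iff₀ (by positivity)]
  nlinarith

end Supercritical

section Infinite
variable {U : Type*} [DecidableEq U] [AddCommGroup U]

theorem exists_truncation {w : Sym2 U → ℝ} (hw : 0 ≤ w) {S : Finset U} (hS : 1 ≤ ph w S) :
    ∃ N : Finset U, 1 / 2 ≤ ∑ a ∈ S, ∑ b ∈ N \ S, rE S.sym2 w (fun ω => ci ω 0 a) * w s(a, b) := by
  have h1 : ph w S = ∑' y, ∑ a ∈ S, if y ∈ S then 0 else
      ENNReal.ofReal (rE S.sym2 w (fun ω => ci ω 0 a) * w s(a, y)) := by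
    rw [ph, Summable.tsum_finsetSum fun _ _ => ENNReal.summable]
    refine Finset.sum_congr rfl fun a _ => ?_
    rw [← ENNReal.tsum_mul_left]
    refine tsum_congr fun y => ?_
    split_ifs
    · rw [mul_zero]
    · rw [ENNReal.ofReal_mul (rE_nonneg hw fun _ _ => ci_nonneg _ _ _)]
  have h2 : (1 / 2 : ℝ≥0∞) < ph w S := lt_of_lt_of_le (by simp) hS
  rw [h1, ENNReal.tsum_eq_iSup_sum, lt_iSup_iff] at h2
  obtain ⟨N, hN⟩ := h2
  refine ⟨N, ?_⟩
  have hnn : ∀ a b, 0 ≤ rE S.sym2 w (fun ω => ci ω 0 a) * w s(a, b) := fun a b =>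
    mul_nonneg (rE_nonneg hw fun _ _ => ci_nonneg _ _ _) (hw _)
  rw [← ENNReal.ofReal_le_ofReal_iff (Finset.sum_nonneg fun a _ => Finset.sum_nonneg fun b _ => hnn a b)]
  have h3 : ENNReal.ofReal (1 / 2) = 1 / 2 := by
    rw [ENNReal.ofReal_div_of_pos two_pos]; simp
  rw [h3, ENNReal.ofReal_sum_of_nonneg fun a _ => Finset.sum_nonneg fun b _ => hnn a b]
  refine hN.le.trans_eq ?_
  rw [Finset.sum_comm]
  refine Finset.sum_congr rfl fun a _ => ?_
  rw [ENNReal.ofReal_sum_of_nonneg fun b _ => hnn a b, Finset.sdiff_eq_filter, Finset.sum_filter]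
  exact Finset.sum_congr rfl fun y _ => by split_ifs <;> simp_all

/-- If `ph w S ≥ 1` for every finite set containing `0`, then slightly larger rates percolate. -/
theorem infinite_of_ph [Countable U] {w : Sym2 U → ℝ} (hw : 0 ≤ w)
    (hS : ∀ S : Finset U, 0 ∈ S → 1 ≤ ph w S) {δ : ℝ} (hδ : 0 < δ)
    {μ : Measure (Sym2 U → Bool)} (hμ : IsPerc μ fun e => edgeProb (w e + δ * w e)) :
    0 < μ {ω | ∃ x, (cluster ω x).Infinite} := by
  set c := (δ / 2) / (1 + δ / 2) with hc
  have hc0 : 0 < c := by positivity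
  have hw' : 0 ≤ fun e => w e + δ * w e := fun e => add_nonneg (hw e) (mul_nonneg hδ.le (hw e))
  have := hμ.1
  have key : ∀ Λ : Finset U, μ {ω | cluster ω 0 ⊆ (Λ : Set U)} ≤ 1 - ENNReal.ofReal c := by
    intro Λ
    by_cases h0 : (0 : U) ∈ Λ
    swap
    · rw [show {ω : Sym2 U → Bool | cluster ω 0 ⊆ (Λ : Set U)} = ∅ from ?_]
      · simp
      ext ω
      simp only [Set.mem_ofPred_eq, Set.mem_empty_iff_false, iff_false]
      exact fun h => h0 (h (show Conn ω 0 0 from Relation.ReflTransGen.refl))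
    have h1 : ∀ S : Finset U, ∃ N : Finset U, 0 ∈ S → 1 / 2 ≤ ∑ a ∈ S, ∑ b ∈ N \ S,
        rE S.sym2 w (fun ω => ci ω 0 a) * w s(a, b) := fun S => by
      by_cases h : (0 : U) ∈ S
      · obtain ⟨N, hN⟩ := exists_truncation hw (hS S h)
        exact ⟨N, fun _ => hN⟩
      · exact ⟨∅, fun h' => absurd h' h⟩
    choose N hN using h1
    set M := Λ ∪ Λ.powerset.biUnion N with hM
    have h2 := rE_escape_step (M := M) 0 h0 Finset.subset_union_left hw (fun S hSΛ h0S => by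
      refine (hN S h0S).trans (Finset.sum_le_sum fun a _ => ?_)
      refine Finset.sum_le_sum_of_subset_of_nonneg (Finset.sdiff_subset_sdiff ?_ le_rfl)
        fun b _ _ => mul_nonneg (rE_nonneg hw fun _ _ => ci_nonneg _ _ _) (hw _)
      exact (Finset.subset_biUnion_of_mem N (Finset.mem_powerset.2 hSΛ)).trans
        Finset.subset_union_right) hδ
    set P : Finset (Sym2 U) → Prop := fun A => ∃ y ∈ M \ Λ, Lk (A : Set (Sym2 U)) 0 y with hP
    have hmeas : MeasurableSet {ω : Sym2 U → Bool | P (opn M.sym2 ω)} := by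
      have := measurable_comp_opn M.sym2 (fun A => if P A then (1 : ℝ≥0∞) else 0)
        (measurableSet_singleton 1)
      convert this using 1
      ext ω
      simp only [Set.mem_ofPred_eq, Set.mem_preimage, Set.mem_singleton_iff]
      split_ifs with h <;> simp [h]
    have h3 : ENNReal.ofReal c ≤ μ {ω | P (opn M.sym2 ω)} := by
      have := lintegral_opn hw' hμ M.sym2 (f := fun A => ind (P A)) fun _ => ind_nonneg _
      rw [← lintegral_indicator_one hmeas]
      refine (ENNReal.ofReal_le_ofReal h2).trans (this.symm.trans_le (lintegral_mono fun ω => ?_))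
      simp only [ind, Set.indicator_apply, Set.mem_ofPred_eq]
      split_ifs <;> simp
    calc _ ≤ μ {ω | P (opn M.sym2 ω)}ᶜ := by
          refine measure_mono fun ω h => ?_
          rintro ⟨y, hy, hl⟩
          exact (Finset.mem_sdiff.1 hy).2 (by
            exact_mod_cast h (show Conn ω 0 y from (conn_iff_exists ω 0 y).2 ⟨M, hl⟩))
      _ = 1 - μ {ω | P (opn M.sym2 ω)} := prob_compl_eq_one_sub hmeas
      _ ≤ _ := tsub_le_tsub_left h3 _
  have hdir : Directed (· ⊆ ·) fun Λ : Finset U => {ω : Sym2 U → Bool | cluster ω 0 ⊆ (Λ : Set U)} := by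
    intro Λ Λ'
    refine ⟨Λ ∪ Λ', fun ω h x hx => ?_, fun ω h x hx => ?_⟩
    · have := h hx; simp only [Finset.coe_union]; exact Or.inl this
    · have := h hx; simp only [Finset.coe_union]; exact Or.inr this
  have h4 : μ {ω | (cluster ω 0).Finite} ≤ 1 - ENNReal.ofReal c := by
    refine (measure_mono ?_).trans ((hdir.measure_iUnion).le.trans (iSup_le key))
    intro ω hω
    exact Set.mem_iUnion.2 ⟨Set.Finite.toFinset hω, by simp⟩
  rw [pos_iff_ne_zero]
  intro h5
  have h6 : (1 : ℝ≥0∞) ≤ μ {ω | (cluster ω 0).Finite} + μ {ω | ∃ x, (cluster ω x).Infinite} := by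
    rw [← measure_univ (μ := μ)]
    refine (measure_mono fun ω _ => ?_).trans (measure_union_le _ _)
    by_cases h : (cluster ω 0).Finite
    · exact Or.inl h
    · exact Or.inr ⟨0, h⟩
  rw [h5, add_zero] at h6
  have h7 := h6.trans h4
  have : (1 : ℝ≥0∞) - ENNReal.ofReal c < 1 :=
    ENNReal.sub_lt_self one_ne_top one_ne_zero (by simpa using hc0)
  exact absurd h7 (not_le.2 this)

theorem measurable_eCard_cluster [Countable U] (o : U) :
    Measurable fun ω : Sym2 U → Bool => eCard (cluster ω o) := by
  simp only [eCard_cluster]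
  exact Measurable.iSup fun Λ => measurable_comp_opn Λ.sym2 fun A => ENNReal.ofReal (cs Λ A o)

/-- A finite susceptibility excludes infinite clusters. -/
theorem infinite_eq_zero_of_Am [Countable U] {w : Sym2 U → ℝ} (hw : 0 ≤ w) (tw : TI w)
    (h : Am 1 w ≠ ∞) {μ : Measure (Sym2 U → Bool)} (hμ : IsPerc μ fun e => edgeProb (w e)) :
    μ {ω | ∃ x, (cluster ω x).Infinite} = 0 := by
  rw [show {ω : Sym2 U → Bool | ∃ x, (cluster ω x).Infinite} = ⋃ x, {ω | (cluster ω x).Infinite} by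
    ext; simp, measure_iUnion_null_iff]
  intro x
  have h1 := lintegral_eCard_pow hw hμ x 1
  rw [EV_cs_base tw] at h1
  simp only [pow_one] at h1
  have h2 := measure_eq_top_of_lintegral_ne_top (measurable_eCard_cluster x).aemeasurable
    (h1 ▸ h)
  refine measure_mono_null (fun ω hω => ?_) h2
  have : (cluster ω x).Infinite := hω
  show eCard (cluster ω x) = ∞
  rw [eCard, if_neg this]

theorem continuous_rE {X : Type*} [TopologicalSpace X] {ι : Type*} [DecidableEq ι] (s : Finset ι)
    {w : X → ι → ℝ} (hw : ∀ e, Continuous fun x => w x e) (f : Finset ι → ℝ) :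
    Continuous fun x => rE s (w x) f := by
  unfold rE bE edgeProb
  refine continuous_finsetSum _ fun ω _ => Continuous.mul ?_ continuous_const
  refine Continuous.mul ?_ ?_ <;> refine continuous_finsetProd _ fun e _ => ?_
  · exact continuous_const.sub (Real.continuous_exp.comp (hw e).neg)
  · exact continuous_const.sub (continuous_const.sub (Real.continuous_exp.comp (hw e).neg))

/-- The susceptibility stays finite under a perturbation that is small on the scale of its
inverse. -/
theorem Am_one_add_le_two {w u : Sym2 U → ℝ} (hw : 0 ≤ w) (hu : 0 ≤ u) (tw : TI w) (tu : TI u)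
    (hχ : Am 1 w ≠ ∞) (hsmall : 4 * (rs u * Am 1 w) < 1) : Am 1 (w + u) ≤ 2 * Am 1 w := by
  set χ := (Am 1 w).toReal with hχd
  have hχ1 : 1 ≤ χ := by
    have := one_le_Am hw 1
    rw [← ENNReal.toReal_le_toReal one_ne_top hχ] at this
    simpa using this
  have hrs : rs u ≠ ∞ := by
    intro h
    rw [h, ENNReal.top_mul (by have := one_le_Am hw 1; positivity)] at hsmall
    simp at hsmall
  set q := (rs u).toReal with hq
  have hq0 : 0 ≤ q := ENNReal.toReal_nonneg
  have hs : 4 * (q * χ) < 1 := by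
    rw [← ENNReal.toReal_lt_toReal (hsmall.trans one_lt_top).ne one_ne_top] at hsmall
    simpa [ENNReal.toReal_mul] using hsmall
  have hrow : ∀ (Λ : Finset U) a, ∑ b ∈ Λ, u s(a, b) ≤ q := fun Λ a => by
    rw [hq, ← ENNReal.ofReal_le_iff_le_toReal hrs, ← rs_row tu a,
      ENNReal.ofReal_sum_of_nonneg fun b _ => hu _]
    exact ENNReal.sum_le_tsum Λ
  have hbase : ∀ Λ v, rE Λ.sym2 w (fun ω => cs Λ ω v) ≤ χ := fun Λ v => by
    rw [hχd, ← ENNReal.ofReal_le_iff_le_toReal hχ, ← EV_cs_base_one tw v]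
    exact le_EV w (fun Λ ω => cs Λ ω v) Λ
  have key : ∀ Λ : Finset U, 0 ∈ Λ → rE Λ.sym2 (w + u) (fun ω => cs Λ ω 0) ≤ 2 * χ := by
    intro Λ h0
    have hne : Λ.Nonempty := ⟨0, h0⟩
    let X : ℝ → ℝ := fun t => Λ.sup' hne fun v => rE Λ.sym2 (w + t • u) (fun ω => cs Λ ω v)
    have hcont : Continuous X := by
      refine Continuous.finset_sup'_apply hne fun v _ => continuous_rE _ (fun e => ?_) _
      simp only [Pi.add_apply, Pi.smul_apply, smul_eq_mul]
      fun_prop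
    have hX0 : X 0 ≤ χ := by
      refine Finset.sup'_le _ _ fun v _ => ?_
      simp only [zero_smul, add_zero]
      exact hbase Λ v
    have hstep : ∀ t ∈ Set.Icc (0:ℝ) 1, X t ≤ χ + q * (X t * X t) := by
      intro t ht
      have htu : 0 ≤ t • u := smul_nonneg ht.1 hu
      have hwt : 0 ≤ w + t • u := add_nonneg hw htu
      refine Finset.sup'_le _ _ fun v hv => ?_
      have h1 := cw_add_le Λ hw htu (φ := fun _ => 1) (fun _ => zero_le_one) v
      rw [cw_one] at h1
      refine h1.trans (add_le_add (hbase Λ v) ?_)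
      have hXle : ∀ b ∈ Λ, rE Λ.sym2 (w + t • u) (fun ω => cs Λ ω b) ≤ X t := fun b hb =>
        Finset.le_sup' (fun v => rE Λ.sym2 (w + t • u) (fun ω => cs Λ ω v)) hb
      have hXt : 0 ≤ X t := (rE_nonneg hwt fun _ _ => cs_nonneg _ _ _).trans (hXle v hv)
      calc _ ≤ ∑ a ∈ Λ, ∑ b ∈ Λ, u s(a, b) * (rE Λ.sym2 (w + t • u) (fun ω => ci ω v a) * X t) := by
            refine Finset.sum_le_sum fun a _ => Finset.sum_le_sum fun b hb => ?_
            refine mul_le_mul ?_ ?_ (mul_nonneg (rE_nonneg hwt fun _ _ => ci_nonneg _ _ _)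
              (rE_nonneg hwt fun _ _ => cs_nonneg _ _ _)) (hu _)
            · exact mul_le_of_le_one_left (hu _) ht.2
            · exact mul_le_mul_of_nonneg_left (hXle b hb) (rE_nonneg hwt fun _ _ => ci_nonneg _ _ _)
        _ = ∑ a ∈ Λ, (∑ b ∈ Λ, u s(a, b)) * (rE Λ.sym2 (w + t • u) (fun ω => ci ω v a) * X t) := by
            simp only [Finset.sum_mul]
        _ ≤ ∑ a ∈ Λ, q * (rE Λ.sym2 (w + t • u) (fun ω => ci ω v a) * X t) :=
            Finset.sum_le_sum fun a _ => mul_le_mul_of_nonneg_right (hrow Λ a)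
              (mul_nonneg (rE_nonneg hwt fun _ _ => ci_nonneg _ _ _) hXt)
        _ = q * (rE Λ.sym2 (w + t • u) (fun ω => cs Λ ω v) * X t) := by
            simp only [cs, rE_sum, Finset.sum_mul, Finset.mul_sum]
        _ ≤ _ := mul_le_mul_of_nonneg_left (mul_le_mul_of_nonneg_right (hXle v hv) hXt) hq0
    have hX1 : X 1 ≤ 2 * χ := by
      by_contra! hlt
      obtain ⟨t, ht, hXt⟩ := intermediate_value_Icc zero_le_one hcont.continuousOn
        (show 2 * χ ∈ Set.Icc (X 0) (X 1) from ⟨by linarith, hlt.le⟩)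
      have := hstep t ht
      rw [hXt] at this
      nlinarith
    refine le_trans ?_ hX1
    have := Finset.le_sup' (fun v => rE Λ.sym2 (w + (1:ℝ) • u) (fun ω => cs Λ ω v)) h0
    refine le_trans (le_of_eq ?_) this
    rw [one_smul]
  rw [← Am_one (w + u), ← ENNReal.ofReal_toReal hχ, ← hχd,
    show (2 : ℝ≥0∞) = ENNReal.ofReal 2 by simp, ← ENNReal.ofReal_mul two_pos.le]
  refine iSup_le fun Λ => ENNReal.ofReal_le_ofReal ?_
  refine le_trans ?_ (key (insert 0 Λ) (by simp))
  exact (vm_cs (U := U) 0).monotone_rE (add_nonneg hw hu) (Finset.subset_insert 0 Λ)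

end Infinite

namespace Kernel
variable {d : ℕ} {α : ℝ} (κ : Kernel d α)

/-- The size of a lattice point in the norm of the kernel. -/
noncomputable def nr (x : V d) : ℝ := κ.N (toR x)

theorem toR_sub (x y : V d) : toR (x - y) = toR x - toR y := by
  funext i; simp [toR]

theorem toR_ne_zero {x : V d} (h : x ≠ 0) : toR x ≠ 0 := fun h' => h (by
  funext i
  have := congrFun h' i
  simpa [toR] using this)

theorem nd_eq (x y : V d) : κ.nd x y = κ.nr (x - y) := by rw [nd, nr, toR_sub]

theorem nr_nonneg (x : V d) : 0 ≤ κ.nr x := apply_nonneg κ.N _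

theorem nr_neg (x : V d) : κ.nr (-x) = κ.nr x := by
  have : toR (-x) = -toR x := by funext i; simp [toR]
  rw [nr, this, map_neg_eq_map, nr]

theorem nr_pos {x : V d} (h : x ≠ 0) : 0 < κ.nr x := κ.N_pos _ (toR_ne_zero h)

/-- The edge rates of the kernel. -/
noncomputable def w0 : Sym2 (V d) → ℝ := Sym2.lift ⟨κ.ker, κ.ker_symm⟩

theorem w0_mk (x y : V d) : κ.w0 s(x, y) = if x = y then 0 else κ.J (κ.nr (x - y)) := by
  rw [← nd_eq]; rfl

theorem w0_nonneg : 0 ≤ κ.w0 := by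
  intro e
  induction e with
  | _ x y =>
    rw [w0_mk]
    split_ifs with h
    · exact le_rfl
    · exact κ.J_nonneg _ (κ.nr_pos (sub_ne_zero.2 h))

theorem w0_TI : TI κ.w0 := by
  intro z a b
  rw [w0_mk, w0_mk]
  simp

theorem edgeP_eq (β : ℝ) : κ.edgeP β = fun e => edgeProb ((β • κ.w0) e) := by
  funext e
  induction e with
  | _ x y => rfl

/-- The rates of the kernel cut off at distance `r`. -/
noncomputable def wc (r : ℝ) : Sym2 (V d) → ℝ := fun e => max (κ.w0 e - κ.J r) 0

theorem wc_nonneg (r : ℝ) : 0 ≤ κ.wc r := fun _ => le_max_right _ _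

theorem wc_le_w0 {r : ℝ} (hr : 0 < r) : κ.wc r ≤ κ.w0 := fun e =>
  max_le (sub_le_self _ (κ.J_nonneg r hr)) (κ.w0_nonneg e)

theorem wc_mono {r r' : ℝ} (hr : 0 < r) (h : r ≤ r') : κ.wc r ≤ κ.wc r' := fun e =>
  max_le_max (sub_le_sub_left (κ.J_anti hr (hr.trans_le h) h) _) le_rfl

theorem wc_TI (r : ℝ) : TI (κ.wc r) := by
  intro z a b
  unfold wc
  rw [κ.w0_TI z a b]

theorem J'_nonpos {r : ℝ} (hr : 0 < r) : κ.J' r ≤ 0 := by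
  by_contra! h
  have h1 := κ.J_hasDeriv r hr
  have h2 : κ.J' r ≤ 0 := by
    have := h1.hasDerivWithinAt (s := Set.Ioi r)
    rw [hasDerivWithinAt_iff_tendsto_slope' (by simp)] at this
    refine le_of_tendsto this ?_
    filter_upwards [self_mem_nhdsWithin] with y hy
    rw [slope_def_field]
    have hy : r < y := hy
    exact div_nonpos_of_nonpos_of_nonneg
      (sub_nonpos.2 (κ.J_anti hr (hr.trans hy) hy.le)) (sub_nonneg.2 hy.le)
  linarith

theorem integral_J' {a b : ℝ} (ha : 0 < a) (hab : a ≤ b) :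
    ∫ s in Set.Ioc a b, |κ.J' s| = κ.J a - κ.J b := by
  have h1 : ∫ s in Set.Ioc a b, |κ.J' s| = ∫ s in Set.Ioc a b, -κ.J' s :=
    setIntegral_congr_fun measurableSet_Ioc fun s hs =>
      abs_of_nonpos (κ.J'_nonpos (ha.trans hs.1))
  have hc : ContinuousOn (fun s => -κ.J s) (Set.Icc a b) := fun s hs =>
    (κ.J_hasDeriv s (ha.trans_le hs.1)).neg.continuousAt.continuousWithinAt
  have hd : ∀ s ∈ Set.Ioo a b, HasDerivAt (fun s => -κ.J s) (-κ.J' s) s := fun s hs =>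
    (κ.J_hasDeriv s (ha.trans hs.1)).neg
  have hi := intervalIntegral.integrableOn_deriv_of_nonneg hc hd fun s hs =>
    neg_nonneg.2 (κ.J'_nonpos (ha.trans hs.1))
  rw [h1, ← intervalIntegral.integral_of_le hab,
    intervalIntegral.integral_eq_sub_of_hasDerivAt_of_le hab hc hd
      ((intervalIntegrable_iff_integrableOn_Ioc_of_le hab).2 hi)]
  ring

theorem edgePCut_eq (β : ℝ) {r : ℝ} (hr : 0 < r) :
    κ.edgePCut β r = fun e => edgeProb ((β • κ.wc r) e) := by
  funext e
  induction e with
  | _ x y =>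
    show edgeProb (β * κ.kerCut r x y) = edgeProb (β * κ.wc r s(x, y))
    congr 2
    rw [kerCut, wc, w0_mk]
    by_cases hxy : x = y
    · simp [hxy, κ.J_nonneg r hr]
    · have hp := κ.nr_pos (sub_ne_zero.2 hxy)
      rw [if_neg hxy]
      by_cases hn : κ.nd x y ≤ r
      · rw [if_pos ⟨hxy, hn⟩]
        rw [nd_eq] at hn ⊢
        rw [κ.integral_J' hp hn, max_eq_left (sub_nonneg.2 (κ.J_anti hp hr hn))]
      · rw [if_neg fun h => hn h.2]
        rw [nd_eq] at hn
        rw [max_eq_right (sub_nonpos.2 (κ.J_anti hr hp (not_le.1 hn).le))]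

section Transfer
variable {μ : Measure (Config d)} {w : Sym2 (V d) → ℝ}

theorem clMom_eq (hw : 0 ≤ w) (hμ : IsPerc μ fun e => edgeProb (w e)) (k : ℕ) :
    clMom μ k = Am k w := lintegral_eCard_pow hw hμ 0 k

/-- The weight of the `p`-th radius of gyration. -/
noncomputable def ep (p : ℝ) (x : V d) : ℝ := enorm2 x ^ p

theorem enorm2_nonneg (x : V d) : 0 ≤ enorm2 x := Real.sqrt_nonneg _

theorem ep_nonneg (p : ℝ) : 0 ≤ (ep p : V d → ℝ) := fun x => Real.rpow_nonneg (enorm2_nonneg x) _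

theorem gyr_eq (hw : 0 ≤ w) (hμ : IsPerc μ fun e => edgeProb (w e)) (p : ℝ) :
    gyr μ p = gy (ep p) w := lintegral_tsum_cluster hw hμ (ep_nonneg p) 0

theorem xi_eq (hw : 0 ≤ w) (hμ : IsPerc μ fun e => edgeProb (w e)) (p : ℝ) :
    xi μ p = (gy (ep p) w / Am 1 w) ^ (1 / p) := by rw [xi, gyr_eq hw hμ, clMom_eq hw hμ]

end Transfer

theorem smul_w0_nonneg {β : ℝ} (hβ : 0 ≤ β) : 0 ≤ β • κ.w0 := smul_nonneg hβ κ.w0_nonneg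

theorem smul_wc_nonneg {β : ℝ} (hβ : 0 ≤ β) (r : ℝ) : 0 ≤ β • κ.wc r :=
  smul_nonneg hβ (κ.wc_nonneg r)

theorem biSup_perc {β : ℝ} (hβ : 0 ≤ β) {F : Measure (Config d) → ℝ≥0∞} {c : ℝ≥0∞}
    (h : ∀ μ, IsPerc μ (fun e => edgeProb ((β • κ.w0) e)) → F μ = c) :
    ⨆ μ ∈ {μ : Measure (Config d) | IsPerc μ (κ.edgeP β)}, F μ = c := by
  obtain ⟨μ, hμ⟩ := exists_isPerc (κ.smul_w0_nonneg hβ)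
  refine le_antisymm (iSup₂_le fun ν hν => ?_) ?_
  · have hν : IsPerc ν (κ.edgeP β) := hν
    rw [edgeP_eq] at hν
    exact (h ν hν).le
  · rw [← h μ hμ]
    refine le_iSup₂_of_le μ ?_ le_rfl
    show IsPerc μ (κ.edgeP β)
    rw [edgeP_eq]; exact hμ

theorem mom_eq {β : ℝ} (hβ : 0 ≤ β) (k : ℕ) : κ.mom β k = Am k (β • κ.w0) :=
  κ.biSup_perc hβ fun μ hμ => clMom_eq (κ.smul_w0_nonneg hβ) hμ k

theorem xiFull_eq {β : ℝ} (hβ : 0 ≤ β) (p : ℝ) :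
    κ.xiFull β p = (gy (ep p) (β • κ.w0) / Am 1 (β • κ.w0)) ^ (1 / p) :=
  κ.biSup_perc hβ fun μ hμ => xi_eq (κ.smul_w0_nonneg hβ) hμ p

theorem betaC_nonneg : 0 ≤ κ.betaC := Real.sInf_nonneg fun β h => h.1

theorem not_percolates {β : ℝ} (hβ : 0 ≤ β) (h : Am 1 (β • κ.w0) ≠ ∞) : ¬ κ.percolates β := by
  intro hp
  obtain ⟨μ, hμ⟩ := exists_isPerc (κ.smul_w0_nonneg hβ)
  have := hp μ (by rw [edgeP_eq]; exact hμ)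
  rw [infinite_eq_zero_of_Am (κ.smul_w0_nonneg hβ) (κ.w0_TI.smul β) h hμ] at this
  exact lt_irrefl _ this

theorem exists_ph_lt_one {β : ℝ} (hβ : 0 < β) (h : β < κ.betaC) :
    ∃ S : Finset (V d), 0 ∈ S ∧ ph (β • κ.w0) S < 1 := by
  by_contra! hc
  set β' := (β + κ.betaC) / 2 with hβ'
  have h1 : β' ∉ {β : ℝ | 0 ≤ β ∧ κ.percolates β} := by
    intro hm
    have := csInf_le ⟨0, fun x hx => hx.1⟩ hm
    have : κ.betaC ≤ β' := this
    linarith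
  refine h1 ⟨by linarith, fun μ hμ => ?_⟩
  refine infinite_of_ph (κ.smul_w0_nonneg hβ.le) hc (δ := β' / β - 1) ?_ ?_
  · rw [sub_pos, lt_div_iff₀ hβ]; linarith
  · rw [edgeP_eq] at hμ
    convert hμ using 3 with e
    simp only [Pi.smul_apply, smul_eq_mul]
    field_simp
    ring

theorem Am_mono {β β' : ℝ} (hβ : 0 ≤ β) (h : β ≤ β') (k : ℕ) :
    Am k (β • κ.w0) ≤ Am k (β' • κ.w0) :=
  Am_mono_rate (κ.smul_w0_nonneg hβ) (fun e => mul_le_mul_of_nonneg_right h (κ.w0_nonneg e)) k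

/-- Sharpness of the phase transition. -/
theorem Am_one_ne_top {β : ℝ} (hβ : 0 ≤ β) (h : β < κ.betaC) : Am 1 (β • κ.w0) ≠ ∞ := by
  obtain ⟨S, h0, hS⟩ := κ.exists_ph_lt_one (β := (β + κ.betaC) / 2) (by linarith) (by linarith)
  have := Am_one_lt_top_of_ph (κ.smul_w0_nonneg (by linarith)) (κ.w0_TI.smul _) h0 hS
  exact ((κ.Am_mono hβ (by linarith) 1).trans_lt this).ne

theorem rs_smul {c : ℝ} (hc : 0 ≤ c) (u : Sym2 (V d) → ℝ) : rs (c • u) = ENNReal.ofReal c * rs u := by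
  rw [rs, rs, ← ENNReal.tsum_mul_left]
  exact tsum_congr fun b => by rw [Pi.smul_apply, smul_eq_mul, ENNReal.ofReal_mul hc]

theorem rs_w0_ne_top (h : 0 < κ.betaC) : rs κ.w0 ≠ ∞ := by
  obtain ⟨S, h0, hS⟩ := κ.exists_ph_lt_one (β := κ.betaC / 2) (by linarith) (by linarith)
  set β := κ.betaC / 2 with hβ
  have hβ0 : 0 < β := by linarith
  have h1 : ∑' y, (if y ∈ S then 0 else ENNReal.ofReal ((β • κ.w0) s(0, y))) < 1 := by
    refine lt_of_le_of_lt ?_ hS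
    have := Finset.single_le_sum (f := fun x => ENNReal.ofReal (rE S.sym2 (β • κ.w0) fun ω => ci ω 0 x) *
      ∑' y, if y ∈ S then 0 else ENNReal.ofReal ((β • κ.w0) s(x, y))) (fun _ _ => zero_le) h0
    refine le_trans (le_of_eq ?_) this
    simp only [ci_self, rE_const, ENNReal.ofReal_one, one_mul]
  have h2 : rs (β • κ.w0) ≠ ∞ := by
    have : rs (β • κ.w0) ≤ (∑ y ∈ S, ENNReal.ofReal ((β • κ.w0) s(0, y))) +
        ∑' y, (if y ∈ S then 0 else ENNReal.ofReal ((β • κ.w0) s(0, y))) := by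
      have h3 : ∑ y ∈ S, ENNReal.ofReal ((β • κ.w0) s(0, y)) =
          ∑' y, (if y ∈ S then ENNReal.ofReal ((β • κ.w0) s(0, y)) else 0) := by
        rw [tsum_eq_sum (s := S) fun b hb => if_neg hb]
        exact Finset.sum_congr rfl fun b hb => (if_pos hb).symm
      rw [h3, ← ENNReal.tsum_add, rs]
      refine ENNReal.tsum_le_tsum fun b => ?_
      split_ifs <;> simp
    refine (this.trans_lt (ENNReal.add_lt_top.2 ⟨?_, h1.trans one_lt_top⟩)).ne
    exact ENNReal.sum_lt_top.2 fun _ _ => ENNReal.ofReal_lt_top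
  rw [rs_smul hβ0.le] at h2
  intro h3
  rw [h3, ENNReal.mul_top (by simpa using hβ0)] at h2
  exact h2 rfl

/-- The mean-field lower bound on the susceptibility. -/
theorem one_le_gap_mul (hne : ∃ β : ℝ, 0 ≤ β ∧ κ.percolates β) {β : ℝ} (hβ : 0 ≤ β)
    (h : β < κ.betaC) :
    1 ≤ 4 * ((κ.betaC - β) * (rs κ.w0).toReal * (Am 1 (β • κ.w0)).toReal) := by
  by_contra! hlt
  have hχ := κ.Am_one_ne_top hβ h
  have hrs := κ.rs_w0_ne_top (hβ.trans_lt h)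
  set q := (rs κ.w0).toReal * (Am 1 (β • κ.w0)).toReal with hq
  have hq0 : 0 ≤ q := mul_nonneg ENNReal.toReal_nonneg ENNReal.toReal_nonneg
  have hex : ∃ β'' > κ.betaC, 4 * ((β'' - β) * q) < 1 := by
    refine ⟨κ.betaC + (1 - 4 * ((κ.betaC - β) * q)) / (8 * (q + 1)), ?_, ?_⟩
    · have : 0 < (1 - 4 * ((κ.betaC - β) * q)) / (8 * (q + 1)) := by
        apply div_pos <;> nlinarith
      linarith
    · have h1 : (1 - 4 * ((κ.betaC - β) * q)) / (8 * (q + 1)) * q ≤ (1 - 4 * ((κ.betaC - β) * q)) / 8 := by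
        rw [div_mul_eq_mul_div, div_le_div_iff₀ (by positivity) (by positivity)]
        nlinarith
      nlinarith
  obtain ⟨β'', hβ'', hsm⟩ := hex
  have key : ∀ b, 0 ≤ b → b < β'' → ¬ κ.percolates b := by
    intro b hb0 hb
    refine κ.not_percolates hb0 ?_
    rcases le_total b β with hbβ | hbβ
    · exact ((κ.Am_mono hb0 hbβ 1).trans_lt hχ.lt_top).ne
    · have h1 := Am_one_add_le_two (κ.smul_w0_nonneg hβ) (κ.smul_w0_nonneg (sub_nonneg.2 hbβ))
        (κ.w0_TI.smul _) (κ.w0_TI.smul (b - β)) hχ (by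
          rw [rs_smul (sub_nonneg.2 hbβ), ← ENNReal.ofReal_toReal hrs, ← ENNReal.ofReal_toReal hχ,
            ← ENNReal.ofReal_mul (sub_nonneg.2 hbβ), ← ENNReal.ofReal_mul (mul_nonneg
              (sub_nonneg.2 hbβ) ENNReal.toReal_nonneg), show (4 : ℝ≥0∞) = ENNReal.ofReal 4 by simp,
            ← ENNReal.ofReal_mul (by norm_num), ENNReal.ofReal_lt_one]
          refine lt_of_le_of_lt ?_ hsm
          rw [mul_assoc (b - β), ← hq]
          have := mul_le_mul_of_nonneg_right (show b - β ≤ β'' - β by linarith) hq0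
          linarith)
      rw [← add_smul, add_sub_cancel] at h1
      exact (h1.trans_lt (ENNReal.mul_lt_top (by simp) hχ.lt_top)).ne
  have : β'' ≤ κ.betaC := le_csInf hne fun b hb => by
    by_contra! hlt
    exact key b hb.1 hlt hb.2
  linarith

end Kernel

/-! ### Geometry of the lattice -/

theorem norm_toR {d : ℕ} (x : V d) : ‖toR x‖ = ‖x‖ := by
  simp only [Pi.norm_def, toR]
  congr 2

theorem one_le_norm {d : ℕ} {x : V d} (h : x ≠ 0) : 1 ≤ ‖x‖ := by
  obtain ⟨i, hi⟩ : ∃ i, x i ≠ 0 := by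
    by_contra! h'
    exact h (funext h')
  refine le_trans ?_ (norm_le_pi_norm x i)
  rw [Int.norm_eq_abs]
  exact_mod_cast Int.one_le_abs hi

theorem norm_le_enorm2 {d : ℕ} (x : V d) : ‖x‖ ≤ enorm2 x := by
  refine (pi_norm_le_iff_of_nonneg (Real.sqrt_nonneg _)).2 fun i => ?_
  rw [Int.norm_eq_abs, ← Real.sqrt_sq_eq_abs]
  exact Real.sqrt_le_sqrt (Finset.single_le_sum (f := fun i => ((x i : ℝ)) ^ 2)
    (fun _ _ => sq_nonneg _) (Finset.mem_univ i))

theorem enorm2_le {d : ℕ} (hd : 1 ≤ d) (x : V d) : enorm2 x ≤ d * ‖x‖ := by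
  have h1 : ∑ i, ((x i : ℝ)) ^ 2 ≤ d * ‖x‖ ^ 2 := by
    have : ∀ i ∈ Finset.univ, ((x i : ℝ)) ^ 2 ≤ ‖x‖ ^ 2 := fun i _ => by
      rw [← sq_abs, ← Int.norm_eq_abs]
      exact pow_le_pow_left₀ (norm_nonneg _) (norm_le_pi_norm x i) 2
    simpa using Finset.sum_le_sum this
  have hd' : (1 : ℝ) ≤ d := by exact_mod_cast hd
  refine Real.sqrt_le_iff.2 ⟨by positivity, h1.trans ?_⟩
  nlinarith [sq_nonneg ‖x‖, mul_nonneg (sub_nonneg.2 hd') (mul_nonneg (by linarith : (0:ℝ) ≤ d) (sq_nonneg ‖x‖))]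

/-- The lattice box `{x | ‖x‖ ≤ R}`. -/
noncomputable def bx (d : ℕ) (R : ℝ) : Finset (V d) := Finset.Icc (fun _ => -(⌊R⌋₊ : ℤ)) (fun _ => (⌊R⌋₊ : ℤ))

theorem mem_bx {d : ℕ} {R : ℝ} (hR : 0 ≤ R) {x : V d} : x ∈ bx d R ↔ ‖x‖ ≤ R := by
  rw [bx, Finset.mem_Icc, pi_norm_le_iff_of_nonneg hR, Pi.le_def, Pi.le_def, ← forall_and]
  refine forall_congr' fun i => ?_
  rw [← abs_le, Int.norm_eq_abs, ← Int.cast_abs, Int.abs_eq_natAbs, Int.cast_natCast,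
    ← Nat.le_floor_iff hR]
  exact_mod_cast Iff.rfl

theorem card_bx {d : ℕ} (R : ℝ) : (bx d R).card = (2 * ⌊R⌋₊ + 1) ^ d := by
  rw [bx, Pi.card_Icc]
  simp only [Int.card_Icc, Finset.prod_const, Finset.card_univ, Fintype.card_fin]
  congr 1
  omega

theorem card_bx_le {d : ℕ} {R : ℝ} (hR : 1 ≤ R) : ((bx d R).card : ℝ) ≤ (3 * R) ^ d := by
  rw [card_bx]
  push_cast
  have := Nat.floor_le (by linarith : 0 ≤ R)
  exact pow_le_pow_left₀ (by positivity) (by linarith) d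

theorem le_card_bx {d : ℕ} {R : ℝ} (hR : 0 ≤ R) : R ^ d ≤ ((bx d R).card : ℝ) := by
  rw [card_bx]
  push_cast
  have := (Nat.lt_floor_add_one R).le
  exact pow_le_pow_left₀ hR (by have : (0:ℝ) ≤ ⌊R⌋₊ := Nat.cast_nonneg _; linarith) d

theorem zero_mem_bx {d : ℕ} {R : ℝ} (hR : 0 ≤ R) : (0 : V d) ∈ bx d R := by
  rw [mem_bx hR, norm_zero]; exact hR

theorem summable_norm_rpow_V (d : ℕ) {ρ : ℝ} (h : (d : ℝ) < ρ) :
    Summable fun x : V d => ‖x‖ ^ (-ρ) := by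
  set L : Submodule ℤ (Fin d → ℝ) := Submodule.span ℤ (Set.range (Pi.basisFun ℝ (Fin d))) with hL
  have hf : Module.finrank ℤ L = d := by
    rw [hL, Module.finrank_eq_card_basis (Module.Basis.restrictScalars ℤ (Pi.basisFun ℝ (Fin d)))]
    simp
  have h1 := ZLattice.summable_norm_rpow L (-ρ) (by rw [hf]; linarith)
  have hmem : ∀ x : V d, toR x ∈ L := fun x => by
    have : toR x = ∑ i, x i • (Pi.basisFun ℝ (Fin d)) i := by
      funext j
      simp [toR, Finset.sum_apply, Pi.single_apply]
    rw [this]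
    exact Submodule.sum_mem _ fun i _ => Submodule.smul_mem _ _ (Submodule.subset_span ⟨i, rfl⟩)
  have hinj : Function.Injective fun x : V d => (⟨toR x, hmem x⟩ : L) := fun x y hxy => by
    have := congrArg Subtype.val hxy
    funext i
    have := congrFun this i
    simpa [toR] using this
  have h2 := h1.comp_injective hinj
  refine h2.congr fun x => ?_
  simp only [Function.comp, Submodule.coe_norm, norm_toR]

namespace Kernel
variable {d : ℕ} {α : ℝ} (κ : Kernel d α)

theorem exists_nr_le : ∃ C : ℝ, 1 ≤ C ∧ ∀ x : Fin d → ℝ, κ.N x ≤ C * ‖x‖ := by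
  refine ⟨1 + ∑ i, κ.N (Pi.single i 1), by
    have : 0 ≤ ∑ i, κ.N (Pi.single i 1) := Finset.sum_nonneg fun i _ => apply_nonneg κ.N _
    linarith, fun x => ?_⟩
  have h1 : κ.N x ≤ ∑ i, ‖x‖ * κ.N (Pi.single i 1) := by
    have hx : x = ∑ i, x i • (Pi.single i (1:ℝ) : Fin d → ℝ) := by
      funext j
      simp [Finset.sum_apply, Pi.single_apply]
    calc κ.N x = κ.N (∑ i, x i • (Pi.single i (1:ℝ) : Fin d → ℝ)) := by rw [← hx]
      _ ≤ ∑ i, κ.N (x i • (Pi.single i (1:ℝ) : Fin d → ℝ)) :=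
        Finset.le_sum_of_subadditive κ.N (map_zero _).le (fun a b => map_add_le_add _ a b) _ _
      _ ≤ _ := Finset.sum_le_sum fun i _ => by
        rw [map_smul_eq_mul]
        exact mul_le_mul_of_nonneg_right (norm_le_pi_norm x i) (apply_nonneg κ.N _)
  rw [← Finset.mul_sum] at h1
  nlinarith [norm_nonneg x]

theorem exists_le_nr (hd : 1 ≤ d) : ∃ c : ℝ, 0 < c ∧ ∀ x : Fin d → ℝ, c * ‖x‖ ≤ κ.N x := by
  obtain ⟨C, hC, hN⟩ := κ.exists_nr_le
  have hcont : Continuous κ.N := by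
    refine LipschitzWith.continuous (K := ⟨C, by linarith⟩) (LipschitzWith.of_dist_le_mul fun x y => ?_)
    rw [Real.dist_eq, dist_eq_norm]
    exact (abs_sub_map_le_sub κ.N x y).trans (hN _)
  have : Nonempty (Fin d) := ⟨⟨0, hd⟩⟩
  obtain ⟨x₀, hx₀, hmin⟩ := (isCompact_sphere (0 : Fin d → ℝ) 1).exists_isMinOn
    (NormedSpace.sphere_nonempty.2 zero_le_one) hcont.continuousOn
  have hx₀' : x₀ ≠ 0 := by
    rintro rfl
    simp at hx₀
  refine ⟨κ.N x₀, κ.N_pos _ hx₀', fun x => ?_⟩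
  rcases eq_or_ne x 0 with rfl | hx
  · simp
  have hx' : 0 < ‖x‖ := norm_pos_iff.2 hx
  have h1 : κ.N x₀ ≤ κ.N (‖x‖⁻¹ • x) := hmin (by simp [norm_smul, hx'.ne'])
  rw [map_smul_eq_mul, norm_inv, norm_norm] at h1
  calc κ.N x₀ * ‖x‖ ≤ ‖x‖⁻¹ * κ.N x * ‖x‖ := mul_le_mul_of_nonneg_right h1 hx'.le
    _ = κ.N x := by field_simp

/-- The norm of the kernel is comparable to the sup norm. -/
theorem exists_nr_equiv (hd : 1 ≤ d) :
    ∃ C : ℝ, 1 ≤ C ∧ ∀ x : V d, κ.nr x ≤ C * ‖x‖ ∧ ‖x‖ ≤ C * κ.nr x := by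
  obtain ⟨C, hC, h1⟩ := κ.exists_nr_le
  obtain ⟨c, hc, h2⟩ := κ.exists_le_nr hd
  refine ⟨max C c⁻¹, hC.trans (le_max_left _ _), fun x => ⟨?_, ?_⟩⟩
  · rw [← norm_toR]
    exact (h1 _).trans (mul_le_mul_of_nonneg_right (le_max_left _ _) (norm_nonneg _))
  · rw [← norm_toR]
    have := h2 (toR x)
    calc ‖toR x‖ = c⁻¹ * (c * ‖toR x‖) := by field_simp
      _ ≤ c⁻¹ * κ.nr x := mul_le_mul_of_nonneg_left this (inv_pos.2 hc).le
      _ ≤ _ := mul_le_mul_of_nonneg_right (le_max_right _ _) (κ.nr_nonneg _)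

theorem tendsto_J (hd : 1 ≤ d) (hrs : rs κ.w0 ≠ ∞) : Tendsto κ.J atTop (nhds 0) := by
  rw [Metric.tendsto_atTop]
  intro ε hε
  have hs : Summable fun b : V d => κ.w0 s(0, b) := by
    have := ENNReal.summable_toReal hrs
    refine this.congr fun b => ENNReal.toReal_ofReal (κ.w0_nonneg _)
  have hfin : {b : V d | ¬ κ.w0 s(0, b) < ε}.Finite := by
    have := hs.tendsto_cofinite_zero.eventually_lt_const hε
    rwa [eventually_cofinite] at this
  have : Nonempty (Fin d) := ⟨⟨0, hd⟩⟩
  have : Infinite (V d) := Pi.infinite_of_right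
  obtain ⟨b, hb⟩ := (hfin.union (Set.finite_singleton (0 : V d))).exists_notMem
  simp only [Set.mem_union, Set.mem_singleton_iff, not_or, Set.mem_ofPred_eq, not_not] at hb
  obtain ⟨hb1, hb0⟩ := hb
  rw [w0_mk, if_neg (Ne.symm hb0), zero_sub, nr_neg] at hb1
  have hp := κ.nr_pos hb0
  refine ⟨κ.nr b, fun r hr => ?_⟩
  rw [Real.dist_eq, sub_zero, abs_of_nonneg (κ.J_nonneg r (hp.trans_le hr))]
  exact (κ.J_anti hp (hp.trans_le hr) hr).trans_lt hb1

theorem exists_J'_bounds : ∃ r₁ : ℝ, 1 ≤ r₁ ∧ ∀ r, r₁ ≤ r →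
    κ.J' r ≤ -(1 / 2 * r ^ (-((d : ℝ) + α) - 1)) ∧ -(2 * r ^ (-((d : ℝ) + α) - 1)) ≤ κ.J' r := by
  have := Metric.tendsto_atTop.1 κ.δ_lim (1 / 2) (by norm_num)
  obtain ⟨r₁, hr₁⟩ := this
  refine ⟨max r₁ 1, le_max_right _ _, fun r hr => ?_⟩
  have hr0 : 0 < r := lt_of_lt_of_le one_pos ((le_max_right _ _).trans hr)
  have h1 := hr₁ r ((le_max_left _ _).trans hr)
  rw [Real.dist_eq, sub_zero, abs_lt] at h1
  have h2 := κ.J'_eq r hr0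
  rw [abs_of_nonpos (κ.J'_nonpos hr0), show -(d : ℝ) - α - 1 = -((d : ℝ) + α) - 1 by ring] at h2
  have hp := Real.rpow_pos_of_pos hr0 (-((d : ℝ) + α) - 1)
  constructor <;> nlinarith

theorem hasDerivAt_rpow_aux {r s : ℝ} (hr : 0 < r) (c : ℝ) :
    HasDerivAt (fun x => c * x ^ (-s)) (c * (-s * r ^ (-s - 1))) r :=
  (Real.hasDerivAt_rpow_const (Or.inl hr.ne')).const_mul c

theorem exists_J_diff (hα : 0 < α) : ∃ r₁ : ℝ, 1 ≤ r₁ ∧ ∀ a b, r₁ ≤ a → a ≤ b →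
    1 / (2 * (d + α)) * (a ^ (-((d : ℝ) + α)) - b ^ (-((d : ℝ) + α))) ≤ κ.J a - κ.J b ∧
    κ.J a - κ.J b ≤ 2 / (d + α) * (a ^ (-((d : ℝ) + α)) - b ^ (-((d : ℝ) + α))) := by
  obtain ⟨r₁, h1, hb⟩ := κ.exists_J'_bounds
  have hs : 0 < (d : ℝ) + α := by positivity
  have hpos : ∀ x ∈ Set.Ici r₁, 0 < x := fun x hx => one_pos.trans_le (h1.trans hx)
  have key : ∀ c : ℝ, ∀ x ∈ Set.Ici r₁, HasDerivAt (fun x => κ.J x - c * x ^ (-((d : ℝ) + α)))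
      (κ.J' x - c * (-((d : ℝ) + α) * x ^ (-((d : ℝ) + α) - 1))) x := fun c x hx =>
    (κ.J_hasDeriv x (hpos x hx)).sub (hasDerivAt_rpow_aux (hpos x hx) c)
  refine ⟨r₁, h1, fun a b ha hab => ⟨?_, ?_⟩⟩
  · have := antitoneOn_of_hasDerivWithinAt_nonpos (convex_Ici r₁)
      (f := fun x => κ.J x - 1 / (2 * (d + α)) * x ^ (-((d : ℝ) + α)))
      (fun x hx => (key _ x hx).continuousAt.continuousWithinAt)
      (fun x hx => (key _ x (interior_subset hx)).hasDerivWithinAt) (fun x hx => by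
        have h2 := (hb x (interior_subset hx)).1
        have h3 : 1 / (2 * ((d : ℝ) + α)) * (-((d : ℝ) + α) * x ^ (-((d : ℝ) + α) - 1)) =
          -(1 / 2 * x ^ (-((d : ℝ) + α) - 1)) := by field_simp
        rw [h3]; linarith) ha (ha.trans hab : r₁ ≤ b) hab
    simp only at this
    linarith
  · have := monotoneOn_of_hasDerivWithinAt_nonneg (convex_Ici r₁)
      (f := fun x => κ.J x - 2 / (d + α) * x ^ (-((d : ℝ) + α)))
      (fun x hx => (key _ x hx).continuousAt.continuousWithinAt)
      (fun x hx => (key _ x (interior_subset hx)).hasDerivWithinAt) (fun x hx => by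
        have h2 := (hb x (interior_subset hx)).2
        have h3 : 2 / ((d : ℝ) + α) * (-((d : ℝ) + α) * x ^ (-((d : ℝ) + α) - 1)) =
          -(2 * x ^ (-((d : ℝ) + α) - 1)) := by field_simp
        rw [h3]; linarith) ha (ha.trans hab : r₁ ≤ b) hab
    simp only at this
    linarith

/-- Two-sided bounds on the kernel and its dyadic increments. -/
theorem exists_J_bounds (hd : 1 ≤ d) (hα : 0 < α) (hrs : rs κ.w0 ≠ ∞) :
    ∃ r₁ C : ℝ, 1 ≤ r₁ ∧ 1 ≤ C ∧ ∀ r, r₁ ≤ r →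
      κ.J r ≤ C * r ^ (-((d : ℝ) + α)) ∧ C⁻¹ * r ^ (-((d : ℝ) + α)) ≤ κ.J r ∧
      C⁻¹ * r ^ (-((d : ℝ) + α)) ≤ κ.J r - κ.J (2 * r) := by
  obtain ⟨r₁, h1, hb⟩ := κ.exists_J_diff hα
  have hs : 1 < (d : ℝ) + α := by
    have : (1 : ℝ) ≤ d := by exact_mod_cast hd
    linarith
  set s := (d : ℝ) + α with hs'
  have hJ := κ.tendsto_J hd hrs
  have h2 : ∀ r, r₁ ≤ r → 1 / (4 * s) * r ^ (-s) ≤ κ.J r - κ.J (2 * r) := fun r hr => by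
    have hr0 : 0 < r := one_pos.trans_le (h1.trans hr)
    have h3 := (hb r (2 * r) hr (by linarith)).1
    have h4 : (2 * r) ^ (-s) ≤ 1 / 2 * r ^ (-s) := by
      rw [Real.mul_rpow (by norm_num) hr0.le]
      refine mul_le_mul_of_nonneg_right ?_ (by positivity)
      calc (2 : ℝ) ^ (-s) ≤ 2 ^ (-1 : ℝ) := Real.rpow_le_rpow_of_exponent_le (by norm_num) (by linarith)
        _ = 1 / 2 := by rw [Real.rpow_neg_one]; norm_num
    refine le_trans ?_ h3
    have : 1 / (4 * s) * r ^ (-s) = 1 / (2 * s) * (1 / 2 * r ^ (-s)) := by field_simp; norm_num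
    rw [this]
    exact mul_le_mul_of_nonneg_left (by linarith) (by positivity)
  refine ⟨r₁, max (4 * s) 2, h1, (by norm_num : (1:ℝ) ≤ 2).trans (le_max_right _ _), fun r hr => ?_⟩
  have hr0 : 0 < r := one_pos.trans_le (h1.trans hr)
  have hrp := Real.rpow_pos_of_pos hr0 (-s)
  have hC : (max (4 * s) 2)⁻¹ * r ^ (-s) ≤ κ.J r - κ.J (2 * r) := by
    refine le_trans ?_ (h2 r hr)
    rw [one_div]
    exact mul_le_mul_of_nonneg_right (inv_anti₀ (by positivity) (le_max_left _ _)) hrp.le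
  refine ⟨?_, hC.trans (sub_le_self _ (κ.J_nonneg _ (by linarith))), hC⟩
  have h5 : ∀ᶠ b in atTop, κ.J r - κ.J b ≤ 2 / s * r ^ (-s) := by
    filter_upwards [eventually_ge_atTop r] with b hb'
    refine (hb r b hr hb').2.trans (mul_le_mul_of_nonneg_left ?_ (by positivity))
    have := Real.rpow_nonneg (hr0.le.trans hb') (-s)
    linarith
  have h6 := le_of_tendsto (tendsto_const_nhds.sub hJ) h5
  rw [sub_zero] at h6
  refine h6.trans (mul_le_mul_of_nonneg_right ?_ hrp.le)
  refine le_trans ?_ (le_max_right _ _)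
  rw [div_le_iff₀ (by linarith)]; linarith

end Kernel

theorem eventually_le_rpow (C : ℝ) {ε : ℝ} (hε : 0 < ε) : ∀ᶠ r : ℝ in atTop, C ≤ r ^ ε :=
  (tendsto_rpow_atTop hε).eventually_ge_atTop C

theorem eventually_mul_rpow_le (C : ℝ) {a b : ℝ} (hab : a < b) :
    ∀ᶠ r : ℝ in atTop, C * r ^ a ≤ r ^ b := by
  filter_upwards [eventually_le_rpow C (sub_pos.2 hab), eventually_gt_atTop 0] with r h1 h2
  calc C * r ^ a ≤ r ^ (b - a) * r ^ a := mul_le_mul_of_nonneg_right h1 (Real.rpow_nonneg h2.le _)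
    _ = r ^ b := by rw [← Real.rpow_add h2, sub_add_cancel]

theorem eventually_rpow_le_mul {c : ℝ} (hc : 0 < c) {a b : ℝ} (hab : a < b) :
    ∀ᶠ r : ℝ in atTop, r ^ a ≤ c * r ^ b := by
  filter_upwards [eventually_mul_rpow_le c⁻¹ hab] with r h
  rwa [inv_mul_le_iff₀ hc] at h

theorem rs_eq_rsw {U : Type*} [AddCommGroup U] (u : Sym2 U → ℝ) : rs u = rsw (fun _ => 1) u := by
  simp [rs, rsw]

namespace Kernel
variable {d : ℕ} {α : ℝ} (κ : Kernel d α)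

/-- The part of the kernel removed by the cut-off. -/
noncomputable def rc (r : ℝ) : Sym2 (V d) → ℝ := κ.w0 - κ.wc r

theorem rc_apply (r : ℝ) (e : Sym2 (V d)) : κ.rc r e = min (κ.w0 e) (κ.J r) := by
  show κ.w0 e - max (κ.w0 e - κ.J r) 0 = _
  rcases le_total (κ.w0 e) (κ.J r) with h | h
  · rw [min_eq_left h, max_eq_right (by linarith)]; ring
  · rw [min_eq_right h, max_eq_left (by linarith)]; ring

theorem rc_nonneg {r : ℝ} (hr : 0 < r) : 0 ≤ κ.rc r := sub_nonneg.2 (κ.wc_le_w0 hr)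

theorem rc_TI (r : ℝ) : TI (κ.rc r) := fun z a b => by
  rw [rc_apply, rc_apply, κ.w0_TI z a b]

theorem wc_add_rc (r : ℝ) : κ.wc r + κ.rc r = κ.w0 := by
  rw [rc]; abel

/-- Standing assumptions in the nontrivial case. -/
structure Ctx (κ : Kernel d α) : Prop where
  hd : 1 ≤ d
  hα : 0 < α
  cl : κ.CL
  pos : 0 < κ.betaC

variable {κ}

theorem Ctx.rs_ne_top (h : κ.Ctx) : rs κ.w0 ≠ ∞ := κ.rs_w0_ne_top h.pos

theorem Ctx.one_lt (h : κ.Ctx) : 1 < (d : ℝ) + α := by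
  have : (1 : ℝ) ≤ d := by exact_mod_cast h.hd
  linarith [h.hα]

theorem Ctx.w0_le (h : κ.Ctx) : ∃ M : ℝ, 1 ≤ M ∧ ∀ e, κ.w0 e ≤ M := by
  obtain ⟨C, hC, hN⟩ := κ.exists_nr_equiv h.hd
  refine ⟨max 1 (κ.J C⁻¹), le_max_left _ _, fun e => ?_⟩
  induction e with
  | _ x y =>
    rw [w0_mk]
    split_ifs with hxy
    · exact zero_le_one.trans (le_max_left _ _)
    · refine le_trans (κ.J_anti (inv_pos.2 (by linarith) : 0 < C⁻¹) (κ.nr_pos (sub_ne_zero.2 hxy)) ?_)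
        (le_max_right _ _)
      rw [inv_le_iff_one_le_mul₀' (by linarith)]
      exact (one_le_norm (sub_ne_zero.2 hxy)).trans (hN _).2

/-- The rates removed by the cut-off are bounded by `min (‖x‖^{-d-α}) (r^{-d-α})`. -/
theorem Ctx.rc_le (h : κ.Ctx) : ∃ r₁ C : ℝ, 1 ≤ r₁ ∧ 1 ≤ C ∧ ∀ r, r₁ ≤ r →
    (∀ e, κ.rc r e ≤ C * r ^ (-((d : ℝ) + α))) ∧
    ∀ x : V d, x ≠ 0 → κ.rc r s(0, x) ≤ C * ‖x‖ ^ (-((d : ℝ) + α)) := by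
  obtain ⟨C₀, hC₀, hN⟩ := κ.exists_nr_equiv h.hd
  obtain ⟨r₁, C, hr₁, hC, hJ⟩ := κ.exists_J_bounds h.hd h.hα h.rs_ne_top
  have hs := h.one_lt
  set s := (d : ℝ) + α
  have hbase : 1 ≤ C₀ * r₁ := one_le_mul_of_one_le_of_one_le hC₀ hr₁
  have hfac : 1 ≤ (C₀ * r₁) ^ s := Real.one_le_rpow hbase (by linarith)
  refine ⟨r₁, C * (C₀ * r₁) ^ s, hr₁, one_le_mul_of_one_le_of_one_le hC hfac,
    fun r hr => ⟨fun e => ?_, fun x hx => ?_⟩⟩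
  · rw [rc_apply]
    refine (min_le_right _ _).trans ((hJ r hr).1.trans ?_)
    exact mul_le_mul_of_nonneg_right (le_mul_of_one_le_right (by linarith) hfac)
      (Real.rpow_nonneg (by linarith) _)
  · rw [rc_apply, w0_mk, if_neg (Ne.symm hx), zero_sub, nr_neg]
    have hxp : 0 < ‖x‖ := norm_pos_iff.2 hx
    have hnp := κ.nr_pos hx
    have hkey : ∀ t : ℝ, ‖x‖ ≤ C₀ * r₁ * t → 0 < t → t ^ (-s) ≤ (C₀ * r₁) ^ s * ‖x‖ ^ (-s) := by
      intro t ht ht0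
      calc t ^ (-s) = (C₀ * r₁) ^ s * (C₀ * r₁ * t) ^ (-s) := by
            rw [Real.mul_rpow (x := C₀ * r₁) (by linarith) ht0.le, ← mul_assoc,
              ← Real.rpow_add (by linarith), add_neg_cancel, Real.rpow_zero, one_mul]
        _ ≤ _ := mul_le_mul_of_nonneg_left
            (Real.rpow_le_rpow_of_nonpos hxp ht (by linarith)) (by linarith)
    rw [mul_assoc]
    rcases le_total r₁ (κ.nr x) with h1 | h1
    · refine (min_le_left _ _).trans ((hJ _ h1).1.trans ?_)
      refine mul_le_mul_of_nonneg_left (hkey _ ((hN x).2.trans ?_) hnp) (by linarith)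
      exact mul_le_mul_of_nonneg_right (le_mul_of_one_le_right (by linarith) hr₁) hnp.le
    · refine (min_le_right _ _).trans ((hJ r hr).1.trans ?_)
      refine mul_le_mul_of_nonneg_left ?_ (by linarith)
      have h2 : ‖x‖ ≤ C₀ * r₁ * 1 := by
        rw [mul_one]; exact (hN x).2.trans (mul_le_mul_of_nonneg_left h1 (by linarith))
      refine le_trans ?_ (hkey 1 h2 one_pos)
      exact Real.rpow_le_rpow_of_nonpos one_pos (hr₁.trans hr) (by linarith)

theorem Ctx.rsw_rc (h : κ.Ctx) {q ε : ℝ} (hq : 0 ≤ q) (hqα : q < α) (hε : 0 < ε) :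
    ∀ᶠ r in atTop, rsw (fun x => ‖x‖ ^ q) (κ.rc r) ≤ ENNReal.ofReal (r ^ (q - α + ε)) := by
  obtain ⟨r₁, C, hr₁, hC, hrc⟩ := h.rc_le
  set η := min (ε / 2) ((α - q) / 2) with hη
  have hη0 : 0 < η := lt_min (by linarith) (by linarith)
  have hη1 : η ≤ ε / 2 := min_le_left _ _
  have hη2 : η ≤ (α - q) / 2 := min_le_right _ _
  have hsum := summable_norm_rpow_V d (show (d : ℝ) < d + η by linarith)
  have hs := h.one_lt
  have hd0 : (0 : ℝ) ≤ d := Nat.cast_nonneg d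
  filter_upwards [eventually_ge_atTop r₁, eventually_mul_rpow_le (C * ∑' x : V d, ‖x‖ ^ (-((d : ℝ) + η)))
    (show q - α + η < q - α + ε by linarith)] with r hr hbig
  have hr0 : 0 < r := by linarith
  have hterm : ∀ x : V d, ENNReal.ofReal (‖x‖ ^ q) * ENNReal.ofReal (κ.rc r s(0, x)) ≤
      ENNReal.ofReal (C * r ^ (q - α + η) * ‖x‖ ^ (-((d : ℝ) + η))) := by
    intro x
    rcases eq_or_ne x 0 with rfl | hx
    · have : κ.rc r s(0, (0 : V d)) = 0 := by
        rw [rc_apply, w0_mk, if_pos rfl, min_eq_left (κ.J_nonneg r hr0)]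
      rw [this, ENNReal.ofReal_zero, mul_zero]
      exact zero_le
    rw [← ENNReal.ofReal_mul (by positivity)]
    refine ENNReal.ofReal_le_ofReal ?_
    have hxp : 0 < ‖x‖ := norm_pos_iff.2 hx
    have hpow : 0 < ‖x‖ ^ (-((d : ℝ) + η)) := Real.rpow_pos_of_pos hxp _
    have hq' := Real.rpow_pos_of_pos hxp q
    rcases le_total ‖x‖ r with hxr | hxr
    · have h1 := (hrc r hr).1 s(0, x)
      have h2 : ‖x‖ ^ q = ‖x‖ ^ (q + (d + η)) * ‖x‖ ^ (-((d : ℝ) + η)) := by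
        rw [← Real.rpow_add hxp]; congr 1; ring
      have h3 : ‖x‖ ^ (q + (d + η)) ≤ r ^ (q + (d + η)) :=
        Real.rpow_le_rpow hxp.le hxr (by linarith)
      have h4 : r ^ (q - α + η) = r ^ (q + (d + η)) * r ^ (-((d : ℝ) + α)) := by
        rw [← Real.rpow_add hr0]; congr 1; ring
      have hr5 := Real.rpow_pos_of_pos hr0 (-((d : ℝ) + α))
      calc ‖x‖ ^ q * κ.rc r s(0, x) ≤ ‖x‖ ^ q * (C * r ^ (-((d : ℝ) + α))) :=
            mul_le_mul_of_nonneg_left h1 hq'.le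
        _ = ‖x‖ ^ (q + (d + η)) * (C * r ^ (-((d : ℝ) + α)) * ‖x‖ ^ (-((d : ℝ) + η))) := by
            rw [h2]; ring
        _ ≤ r ^ (q + (d + η)) * (C * r ^ (-((d : ℝ) + α)) * ‖x‖ ^ (-((d : ℝ) + η))) :=
            mul_le_mul_of_nonneg_right h3 (by positivity)
        _ = _ := by rw [h4]; ring
    · have h1 := (hrc r hr).2 x hx
      have h2 : ‖x‖ ^ q * ‖x‖ ^ (-((d : ℝ) + α)) = ‖x‖ ^ (q - α + η) * ‖x‖ ^ (-((d : ℝ) + η)) := by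
        rw [← Real.rpow_add hxp, ← Real.rpow_add hxp]; congr 1; ring
      have h3 : ‖x‖ ^ (q - α + η) ≤ r ^ (q - α + η) :=
        Real.rpow_le_rpow_of_nonpos hr0 hxr (by linarith)
      calc ‖x‖ ^ q * κ.rc r s(0, x) ≤ ‖x‖ ^ q * (C * ‖x‖ ^ (-((d : ℝ) + α))) :=
            mul_le_mul_of_nonneg_left h1 hq'.le
        _ = C * (‖x‖ ^ (q - α + η) * ‖x‖ ^ (-((d : ℝ) + η))) := by rw [← h2]; ring
        _ ≤ C * (r ^ (q - α + η) * ‖x‖ ^ (-((d : ℝ) + η))) :=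
            mul_le_mul_of_nonneg_left (mul_le_mul_of_nonneg_right h3 hpow.le) (by linarith)
        _ = _ := by ring
  have hnn : ∀ x : V d, 0 ≤ C * r ^ (q - α + η) * ‖x‖ ^ (-((d : ℝ) + η)) := fun x => by positivity
  calc rsw (fun x => ‖x‖ ^ q) (κ.rc r) ≤
        ∑' x : V d, ENNReal.ofReal (C * r ^ (q - α + η) * ‖x‖ ^ (-((d : ℝ) + η))) :=
        ENNReal.tsum_le_tsum hterm
    _ = ENNReal.ofReal (∑' x : V d, C * r ^ (q - α + η) * ‖x‖ ^ (-((d : ℝ) + η))) :=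
        (ENNReal.ofReal_tsum_of_nonneg hnn (hsum.mul_left _)).symm
    _ ≤ _ := by
        refine ENNReal.ofReal_le_ofReal ?_
        rw [tsum_mul_left]
        refine le_trans (le_of_eq ?_) hbig
        ring

theorem Ctx.rs_rc (h : κ.Ctx) {ε : ℝ} (hε : 0 < ε) :
    ∀ᶠ r in atTop, rs (κ.rc r) ≤ ENNReal.ofReal (r ^ (-α + ε)) := by
  filter_upwards [h.rsw_rc le_rfl h.hα hε] with r hr
  rw [rs_eq_rsw]
  simpa using hr

theorem Ctx.rc_le_rpow (h : κ.Ctx) {ε : ℝ} (hε : 0 < ε) :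
    ∀ᶠ r in atTop, ∀ e, κ.rc r e ≤ r ^ (-((d : ℝ) + α) + ε) := by
  obtain ⟨r₁, C, hr₁, hC, hrc⟩ := h.rc_le
  filter_upwards [eventually_ge_atTop r₁, eventually_mul_rpow_le C
    (show -((d : ℝ) + α) < -((d : ℝ) + α) + ε by linarith)] with r hr hb e
  exact ((hrc r hr).1 e).trans hb

/-- Dyadic increments of the kernel. -/
noncomputable def dk (κ : Kernel d α) (r : ℝ) : Sym2 (V d) → ℝ := κ.wc (2 * r) - κ.wc r

theorem dk_nonneg {r : ℝ} (hr : 0 < r) : 0 ≤ κ.dk r :=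
  sub_nonneg.2 (κ.wc_mono hr (by linarith))

theorem dk_TI (r : ℝ) : TI (κ.dk r) := fun z a b => by
  show κ.wc _ _ - κ.wc _ _ = κ.wc _ _ - κ.wc _ _
  rw [κ.wc_TI (2 * r) z a b, κ.wc_TI r z a b]

theorem wc_add_dk (r : ℝ) : κ.wc r + κ.dk r = κ.wc (2 * r) := by
  rw [dk]; abel

theorem dk_le_rc {r : ℝ} (hr : 0 < r) : κ.dk r ≤ κ.rc r :=
  sub_le_sub_right (κ.wc_le_w0 (by linarith)) _

theorem Ctx.rs_dk_ge (h : κ.Ctx) {ε : ℝ} (hε : 0 < ε) :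
    ∀ᶠ r in atTop, ENNReal.ofReal (r ^ (-α - ε)) ≤ rs (κ.dk r) := by
  obtain ⟨C₀, hC₀, hN⟩ := κ.exists_nr_equiv h.hd
  obtain ⟨r₁, C, hr₁, hC, hJ⟩ := κ.exists_J_bounds h.hd h.hα h.rs_ne_top
  have hCp : 0 < C₀⁻¹ := by positivity
  filter_upwards [eventually_ge_atTop r₁, eventually_ge_atTop (C₀ * 2),
    eventually_rpow_le_mul (show 0 < C⁻¹ * (1 / 2 * C₀⁻¹ ^ d) by positivity)
      (show -α - ε < -α by linarith)] with r hr hr2 hb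
  have hr0 : 0 < r := by linarith
  have hterm : ∀ x ∈ (bx d (C₀⁻¹ * r)).erase 0, C⁻¹ * r ^ (-((d : ℝ) + α)) ≤ κ.dk r s(0, x) := by
    intro x hx
    obtain ⟨hx0, hx⟩ := Finset.mem_erase.1 hx
    rw [mem_bx (by positivity)] at hx
    have h1 : κ.nr x ≤ r := (hN x).1.trans (by
      calc C₀ * ‖x‖ ≤ C₀ * (C₀⁻¹ * r) := mul_le_mul_of_nonneg_left hx (by linarith)
        _ = r := by field_simp)
    have hJ1 := κ.J_anti (κ.nr_pos hx0) hr0 h1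
    have hJ2 := κ.J_anti hr0 (by simpa using hr0 : (2 * r) ∈ Set.Ioi 0) (by linarith)
    show _ ≤ max (κ.w0 _ - κ.J (2 * r)) 0 - max (κ.w0 _ - κ.J r) 0
    rw [w0_mk, if_neg (Ne.symm hx0), zero_sub, nr_neg, max_eq_left (by linarith),
      max_eq_left (by linarith)]
    linarith [(hJ r hr).2.2]
  have hcard : 1 / 2 * C₀⁻¹ ^ d * r ^ d ≤ (((bx d (C₀⁻¹ * r)).erase 0).card : ℝ) := by
    rw [Finset.card_erase_of_mem (zero_mem_bx (by positivity)), Nat.cast_pred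
      (Finset.card_pos.2 ⟨0, zero_mem_bx (by positivity)⟩)]
    have h2 : 2 ≤ C₀⁻¹ * r := by
      rw [inv_mul_eq_div, le_div_iff₀ (by linarith)]; linarith
    have h3 := le_card_bx (d := d) (show 0 ≤ C₀⁻¹ * r by positivity)
    have h4 : 2 ≤ (C₀⁻¹ * r) ^ d := h2.trans (le_self_pow₀ (by linarith) (by have := h.hd; omega))
    rw [mul_assoc, ← mul_pow]
    linarith
  calc ENNReal.ofReal (r ^ (-α - ε)) ≤
      ENNReal.ofReal ((((bx d (C₀⁻¹ * r)).erase 0).card : ℝ) * (C⁻¹ * r ^ (-((d : ℝ) + α)))) := by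
        refine ENNReal.ofReal_le_ofReal (hb.trans ?_)
        have h5 : r ^ (-α) = r ^ d * r ^ (-((d : ℝ) + α)) := by
          rw [← Real.rpow_natCast, ← Real.rpow_add hr0]; congr 1; ring
        rw [h5]
        calc _ = (1 / 2 * C₀⁻¹ ^ d * r ^ d) * (C⁻¹ * r ^ (-((d : ℝ) + α))) := by ring
          _ ≤ _ := mul_le_mul_of_nonneg_right hcard (by positivity)
    _ = ∑ x ∈ (bx d (C₀⁻¹ * r)).erase 0, ENNReal.ofReal (C⁻¹ * r ^ (-((d : ℝ) + α))) := by
        rw [Finset.sum_const, nsmul_eq_mul, ENNReal.ofReal_mul (Nat.cast_nonneg _),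
          ENNReal.ofReal_natCast]
    _ ≤ ∑ x ∈ (bx d (C₀⁻¹ * r)).erase 0, ENNReal.ofReal (κ.dk r s(0, x)) :=
        Finset.sum_le_sum fun x hx => ENNReal.ofReal_le_ofReal (hterm x hx)
    _ ≤ rs (κ.dk r) := ENNReal.sum_le_tsum _

/-- Lower bound on the rates added between nearby points when the cut-off is raised. -/
theorem Ctx.wc_sub_ge (h : κ.Ctx) : ∃ C c : ℝ, 1 ≤ C ∧ 0 < c ∧ ∀ᶠ r' in atTop, ∀ r, 0 < r →
    C * r ≤ r' → ∀ x y : V d, x ≠ y → C * ‖x - y‖ ≤ r' →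
      c * r' ^ (-((d : ℝ) + α)) ≤ κ.wc r' s(x, y) - κ.wc r s(x, y) := by
  obtain ⟨C₀, hC₀, hN⟩ := κ.exists_nr_equiv h.hd
  obtain ⟨r₁, C, hr₁, hC, hJ⟩ := κ.exists_J_bounds h.hd h.hα h.rs_ne_top
  refine ⟨2 * C₀, C⁻¹, by linarith, by positivity, ?_⟩
  filter_upwards [eventually_ge_atTop (2 * r₁)] with r' hr' r hr hrr x y hxy hd
  have ht : r₁ ≤ r' / 2 := by linarith
  have ht0 : 0 < r' / 2 := by linarith
  have hn : κ.nr (x - y) ≤ r' / 2 := by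
    have := (hN (x - y)).1
    linarith
  have hrt : r ≤ r' / 2 := by nlinarith
  have hnp := κ.nr_pos (sub_ne_zero.2 hxy)
  have h1 := κ.J_anti hnp ht0 hn
  have h2 := κ.J_anti hr ht0 hrt
  have h3 := (hJ _ ht).2.2
  rw [show 2 * (r' / 2) = r' by ring] at h3
  have h4 : C⁻¹ * r' ^ (-((d : ℝ) + α)) ≤ C⁻¹ * (r' / 2) ^ (-((d : ℝ) + α)) :=
    mul_le_mul_of_nonneg_left (Real.rpow_le_rpow_of_nonpos ht0 (by linarith)
      (by linarith [h.one_lt])) (by positivity)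
  show _ ≤ max (κ.w0 _ - κ.J r') 0 - max (κ.w0 _ - κ.J r) 0
  rw [w0_mk, if_neg hxy]
  have h5 : max (κ.J (κ.nr (x - y)) - κ.J r) 0 ≤ κ.J (κ.nr (x - y)) - κ.J (r' / 2) :=
    max_le (by linarith) (by linarith)
  have h6 := le_max_left (κ.J (κ.nr (x - y)) - κ.J r') 0
  linarith

end Kernel

section
variable {U : Type*} [DecidableEq U] [AddCommGroup U]

theorem gy_ind_le {w : Sym2 U → ℝ} (hw : 0 ≤ w) (S : Finset U) :
    gy (fun x => if x ∈ S then 1 else 0) w ≤ S.card := by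
  rw [gy_eq_tsum hw (fun x => by dsimp only; split_ifs <;> simp), tsum_eq_sum (s := S) fun x hx => by
    rw [if_neg hx, ENNReal.ofReal_zero, zero_mul]]
  have : ∀ x ∈ S, ENNReal.ofReal (if x ∈ S then 1 else 0) * (EV w fun _ ω => ci ω 0 x) ≤ 1 := by
    intro x hx
    rw [if_pos hx, ENNReal.ofReal_one, one_mul]
    refine iSup_le fun Λ => ?_
    rw [← ENNReal.ofReal_one]
    refine ENNReal.ofReal_le_ofReal ((rE_mono hw fun ω _ => ci_le_one ω 0 x).trans ?_)
    rw [rE_const]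
  exact (Finset.sum_le_sum this).trans (by simp)

theorem gy_truncate {w : Sym2 U → ℝ} {φ : U → ℝ} {X : ℝ≥0∞}
    (h : ∀ N : ℝ, 0 ≤ N → gy (fun x => min (φ x) N) w ≤ X) : gy φ w ≤ X := by
  refine iSup_le fun Λ => ?_
  obtain ⟨N, hN⟩ : ∃ N : ℝ, ∀ x ∈ Λ, φ x ≤ N := by
    obtain ⟨N, hN⟩ := (Λ.image φ).bddAbove
    exact ⟨N, fun x hx => hN (by simpa using ⟨x, hx, rfl⟩)⟩
  refine le_trans ?_ ((le_EV w (fun Λ ω => cw (fun x => min (φ x) (max N 0)) Λ ω 0) Λ).trans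
    (h (max N 0) (le_max_right _ _)))
  refine le_of_eq (congrArg ENNReal.ofReal (congrArg _ ?_))
  funext ω
  refine Finset.sum_congr rfl fun x hx => ?_
  simp only [min_eq_left ((hN x hx).trans (le_max_left _ _))]

/-- A perturbation of the rates of small total weight changes weighted moments boundedly. -/
theorem gy_add_le_two {w u : Sym2 U → ℝ} (hw : 0 ≤ w) (hu : 0 ≤ u) (tw : TI w) (tu : TI u)
    {φ : U → ℝ} (hφ : 0 ≤ φ) (hsub : ∀ x y, φ (x + y) ≤ φ x + φ y)
    (hχ : Am 1 (w + u) ≠ ∞) (hsm : 4 * (rs u * Am 1 (w + u)) ≤ 1) :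
    gy φ (w + u) ≤ 2 * (gy φ w + Am 1 (w + u) * (Am 1 (w + u) * rsw φ u)) := by
  refine gy_truncate fun N hN => ?_
  set ψ : U → ℝ := fun x => min (φ x) N with hψdef
  have hψ : 0 ≤ ψ := fun x => le_min (hφ x) hN
  have hψφ : ψ ≤ φ := fun x => min_le_left _ _
  have hψsub : ∀ x y, ψ (x + y) ≤ ψ x + ψ y := fun x y => by
    have h1 := hφ x; have h2 := hφ y; have h3 := hsub x y
    simp only [Pi.zero_apply] at h1 h2
    simp only [hψdef]
    rcases le_total (φ x) N with h4 | h4 <;> rcases le_total (φ y) N with h5 | h5 <;>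
      simp only [min_eq_left, min_eq_right, h4, h5] <;>
      first
        | exact (min_le_left _ _).trans h3
        | exact (min_le_right _ _).trans (by linarith)
  have hfin : gy ψ (w + u) ≠ ∞ := by
    have h1 : gy ψ (w + u) ≤ ENNReal.ofReal N * Am 1 (w + u) := by
      rw [← gy_const hN]
      exact gy_mono (add_nonneg hw hu) fun x => min_le_right _ _
    exact (h1.trans_lt (ENNReal.mul_lt_top ENNReal.ofReal_lt_top hχ.lt_top)).ne
  have h2 := gy_add_le hw hu tw tu hψ hψsub
  have h3 : gy ψ w ≤ gy φ w := gy_mono hw hψφ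
  have h4 : rsw ψ u ≤ rsw φ u := ENNReal.tsum_le_tsum fun b =>
    mul_le_mul_left (ENNReal.ofReal_le_ofReal (hψφ b)) _
  set g := gy ψ (w + u)
  set X := gy φ w + Am 1 (w + u) * (Am 1 (w + u) * rsw φ u)
  have h5 : 2 * g ≤ 2 * X + g := by
    have h6 : 4 * (rs u * (Am 1 (w + u) * g)) ≤ g := by
      calc 4 * (rs u * (Am 1 (w + u) * g)) = 4 * (rs u * Am 1 (w + u)) * g := by ring
        _ ≤ 1 * g := mul_le_mul_left hsm _
        _ = g := one_mul _
    calc 2 * g ≤ 2 * (gy φ w + (2 * (rs u * (Am 1 (w + u) * g)) +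
          Am 1 (w + u) * (Am 1 (w + u) * rsw φ u))) := by gcongr; exact h2.trans (by gcongr)
      _ = 2 * X + 4 * (rs u * (Am 1 (w + u) * g)) := by ring
      _ ≤ 2 * X + g := by gcongr
  rw [two_mul g] at h5
  exact (ENNReal.add_le_add_iff_right hfin).1 h5

end

section
variable {d : ℕ}

theorem norm_rpow_add_le {p : ℝ} (hp : 0 ≤ p) (hp1 : p ≤ 1) (x y : V d) :
    ‖x + y‖ ^ p ≤ ‖x‖ ^ p + ‖y‖ ^ p :=
  (Real.rpow_le_rpow (norm_nonneg _) (norm_add_le x y) hp).trans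
    (Real.rpow_add_le_add_rpow (norm_nonneg _) (norm_nonneg _) hp hp1)

theorem gy_norm_le_ep {w : Sym2 (V d) → ℝ} (hw : 0 ≤ w) {p : ℝ} (hp : 0 ≤ p) :
    gy (fun x => ‖x‖ ^ p) w ≤ gy (Kernel.ep p) w :=
  gy_mono hw fun x => Real.rpow_le_rpow (norm_nonneg _) (norm_le_enorm2 x) hp

theorem gy_ep_le_norm (hd : 1 ≤ d) {w : Sym2 (V d) → ℝ} (hw : 0 ≤ w) {p : ℝ} (hp : 0 ≤ p) :
    gy (Kernel.ep p) w ≤ ENNReal.ofReal ((d : ℝ) ^ p) * gy (fun x => ‖x‖ ^ p) w := by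
  rw [← gy_const_mul (by positivity)]
  refine gy_mono hw fun x => ?_
  dsimp only
  rw [← Real.mul_rpow (Nat.cast_nonneg d) (norm_nonneg _)]
  exact Real.rpow_le_rpow (Real.sqrt_nonneg _) (enorm2_le hd x) hp

/-- The mass outside a box is controlled by a moment of the radius. -/
theorem Am_one_le_of_gy {w : Sym2 (V d) → ℝ} (hw : 0 ≤ w) {p R : ℝ} (hp : 0 < p) (hR : 0 < R)
    (hχ : Am 1 w ≠ ∞) (h : 2 * gy (fun x => ‖x‖ ^ p) w ≤ ENNReal.ofReal (R ^ p) * Am 1 w) :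
    Am 1 w ≤ 2 * gy (fun x => if x ∈ bx d R then 1 else 0) w := by
  have hRp : 0 < R ^ p := Real.rpow_pos_of_pos hR p
  have h1 : Am 1 w ≤ gy (fun x => if x ∈ bx d R then 1 else 0) w +
      ENNReal.ofReal ((R ^ p)⁻¹) * gy (fun x => ‖x‖ ^ p) w := by
    rw [← gy_const_mul (by positivity), ← gy_add hw
      (fun x => by dsimp only; split_ifs <;> simp) (fun x => by dsimp only; positivity)]
    have := gy_const (w := w) zero_le_one
    rw [ENNReal.ofReal_one, one_mul] at this
    rw [← this]
    refine gy_mono hw fun x => ?_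
    dsimp only
    split_ifs with hx
    · have : 0 ≤ (R ^ p)⁻¹ * ‖x‖ ^ p := by positivity
      linarith
    · rw [mem_bx hR.le, not_le] at hx
      rw [zero_add, inv_mul_eq_div, le_div_iff₀ hRp, one_mul]
      exact Real.rpow_le_rpow hR.le hx.le hp.le
  have h2 : 2 * (ENNReal.ofReal ((R ^ p)⁻¹) * gy (fun x => ‖x‖ ^ p) w) ≤ Am 1 w := by
    calc _ = ENNReal.ofReal ((R ^ p)⁻¹) * (2 * gy (fun x => ‖x‖ ^ p) w) := by ring
      _ ≤ ENNReal.ofReal ((R ^ p)⁻¹) * (ENNReal.ofReal (R ^ p) * Am 1 w) := by gcongr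
      _ = Am 1 w := by
        rw [← mul_assoc, ← ENNReal.ofReal_mul (by positivity), inv_mul_cancel₀ hRp.ne',
          ENNReal.ofReal_one, one_mul]
  refine (ENNReal.add_le_add_iff_right hχ).1 ?_
  calc Am 1 w + Am 1 w = 2 * Am 1 w := (two_mul _).symm
    _ ≤ 2 * (gy (fun x => if x ∈ bx d R then 1 else 0) w +
      ENNReal.ofReal ((R ^ p)⁻¹) * gy (fun x => ‖x‖ ^ p) w) := by gcongr
    _ = 2 * gy (fun x => if x ∈ bx d R then 1 else 0) w +
      2 * (ENNReal.ofReal ((R ^ p)⁻¹) * gy (fun x => ‖x‖ ^ p) w) := by ring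
    _ ≤ _ := by gcongr
end

namespace Kernel
variable {d : ℕ} {α : ℝ} {κ : Kernel d α}

theorem Ctx.gy_cut (h : κ.Ctx) {p : ℝ} (hp : 0 < p) : ∃ C : ℝ, 1 ≤ C ∧ ∀ r : ℝ, 1 ≤ r →
    gy (ep p) (κ.betaC • κ.wc r) ≤ ENNReal.ofReal ((C * r) ^ p) * Am 1 (κ.betaC • κ.wc r) := by
  obtain ⟨C, hC, hx⟩ := h.cl.2 p hp
  refine ⟨max C 1, le_max_right _ _, fun r hr => ?_⟩
  have hw := κ.smul_wc_nonneg h.pos.le r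
  obtain ⟨μ, hμ⟩ := exists_isPerc hw
  have hr0 : 0 < r := by linarith
  have h1 := hx r hr μ (by rw [κ.edgePCut_eq _ hr0]; exact hμ)
  rw [xi_eq hw hμ] at h1
  have hA : Am 1 (κ.betaC • κ.wc r) ≠ 0 := (one_pos.trans_le (one_le_Am hw 1)).ne'
  by_cases htop : Am 1 (κ.betaC • κ.wc r) = ∞
  · rw [htop, ENNReal.mul_top]
    · exact le_top
    · rw [Ne, ENNReal.ofReal_eq_zero, not_le]
      have : 0 < max C 1 * r := mul_pos (lt_max_of_lt_right one_pos) hr0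
      positivity
  have h2 : gy (ep p) (κ.betaC • κ.wc r) / Am 1 (κ.betaC • κ.wc r) ≤ ENNReal.ofReal ((C * r) ^ p) := by
    have := ENNReal.rpow_le_rpow h1 hp.le
    rw [← ENNReal.rpow_mul, one_div, inv_mul_cancel₀ hp.ne', ENNReal.rpow_one,
      ENNReal.ofReal_rpow_of_nonneg (by positivity) hp.le] at this
    exact this
  rw [ENNReal.div_le_iff hA htop] at h2
  refine h2.trans ?_
  gcongr
  exact le_max_left _ _

/-- The cut-off model at criticality is dominated by a slightly subcritical model. -/
theorem Ctx.cut_le (h : κ.Ctx) : ∃ c : ℝ, 0 < c ∧ ∀ᶠ r in atTop,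
    κ.betaC • κ.wc r ≤ (κ.betaC - c * r ^ (-((d : ℝ) + α))) • κ.w0 ∧
      c * r ^ (-((d : ℝ) + α)) ≤ κ.betaC / 2 := by
  obtain ⟨M, hM, hw0⟩ := h.w0_le
  obtain ⟨r₁, C, hr₁, hC, hJ⟩ := κ.exists_J_bounds h.hd h.hα h.rs_ne_top
  have hb := h.pos
  refine ⟨κ.betaC * C⁻¹ / M / 2, by positivity, ?_⟩
  filter_upwards [eventually_ge_atTop r₁] with r hr
  have hr0 : 0 < r := by linarith
  have hp := Real.rpow_nonneg hr0.le (-((d : ℝ) + α))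
  have hp1 : r ^ (-((d : ℝ) + α)) ≤ 1 :=
    Real.rpow_le_one_of_one_le_of_nonpos (by linarith) (by linarith [h.one_lt])
  have hCM : C⁻¹ / M ≤ 1 := by
    rw [div_le_one (by linarith)]
    exact (inv_le_one_of_one_le₀ hC).trans hM
  have hsm : κ.betaC * C⁻¹ / M / 2 * r ^ (-((d : ℝ) + α)) ≤ κ.betaC / 2 := by
    calc _ = κ.betaC / 2 * (C⁻¹ / M * r ^ (-((d : ℝ) + α))) := by ring
      _ ≤ κ.betaC / 2 * 1 := mul_le_mul_of_nonneg_left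
        (mul_le_one₀ hCM hp hp1) (by linarith)
      _ = _ := mul_one _
  refine ⟨fun e => ?_, hsm⟩
  show κ.betaC * max (κ.w0 e - κ.J r) 0 ≤ (κ.betaC - _) * κ.w0 e
  have he := κ.w0_nonneg e
  simp only [Pi.zero_apply] at he
  rcases le_total (κ.w0 e - κ.J r) 0 with h1 | h1
  · rw [max_eq_right h1, mul_zero]
    exact mul_nonneg (by linarith) he
  · rw [max_eq_left h1]
    have h2 : κ.betaC * C⁻¹ / M / 2 * r ^ (-((d : ℝ) + α)) * κ.w0 e ≤ κ.betaC * κ.J r := by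
      calc _ = κ.betaC * (C⁻¹ * r ^ (-((d : ℝ) + α))) * (κ.w0 e / M / 2) := by ring
        _ ≤ κ.betaC * (C⁻¹ * r ^ (-((d : ℝ) + α))) * 1 := by
            refine mul_le_mul_of_nonneg_left ?_ (by positivity)
            rw [div_div, div_le_one (by linarith)]
            linarith [hw0 e]
        _ ≤ κ.betaC * κ.J r := by
            rw [mul_one]
            exact mul_le_mul_of_nonneg_left (hJ r hr).2.1 hb.le
    nlinarith

theorem Ctx.tendsto_gap (h : κ.Ctx) (c : ℝ) (hc : 0 < c) :
    Tendsto (fun r : ℝ => κ.betaC - c * r ^ (-((d : ℝ) + α))) atTop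
      (nhdsWithin κ.betaC (Set.Iio κ.betaC)) := by
  refine tendsto_nhdsWithin_iff.2 ⟨?_, ?_⟩
  · have := (tendsto_rpow_neg_atTop (show 0 < (d : ℝ) + α by linarith [h.one_lt])).const_mul c
    simpa using this.const_sub κ.betaC
  · filter_upwards [eventually_gt_atTop 0] with r hr
    have := mul_pos hc (Real.rpow_pos_of_pos hr (-((d : ℝ) + α)))
    simp only [Set.mem_Iio]; linarith

theorem Ctx.cut_finite (h : κ.Ctx) : ∀ᶠ r in atTop, Am 1 (κ.betaC • κ.wc r) ≠ ∞ := by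
  obtain ⟨c, hc, hr⟩ := h.cut_le
  filter_upwards [hr, eventually_gt_atTop 0] with r hr hr0
  have := mul_pos hc (Real.rpow_pos_of_pos hr0 (-((d : ℝ) + α)))
  have hp := h.pos
  exact ((Am_mono_rate (κ.smul_wc_nonneg h.pos.le r) hr.1 1).trans_lt
    (κ.Am_one_ne_top (by linarith [hr.2]) (by linarith)).lt_top).ne

theorem smul_wc_add_rc (β r : ℝ) : β • κ.wc r + β • κ.rc r = β • κ.w0 := by
  rw [← smul_add, wc_add_rc]

/-- Weighted moments of the full model in terms of the cut-off model. -/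
theorem Ctx.gy_full_le (h : κ.Ctx) {p : ℝ} (hp : 0 < p) (hp1 : p ≤ 1) {β r : ℝ} (hβ : 0 ≤ β)
    (hβc : β < κ.betaC) (hr : 0 < r) (hsm : 4 * (rs (β • κ.rc r) * Am 1 (β • κ.w0)) ≤ 1) :
    gy (fun x => ‖x‖ ^ p) (β • κ.w0) ≤ 2 * (gy (fun x => ‖x‖ ^ p) (β • κ.wc r) +
      Am 1 (β • κ.w0) * (Am 1 (β • κ.w0) * rsw (fun x => ‖x‖ ^ p) (β • κ.rc r))) := by
  have := gy_add_le_two (w := β • κ.wc r) (u := β • κ.rc r) (κ.smul_wc_nonneg hβ r)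
    (smul_nonneg hβ (κ.rc_nonneg hr)) ((κ.wc_TI r).smul β) ((κ.rc_TI r).smul β)
    (φ := fun x => ‖x‖ ^ p) (fun x => Real.rpow_nonneg (norm_nonneg _) _)
    (norm_rpow_add_le hp.le hp1) (by rw [smul_wc_add_rc]; exact κ.Am_one_ne_top hβ hβc)
    (by rw [smul_wc_add_rc]; exact hsm)
  rwa [smul_wc_add_rc] at this

theorem rsw_smul {c : ℝ} (hc : 0 ≤ c) (φ : V d → ℝ) (u : Sym2 (V d) → ℝ) :
    rsw φ (c • u) = ENNReal.ofReal c * rsw φ u := by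
  rw [rsw, rsw, ← ENNReal.tsum_mul_left]
  exact tsum_congr fun b => by rw [Pi.smul_apply, smul_eq_mul, ENNReal.ofReal_mul hc]; ring

theorem Ctx.gy_ne_top (h : κ.Ctx) {p : ℝ} (hp : 0 < p) (hp1 : p ≤ 1) (hpα : p < α) {β : ℝ}
    (hβ : 0 ≤ β) (hβc : β < κ.betaC) : gy (fun x => ‖x‖ ^ p) (β • κ.w0) ≠ ∞ := by
  have hχ := κ.Am_one_ne_top hβ hβc
  have h0 : Tendsto (fun r : ℝ => r ^ (-(α / 2))) atTop (nhds 0) :=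
    tendsto_rpow_neg_atTop (by linarith [h.hα])
  set K := 4 * (β * (Am 1 (β • κ.w0)).toReal) with hK
  have h1 : ∀ᶠ r : ℝ in atTop, K * r ^ (-(α / 2)) ≤ 1 := by
    have := h0.const_mul K
    rw [mul_zero] at this
    exact this.eventually_le_const one_pos
  obtain ⟨C, hC, hgy⟩ := h.gy_cut hp
  obtain ⟨r, hr1, hr2, hr3, hr4, hr5⟩ := (h1.and ((h.rs_rc (show 0 < α / 2 by linarith [h.hα])).and
    ((h.rsw_rc hp.le hpα one_pos).and (h.cut_finite.and (eventually_ge_atTop 1))))).exists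
  have hr0 : 0 < r := by linarith
  refine ((h.gy_full_le hp hp1 hβ hβc hr0 ?_).trans_lt (ENNReal.mul_lt_top (by simp)
    (ENNReal.add_lt_top.2 ⟨?_, ENNReal.mul_lt_top hχ.lt_top (ENNReal.mul_lt_top hχ.lt_top ?_)⟩))).ne
  · rw [rs_smul hβ]
    calc 4 * (ENNReal.ofReal β * rs (κ.rc r) * Am 1 (β • κ.w0)) ≤
        4 * (ENNReal.ofReal β * ENNReal.ofReal (r ^ (-(α / 2))) * ENNReal.ofReal (Am 1 (β • κ.w0)).toReal) := by
          rw [ENNReal.ofReal_toReal hχ]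
          gcongr
          rwa [show -(α / 2) = -α + α / 2 by ring]
      _ = ENNReal.ofReal (K * r ^ (-(α / 2))) := by
          rw [show (4 : ℝ≥0∞) = ENNReal.ofReal 4 by simp, ← ENNReal.ofReal_mul hβ,
            ← ENNReal.ofReal_mul (by positivity), ← ENNReal.ofReal_mul (by positivity), hK]
          congr 1; ring
      _ ≤ 1 := by rw [ENNReal.ofReal_le_one]; exact hr1
  · refine (gy_mono_rate (κ.smul_wc_nonneg hβ r) (smul_le_smul_of_nonneg_right hβc.le (κ.wc_nonneg r))
      (fun x => Real.rpow_nonneg (norm_nonneg _) _)).trans_lt ?_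
    refine (gy_norm_le_ep (κ.smul_wc_nonneg h.pos.le r) hp.le).trans_lt ?_
    exact (hgy r hr5).trans_lt (ENNReal.mul_lt_top ENNReal.ofReal_lt_top hr4.lt_top)
  · rw [rsw_smul hβ]
    exact ENNReal.mul_lt_top ENNReal.ofReal_lt_top (hr3.trans_lt ENNReal.ofReal_lt_top)

end Kernel

namespace Kernel
variable {d : ℕ} {α : ℝ} {κ : Kernel d α}

theorem tendsto_log_gap (κ : Kernel d α) :
    Tendsto (fun β => Real.log (1 / (κ.betaC - β))) (nhdsWithin κ.betaC (Set.Iio κ.betaC)) atTop := by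
  refine Real.tendsto_log_atTop.comp ?_
  simp only [one_div]
  refine tendsto_inv_nhdsGT_zero.comp (tendsto_nhdsWithin_iff.2 ⟨?_, ?_⟩)
  · have : Tendsto (fun β => κ.betaC - β) (nhds κ.betaC) (nhds (κ.betaC - κ.betaC)) :=
      (continuous_const.sub continuous_id).tendsto _
    rw [sub_self] at this
    exact this.mono_left nhdsWithin_le_nhds
  · filter_upwards [self_mem_nhdsWithin] with β hβ
    exact sub_pos.2 (Set.mem_Iio.1 hβ)

theorem HasExp.upper {f : ℝ → ℝ≥0∞} {c : ℝ} (hf : κ.HasExp f c) : ∃ A : ℝ, 0 < A ∧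
    ∀ᶠ β in nhdsWithin κ.betaC (Set.Iio κ.betaC), (f β).toReal ≤ (κ.betaC - β) ^ (-A) := by
  refine ⟨|c| + 1, by positivity, ?_⟩
  have h1 := hf.eventually_lt_const (show c < |c| + 1 by linarith [le_abs_self c])
  filter_upwards [h1, κ.tendsto_log_gap.eventually_gt_atTop 0, self_mem_nhdsWithin] with β h1 h2 hβ
  have hgap : 0 < κ.betaC - β := sub_pos.2 hβ
  rcases ENNReal.toReal_nonneg.eq_or_lt' with h3 | h3
  · rw [h3]; positivity
  rw [div_lt_iff₀ h2, one_div, Real.log_inv] at h1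
  rw [← Real.log_le_log_iff h3 (by positivity), Real.log_rpow hgap]
  linarith

theorem Ctx.eventually_pos (h : κ.Ctx) :
    ∀ᶠ β in nhdsWithin κ.betaC (Set.Iio κ.betaC), 0 < β ∧ β < κ.betaC := by
  filter_upwards [self_mem_nhdsWithin, nhdsWithin_le_nhds (lt_mem_nhds h.pos)] with β h1 h2
  exact ⟨h2, h1⟩

theorem Ctx.eventually_gap (h : κ.Ctx) (C : ℝ) {A B : ℝ} (hAB : A < B) :
    ∀ᶠ β in nhdsWithin κ.betaC (Set.Iio κ.betaC),
      C * (κ.betaC - β) ^ (-A) ≤ (κ.betaC - β) ^ (-B) := by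
  have h1 : Tendsto (fun β => (κ.betaC - β)⁻¹) (nhdsWithin κ.betaC (Set.Iio κ.betaC)) atTop := by
    have := Real.tendsto_exp_atTop.comp κ.tendsto_log_gap
    refine this.congr' ?_
    filter_upwards [self_mem_nhdsWithin] with β hβ
    have hgap : 0 < κ.betaC - β := sub_pos.2 hβ
    rw [Function.comp, one_div, Real.exp_log (inv_pos.2 hgap)]
  filter_upwards [h1.eventually (eventually_mul_rpow_le C hAB), self_mem_nhdsWithin] with β h2 hβ
  have hgap : 0 < κ.betaC - β := sub_pos.2 hβ
  simpa only [Real.inv_rpow hgap.le, ← Real.rpow_neg hgap.le] using h2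

theorem Ctx.chi_le_xi (h : κ.Ctx) {p : ℝ} (hp : 0 < p) (hp1 : p ≤ 1) (hpα : p < α) {β : ℝ}
    (hβ : 0 ≤ β) (hβc : β < κ.betaC) : (Am 1 (β • κ.w0)).toReal ≤
      2 * (3 * (2 ^ (1 / p) * max 1 (κ.xiFull β p).toReal)) ^ d := by
  have hw := κ.smul_w0_nonneg hβ
  have hχ := κ.Am_one_ne_top hβ hβc
  have hA : Am 1 (β • κ.w0) ≠ 0 := (one_pos.trans_le (one_le_Am hw 1)).ne'
  have hgy : gy (ep p) (β • κ.w0) ≠ ∞ := ((gy_ep_le_norm h.hd hw hp.le).trans_lt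
    (ENNReal.mul_lt_top ENNReal.ofReal_lt_top (h.gy_ne_top hp hp1 hpα hβ hβc).lt_top)).ne
  set q := gy (ep p) (β • κ.w0) / Am 1 (β • κ.w0) with hq
  have hqt : q ≠ ∞ := (ENNReal.div_lt_top hgy hA).ne
  have hx : (κ.xiFull β p).toReal = q.toReal ^ (1 / p) := by
    rw [κ.xiFull_eq hβ p, ENNReal.toReal_rpow]
  set m := max 1 (κ.xiFull β p).toReal with hm
  have hm1 : 1 ≤ m := le_max_left _ _
  have h2p : (1 : ℝ) ≤ 2 ^ (1 / p) := Real.one_le_rpow (by norm_num) (by positivity)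
  have hR1 : 1 ≤ 2 ^ (1 / p) * m := one_le_mul_of_one_le_of_one_le h2p hm1
  have hqm : q.toReal ≤ m ^ p := by
    have : q.toReal = (q.toReal ^ (1 / p)) ^ p := by
      rw [← Real.rpow_mul ENNReal.toReal_nonneg, one_div, inv_mul_cancel₀ hp.ne', Real.rpow_one]
    rw [this, ← hx]
    exact Real.rpow_le_rpow ENNReal.toReal_nonneg (le_max_right _ _) hp.le
  have h1 := Am_one_le_of_gy hw hp (by linarith : 0 < 2 ^ (1 / p) * m) hχ (by
    rw [Real.mul_rpow (by positivity) (by linarith), ← Real.rpow_mul (by norm_num), one_div,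
      inv_mul_cancel₀ hp.ne', Real.rpow_one, ENNReal.ofReal_mul (by norm_num)]
    have h3 : gy (ep p) (β • κ.w0) = q * Am 1 (β • κ.w0) := (ENNReal.div_mul_cancel hA hχ).symm
    have h4 : q ≤ ENNReal.ofReal (m ^ p) := by
      rw [← ENNReal.ofReal_toReal hqt]; exact ENNReal.ofReal_le_ofReal hqm
    calc 2 * gy (fun x => ‖x‖ ^ p) (β • κ.w0) ≤ 2 * gy (ep p) (β • κ.w0) := by
          gcongr; exact gy_norm_le_ep hw hp.le
      _ ≤ 2 * (ENNReal.ofReal (m ^ p) * Am 1 (β • κ.w0)) := by rw [h3]; gcongr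
      _ = _ := by rw [← mul_assoc]; simp)
  have h5 := h1.trans (mul_le_mul_right (gy_ind_le hw _) 2)
  have h6 := ENNReal.toReal_mono (ENNReal.mul_ne_top (by simp) (by simp)) h5
  rw [ENNReal.toReal_mul] at h6
  refine h6.trans ?_
  simp only [ENNReal.toReal_ofNat, ENNReal.toReal_natCast]
  exact mul_le_mul_of_nonneg_left (card_bx_le hR1) (by norm_num)

/-- If one of the three exponents exists then the susceptibility diverges at most polynomially. -/
theorem Ctx.chi_upper (h : κ.Ctx)
    (hone : (∃ g : ℝ, κ.HasExp (fun β => κ.chi β) g) ∨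
      (∃ v : ℝ, ∃ p₀ : ℝ, 0 < p₀ ∧ ∀ p : ℝ, 0 < p → p < p₀ →
        κ.HasExp (fun β => κ.xiFull β p) v) ∨
      (∃ D : ℝ, κ.HasExp (fun β => κ.zeta β) D)) :
    ∃ A : ℝ, 0 < A ∧ ∀ᶠ β in nhdsWithin κ.betaC (Set.Iio κ.betaC),
      (Am 1 (β • κ.w0)).toReal ≤ (κ.betaC - β) ^ (-A) := by
  rcases hone with ⟨g, hg⟩ | ⟨v, p₀, hp₀, hv⟩ | ⟨D, hD⟩
  · obtain ⟨A, hA, hev⟩ := hg.upper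
    refine ⟨A, hA, ?_⟩
    filter_upwards [hev, h.eventually_pos] with β h1 h2
    simpa only [chi, κ.mom_eq h2.1.le] using h1
  · set p := min p₀ (min α 1) / 2 with hp
    have hα := h.hα
    have hm : 0 < min p₀ (min α 1) := lt_min hp₀ (lt_min hα one_pos)
    have hp0 : 0 < p := by positivity
    have h1 : min p₀ (min α 1) ≤ p₀ := min_le_left _ _
    have h2 : min p₀ (min α 1) ≤ α := (min_le_right _ _).trans (min_le_left _ _)
    have h3 : min p₀ (min α 1) ≤ 1 := (min_le_right _ _).trans (min_le_right _ _)
    obtain ⟨A, hA, hev⟩ := (hv p hp0 (by linarith)).upper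
    refine ⟨A * d + 1, by positivity, ?_⟩
    filter_upwards [hev, h.eventually_pos, h.eventually_gap (2 * (3 * 2 ^ (1 / p)) ^ d)
      (lt_add_one (A * d)), h.eventually_gap 1 hA] with β h4 h5 h6 h7
    have hgap : 0 < κ.betaC - β := by linarith
    refine (h.chi_le_xi hp0 (by linarith) (by linarith) h5.1.le h5.2).trans (le_trans ?_ h6)
    rw [neg_zero, Real.rpow_zero, one_mul] at h7
    have h8 : max 1 (κ.xiFull β p).toReal ≤ (κ.betaC - β) ^ (-A) := max_le h7 h4
    have h9 : (κ.betaC - β) ^ (-(A * d)) = ((κ.betaC - β) ^ (-A)) ^ d := by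
      rw [← Real.rpow_natCast, ← Real.rpow_mul hgap.le]; congr 1; ring
    rw [h9, mul_assoc 2, ← mul_pow, mul_assoc 3]
    gcongr
  · obtain ⟨A, hA, hev⟩ := hD.upper
    refine ⟨A, hA, ?_⟩
    filter_upwards [hev, h.eventually_pos] with β h1 h2
    simp only [zeta, κ.mom_eq h2.1.le] at h1
    refine le_trans ?_ h1
    have hw := κ.smul_w0_nonneg h2.1.le
    have hχ := κ.Am_one_ne_top h2.1.le h2.2
    have hA0 : Am 1 (β • κ.w0) ≠ 0 := (one_pos.trans_le (one_le_Am hw 1)).ne'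
    have h2t : Am 2 (β • κ.w0) ≠ ∞ :=
      ((Am_two_le hw (κ.w0_TI.smul β)).trans_lt (ENNReal.pow_lt_top hχ.lt_top)).ne
    refine ENNReal.toReal_mono (ENNReal.div_lt_top h2t hA0).ne ?_
    rw [ENNReal.le_div_iff_mul_le (Or.inl hA0) (Or.inl hχ), ← pow_two]
    exact Am_one_sq_le hw

/-- Polynomial growth of the critical cut-off susceptibility. -/
def Poly (κ : Kernel d α) : Prop :=
  ∃ A : ℝ, 0 < A ∧ ∀ᶠ r in atTop, Am 1 (κ.betaC • κ.wc r) ≤ ENNReal.ofReal (r ^ A)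

theorem Ctx.poly (h : κ.Ctx) (hχ : ∃ A : ℝ, 0 < A ∧
    ∀ᶠ β in nhdsWithin κ.betaC (Set.Iio κ.betaC), (Am 1 (β • κ.w0)).toReal ≤ (κ.betaC - β) ^ (-A)) :
    κ.Poly := by
  obtain ⟨A, hA, hev⟩ := hχ
  obtain ⟨c, hc, hcut⟩ := h.cut_le
  have hs := h.one_lt
  refine ⟨((d : ℝ) + α) * A + 1, by positivity, ?_⟩
  filter_upwards [(h.tendsto_gap c hc).eventually (hev.and h.eventually_pos), hcut,
    eventually_gt_atTop 0, eventually_mul_rpow_le (c ^ (-A)) (lt_add_one (((d : ℝ) + α) * A))]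
    with r h1 h2 h3 h4
  obtain ⟨h1, h5, h6⟩ := h1
  refine (Am_mono_rate (κ.smul_wc_nonneg h.pos.le r) h2.1 1).trans ?_
  rw [← ENNReal.ofReal_toReal (κ.Am_one_ne_top h5.le h6)]
  refine ENNReal.ofReal_le_ofReal (h1.trans (le_trans (le_of_eq ?_) h4))
  rw [show κ.betaC - (κ.betaC - c * r ^ (-((d : ℝ) + α))) = c * r ^ (-((d : ℝ) + α)) by ring, Real.mul_rpow hc.le (by positivity), ← Real.rpow_mul h3.le]
  congr 2; ring

end Kernel

theorem cs_eq_card {U : Type*} [DecidableEq U] (Λ : Finset U) (ω : Finset (Sym2 U)) (o : U) :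
    cs Λ ω o = (Λ.filter fun x => Lk (↑ω) o x).card := by
  simp only [cs, ci, ind, Finset.sum_boole]

/-- The number of points of a cluster is bounded by the volume of a box containing it. -/
theorem cs_pow_le {d : ℕ} (Λ : Finset (V d)) (ω : Finset (Sym2 (V d))) {k : ℕ} (hk : k ≠ 0) :
    cs Λ ω 0 ^ k ≤ cw (fun x => 3 ^ (d * k) * (1 + ‖x‖ ^ (d * k))) Λ ω 0 := by
  rw [cs_eq_card]
  have hnn : ∀ x ∈ Λ, 0 ≤ 3 ^ (d * k) * (1 + ‖x‖ ^ (d * k)) * ci ω 0 x := fun x _ =>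
    mul_nonneg (by positivity) (ci_nonneg _ _ _)
  rcases (Λ.filter fun x => Lk (↑ω) 0 x).eq_empty_or_nonempty with h | h
  · rw [h, Finset.card_empty, Nat.cast_zero, zero_pow hk]
    exact Finset.sum_nonneg hnn
  · obtain ⟨x, hx, hmax⟩ := Finset.exists_max_image _ (fun x => ‖x‖) h
    have hx' := Finset.mem_filter.1 hx
    refine le_trans ?_ (Finset.single_le_sum hnn hx'.1)
    have h1 : (1 : ℝ) ≤ max 1 ‖x‖ := le_max_left _ _
    have h2 : (Λ.filter fun x => Lk (↑ω) 0 x) ⊆ bx d (max 1 ‖x‖) := fun y hy => by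
      rw [mem_bx (by linarith)]
      exact (hmax y hy).trans (le_max_right _ _)
    have h3 : ((Λ.filter fun x => Lk (↑ω) 0 x).card : ℝ) ≤ (3 * max 1 ‖x‖) ^ d :=
      (Nat.cast_le.2 (Finset.card_le_card h2)).trans (card_bx_le h1)
    rw [ci, ind_true hx'.2, mul_one]
    calc _ ≤ ((3 * max 1 ‖x‖) ^ d) ^ k := by gcongr
      _ = 3 ^ (d * k) * max 1 ‖x‖ ^ (d * k) := by rw [← pow_mul, mul_pow]
      _ ≤ _ := by
        gcongr
        rcases max_cases 1 ‖x‖ with ⟨h, _⟩ | ⟨h, _⟩ <;> rw [h]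
        · rw [one_pow]; linarith [pow_nonneg (norm_nonneg x) (d * k)]
        · linarith

namespace Kernel
variable {d : ℕ} {α : ℝ} {κ : Kernel d α}

theorem Ctx.gy_poly (h : κ.Ctx) (hP : κ.Poly) : ∃ A : ℝ, 0 < A ∧ ∀ p : ℝ, 0 < p → ∀ᶠ r in atTop,
    gy (fun x => ‖x‖ ^ p) (κ.betaC • κ.wc r) ≤ ENNReal.ofReal (r ^ (p + A)) := by
  obtain ⟨A, hA, hP⟩ := hP
  refine ⟨A + 1, by linarith, fun p hp => ?_⟩
  obtain ⟨C, hC, hcut⟩ := h.gy_cut hp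
  filter_upwards [hP, eventually_ge_atTop 1,
    eventually_mul_rpow_le (C ^ p) (show p + A < p + (A + 1) by linarith)] with r h1 h2 h3
  have hr : 0 < r := by linarith
  refine (gy_norm_le_ep (κ.smul_wc_nonneg h.pos.le r) hp.le).trans ((hcut r h2).trans ?_)
  calc _ ≤ ENNReal.ofReal ((C * r) ^ p) * ENNReal.ofReal (r ^ A) := by gcongr
    _ = ENNReal.ofReal (C ^ p * r ^ (p + A)) := by
        rw [← ENNReal.ofReal_mul (by positivity), Real.mul_rpow (by linarith) hr.le,
          Real.rpow_add hr, mul_assoc]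
    _ ≤ _ := ENNReal.ofReal_le_ofReal h3

theorem Ctx.moment (h : κ.Ctx) (hP : κ.Poly) {k : ℕ} (hk : k ≠ 0) : ∃ B : ℝ, 0 < B ∧
    ∀ᶠ r in atTop, Am k (κ.betaC • κ.wc r) ≤ ENNReal.ofReal (r ^ B) := by
  obtain ⟨A, hA, hg⟩ := h.gy_poly hP
  obtain ⟨A', hA', hP⟩ := hP
  have hp : (0 : ℝ) < ((d * k : ℕ) : ℝ) := by
    exact_mod_cast Nat.mul_pos h.hd (Nat.pos_of_ne_zero hk)
  refine ⟨((d * k : ℕ) : ℝ) + A + A' + 1, by positivity, ?_⟩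
  filter_upwards [hP, hg _ hp, eventually_ge_atTop 1, eventually_mul_rpow_le (2 * 3 ^ (d * k))
    (show ((d * k : ℕ) : ℝ) + A + A' < ((d * k : ℕ) : ℝ) + A + A' + 1 by linarith)]
    with r h1 h2 h3 h4
  have hw := κ.smul_wc_nonneg h.pos.le r
  have hr : 0 < r := by linarith
  calc Am k (κ.betaC • κ.wc r)
      ≤ gy (fun x => 3 ^ (d * k) * (1 + ‖x‖ ^ (d * k))) (κ.betaC • κ.wc r) :=
        EV_mono hw fun Λ ω _ => cs_pow_le Λ ω hk
    _ = ENNReal.ofReal (3 ^ (d * k)) * (ENNReal.ofReal 1 * Am 1 (κ.betaC • κ.wc r) +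
        gy (fun x => ‖x‖ ^ ((d * k : ℕ) : ℝ)) (κ.betaC • κ.wc r)) := by
        rw [gy_const_mul (by positivity), gy_add hw (fun x => by dsimp only; positivity)
          (fun x => by dsimp only; positivity), gy_const zero_le_one]
        simp only [Real.rpow_natCast]
    _ ≤ ENNReal.ofReal (3 ^ (d * k)) * (ENNReal.ofReal 1 * ENNReal.ofReal (r ^ A') +
        ENNReal.ofReal (r ^ (((d * k : ℕ) : ℝ) + A))) := by gcongr
    _ = ENNReal.ofReal (3 ^ (d * k) * (r ^ A' + r ^ (((d * k : ℕ) : ℝ) + A))) := by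
        rw [ENNReal.ofReal_one, one_mul, ← ENNReal.ofReal_add (by positivity) (by positivity),
          ← ENNReal.ofReal_mul (by positivity)]
    _ ≤ _ := by
        refine ENNReal.ofReal_le_ofReal (le_trans ?_ h4)
        have e1 : r ^ A' ≤ r ^ (((d * k : ℕ) : ℝ) + A + A') :=
          Real.rpow_le_rpow_of_exponent_le h3 (by linarith)
        have e2 : r ^ (((d * k : ℕ) : ℝ) + A) ≤ r ^ (((d * k : ℕ) : ℝ) + A + A') :=
          Real.rpow_le_rpow_of_exponent_le h3 (by linarith)
        rw [mul_comm (2 : ℝ), mul_assoc]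
        gcongr
        linarith

/-- Connections substantially longer than the cut-off scale are very unlikely. -/
theorem Ctx.tail (h : κ.Ctx) (hP : κ.Poly) {ε : ℝ} (hε : 0 < ε) (A : ℝ) : ∀ᶠ r in atTop,
    ∀ w : Sym2 (V d) → ℝ, 0 ≤ w → w ≤ κ.betaC • κ.wc r → ∀ (Λ : Finset (V d)) (x : V d),
      rE Λ.sym2 w (fun ω => ind (∃ y ∈ Λ, Lk (↑ω) x y ∧ r ^ (1 + ε) < ‖y - x‖)) ≤ r ^ (-A) := by
  obtain ⟨B, hB, hg⟩ := h.gy_poly hP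
  set p : ℝ := (|A| + B) / ε with hp
  have hp0 : 0 < p := by positivity
  have hpe : p * ε = |A| + B := by rw [hp, div_mul_cancel₀ _ hε.ne']
  filter_upwards [hg p hp0, eventually_ge_atTop 1] with r h1 h2 w hw hwr Λ x
  have hr : 0 < r := by linarith
  set φ : V d → ℝ := fun y => (r ^ (1 + ε)) ^ (-p) * ‖y - x‖ ^ p with hφ
  have hφ0 : 0 ≤ φ := fun y => by dsimp only [φ]; positivity
  have e1 : ∀ ω : Finset (Sym2 (V d)), ind (∃ y ∈ Λ, Lk (↑ω) x y ∧ r ^ (1 + ε) < ‖y - x‖) ≤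
      cw φ Λ ω x := by
    intro ω
    by_cases hy : ∃ y ∈ Λ, Lk (↑ω) x y ∧ r ^ (1 + ε) < ‖y - x‖
    · rw [ind_true hy]
      obtain ⟨y, hy, hl, hlt⟩ := hy
      refine le_trans ?_ (Finset.single_le_sum (f := fun y => φ y * ci ω x y)
        (fun z _ => mul_nonneg (hφ0 z) (ci_nonneg _ _ _)) hy)
      dsimp only [φ]
      rw [ci, ind_true hl, mul_one]
      have hq : 0 < r ^ (1 + ε) := Real.rpow_pos_of_pos hr _
      calc (1 : ℝ) = (r ^ (1 + ε)) ^ (-p) * (r ^ (1 + ε)) ^ p := by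
            rw [← Real.rpow_add hq, neg_add_cancel, Real.rpow_zero]
        _ ≤ _ := by gcongr
    · rw [ind_false hy]
      exact cw_nonneg hφ0 _ _ _
  have e2 : ENNReal.ofReal (rE Λ.sym2 w (fun ω => cw φ Λ ω x)) ≤ ENNReal.ofReal (r ^ (-A)) := by
    calc ENNReal.ofReal (rE Λ.sym2 w (fun ω => cw φ Λ ω x))
        ≤ ENNReal.ofReal (rE Λ.sym2 (κ.betaC • κ.wc r) (fun ω => cw φ Λ ω x)) :=
          ENNReal.ofReal_le_ofReal (rE_mono_rate hw hwr (cw_mono hφ0 Λ x))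
      _ ≤ EV (κ.betaC • κ.wc r) (fun Λ ω => cw φ Λ ω x) := le_EV _ (fun Λ ω => cw φ Λ ω x) Λ
      _ = gy (fun z => φ (z + x)) (κ.betaC • κ.wc r) := EV_cw_base ((κ.wc_TI r).smul _) φ x
      _ = ENNReal.ofReal ((r ^ (1 + ε)) ^ (-p)) * gy (fun z => ‖z‖ ^ p) (κ.betaC • κ.wc r) := by
          simp only [φ, add_sub_cancel_right]
          rw [gy_const_mul (by positivity)]
      _ ≤ ENNReal.ofReal ((r ^ (1 + ε)) ^ (-p)) * ENNReal.ofReal (r ^ (p + B)) := by gcongr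
      _ = ENNReal.ofReal (r ^ (-|A|)) := by
          rw [← ENNReal.ofReal_mul (by positivity), ← Real.rpow_mul hr.le, ← Real.rpow_add hr]
          congr 2; linarith
      _ ≤ _ := ENNReal.ofReal_le_ofReal
          (Real.rpow_le_rpow_of_exponent_le h2 (by linarith [le_abs_self A]))
  exact (rE_mono hw fun ω _ => e1 ω).trans
    ((ENNReal.ofReal_le_ofReal_iff (by positivity)).1 e2)

end Kernel

section
variable {U : Type*} [DecidableEq U]

/-- Some cluster contains at least `m` points of `B`. -/
def D1 (B : Finset U) (m : ℕ) (ω : Finset (Sym2 U)) : Prop :=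
  ∃ x, m ≤ (B.filter fun y => Lk (↑ω) x y).card

/-- There are `k` edge-disjoint connected sets of open edges, each joining at least `m` points. -/
def Dk (B : Finset U) (m : ℕ) : ℕ → Finset (Sym2 U) → Prop
  | 0, _ => True
  | k + 1, ω => DisjOcc (fun I J => D1 B m I ∧ Dk B m k J) ω

theorem D1_monotone (B : Finset U) (m : ℕ) : Monotone (D1 B m) := by
  rintro ω ω' h ⟨x, hx⟩
  exact ⟨x, hx.trans (Finset.card_le_card
    (Finset.monotone_filter_right _ fun y _ hy => lk_monotone x y h hy))⟩

theorem Dk_monotone (B : Finset U) (m : ℕ) : ∀ k, Monotone (Dk B m k)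
  | 0 => fun _ _ _ => id
  | _ + 1 => disjOcc_monotone _

theorem Dk_add {B : Finset U} {m a b : ℕ} {I J : Finset (Sym2 U)} (hI : Dk B m a I)
    (hJ : Dk B m b J) (hd : Disjoint I J) : Dk B m (a + b) (I ∪ J) := by
  induction a generalizing I with
  | zero => rw [Nat.zero_add]; exact Dk_monotone B m b Finset.subset_union_right hJ
  | succ a ih =>
    obtain ⟨I₁, I₂, h1, h2, h12, hD, hk⟩ := hI
    rw [Nat.add_right_comm]
    refine ⟨I₁, I₂ ∪ J, h1.trans Finset.subset_union_left,
      Finset.union_subset_union h2 subset_rfl, ?_, hD, ih hk (hd.mono_left h2)⟩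
    exact Finset.disjoint_union_right.2 ⟨h12, hd.mono_left h1⟩

theorem Dk_antitone {B : Finset U} {m k l : ℕ} (h : k ≤ l) {ω : Finset (Sym2 U)}
    (hl : Dk B m l ω) : Dk B m k ω := by
  induction l, h using Nat.le_induction with
  | base => exact hl
  | succ l _ ih =>
    obtain ⟨I, J, _, hJ, _, _, hk⟩ := hl
    exact ih (Dk_monotone B m l hJ hk)

theorem rE_Dk_le {s : Finset (Sym2 U)} {w : Sym2 U → ℝ} (hw : 0 ≤ w) (B : Finset U) (m k : ℕ) :
    rE s w (fun ω => ind (Dk B m k ω)) ≤ rE s w (fun ω => ind (D1 B m ω)) ^ k := by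
  induction k with
  | zero =>
    rw [pow_zero]
    calc _ ≤ rE s w fun _ => 1 := rE_mono hw fun ω _ => ind_le_one _
      _ = 1 := rE_const s w 1
  | succ k ih =>
    rw [pow_succ']
    exact (rE_bk hw (D1_monotone B m) (Dk_monotone B m k)).trans
      (mul_le_mul_of_nonneg_left ih (rE_nonneg hw fun ω _ => ind_nonneg _))

/-- The edges of `ω` inside a vertex set. -/
noncomputable def rst (ω : Finset (Sym2 U)) (S : Finset U) : Finset (Sym2 U) := ω.filter fun e => ∀ y ∈ e, y ∈ S

theorem mem_rst {ω : Finset (Sym2 U)} {S : Finset U} {e : Sym2 U} :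
    e ∈ rst ω S ↔ e ∈ ω ∧ ∀ y ∈ e, y ∈ S := Finset.mem_filter

theorem rst_mono {ω : Finset (Sym2 U)} {S T : Finset U} (h : S ⊆ T) : rst ω S ⊆ rst ω T :=
  fun e he => by rw [mem_rst] at he ⊢; exact ⟨he.1, fun y hy => h (he.2 y hy)⟩

theorem rst_disjoint {ω : Finset (Sym2 U)} {S T : Finset U} (h : Disjoint S T) :
    Disjoint (rst ω S) (rst ω T) := by
  rw [Finset.disjoint_left]
  intro e he he'
  rw [mem_rst] at he he'
  induction e with
  | _ a b => exact Finset.disjoint_left.1 h (he.2 a (by simp)) (he'.2 a (by simp))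

/-- A connected set can be cut at a vertex adjacent to the root. -/
theorem exists_cut {ω : Finset (Sym2 U)} {S : Finset U} {v : U} (hv : v ∈ S)
    (hc : ∀ z ∈ S, Lk (↑(rst ω S)) v z) (hS : ∃ z ∈ S, z ≠ v) :
    ∃ b S' S'', v ∈ S' ∧ b ∈ S'' ∧ Disjoint S' S'' ∧ S' ∪ S'' = S ∧ s(v, b) ∈ rst ω S ∧
      (∀ z ∈ S', Lk (↑(rst ω S')) v z) ∧ (∀ z ∈ S'', Lk (↑(rst ω S'')) b z) := by
  obtain ⟨z₀, hz₀, hne⟩ := hS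
  obtain ⟨a, ha, b, hb, hab, -⟩ := (hc z₀ hz₀).last_escape (C := {v}) rfl hne
  rw [Set.mem_singleton_iff.1 ha] at hab
  set O : Set (Sym2 U) := {e | e ∈ (↑(rst ω S) : Set (Sym2 U)) ∧ ∀ y ∈ e, y ∉ ({v} : Set U)} with hO
  have hOS : ∀ e ∈ O, e ∈ ω ∧ ∀ y ∈ e, y ∈ S := fun e he => mem_rst.1 he.1
  have hbS : b ∈ S := (mem_rst.1 hab).2 b (by simp)
  have hOv : ∀ {z}, Lk O b z → z ≠ v := by
    intro z hz
    induction hz with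
    | refl => exact hb
    | @tail y z _ h _ => exact h.2 z (by simp)
  have hbO : ∀ {z y}, Lk O z y → z ∈ S → y ∈ S := by
    intro z y hzy hz
    induction hzy with
    | refl => exact hz
    | @tail x y _ h _ => exact (hOS _ h).2 y (by simp)
  refine ⟨b, S.filter fun z => ¬ Lk O b z, S.filter fun z => Lk O b z, ?_, ?_, ?_, ?_, hab, ?_, ?_⟩
  · exact Finset.mem_filter.2 ⟨hv, fun h => hOv h rfl⟩
  · exact Finset.mem_filter.2 ⟨hbS, Lk.refl _⟩
  · exact (Finset.disjoint_filter_filter_not _ _ _).symm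
  · rw [Finset.union_comm]; exact Finset.filter_union_filter_not_eq _ _
  · intro z hz
    obtain ⟨hzS, hbz⟩ := Finset.mem_filter.1 hz
    rcases eq_or_ne z v with rfl | hzv
    · exact Lk.refl _
    obtain ⟨a, ha, c, hcv, hac, hcz⟩ := (hc z hzS).last_escape (C := {v}) rfl hzv
    rw [Set.mem_singleton_iff.1 ha] at hac
    have hbc : ∀ {y}, Lk O c y → ¬ Lk O b y := fun {y} h1 h2 =>
      hbz ((h2.trans h1.symm).trans hcz)
    have hcS : c ∈ S := (mem_rst.1 hac).2 c (by simp)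
    refine (Lk.single ?_).trans (Lk.mono ?_ hcz.restrict)
    · rw [Finset.mem_coe, mem_rst]
      refine ⟨(mem_rst.1 hac).1, fun y hy => ?_⟩
      rcases Sym2.mem_iff.1 hy with rfl | rfl
      · exact Finset.mem_filter.2 ⟨hv, fun h => hOv h rfl⟩
      · exact Finset.mem_filter.2 ⟨hcS, hbc (Lk.refl _)⟩
    · rintro e ⟨he, hy⟩
      exact mem_rst.2 ⟨(hOS e he).1, fun y hye =>
        Finset.mem_filter.2 ⟨(hOS e he).2 y hye, hbc (hy y hye)⟩⟩
  · intro z hz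
    refine Lk.mono ?_ (Finset.mem_filter.1 hz).2.restrict
    rintro e ⟨he, hy⟩
    exact mem_rst.2 ⟨(hOS e he).1, fun y hye =>
      Finset.mem_filter.2 ⟨(hOS e he).2 y hye, hy y hye⟩⟩

/-- A connected set splits into many edge-disjoint connected pieces of moderate size. -/
theorem exists_pieces (ω : Finset (Sym2 U)) (B : Finset U) {M : ℕ} (hM : 2 ≤ M) (n : ℕ) :
    ∀ (S : Finset U) (v : U), S.card ≤ n → v ∈ S → (∀ z ∈ S, Lk (↑(rst ω S)) v z) →
      ∃ (k : ℕ) (ω₁ ω₀ : Finset (Sym2 U)) (W : Finset U), ω₁ ⊆ rst ω S ∧ ω₀ ⊆ rst ω S ∧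
        Disjoint ω₁ ω₀ ∧ Dk B M k ω₁ ∧ W ⊆ S ∧ v ∈ W ∧ (∀ z ∈ W, Lk (↑ω₀) v z) ∧
        (W ∩ B).card < M ∧ (S ∩ B).card ≤ 2 * M * k + (W ∩ B).card := by
  induction n with
  | zero =>
    intro S v hS hv
    rw [Nat.le_zero, Finset.card_eq_zero] at hS
    rw [hS] at hv; exact absurd hv (Finset.notMem_empty v)
  | succ n ih =>
    intro S v hSn hv hc
    have hsing : ∀ x : U, (({x} : Finset U) ∩ B).card < M := fun x =>
      (Finset.card_le_card Finset.inter_subset_left).trans_lt (by rw [Finset.card_singleton]; omega)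
    by_cases hS : ∃ z ∈ S, z ≠ v
    · obtain ⟨b, S', S'', hv', hb, hdisj, hun, hvb, hc', hc''⟩ := exists_cut hv hc hS
      have hcard : S'.card + S''.card = S.card := by
        rw [← Finset.card_union_of_disjoint hdisj, hun]
      have h1 : 0 < S'.card := Finset.card_pos.2 ⟨v, hv'⟩
      have h2 : 0 < S''.card := Finset.card_pos.2 ⟨b, hb⟩
      have hs' : S' ⊆ S := hun ▸ Finset.subset_union_left
      have hs'' : S'' ⊆ S := hun ▸ Finset.subset_union_right
      obtain ⟨k', I', O', W', hI', hO', hdisj', hD', hW', hvW', hl', hlt', hle'⟩ :=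
        ih S' v (by omega) hv' hc'
      obtain ⟨k'', I'', O'', W'', hI'', hO'', hdisj'', hD'', hW'', hbW'', hl'', hlt'', hle''⟩ :=
        ih S'' b (by omega) hb hc''
      have hr := rst_disjoint (ω := ω) hdisj
      have hvb' : s(v, b) ∉ rst ω S' := fun h =>
        Finset.disjoint_left.1 hdisj ((mem_rst.1 h).2 b (by simp)) hb
      have hvb'' : s(v, b) ∉ rst ω S'' := fun h =>
        Finset.disjoint_left.1 hdisj hv' ((mem_rst.1 h).2 v (by simp))
      have hD : Dk B M (k' + k'') (I' ∪ I'') := Dk_add hD' hD'' (hr.mono hI' hI'')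
      have hIsub : I' ∪ I'' ⊆ rst ω S := Finset.union_subset (hI'.trans (rst_mono hs'))
        (hI''.trans (rst_mono hs''))
      have hOsub : insert s(v, b) (O' ∪ O'') ⊆ rst ω S := Finset.insert_subset hvb
        (Finset.union_subset (hO'.trans (rst_mono hs')) (hO''.trans (rst_mono hs'')))
      have hedge : Disjoint (I' ∪ I'') (insert s(v, b) (O' ∪ O'')) := by
        rw [Finset.disjoint_insert_right, Finset.disjoint_union_left, Finset.disjoint_union_right,
          Finset.disjoint_union_right, Finset.mem_union, not_or]
        exact ⟨⟨fun h => hvb' (hI' h), fun h => hvb'' (hI'' h)⟩,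
          ⟨hdisj', hr.mono hI' hO''⟩, (hr.mono hO' hI'').symm, hdisj''⟩
      have hl : ∀ z ∈ W' ∪ W'', Lk (↑(insert s(v, b) (O' ∪ O''))) v z := by
        intro z hz
        rcases Finset.mem_union.1 hz with hz | hz
        · exact (hl' z hz).mono (Finset.coe_subset.2
            (Finset.subset_union_left.trans (Finset.subset_insert _ _)))
        · exact (Lk.single (by simp)).trans ((hl'' z hz).mono (Finset.coe_subset.2
            (Finset.subset_union_right.trans (Finset.subset_insert _ _))))
      have hSB : (S ∩ B).card = (S' ∩ B).card + (S'' ∩ B).card := by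
        rw [← hun, Finset.union_inter_distrib_right, Finset.card_union_of_disjoint]
        exact hdisj.mono Finset.inter_subset_left Finset.inter_subset_left
      have hWB : ((W' ∪ W'') ∩ B).card = (W' ∩ B).card + (W'' ∩ B).card := by
        rw [Finset.union_inter_distrib_right, Finset.card_union_of_disjoint]
        exact (hdisj.mono hW' hW'').mono Finset.inter_subset_left Finset.inter_subset_left
      have hexp : 2 * M * (k' + k'') = 2 * M * k' + 2 * M * k'' := by ring
      by_cases hbig : ((W' ∪ W'') ∩ B).card < M
      · exact ⟨k' + k'', I' ∪ I'', _, W' ∪ W'', hIsub, hOsub, hedge, hD,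
          Finset.union_subset (hW'.trans hs') (hW''.trans hs''),
          Finset.mem_union_left _ hvW', hl, hbig, by omega⟩
      · refine ⟨k' + k'' + 1, (I' ∪ I'') ∪ insert s(v, b) (O' ∪ O''), ∅, {v},
          Finset.union_subset hIsub hOsub, by simp, by simp, ?_, by simpa using hv, by simp, ?_,
          hsing v, ?_⟩
        · refine ⟨insert s(v, b) (O' ∪ O''), I' ∪ I'', Finset.subset_union_right,
            Finset.subset_union_left, hedge.symm, ⟨v, ?_⟩, hD⟩
          refine (not_lt.1 hbig).trans (Finset.card_le_card fun z hz => ?_)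
          obtain ⟨hz1, hz2⟩ := Finset.mem_inter.1 hz
          exact Finset.mem_filter.2 ⟨hz2, hl z hz1⟩
        · intro z hz
          rw [Finset.mem_singleton.1 hz]; exact Lk.refl _
        · have : 2 * M * (k' + k'' + 1) = 2 * M * (k' + k'') + 2 * M := by ring
          omega
    · push Not at hS
      have : S = {v} := Finset.eq_singleton_iff_unique_mem.2 ⟨hv, hS⟩
      refine ⟨0, ∅, ∅, {v}, by simp, by simp, by simp, trivial, by simpa using hv, by simp, ?_,
        hsing v, by rw [this]; omega⟩
      intro z hz
      rw [Finset.mem_singleton.1 hz]; exact Lk.refl _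

theorem Dk_of_card {Λ B : Finset U} {ω : Finset (Sym2 U)} (hω : ω ⊆ Λ.sym2) {M : ℕ} (hM : 2 ≤ M)
    {x : U} {k : ℕ} (h : 2 * M * k ≤ ((Λ.filter fun y => Lk (↑ω) x y) ∩ B).card) : Dk B M k ω := by
  by_cases hx : x ∈ Λ
  · set S := Λ.filter fun y => Lk (↑ω) x y with hS
    obtain ⟨k', I, O, W, hI, -, -, hD, -, -, -, hlt, hle⟩ := exists_pieces ω B hM S.card S x le_rfl
      (Finset.mem_filter.2 ⟨hx, Lk.refl _⟩) (by
        intro z hz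
        refine Lk.mono ?_ (Finset.mem_filter.1 hz).2.restrict
        rintro e ⟨he, hy⟩
        exact mem_rst.2 ⟨he, fun y hye => Finset.mem_filter.2
          ⟨lk_mem_of_sym2 hω hx (hy y hye), hy y hye⟩⟩)
    have hk : k ≤ k' := by
      by_contra hlt'
      have h1 : 2 * M * (k' + 1) ≤ 2 * M * k := Nat.mul_le_mul_left _ (by omega)
      have h2 : 2 * M * (k' + 1) = 2 * M * k' + 2 * M := by ring
      omega
    exact Dk_antitone hk (Dk_monotone B M k' (hI.trans (Finset.filter_subset _ _)) hD)
  · have : (Λ.filter fun y => Lk (↑ω) x y) = ∅ := by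
      refine Finset.filter_eq_empty_iff.2 fun y hy hl => hx (lk_mem_of_sym2 hω hy hl.symm)
    rw [this, Finset.empty_inter, Finset.card_empty, Nat.le_zero] at h
    have hk : k = 0 := by
      rcases Nat.mul_eq_zero.1 h with h | h
      · omega
      · exact h
    rw [hk]; trivial

end

theorem eventually_exp_le {ε : ℝ} (hε : 0 < ε) (A : ℝ) :
    ∀ᶠ r : ℝ in atTop, Real.exp (-r ^ ε) ≤ r ^ (-A) := by
  have h1 := (tendsto_rpow_mul_exp_neg_mul_atTop_nhds_zero (A / ε) 1 one_pos).comp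
    (tendsto_rpow_atTop hε)
  filter_upwards [h1.eventually_le_const one_pos, eventually_gt_atTop 0] with r h2 hr
  simp only [Function.comp, neg_mul, one_mul, ← Real.rpow_mul hr.le] at h2
  rw [mul_div_cancel₀ _ hε.ne'] at h2
  have hA : 0 < r ^ A := Real.rpow_pos_of_pos hr A
  rw [Real.rpow_neg hr.le, ← one_div, le_div_iff₀ hA]
  linarith

namespace Kernel
variable {d : ℕ} {α : ℝ} {κ : Kernel d α}

/-- If large clusters in a box are not overwhelmingly likely, then higher moments are
controlled by lower ones. -/
theorem Ctx.tight (h : κ.Ctx) (hP : κ.Poly) {ε : ℝ} (hε : 0 < ε) {k j : ℕ} (hkj : k + j ≠ 0) :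
    ∀ᶠ r in atTop, ∀ w : Sym2 (V d) → ℝ, 0 ≤ w → w ≤ κ.betaC • κ.wc r → ∀ m : ℕ, 2 ≤ m →
      (∀ Λ : Finset (V d), rE Λ.sym2 w (fun ω => ind (D1 (bx d (r ^ (1 + ε))) m ω)) ≤
        1 - r ^ (-ε)) →
      Am (k + j) w ≤ ENNReal.ofReal ((m * r ^ (4 * ε)) ^ j) * Am k w + 1 := by
  obtain ⟨B, hB, hmom⟩ := h.moment hP (k := 2 * (k + j)) (by omega)
  filter_upwards [hmom, h.tail hP hε (B + 1), eventually_exp_le hε (B + 1), eventually_ge_atTop 2,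
    eventually_mul_rpow_le 4 (show 2 * ε < 4 * ε by linarith)]
    with r hmom htail hexp hr2 h4 w hw hwr m hm hD
  have hr : 0 < r := by linarith
  have hrX : 0 ≤ r ^ (4 * ε) := Real.rpow_nonneg hr.le _
  set X : ℝ := m * r ^ (4 * ε) with hX
  have hX0 : 0 ≤ X := by positivity
  set K : ℕ := ⌈r ^ (2 * ε)⌉₊ with hK
  have hone : 1 ≤ r ^ (2 * ε) := Real.one_le_rpow (by linarith) (by linarith)
  have hK1 : r ^ (2 * ε) ≤ K := Nat.le_ceil _
  have hK2 : (K : ℝ) < r ^ (2 * ε) + 1 := Nat.ceil_lt_add_one (by linarith)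
  have hKX : ((2 * m * K : ℕ) : ℝ) ≤ X := by
    have hm0 : (0 : ℝ) ≤ m := Nat.cast_nonneg m
    push_cast
    rw [hX, mul_assoc, mul_left_comm]
    exact mul_le_mul_of_nonneg_left (by linarith) hm0
  refine iSup_le fun Λ => ?_
  have hwp : ∀ e, edgeProb (w e) ∈ Set.Icc 0 1 := fun e => edgeProb_mem (hw e)
  -- the probability of a large cluster
  have hprob : rE Λ.sym2 w (fun ω => ind (X < cs Λ ω 0)) ≤ r ^ (-(B + 1)) + r ^ (-(B + 1)) := by
    have e1 : ∀ ω ⊆ Λ.sym2, ind (X < cs Λ ω 0) ≤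
        ind (∃ y ∈ Λ, Lk (↑ω) 0 y ∧ r ^ (1 + ε) < ‖y - 0‖) +
          ind (Dk (bx d (r ^ (1 + ε))) m K ω) := by
      intro ω hω
      by_cases h1 : X < cs Λ ω 0
      · by_cases h2 : ∃ y ∈ Λ, Lk (↑ω) 0 y ∧ r ^ (1 + ε) < ‖y - 0‖
        · rw [ind_true h2]
          linarith [ind_le_one (X < cs Λ ω 0), ind_nonneg (Dk (bx d (r ^ (1 + ε))) m K ω)]
        · have : Dk (bx d (r ^ (1 + ε))) m K ω := by
            refine Dk_of_card hω hm (x := 0) ?_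
            rw [Finset.inter_eq_left.2]
            · have := hKX.trans h1.le
              rw [cs_eq_card] at this
              exact_mod_cast this
            · intro y hy
              obtain ⟨hy1, hy2⟩ := Finset.mem_filter.1 hy
              rw [mem_bx (by positivity)]
              by_contra h3
              exact h2 ⟨y, hy1, hy2, by rw [sub_zero]; exact not_le.1 h3⟩
          rw [ind_true this]
          linarith [ind_le_one (X < cs Λ ω 0),
            ind_nonneg (∃ y ∈ Λ, Lk (↑ω) 0 y ∧ r ^ (1 + ε) < ‖y - 0‖)]
      · rw [ind_false h1]
        exact add_nonneg (ind_nonneg _) (ind_nonneg _)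
    refine (rE_mono hw e1).trans ?_
    rw [rE_add]
    refine add_le_add (htail w hw hwr Λ 0) ((rE_Dk_le hw _ m K).trans ?_)
    refine (pow_le_pow_left₀ (rE_nonneg hw fun ω _ => ind_nonneg _) ((hD Λ).trans
      (Real.one_sub_le_exp_neg _)) K).trans (le_trans ?_ hexp)
    rw [← Real.exp_nat_mul]
    refine Real.exp_le_exp.2 ?_
    have : r ^ ε = r ^ (2 * ε) * r ^ (-ε) := by rw [← Real.rpow_add hr]; congr 1; ring
    rw [this, mul_neg]
    exact neg_le_neg (mul_le_mul_of_nonneg_right hK1 (Real.rpow_nonneg hr.le _))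
  have hmom' : rE Λ.sym2 w (fun ω => cs Λ ω 0 ^ (2 * (k + j))) ≤ r ^ B :=
    (ENNReal.ofReal_le_ofReal_iff (by positivity)).1 ((le_EV w
      (fun Λ ω => cs Λ ω 0 ^ (2 * (k + j))) Λ).trans ((Am_mono_rate hw hwr _).trans hmom))
  have hCS := bE_cauchy_schwarz (s := Λ.sym2) hwp (fun ω => cs Λ ω 0 ^ (k + j))
    (fun ω => ind (X < cs Λ ω 0))
  have hsq : ∀ P : Prop, ind P ^ 2 = ind P := fun P => by
    by_cases hP : P
    · rw [ind_true hP, one_pow]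
    · rw [ind_false hP, zero_pow two_ne_zero]
  simp only [hsq, ← pow_mul] at hCS
  rw [mul_comm (k + j) 2] at hCS
  set Q := rE Λ.sym2 w (fun ω => cs Λ ω 0 ^ (k + j) * ind (X < cs Λ ω 0)) with hQ
  have hQ1 : Q ≤ 1 := by
    have h1 : Q ^ 2 ≤ r ^ B * (r ^ (-(B + 1)) + r ^ (-(B + 1))) := hCS.trans
      (mul_le_mul hmom' hprob (rE_nonneg hw fun ω _ => ind_nonneg _) (by positivity))
    have h2 : r ^ B * (r ^ (-(B + 1)) + r ^ (-(B + 1))) = 2 * r⁻¹ := by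
      rw [← two_mul, mul_left_comm, ← Real.rpow_add hr, ← Real.rpow_neg_one]; congr 2; ring
    have h3 : 2 * r⁻¹ ≤ 1 := by
      rw [← div_eq_mul_inv, div_le_one hr]; exact hr2
    nlinarith
  have hmain : rE Λ.sym2 w (fun ω => cs Λ ω 0 ^ (k + j)) ≤
      X ^ j * rE Λ.sym2 w (fun ω => cs Λ ω 0 ^ k) + Q := by
    rw [← rE_const_mul, hQ, ← rE_add]
    refine rE_mono hw fun ω _ => ?_
    have hc := cs_nonneg Λ ω (0 : V d)
    by_cases h1 : X < cs Λ ω 0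
    · rw [ind_true h1, mul_one]
      linarith [mul_nonneg (pow_nonneg hX0 j) (pow_nonneg hc k)]
    · rw [ind_false h1, mul_zero, add_zero, pow_add, mul_comm]
      exact mul_le_mul_of_nonneg_right (pow_le_pow_left₀ hc (not_lt.1 h1) j) (pow_nonneg hc k)
  calc ENNReal.ofReal (rE Λ.sym2 w (fun ω => cs Λ ω 0 ^ (k + j)))
      ≤ ENNReal.ofReal (X ^ j * rE Λ.sym2 w (fun ω => cs Λ ω 0 ^ k) + 1) :=
        ENNReal.ofReal_le_ofReal (by linarith)
    _ = ENNReal.ofReal (X ^ j) * ENNReal.ofReal (rE Λ.sym2 w (fun ω => cs Λ ω 0 ^ k)) + 1 := by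
        rw [ENNReal.ofReal_add (mul_nonneg (pow_nonneg hX0 j)
          (rE_nonneg hw fun ω _ => pow_nonneg (cs_nonneg _ _ _) _)) zero_le_one,
          ENNReal.ofReal_mul (pow_nonneg hX0 j), ENNReal.ofReal_one]
    _ ≤ _ := by gcongr; exact le_EV w (fun Λ ω => cs Λ ω 0 ^ k) Λ

end Kernel

section
variable {U : Type*} [DecidableEq U]

theorem rE_all_closed {ι : Type*} [DecidableEq ι] {s S : Finset ι} (hS : S ⊆ s) (u : ι → ℝ) :
    rE s u (fun η => ind (∀ e ∈ S, e ∉ η)) = ∏ e ∈ S, Real.exp (-u e) := by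
  have h1 : ∀ η : Finset ι, ind (∀ e ∈ S, e ∉ η) = (fun ζ => ind (ζ = ∅)) (η ∩ S) := fun η =>
    ind_congr (by
      rw [Finset.eq_empty_iff_forall_notMem]
      simp only [Finset.mem_inter, not_and']
      )
  simp only [h1]
  rw [rE_inter hS u (fun ζ => ind (ζ = ∅)), rE, bE, Finset.sum_eq_single ∅]
  · simp [ind, edgeProb]
  · intro ζ _ hζ
    rw [ind_false hζ, mul_zero]
  · simp

theorem rE_all_closed_le {ι : Type*} [DecidableEq ι] {s S : Finset ι} (hS : S ⊆ s) {u : ι → ℝ}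
    {q : ℝ} {n : ℕ} (hq : 0 ≤ q) (hu : ∀ e ∈ S, q ≤ u e) (hn : n ≤ S.card) :
    rE s u (fun η => ind (∀ e ∈ S, e ∉ η)) ≤ Real.exp (-(n * q)) := by
  rw [rE_all_closed hS, ← Real.exp_sum, Finset.sum_neg_distrib]
  refine Real.exp_le_exp.2 (neg_le_neg ?_)
  calc (n : ℝ) * q ≤ S.card * q := mul_le_mul_of_nonneg_right (Nat.cast_le.2 hn) hq
    _ = ∑ e ∈ S, q := by rw [Finset.sum_const, nsmul_eq_mul]
    _ ≤ _ := Finset.sum_le_sum hu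

theorem card_pairs {A B : Finset U} (h : Disjoint A B) :
    ((A ×ˢ B).image fun p => s(p.1, p.2)).card = A.card * B.card := by
  rw [Finset.card_image_of_injOn, Finset.card_product]
  rintro ⟨a, b⟩ hab ⟨a', b'⟩ hab' he
  simp only [Finset.coe_product, Set.mem_prod, Finset.mem_coe] at hab hab'
  rcases Sym2.eq_iff.1 he with ⟨rfl, rfl⟩ | ⟨h1, h2⟩
  · rfl
  · exact absurd (show a ∈ B from (show a = b' from h1) ▸ hab'.2) (Finset.disjoint_left.1 h hab.1)

/-- Large clusters in a chain of boxes are joined together by sprinkling. -/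
theorem rE_chain {w u : Sym2 U → ℝ} (hw : 0 ≤ w) (hu : 0 ≤ u) {s : Finset (Sym2 U)} {L m : ℕ}
    (hm : 1 ≤ m) {B : ℕ → Finset U} {q η : ℝ} (hq : 0 ≤ q)
    (hB : ∀ j < L, Disjoint (B j) (B (j + 1)))
    (hpair : ∀ j < L, ∀ a ∈ B j, ∀ b ∈ B (j + 1), s(a, b) ∈ s ∧ q ≤ u s(a, b))
    (hE : ∀ j ≤ L, 1 - η ≤ rE s w (fun ω => ind (D1 (B j) m ω))) :
    1 - (L + 1) * η - L * Real.exp (-((m * m : ℕ) * q)) ≤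
      rE s (fun e => w e + u e) (fun ω => ind (∃ x ∈ B 0, ∃ y ∈ B L, Lk (↑ω) x y)) := by
  rw [rE_merge]
  have key : ∀ ω ⊆ s, (1 - L * Real.exp (-((m * m : ℕ) * q))) -
      ∑ j ∈ Finset.range (L + 1), (1 - ind (D1 (B j) m ω)) ≤
      rE s u (fun η => ind (∃ x ∈ B 0, ∃ y ∈ B L, Lk (↑(ω ∪ η)) x y)) := by
    intro ω _
    have hterm : ∀ j, 0 ≤ 1 - ind (D1 (B j) m ω) := fun j => by linarith [ind_le_one (D1 (B j) m ω)]
    by_cases hgood : ∀ j ≤ L, D1 (B j) m ω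
    · have h0 : ∑ j ∈ Finset.range (L + 1), (1 - ind (D1 (B j) m ω)) = 0 :=
        Finset.sum_eq_zero fun j hj => by
          rw [ind_true (hgood j (Nat.lt_succ_iff.1 (Finset.mem_range.1 hj))), sub_self]
      rw [h0, sub_zero]
      have : Nonempty U := ⟨(hgood 0 (Nat.zero_le _)).choose⟩
      choose! x hx using hgood
      set A : ℕ → Finset U := fun j => (B j).filter fun y => Lk (↑ω) (x j) y with hA
      have hAB : ∀ j, A j ⊆ B j := fun j => Finset.filter_subset _ _
      set S : ℕ → Finset (Sym2 U) := fun j => (A j ×ˢ A (j + 1)).image fun p => s(p.1, p.2) with hS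
      have hmem : ∀ j < L, ∀ e ∈ S j, e ∈ s ∧ q ≤ u e := by
        intro j hj e he
        obtain ⟨p, hp, rfl⟩ := Finset.mem_image.1 he
        obtain ⟨h1, h2⟩ := Finset.mem_product.1 hp
        exact hpair j hj _ (hAB _ h1) _ (hAB _ h2)
      have hprob : ∀ j < L, rE s u (fun η => ind (∀ e ∈ S j, e ∉ η)) ≤
          Real.exp (-((m * m : ℕ) * q)) := by
        intro j hj
        refine rE_all_closed_le (fun e he => (hmem j hj e he).1) hq
          (fun e he => (hmem j hj e he).2) ?_
        rw [card_pairs ((hB j hj).mono (hAB _) (hAB _))]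
        exact Nat.mul_le_mul (hx j hj.le) (hx (j + 1) hj)
      have hpt : ∀ η ⊆ s, 1 - ∑ j ∈ Finset.range L, ind (∀ e ∈ S j, e ∉ η) ≤
          ind (∃ x ∈ B 0, ∃ y ∈ B L, Lk (↑(ω ∪ η)) x y) := by
        intro η _
        by_cases hall : ∃ j ∈ Finset.range L, ∀ e ∈ S j, e ∉ η
        · obtain ⟨j, hj, hc⟩ := hall
          have := Finset.single_le_sum (f := fun j => ind (∀ e ∈ S j, e ∉ η))
            (fun i _ => ind_nonneg _) hj
          simp only [ind_true hc] at this
          linarith [ind_nonneg (∃ x ∈ B 0, ∃ y ∈ B L, Lk (↑(ω ∪ η)) x y)]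
        · push Not at hall
          have hl1 : ∀ {a b : U}, Lk (↑ω) a b → Lk (↑(ω ∪ η)) a b := fun h =>
            h.mono (Finset.coe_subset.2 Finset.subset_union_left)
          have hlink : ∀ j ≤ L, Lk (↑(ω ∪ η)) (x 0) (x j) := by
            intro j
            induction j with
            | zero => exact fun _ => Lk.refl _
            | succ j ih =>
              intro hj
              obtain ⟨e, he, heη⟩ := hall j (Finset.mem_range.2 hj)
              obtain ⟨p, hp, rfl⟩ := Finset.mem_image.1 he
              obtain ⟨h1, h2⟩ := Finset.mem_product.1 hp
              have e1 := (Finset.mem_filter.1 h1).2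
              have e2 := (Finset.mem_filter.1 h2).2
              exact (((ih (by omega)).trans (hl1 e1)).trans (Lk.single
                (Finset.mem_coe.2 (Finset.mem_union_right _ heη)))).trans (hl1 e2.symm)
          have hne : ∀ j ≤ L, ∃ a ∈ B j, Lk (↑ω) (x j) a := by
            intro j hj
            obtain ⟨a, ha⟩ := Finset.card_pos.1 (lt_of_lt_of_le hm (hx j hj))
            exact ⟨a, (Finset.mem_filter.1 ha).1, (Finset.mem_filter.1 ha).2⟩
          obtain ⟨a, ha, hla⟩ := hne 0 (Nat.zero_le _)
          obtain ⟨b, hb, hlb⟩ := hne L le_rfl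
          rw [ind_true ⟨a, ha, b, hb, ((hl1 hla.symm).trans (hlink L le_rfl)).trans (hl1 hlb)⟩]
          linarith [Finset.sum_nonneg (s := Finset.range L)
            (f := fun j => ind (∀ e ∈ S j, e ∉ η)) fun i _ => ind_nonneg _]
      refine le_trans ?_ (rE_mono hu hpt)
      rw [rE_sub, rE_const, rE_sum]
      have := Finset.sum_le_sum fun j hj => hprob j (Finset.mem_range.1 hj)
      rw [Finset.sum_const, Finset.card_range, nsmul_eq_mul] at this
      linarith
    · push Not at hgood
      obtain ⟨j, hj, hn⟩ := hgood
      have h1 := Finset.single_le_sum (f := fun j => 1 - ind (D1 (B j) m ω))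
        (fun i _ => hterm i) (Finset.mem_range.2 (Nat.lt_succ_of_le hj))
      simp only [ind_false hn] at h1
      have h2 : 0 ≤ (L : ℝ) * Real.exp (-((m * m : ℕ) * q)) := by positivity
      have h3 := rE_nonneg hu (s := s)
        (f := fun η => ind (∃ x ∈ B 0, ∃ y ∈ B L, Lk (↑(ω ∪ η)) x y)) fun η _ => ind_nonneg _
      linarith
  refine le_trans ?_ (rE_mono hw key)
  rw [rE_sub, rE_const, rE_sum]
  have : ∀ j ∈ Finset.range (L + 1), rE s w (fun ω => 1 - ind (D1 (B j) m ω)) ≤ η := by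
    intro j hj
    rw [rE_sub, rE_const]
    linarith [hE j (Nat.lt_succ_iff.1 (Finset.mem_range.1 hj))]
  have := Finset.sum_le_sum this
  rw [Finset.sum_const, Finset.card_range, nsmul_eq_mul] at this
  push_cast at this ⊢
  linarith

end

section
variable {U : Type*} [DecidableEq U] [AddCommGroup U]

theorem D1_tr (z : U) (B : Finset U) (m : ℕ) (ω : Finset (Sym2 U)) :
    D1 (B.map (tr z)) m (ω.map (tr z).sym2Map) ↔ D1 B m ω := by
  have hcard : ∀ x, ((B.map (tr z)).filter fun y =>
      Lk (↑(ω.map (tr z).sym2Map)) (x + z) y).card = (B.filter fun y => Lk (↑ω) x y).card := by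
    intro x
    rw [Finset.filter_map, Finset.card_map]
    congr 1
    refine Finset.filter_congr fun y _ => ?_
    simp only [Function.comp, tr_apply, lk_tr]
  constructor
  · rintro ⟨x, hx⟩
    exact ⟨x - z, by rw [← hcard, sub_add_cancel]; exact hx⟩
  · rintro ⟨x, hx⟩
    exact ⟨x + z, by rw [hcard]; exact hx⟩

theorem rE_D1_tr {w : Sym2 U → ℝ} (hw : TI w) (z : U) (Λ B : Finset U) (m : ℕ) :
    rE (Λ.map (tr z)).sym2 w (fun ω => ind (D1 (B.map (tr z)) m ω)) =
      rE Λ.sym2 w (fun ω => ind (D1 B m ω)) := by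
  rw [rE_tr hw]
  exact congrArg _ (funext fun ω => ind_congr (D1_tr z B m ω))

end

namespace Kernel
variable {d : ℕ} {α : ℝ} {κ : Kernel d α}

set_option maxHeartbeats 2000000 in
/-- Below criticality a box rarely meets a cluster in more points than the square root of the
inverse long-range connection rate. -/
theorem Ctx.box_bound (h : κ.Ctx) (hP : κ.Poly) {ε : ℝ} (hε : 0 < ε) (hε1 : ε ≤ 1 / 2) :
    ∀ᶠ r in atTop, ∀ β : ℝ, κ.betaC / 2 ≤ β → β ≤ κ.betaC → ∀ m : ℕ,
      r ^ (((d : ℝ) + α) / 2 + ((d : ℝ) + α + 1) * ε) ≤ (m : ℝ) → ∀ Λ : Finset (V d),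
      rE Λ.sym2 (β • κ.wc r) (fun ω => ind (D1 (bx d (r ^ (1 + ε))) m ω)) ≤ 1 - r ^ (-ε) := by
  obtain ⟨C, c, hC, hc, hsp⟩ := h.wc_sub_ge
  have hs := h.one_lt
  set s : ℝ := (d : ℝ) + α with hsdef
  have hb := h.pos
  have hC0 : 0 < C := by linarith
  have hT : Tendsto (fun r : ℝ => 6 * C * r ^ (1 + ε)) atTop atTop :=
    (tendsto_rpow_atTop (by linarith)).const_mul_atTop (by linarith)
  set k₀ : ℝ := κ.betaC / 2 * (c * (6 * C) ^ (-s)) with hk₀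
  have hk₀0 : 0 < k₀ := by positivity
  filter_upwards [hT.eventually hsp, hT.eventually (h.tail hP (show 0 < ε / 4 by linarith) (d + 1)),
    eventually_ge_atTop 1, eventually_exp_le hε ε,
    eventually_mul_rpow_le 12 (show -(ε / 2) < 0 by linarith),
    eventually_mul_rpow_le (2 * (6 * C) ^ (1 + ε / 4))
      (show (1 + ε) * (1 + ε / 4) < 1 + 3 / 2 * ε by nlinarith),
    eventually_rpow_le_mul hk₀0 (show ε < (s + 2) * ε by nlinarith),
    eventually_mul_rpow_le (8 * 3 ^ d) (show -(1 + ε) < 0 by linarith)]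
    with r hsp htail hr1 hexp h12 hdist hqm h3d β hβ1 hβ2 m hm Λ
  by_contra hcon
  push Not at hcon
  have hr : 0 < r := by linarith
  rw [Real.rpow_zero] at h12 h3d
  set R : ℝ := r ^ (1 + ε) with hR
  have hR0 : 0 < R := Real.rpow_pos_of_pos hr _
  have hR1 : 1 ≤ R := Real.one_le_rpow hr1 (by linarith)
  have hrR : r ≤ R := by
    calc r = r ^ (1 : ℝ) := (Real.rpow_one r).symm
      _ ≤ R := Real.rpow_le_rpow_of_exponent_le hr1 (by linarith)
  set r' : ℝ := 6 * C * R with hr'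
  have hRr' : R ≤ r' := by nlinarith
  have hr'0 : 0 < r' := by linarith
  have hβ : 0 < β := by linarith
  set N : ℕ := ⌈3 * R⌉₊ with hN
  have hN1 : 3 * R ≤ N := Nat.le_ceil _
  have hN2 : (N : ℝ) < 3 * R + 1 := Nat.ceil_lt_add_one (by positivity)
  set L : ℕ := ⌈r ^ (ε / 2)⌉₊ with hL
  have hr2 : 1 ≤ r ^ (ε / 2) := Real.one_le_rpow hr1 (by linarith)
  have hL1 : r ^ (ε / 2) ≤ L := Nat.le_ceil _
  have hL2 : (L : ℝ) < r ^ (ε / 2) + 1 := Nat.ceil_lt_add_one (by linarith)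
  have : Nonempty (Fin d) := ⟨⟨0, h.hd⟩⟩
  set z : ℕ → V d := fun j _ => (j : ℤ) * N with hz
  have hznorm : ∀ j : ℕ, ‖z j‖ = j * N := fun j => by
    refine (pi_norm_const (ι := Fin d) ((j : ℤ) * (N : ℤ))).trans ?_
    rw [norm_mul, Int.norm_natCast, Int.norm_natCast]
  have hzsub : ∀ j, z (j + 1) - z j = z 1 := fun j => by
    funext i; simp only [z, Pi.sub_apply]; push_cast; ring
  set B : ℕ → Finset (V d) := fun j => (bx d R).map (tr (z j)) with hB
  have hmemB : ∀ j y, y ∈ B j → ‖y - z j‖ ≤ R := by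
    intro j y hy
    obtain ⟨x, hx, rfl⟩ := Finset.mem_map.1 hy
    rw [tr_apply, add_sub_cancel_right]
    exact (mem_bx hR0.le).1 hx
  set Λ' : Finset (V d) := (Finset.range (L + 1)).biUnion fun j => (Λ ∪ bx d R).map (tr (z j))
    with hΛ'
  have hsub : ∀ j ≤ L, (Λ ∪ bx d R).map (tr (z j)) ⊆ Λ' := fun j hj =>
    Finset.subset_biUnion_of_mem (fun j => (Λ ∪ bx d R).map (tr (z j)))
      (Finset.mem_range.2 (Nat.lt_succ_of_le hj))
  have hBΛ : ∀ j ≤ L, B j ⊆ Λ' := fun j hj =>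
    (Finset.map_subset_map.2 Finset.subset_union_right).trans (hsub j hj)
  have hw : (0 : Sym2 (V d) → ℝ) ≤ β • κ.wc r := κ.smul_wc_nonneg hβ.le r
  have hmono : κ.wc r ≤ κ.wc r' := κ.wc_mono hr (hrR.trans hRr')
  have hu : (0 : Sym2 (V d) → ℝ) ≤ β • (κ.wc r' - κ.wc r) :=
    smul_nonneg hβ.le (sub_nonneg.2 hmono)
  have hdisj : ∀ j < L, Disjoint (B j) (B (j + 1)) := by
    intro j _
    rw [Finset.disjoint_left]
    intro y h1 h2
    have e1 := hmemB _ _ h1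
    have e2 := hmemB _ _ h2
    have e3 : ‖z 1‖ ≤ ‖y - z j‖ + ‖y - z (j + 1)‖ := by
      rw [← hzsub j]
      calc ‖z (j + 1) - z j‖ = ‖(y - z j) - (y - z (j + 1))‖ := by congr 1; abel
        _ ≤ _ := norm_sub_le _ _
    rw [hznorm, Nat.cast_one, one_mul] at e3
    linarith
  set q : ℝ := k₀ * R ^ (-s) with hq
  have hq0 : 0 ≤ q := by positivity
  have hqr : q = κ.betaC / 2 * (c * r' ^ (-s)) := by
    rw [hq, hk₀, hr', Real.mul_rpow (by positivity) hR0.le]; ring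
  have hchain := rE_chain hw hu (s := Λ'.sym2) (L := L) (m := m) (by
      have h1 : (1 : ℝ) ≤ r ^ (s / 2 + (s + 1) * ε) := Real.one_le_rpow hr1 (by positivity)
      exact_mod_cast h1.trans hm) (B := B) (q := q) (η := r ^ (-ε)) hq0 hdisj (by
      intro j hj a ha b hb
      refine ⟨Finset.mk_mem_sym2_iff.2 ⟨hBΛ j hj.le ha, hBΛ (j + 1) hj hb⟩, ?_⟩
      have hne : a ≠ b := fun hab => Finset.disjoint_left.1 (hdisj j hj) ha (hab ▸ hb)
      have e1 := hmemB _ _ ha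
      have e2 := hmemB _ _ hb
      have e3 : ‖a - b‖ ≤ 6 * R := by
        have : ‖a - b‖ ≤ ‖a - z j‖ + ‖b - z (j + 1)‖ + ‖z 1‖ := by
          rw [← hzsub j]
          calc ‖a - b‖ = ‖(a - z j) - (b - z (j + 1)) - (z (j + 1) - z j)‖ := by congr 1; abel
            _ ≤ ‖(a - z j) - (b - z (j + 1))‖ + ‖z (j + 1) - z j‖ := norm_sub_le _ _
            _ ≤ _ := add_le_add (norm_sub_le _ _) le_rfl
        rw [hznorm, Nat.cast_one, one_mul] at this
        linarith
      have e4 := hsp r hr (by nlinarith) a b hne (by rw [hr']; nlinarith)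
      rw [Pi.smul_apply, smul_eq_mul, hqr, Pi.sub_apply]
      exact mul_le_mul hβ1 e4 (by positivity) hβ.le) (by
      intro j hj
      refine hcon.le.trans ?_
      rw [← rE_D1_tr ((κ.wc_TI r).smul β) (z j)]
      exact rE_mono_set hw (Finset.sym2_mono ((Finset.map_subset_map.2
        Finset.subset_union_left).trans (hsub j hj))) (ind_monotone (D1_monotone _ m)))
  have hwu : (fun e => (β • κ.wc r) e + (β • (κ.wc r' - κ.wc r)) e) = β • κ.wc r' := by
    funext e
    simp only [Pi.smul_apply, Pi.sub_apply, smul_eq_mul]; ring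
  rw [hwu] at hchain
  have hw' : (0 : Sym2 (V d) → ℝ) ≤ β • κ.wc r' := κ.smul_wc_nonneg hβ.le r'
  have hwc' : β • κ.wc r' ≤ κ.betaC • κ.wc r' :=
    smul_le_smul_of_nonneg_right hβ2 (κ.wc_nonneg r')
  have hLone : (1 : ℝ) ≤ L := hr2.trans hL1
  have hfar : ∀ x ∈ B 0, ∀ y ∈ B L, r' ^ (1 + ε / 4) < ‖y - x‖ := by
    intro x hx y hy
    have e1 := hmemB _ _ hx
    have e2 := hmemB _ _ hy
    have e3 : ‖z L‖ ≤ ‖y - x‖ + ‖x - z 0‖ + ‖y - z L‖ := by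
      have hz0 : z 0 = 0 := by funext i; simp [z]
      calc ‖z L‖ = ‖(y - x) + (x - z 0) - (y - z L)‖ := by rw [hz0]; congr 1; abel
        _ ≤ ‖(y - x) + (x - z 0)‖ + ‖y - z L‖ := norm_sub_le _ _
        _ ≤ _ := add_le_add (norm_add_le _ _) le_rfl
    rw [hznorm] at e3
    have e4 : (L : ℝ) * (3 * R) ≤ L * N := mul_le_mul_of_nonneg_left hN1 (by linarith)
    have e5 : (L : ℝ) * R ≤ ‖y - x‖ := by nlinarith
    have e6 : r ^ (1 + 3 / 2 * ε) ≤ L * R := by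
      have : r ^ (1 + 3 / 2 * ε) = r ^ (ε / 2) * R := by
        rw [hR, ← Real.rpow_add hr]; congr 1; ring
      rw [this]
      exact mul_le_mul_of_nonneg_right hL1 hR0.le
    have e7 : r' ^ (1 + ε / 4) = (6 * C) ^ (1 + ε / 4) * r ^ ((1 + ε) * (1 + ε / 4)) := by
      rw [hr', Real.mul_rpow (by positivity) hR0.le, hR, ← Real.rpow_mul hr.le]
    have e8 : 0 < r' ^ (1 + ε / 4) := Real.rpow_pos_of_pos hr'0 _
    have e9 : 2 * r' ^ (1 + ε / 4) ≤ r ^ (1 + 3 / 2 * ε) := by rw [e7, ← mul_assoc]; exact hdist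
    linarith
  have hupper : rE Λ'.sym2 (β • κ.wc r') (fun ω => ind (∃ x ∈ B 0, ∃ y ∈ B L, Lk (↑ω) x y)) ≤
      1 / 8 := by
    have e1 : ∀ ω ⊆ Λ'.sym2, ind (∃ x ∈ B 0, ∃ y ∈ B L, Lk (↑ω) x y) ≤
        ∑ x ∈ B 0, ind (∃ y ∈ Λ', Lk (↑ω) x y ∧ r' ^ (1 + ε / 4) < ‖y - x‖) := by
      intro ω _
      by_cases hex : ∃ x ∈ B 0, ∃ y ∈ B L, Lk (↑ω) x y
      · rw [ind_true hex]
        obtain ⟨x, hx, y, hy, hl⟩ := hex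
        have := Finset.single_le_sum
          (f := fun x => ind (∃ y ∈ Λ', Lk (↑ω) x y ∧ r' ^ (1 + ε / 4) < ‖y - x‖))
          (fun i _ => ind_nonneg _) hx
        refine le_trans (le_of_eq ?_) this
        exact (ind_true ⟨y, hBΛ L le_rfl hy, hl, hfar x hx y hy⟩).symm
      · rw [ind_false hex]
        exact Finset.sum_nonneg fun i _ => ind_nonneg _
    refine (rE_mono hw' e1).trans ?_
    rw [rE_sum]
    have e2 := Finset.sum_le_sum fun x (_ : x ∈ B 0) => htail _ hw' hwc' Λ' x
    refine e2.trans ?_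
    rw [Finset.sum_const, nsmul_eq_mul, hB, Finset.card_map]
    have e3 : r' ^ (-((d : ℝ) + 1)) ≤ R ^ (-((d : ℝ) + 1)) :=
      Real.rpow_le_rpow_of_nonpos hR0 hRr' (by linarith [(Nat.cast_nonneg d : (0 : ℝ) ≤ d)])
    have e4 : (3 * R) ^ d * R ^ (-((d : ℝ) + 1)) = 3 ^ d * r ^ (-(1 + ε)) := by
      rw [mul_pow, mul_assoc, ← Real.rpow_natCast R d, ← Real.rpow_add hR0,
        show (d : ℝ) + -((d : ℝ) + 1) = -1 by ring, hR, ← Real.rpow_mul hr.le]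
      congr 2; ring
    calc _ ≤ (3 * R) ^ d * R ^ (-((d : ℝ) + 1)) :=
          mul_le_mul (card_bx_le hR1) e3 (by positivity) (by positivity)
      _ ≤ 1 / 8 := by rw [e4]; linarith
  have hmq : r ^ ε ≤ (m * m : ℕ) * q := by
    have e1 : r ^ (s / 2 + (s + 1) * ε) * r ^ (s / 2 + (s + 1) * ε) ≤ (m : ℝ) * m :=
      mul_le_mul hm hm (by positivity) (by positivity)
    push_cast
    calc r ^ ε ≤ k₀ * r ^ ((s + 2) * ε) := hqm
      _ = (r ^ (s / 2 + (s + 1) * ε) * r ^ (s / 2 + (s + 1) * ε)) * q := by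
          rw [hq, hR, ← Real.rpow_mul hr.le, ← Real.rpow_add hr, mul_left_comm, ← Real.rpow_add hr]
          congr 2; ring
      _ ≤ _ := mul_le_mul_of_nonneg_right e1 hq0
  have hx : r ^ (ε / 2) * r ^ (-ε) = r ^ (-(ε / 2)) := by
    rw [← Real.rpow_add hr]; congr 1; ring
  have hη : 0 < r ^ (-ε) := Real.rpow_pos_of_pos hr _
  have f1 : ((L : ℝ) + 1) * r ^ (-ε) ≤ 3 * r ^ (-(ε / 2)) := by
    rw [← hx, ← mul_assoc]
    exact mul_le_mul_of_nonneg_right (by linarith) hη.le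
  have f2 : (L : ℝ) * Real.exp (-((m * m : ℕ) * q)) ≤ 2 * r ^ (-(ε / 2)) := by
    calc _ ≤ (2 * r ^ (ε / 2)) * r ^ (-ε) := mul_le_mul (by linarith)
          ((Real.exp_le_exp.2 (neg_le_neg hmq)).trans hexp) (Real.exp_pos _).le (by positivity)
      _ = _ := by rw [mul_assoc, hx]
  linarith

end Kernel

namespace Kernel
variable {d : ℕ} {α : ℝ} {κ : Kernel d α}

theorem Ctx.moments_le (h : κ.Ctx) (hP : κ.Poly) {ε : ℝ} (hε : 0 < ε) {k j : ℕ} (hj : j ≠ 0) :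
    ∀ᶠ r in atTop, ∀ w : Sym2 (V d) → ℝ, 0 ≤ w → w ≤ κ.betaC • κ.wc r →
      Am (k + j) w ≤ ENNReal.ofReal ((r ^ (((d : ℝ) + α) / 2 + ε)) ^ j) * Am k w := by
  set s : ℝ := (d : ℝ) + α with hs
  have hs1 : 1 < s := h.one_lt
  obtain ⟨ε₁, h1, h2, h3⟩ : ∃ ε₁ : ℝ, 0 < ε₁ ∧ ε₁ ≤ 1 / 2 ∧ (s + 5) * ε₁ < ε := by
    refine ⟨min (1 / 2) (ε / (s + 6)), by positivity, min_le_left _ _, ?_⟩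
    have e1 : min (1 / 2) (ε / (s + 6)) ≤ ε / (s + 6) := min_le_right _ _
    have e2 : (s + 5) * (ε / (s + 6)) < ε := by
      rw [← mul_div_assoc, div_lt_iff₀ (by linarith)]
      nlinarith
    exact (mul_le_mul_of_nonneg_left e1 (by linarith)).trans_lt e2
  filter_upwards [h.box_bound hP h1 h2, h.tight hP h1 (k := k) (j := j) (by omega),
    eventually_ge_atTop (2 : ℝ),
    eventually_le_rpow 2 (show 0 < s / 2 + (s + 1) * ε₁ by nlinarith),
    eventually_mul_rpow_le 4 (show s / 2 + (s + 5) * ε₁ < s / 2 + ε by linarith)]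
    with r hbox htight hr2 hm2 h4 w hw hwr
  have hr : 0 < r := by linarith
  set y := r ^ (s / 2 + (s + 1) * ε₁) with hy
  set m := ⌈y⌉₊ with hm
  have hy0 : 0 < y := by linarith
  have hmy : y ≤ (m : ℝ) := Nat.le_ceil y
  have hmle : (m : ℝ) ≤ 2 * y := by
    have := Nat.ceil_lt_add_one hy0.le
    linarith
  have hm2' : 2 ≤ m := by
    have : (2 : ℝ) ≤ m := hm2.trans hmy
    exact_mod_cast this
  have hD : ∀ Λ : Finset (V d),
      rE Λ.sym2 w (fun ω => ind (D1 (bx d (r ^ (1 + ε₁))) m ω)) ≤ 1 - r ^ (-ε₁) := fun Λ =>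
    (rE_mono_rate hw hwr (ind_monotone (D1_monotone _ _))).trans
      (hbox κ.betaC (by linarith [h.pos]) le_rfl m hmy Λ)
  refine (htight w hw hwr m hm2' hD).trans ?_
  set X := (m : ℝ) * r ^ (4 * ε₁) with hX
  have hX1 : 1 ≤ X := by
    have e1 : (1 : ℝ) ≤ r ^ (4 * ε₁) := Real.one_le_rpow (by linarith) (by positivity)
    have e2 : (1 : ℝ) ≤ m := by linarith
    nlinarith
  have hX2 : 2 * X ≤ r ^ (s / 2 + ε) := by
    refine le_trans ?_ h4
    have : r ^ (s / 2 + (s + 5) * ε₁) = y * r ^ (4 * ε₁) := by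
      rw [hy, ← Real.rpow_add hr]; congr 1; ring
    rw [this, hX]
    have := Real.rpow_nonneg hr.le (4 * ε₁)
    nlinarith
  have hXj : 1 ≤ X ^ j := one_le_pow₀ hX1
  have hA := one_le_Am hw k
  calc ENNReal.ofReal (X ^ j) * Am k w + 1
      ≤ ENNReal.ofReal (X ^ j) * Am k w + ENNReal.ofReal (X ^ j) * Am k w := by
        refine add_le_add le_rfl ?_
        have : (1 : ℝ≥0∞) ≤ ENNReal.ofReal (X ^ j) := by
          rw [← ENNReal.ofReal_one]; exact ENNReal.ofReal_le_ofReal hXj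
        calc (1 : ℝ≥0∞) = 1 * 1 := (one_mul _).symm
          _ ≤ _ := mul_le_mul' this hA
    _ = ENNReal.ofReal (2 * X ^ j) * Am k w := by
        rw [← add_mul, ← ENNReal.ofReal_add (by positivity) (by positivity), two_mul]
    _ ≤ _ := by
        refine mul_le_mul' (ENNReal.ofReal_le_ofReal ?_) le_rfl
        calc 2 * X ^ j ≤ 2 ^ j * X ^ j := by
              refine mul_le_mul_of_nonneg_right ?_ (by linarith)
              exact le_self_pow₀ (by norm_num) hj
          _ = (2 * X) ^ j := (mul_pow _ _ _).symm
          _ ≤ _ := pow_le_pow_left₀ (by linarith) hX2 j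

set_option maxHeartbeats 1000000 in
theorem Ctx.chi_cut_le (h : κ.Ctx) (hP : κ.Poly) {ε : ℝ} (hε : 0 < ε) :
    ∀ᶠ r in atTop, Am 1 (κ.betaC • κ.wc r) ≤ ENNReal.ofReal (r ^ (α + ε)) := by
  set s : ℝ := (d : ℝ) + α with hs
  have hs1 : 1 < s := h.one_lt
  set δ := ε / 6 with hδ
  have hδ0 : 0 < δ := by positivity
  obtain ⟨A, hA, hpoly⟩ := id hP
  have h2 : Tendsto (fun r : ℝ => 2 * r) atTop atTop :=
    tendsto_id.const_mul_atTop (by norm_num)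
  have hbc := h.pos
  filter_upwards [h2.eventually (h.moments_le hP hδ0 (k := 1) (j := 2) two_ne_zero),
    h2.eventually hpoly, h.rc_le_rpow hδ0, h.rs_dk_ge hδ0, eventually_ge_atTop (2 : ℝ),
    eventually_mul_rpow_le (κ.betaC * 2 ^ (s + 2 * δ)) (show -δ < 0 by linarith),
    eventually_le_rpow (6 / κ.betaC) hδ0, eventually_exp_le (show 0 < 3 * δ by positivity) (A + 1),
    eventually_le_rpow 2 hδ0, eventually_mul_rpow_le (2 ^ A + 1) (show A < A + 1 by linarith)]
    with r hmom hpol hrc hdk hr2 hMY h6 hexp hr2' h2A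
  have hr : 0 < r := by linarith
  by_contra! hcon
  set n := ⌈r ^ (4 * δ)⌉₊ with hn
  have hy1 : 1 ≤ r ^ (4 * δ) := Real.one_le_rpow (by linarith) (by positivity)
  have hny : r ^ (4 * δ) ≤ (n : ℝ) := Nat.le_ceil _
  have hnle : (n : ℝ) ≤ 2 * r ^ (4 * δ) := by
    have := Nat.ceil_lt_add_one (show 0 ≤ r ^ (4 * δ) by linarith)
    linarith
  have hn0 : (0 : ℝ) < n := by linarith
  set c := κ.betaC / n with hc
  have hc0 : 0 < c := by positivity
  have hdk0 := dk_nonneg (κ := κ) hr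
  set W : ℕ → Sym2 (V d) → ℝ := fun i => κ.betaC • κ.wc r + ((i : ℝ) * c) • κ.dk r with hW
  have hcd : 0 ≤ c • κ.dk r := smul_nonneg hc0.le hdk0
  have hWs : ∀ i, W (i + 1) = W i + c • κ.dk r := fun i => by
    simp only [hW]; push_cast; rw [add_assoc, ← add_smul]; congr 2; ring
  have hW0 : ∀ i, 0 ≤ W i := fun i =>
    add_nonneg (smul_wc_nonneg κ hbc.le r) (smul_nonneg (by positivity) hdk0)
  have hWT : ∀ i, TI (W i) := fun i => ((wc_TI κ r).smul _).add ((dk_TI r).smul _)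
  have hWle : ∀ i, i ≤ n → W i ≤ κ.betaC • κ.wc (2 * r) := fun i hi => by
    rw [← wc_add_dk, smul_add]
    refine add_le_add le_rfl (smul_le_smul_of_nonneg_right ?_ hdk0)
    rw [hc, ← mul_div_assoc, div_le_iff₀ hn0, mul_comm]
    exact mul_le_mul_of_nonneg_left (by exact_mod_cast hi) hbc.le
  have hstep : ∀ i, i + 1 ≤ n → 2 * Am 1 (W i) ≤ Am 1 (W (i + 1)) := fun i hi => by
    have hL := chi_add_ge (hW0 i) hcd (hWT i) ((dk_TI r).smul c)
      (M := c * r ^ (-s + δ)) (fun e => by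
        rw [Pi.smul_apply, smul_eq_mul]
        exact mul_le_mul_of_nonneg_left ((dk_le_rc hr e).trans (hrc e)) hc0.le)
    rw [← hWs] at hL
    have h3 := hmom (W (i + 1)) (hW0 _) (hWle _ hi)
    have hb : ENNReal.ofReal (c * r ^ (-s + δ)) * Am 3 (W (i + 1)) ≤ Am 1 (W (i + 1)) := by
      calc _ ≤ ENNReal.ofReal (c * r ^ (-s + δ)) *
            (ENNReal.ofReal (((2 * r) ^ (s / 2 + δ)) ^ 2) * Am 1 (W (i + 1))) :=
            mul_le_mul' le_rfl h3
        _ = ENNReal.ofReal (c * r ^ (-s + δ) * ((2 * r) ^ (s / 2 + δ)) ^ 2) * Am 1 (W (i + 1)) := by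
            rw [← mul_assoc, ← ENNReal.ofReal_mul (by positivity)]
        _ ≤ 1 * Am 1 (W (i + 1)) := by
            refine mul_le_mul' ?_ le_rfl
            rw [← ENNReal.ofReal_one]
            refine ENNReal.ofReal_le_ofReal ?_
            rw [Real.rpow_zero] at hMY
            refine le_trans ?_ hMY
            have e1 : ((2 * r) ^ (s / 2 + δ)) ^ 2 = 2 ^ (s + 2 * δ) * r ^ (s + 2 * δ) := by
              rw [← Real.rpow_natCast, ← Real.rpow_mul (by positivity),
                ← Real.mul_rpow (by norm_num) hr.le]
              congr 1; push_cast; ring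
            have e2 : c ≤ κ.betaC * r ^ (-(4 * δ)) := by
              rw [hc, div_le_iff₀ hn0, Real.rpow_neg hr.le, mul_assoc]
              refine le_mul_of_one_le_right hbc.le ?_
              rw [← div_eq_inv_mul, le_div_iff₀ (by linarith), one_mul]
              exact hny
            have e3 : r ^ (-(4 * δ)) * (r ^ (-s + δ) * r ^ (s + 2 * δ)) = r ^ (-δ) := by
              rw [← Real.rpow_add hr, ← Real.rpow_add hr]; congr 1; ring
            rw [e1]
            calc _ ≤ (κ.betaC * r ^ (-(4 * δ))) * r ^ (-s + δ) *
                  (2 ^ (s + 2 * δ) * r ^ (s + 2 * δ)) := by gcongr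
              _ = κ.betaC * 2 ^ (s + 2 * δ) *
                  (r ^ (-(4 * δ)) * (r ^ (-s + δ) * r ^ (s + 2 * δ))) := by ring
              _ = _ := by rw [e3]
        _ = _ := one_mul _
    have ha : ENNReal.ofReal (r ^ (α + ε)) ≤ Am 1 (W i) :=
      hcon.le.trans (Am_mono_rate (smul_wc_nonneg κ hbc.le r)
        (le_add_of_nonneg_right (smul_nonneg (by positivity) hdk0)) 1)
    have hq : 3 ≤ rs (c • κ.dk r) * Am 1 (W i) := by
      rw [rs_smul hc0.le]
      calc (3 : ℝ≥0∞) = ENNReal.ofReal 3 := by norm_num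
        _ ≤ ENNReal.ofReal (c * r ^ (-α - δ) * r ^ (α + ε)) := by
            refine ENNReal.ofReal_le_ofReal ?_
            have e1 : κ.betaC / 2 * r ^ (-(4 * δ)) ≤ c := by
              rw [hc, le_div_iff₀ hn0, Real.rpow_neg hr.le]
              calc κ.betaC / 2 * (r ^ (4 * δ))⁻¹ * n
                  ≤ κ.betaC / 2 * (r ^ (4 * δ))⁻¹ * (2 * r ^ (4 * δ)) := by gcongr
                _ = κ.betaC := by field_simp
            have e2 : r ^ (-(4 * δ)) * r ^ (-α - δ) * r ^ (α + ε) = r ^ δ := by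
              rw [← Real.rpow_add hr, ← Real.rpow_add hr]; congr 1; rw [hδ]; ring
            calc (3 : ℝ) = κ.betaC / 2 * (6 / κ.betaC) := by field_simp; norm_num
              _ ≤ κ.betaC / 2 * r ^ δ := mul_le_mul_of_nonneg_left h6 (by positivity)
              _ = (κ.betaC / 2 * r ^ (-(4 * δ))) * r ^ (-α - δ) * r ^ (α + ε) := by
                  rw [← e2]; ring
              _ ≤ _ := by gcongr
        _ = ENNReal.ofReal c * ENNReal.ofReal (r ^ (-α - δ)) * ENNReal.ofReal (r ^ (α + ε)) := by
            rw [ENNReal.ofReal_mul (by positivity), ENNReal.ofReal_mul hc0.le]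
        _ ≤ _ := mul_le_mul' (mul_le_mul' le_rfl hdk) ha
    have h4 : 2 * (2 * Am 1 (W i)) ≤ 2 * Am 1 (W (i + 1)) := by
      calc 2 * (2 * Am 1 (W i)) = Am 1 (W i) + 3 * Am 1 (W i) := by ring
        _ ≤ Am 1 (W i) + rs (c • κ.dk r) * (Am 1 (W i) * Am 1 (W i)) := by
            rw [← mul_assoc]; exact add_le_add le_rfl (mul_le_mul' hq le_rfl)
        _ ≤ _ := hL
        _ ≤ Am 1 (W (i + 1)) + Am 1 (W (i + 1)) := add_le_add le_rfl hb
        _ = _ := (two_mul _).symm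
    exact (ENNReal.mul_le_mul_iff_right two_ne_zero (by norm_num)).1 h4
  have hind : ∀ i, i ≤ n → (2 : ℝ≥0∞) ^ i ≤ Am 1 (W i) := by
    intro i
    induction i with
    | zero => intro _; rw [pow_zero]; exact one_le_Am (hW0 0) 1
    | succ i ih =>
      intro hi
      rw [pow_succ']
      exact (mul_le_mul' le_rfl (ih (by omega))).trans (hstep i hi)
  have hfin : (2 : ℝ≥0∞) ^ n ≤ ENNReal.ofReal ((2 * r) ^ A) :=
    (hind n le_rfl).trans ((Am_mono_rate (hW0 n) (hWle n le_rfl) 1).trans hpol)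
  have hfin' : (2 : ℝ) ^ n ≤ (2 * r) ^ A := by
    refine (ENNReal.ofReal_le_ofReal_iff (by positivity)).1 ?_
    rwa [ENNReal.ofReal_pow (by norm_num), show ENNReal.ofReal 2 = 2 by norm_num]
  have hlow : Real.exp (r ^ (3 * δ)) ≤ 2 ^ n := by
    have e1 : Real.exp (1 / 2) ≤ 2 := by
      have := Real.exp_one_lt_d9
      have h5 : Real.exp (1 / 2) ^ 2 = Real.exp 1 := by
        rw [← Real.exp_nat_mul]; norm_num
      nlinarith [Real.exp_pos (1 / 2)]
    calc Real.exp (r ^ (3 * δ)) ≤ Real.exp ((n : ℝ) * (1 / 2)) := by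
          refine Real.exp_le_exp.2 ?_
          have : r ^ (4 * δ) = r ^ δ * r ^ (3 * δ) := by
            rw [← Real.rpow_add hr]; congr 1; ring
          have h7 := Real.rpow_nonneg hr.le (3 * δ)
          nlinarith
      _ = Real.exp (1 / 2) ^ n := Real.exp_nat_mul _ _
      _ ≤ 2 ^ n := pow_le_pow_left₀ (Real.exp_pos _).le e1 n
  have hup : r ^ (A + 1) ≤ Real.exp (r ^ (3 * δ)) := by
    rw [Real.exp_neg, Real.rpow_neg hr.le] at hexp
    exact (inv_le_inv₀ (Real.exp_pos _) (by positivity)).1 hexp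
  have : r ^ (A + 1) ≤ (2 * r) ^ A := hup.trans (hlow.trans hfin')
  rw [Real.mul_rpow (by norm_num) hr.le] at this
  have h8 : (2 : ℝ) ^ A * r ^ A < r ^ (A + 1) := by
    have := Real.rpow_pos_of_pos hr A
    linarith
  linarith

end Kernel

section
variable {U : Type*} [DecidableEq U] [AddCommGroup U]

theorem gy_ind_add_le {w u : Sym2 U → ℝ} (hw : 0 ≤ w) (hu : 0 ≤ u) (tw : TI w) (tu : TI u)
    {M : ℝ} (hM : ∀ e, u e ≤ M) (B : Finset U) :
    gy (fun x => if x ∈ B then 1 else 0) (w + u) ≤ gy (fun x => if x ∈ B then 1 else 0) w +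
      ENNReal.ofReal M * ((B.card : ℝ≥0∞) * (Am 1 (w + u) * Am 1 (w + u))) := by
  have hwu : 0 ≤ w + u := add_nonneg hw hu
  have hM0 : 0 ≤ M := (hu s(0, 0)).trans (hM s(0, 0))
  set φ : U → ℝ := fun x => if x ∈ B then 1 else 0 with hφd
  have hφ : 0 ≤ φ := fun x => by
    by_cases hx : x ∈ B <;> simp [hφd, hx]
  refine iSup_le fun Λ => ?_
  refine (ENNReal.ofReal_le_ofReal (cw_add_le Λ hw hu hφ 0)).trans (ENNReal.ofReal_add_le.trans ?_)
  refine add_le_add (le_EV w (fun Λ ω => cw φ Λ ω 0) Λ) ?_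
  have hg : ∀ a, 0 ≤ rE Λ.sym2 (w + u) (fun ω => ci ω 0 a) := fun a =>
    rE_nonneg hwu fun _ _ => ci_nonneg _ _ _
  have hc : ∀ b, 0 ≤ rE Λ.sym2 (w + u) (fun ω => cw φ Λ ω b) := fun a =>
    rE_nonneg hwu fun _ _ => cw_nonneg hφ _ _ _
  have hs : ∀ b, 0 ≤ rE Λ.sym2 (w + u) (fun ω => cs Λ ω b) := fun a =>
    rE_nonneg hwu fun _ _ => cs_nonneg _ _ _
  have e1 : ∑ a ∈ Λ, ∑ b ∈ Λ, u s(a, b) * (rE Λ.sym2 (w + u) (fun ω => ci ω 0 a) *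
      rE Λ.sym2 (w + u) (fun ω => cw φ Λ ω b)) ≤
      M * (rE Λ.sym2 (w + u) (fun ω => cs Λ ω 0) *
        ∑ b ∈ Λ, rE Λ.sym2 (w + u) (fun ω => cw φ Λ ω b)) := by
    have : rE Λ.sym2 (w + u) (fun ω => cs Λ ω 0) =
      ∑ a ∈ Λ, rE Λ.sym2 (w + u) (fun ω => ci ω 0 a) := by rw [← rE_sum]; rfl
    rw [this, Finset.sum_mul_sum, Finset.mul_sum]
    refine Finset.sum_le_sum fun a _ => ?_
    rw [Finset.mul_sum]
    exact Finset.sum_le_sum fun b _ =>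
      mul_le_mul_of_nonneg_right (hM _) (mul_nonneg (hg a) (hc b))
  have e2 : ∑ b ∈ Λ, rE Λ.sym2 (w + u) (fun ω => cw φ Λ ω b) =
      ∑ x ∈ Λ, φ x * rE Λ.sym2 (w + u) (fun ω => cs Λ ω x) := by
    simp only [← rE_const_mul, ← rE_sum]
    congr 1
    funext ω
    simp only [cw, cs]
    rw [Finset.sum_comm]
    refine Finset.sum_congr rfl fun x _ => ?_
    rw [Finset.mul_sum]
    exact Finset.sum_congr rfl fun b _ => by rw [ci_comm]
  have e3 : ∀ b, ENNReal.ofReal (rE Λ.sym2 (w + u) (fun ω => cs Λ ω b)) ≤ Am 1 (w + u) :=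
    fun b => (le_EV (w + u) (fun Λ ω => cs Λ ω b) Λ).trans (EV_cs_base_one (tw.add tu) b).le
  have e4 : ENNReal.ofReal (∑ x ∈ Λ, φ x * rE Λ.sym2 (w + u) (fun ω => cs Λ ω x)) ≤
      (B.card : ℝ≥0∞) * Am 1 (w + u) := by
    rw [ENNReal.ofReal_sum_of_nonneg fun x _ => mul_nonneg (hφ x) (hs x)]
    calc _ ≤ ∑ x ∈ Λ, if x ∈ B then Am 1 (w + u) else 0 := by
          refine Finset.sum_le_sum fun x _ => ?_
          by_cases hx : x ∈ B
          · simp only [hφd, hx, if_true, one_mul]; exact e3 x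
          · simp [hφd, hx]
      _ = ∑ x ∈ Λ.filter (· ∈ B), Am 1 (w + u) := (Finset.sum_filter _ _).symm
      _ ≤ _ := by
          rw [Finset.sum_const, nsmul_eq_mul]
          refine mul_le_mul' ?_ le_rfl
          exact_mod_cast Finset.card_le_card fun x hx => (Finset.mem_filter.1 hx).2
  refine (ENNReal.ofReal_le_ofReal e1).trans ?_
  rw [e2, ENNReal.ofReal_mul hM0, ENNReal.ofReal_mul (hs 0), mul_left_comm (B.card : ℝ≥0∞)]
  exact mul_le_mul' le_rfl (mul_le_mul' (e3 0) e4)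

end

namespace Kernel
variable {d : ℕ} {α : ℝ} {κ : Kernel d α}

/-- The susceptibility as a real number. -/
noncomputable def sus (κ : Kernel d α) (β : ℝ) : ℝ := (Am 1 (β • κ.w0)).toReal

theorem Ctx.tendsto_sus (h : κ.Ctx) :
    Tendsto κ.sus (nhdsWithin κ.betaC (Set.Iio κ.betaC)) atTop := by
  have h1 := κ.tendsto_log_gap
  refine tendsto_atTop.2 fun C => ?_
  set S := (rs κ.w0).toReal
  have h2 : Tendsto (fun β => Real.exp (Real.log (1 / (κ.betaC - β))))
      (nhdsWithin κ.betaC (Set.Iio κ.betaC)) atTop := Real.tendsto_exp_atTop.comp h1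
  filter_upwards [h.eventually_pos, h2.eventually_ge_atTop (4 * S * max C 0)] with β hβ hC
  have hg := sub_pos.2 hβ.2
  rw [Real.exp_log (by positivity), le_div_iff₀ hg] at hC
  have h3 : 1 ≤ 4 * ((κ.betaC - β) * S * κ.sus β) := κ.one_le_gap_mul h.cl.1 hβ.1.le hβ.2
  by_contra! hlt
  have hs0 : 0 ≤ κ.sus β := ENNReal.toReal_nonneg
  have hS0 : 0 ≤ S := ENNReal.toReal_nonneg
  have h4 : κ.sus β < max C 0 := hlt.trans_le (le_max_left _ _)
  rcases hS0.eq_or_lt with h0 | h0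
  · rw [← h0] at h3; norm_num at h3
  · have h5 : (κ.betaC - β) * S * κ.sus β < (κ.betaC - β) * S * max C 0 :=
      mul_lt_mul_of_pos_left h4 (by positivity)
    nlinarith

theorem Ctx.eventually_sus (h : κ.Ctx) {c : ℝ} (hc : 0 < c) {Q : ℝ → Prop}
    (hQ : ∀ᶠ r in atTop, Q r) :
    ∀ᶠ β in nhdsWithin κ.betaC (Set.Iio κ.betaC), Q (κ.sus β ^ c) :=
  ((tendsto_rpow_atTop hc).comp h.tendsto_sus).eventually hQ

theorem Ctx.ofReal_sus (h : κ.Ctx) {β : ℝ} (h0 : 0 < β) (h1 : β < κ.betaC) :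
    Am 1 (β • κ.w0) = ENNReal.ofReal (κ.sus β) :=
  (ENNReal.ofReal_toReal (κ.Am_one_ne_top h0.le h1)).symm

theorem Ctx.one_le_sus (h : κ.Ctx) {β : ℝ} (h0 : 0 < β) (h1 : β < κ.betaC) : 1 ≤ κ.sus β := by
  have := one_le_Am (κ.smul_w0_nonneg h0.le) 1
  rw [h.ofReal_sus h0 h1] at this
  exact ENNReal.one_le_ofReal.1 this

theorem smul_rc_le {β c r M : ℝ} (hβ : 0 ≤ β) (hβc : β ≤ c) (hr : ∀ e, κ.rc r e ≤ M) (hM : 0 ≤ M) :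
    ∀ e, (β • κ.rc r) e ≤ c * M := fun e => by
  rw [Pi.smul_apply, smul_eq_mul]
  exact (mul_le_mul_of_nonneg_left (hr e) hβ).trans (mul_le_mul_of_nonneg_right hβc hM)

theorem rs_rc_le {β c r q : ℝ} (hβ : 0 ≤ β) (hβc : β ≤ c)
    (hr : rs (κ.rc r) ≤ ENNReal.ofReal q) : rs (β • κ.rc r) ≤ ENNReal.ofReal (c * q) := by
  rw [rs_smul hβ, ENNReal.ofReal_mul (hβ.trans hβc)]
  exact mul_le_mul' (ENNReal.ofReal_le_ofReal hβc) hr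

theorem Ctx.zeta_le_one (h : κ.Ctx) : ∀ᶠ β in nhdsWithin κ.betaC (Set.Iio κ.betaC),
    Am 2 (β • κ.w0) ≤ ENNReal.ofReal (κ.sus β ^ (2 : ℝ)) * Am 1 (β • κ.w0) := by
  filter_upwards [h.eventually_pos] with β hβ
  refine (Am_two_le (κ.smul_w0_nonneg hβ.1.le) (κ.w0_TI.smul β)).trans (le_of_eq ?_)
  rw [h.ofReal_sus hβ.1 hβ.2, Real.rpow_two, ENNReal.ofReal_pow (by linarith [h.one_le_sus hβ.1 hβ.2])]
  ring

theorem Ctx.zeta_le_two (h : κ.Ctx) (hP : κ.Poly) {ε : ℝ} (hε : 0 < ε) :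
    ∀ᶠ β in nhdsWithin κ.betaC (Set.Iio κ.betaC),
    Am 2 (β • κ.w0) ≤ ENNReal.ofReal (κ.sus β ^ (((d : ℝ) + α) / 2 / α + ε)) *
      Am 1 (β • κ.w0) := by
  set s : ℝ := (d : ℝ) + α with hs
  have hs1 := h.one_lt
  have hα := h.hα
  have hbc := h.pos
  obtain ⟨δ, hδ, hδ1⟩ : ∃ δ : ℝ, 0 < δ ∧ (s / 2 + δ) * (1 / α + δ) < s / 2 / α + ε := by
    have : Tendsto (fun δ : ℝ => (s / 2 + δ) * (1 / α + δ)) (nhdsWithin 0 (Set.Ioi 0))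
        (nhds ((s / 2 + 0) * (1 / α + 0))) := by
      refine Tendsto.mono_left ?_ nhdsWithin_le_nhds
      exact ((continuous_const.add continuous_id).mul
        (continuous_const.add continuous_id)).tendsto 0
    have h2 := this.eventually (Iio_mem_nhds (show (s / 2 + 0) * (1 / α + 0) < s / 2 / α + ε by
      rw [add_zero, add_zero, mul_one_div]; linarith))
    obtain ⟨δ, h3, h4⟩ := (h2.and self_mem_nhdsWithin).exists
    exact ⟨δ, h4, h3⟩
  obtain ⟨η, hη, hη1⟩ : ∃ η : ℝ, 0 < η ∧ (-α + η) * (1 / α + δ) + 1 < 0 := by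
    refine ⟨α * δ / (2 * (1 / α + δ)), by positivity, ?_⟩
    have e1 : (-α + α * δ / (2 * (1 / α + δ))) * (1 / α + δ) = -1 - α * δ + α * δ / 2 := by
      field_simp; ring
    rw [e1]; nlinarith
  have hc : 0 < 1 / α + δ := by positivity
  filter_upwards [h.eventually_pos, h.eventually_sus hc (h.moments_le hP hδ (k := 1) (j := 1) one_ne_zero),
    h.eventually_sus hc (h.rs_rc hη), h.eventually_sus hc (eventually_gt_atTop 0),
    h.tendsto_sus.eventually (eventually_mul_rpow_le (6 * κ.betaC) hη1),
    h.tendsto_sus.eventually (eventually_mul_rpow_le 2 hδ1)] with β hβ hmom hrs hr hsm hlast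
  have hX := h.one_le_sus hβ.1 hβ.2
  have hA1 := h.ofReal_sus hβ.1 hβ.2
  set X := κ.sus β with hXd
  have hX0 : 0 < X := by linarith
  set r := X ^ (1 / α + δ) with hrd
  have hw := κ.smul_wc_nonneg hβ.1.le r
  have hu : 0 ≤ β • κ.rc r := smul_nonneg hβ.1.le (κ.rc_nonneg hr)
  have h2 := Am_two_add_le hw hu ((κ.wc_TI r).smul β) ((κ.rc_TI r).smul β)
  rw [smul_wc_add_rc] at h2
  have hwle : β • κ.wc r ≤ κ.betaC • κ.wc r :=
    smul_le_smul_of_nonneg_right hβ.2.le (κ.wc_nonneg r)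
  have h3 : 3 * (rs (β • κ.rc r) * (Am 2 (β • κ.w0) * Am 1 (β • κ.w0))) ≤
      2⁻¹ * Am 2 (β • κ.w0) := by
    calc _ = (3 * (rs (β • κ.rc r) * Am 1 (β • κ.w0))) * Am 2 (β • κ.w0) := by ring
      _ ≤ _ := by
        refine mul_le_mul' ?_ le_rfl
        calc _ ≤ 3 * (ENNReal.ofReal (κ.betaC * r ^ (-α + η)) * ENNReal.ofReal X) := by
              rw [hA1]
              exact mul_le_mul' le_rfl (mul_le_mul' (rs_rc_le hβ.1.le hβ.2.le hrs) le_rfl)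
          _ = ENNReal.ofReal (3 * (κ.betaC * r ^ (-α + η) * X)) := by
              rw [← ENNReal.ofReal_mul (mul_nonneg hbc.le (Real.rpow_nonneg hr.le _)),
                ENNReal.ofReal_mul (p := 3) (by norm_num), ENNReal.ofReal_ofNat]
          _ ≤ ENNReal.ofReal 2⁻¹ := by
              refine ENNReal.ofReal_le_ofReal ?_
              have e1 : r ^ (-α + η) * X = X ^ ((-α + η) * (1 / α + δ) + 1) := by
                rw [Real.rpow_add hX0, Real.rpow_one, hrd, ← Real.rpow_mul hX0.le, mul_comm (1 / α + δ)]
              rw [Real.rpow_zero, ← e1] at hsm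
              linarith
          _ = _ := by rw [ENNReal.ofReal_inv_of_pos (by norm_num)]; norm_num
  have hfin : Am 2 (β • κ.w0) ≠ ∞ :=
    ((Am_two_le (κ.smul_w0_nonneg hβ.1.le) (κ.w0_TI.smul β)).trans_lt
      (ENNReal.pow_lt_top (κ.Am_one_ne_top hβ.1.le hβ.2).lt_top)).ne
  have h4 : Am 2 (β • κ.w0) ≤ 2 * Am 2 (β • κ.wc r) := by
    have h5 := h2.trans (add_le_add le_rfl h3)
    have h6 : Am 2 (β • κ.wc r) ≠ ∞ := ((Am_mono_rate hw (smul_le_smul_of_nonneg_left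
      (κ.wc_le_w0 hr) hβ.1.le) 2).trans_lt hfin.lt_top).ne
    have h7 := ENNReal.toReal_mono (ENNReal.add_ne_top.2
      ⟨h6, ENNReal.mul_ne_top (by norm_num) hfin⟩) h5
    rw [ENNReal.toReal_add h6 (ENNReal.mul_ne_top (by norm_num) hfin), ENNReal.toReal_mul,
      ENNReal.toReal_inv] at h7
    rw [← ENNReal.toReal_le_toReal hfin (ENNReal.mul_ne_top (by norm_num) h6), ENNReal.toReal_mul]
    norm_num at h7 ⊢
    linarith
  refine h4.trans ?_
  calc _ ≤ 2 * (ENNReal.ofReal ((r ^ (s / 2 + δ)) ^ 1) * Am 1 (β • κ.w0)) := by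
        refine mul_le_mul' le_rfl ((hmom _ hw hwle).trans (mul_le_mul' le_rfl ?_))
        exact Am_mono_rate hw (smul_le_smul_of_nonneg_left (κ.wc_le_w0 hr) hβ.1.le) 1
    _ = ENNReal.ofReal (2 * r ^ (s / 2 + δ)) * Am 1 (β • κ.w0) := by
        rw [pow_one, ← mul_assoc, ENNReal.ofReal_mul (by norm_num)]; norm_num
    _ ≤ _ := by
        refine mul_le_mul' (ENNReal.ofReal_le_ofReal ?_) le_rfl
        rwa [hrd, ← Real.rpow_mul hX0.le, mul_comm (1 / α + δ)]

end Kernel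

namespace Kernel
variable {d : ℕ} {α : ℝ} {κ : Kernel d α}

theorem Ctx.gy_upper (h : κ.Ctx) (hP : κ.Poly) {p : ℝ} (hp : 0 < p) (hp1 : p ≤ 1) (hpα : p < α)
    {ε : ℝ} (hε : 0 < ε) : ∀ᶠ β in nhdsWithin κ.betaC (Set.Iio κ.betaC),
      gy (fun x => ‖x‖ ^ p) (β • κ.w0) ≤
        ENNReal.ofReal (κ.sus β ^ (p / α + ε)) * Am 1 (β • κ.w0) := by
  have hs1 := h.one_lt
  have hα := h.hα
  have hbc := h.pos
  obtain ⟨C, hC1, hcut⟩ := h.gy_cut hp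
  obtain ⟨δ, hδ, hδ1⟩ : ∃ δ : ℝ, 0 < δ ∧ (1 / α + δ) * (p + α + δ) < p / α + ε + 1 := by
    have : Tendsto (fun δ : ℝ => (1 / α + δ) * (p + α + δ)) (nhdsWithin 0 (Set.Ioi 0))
        (nhds ((1 / α + 0) * (p + α + 0))) := by
      refine Tendsto.mono_left ?_ nhdsWithin_le_nhds
      exact ((continuous_const.add continuous_id).mul
        (continuous_const.add continuous_id)).tendsto 0
    have h2 := this.eventually (Iio_mem_nhds (show
        (1 / α + 0) * (p + α + 0) < p / α + ε + 1 by
      rw [add_zero, add_zero, one_div_mul_eq_div, add_div, div_self hα.ne']; linarith))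
    obtain ⟨δ, h3, h4⟩ := (h2.and self_mem_nhdsWithin).exists
    exact ⟨δ, h4, h3⟩
  have hc : 0 < 1 / α + δ := by positivity
  set c := 1 / α + δ with hcd
  have hcα : c * α = 1 + α * δ := by rw [hcd]; field_simp
  have hcp : c * p = p / α + p * δ := by rw [hcd]; ring
  obtain ⟨η, hη, hη1, hη2⟩ : ∃ η : ℝ, 0 < η ∧ c * η < α * δ ∧ c * η < ε := by
    refine ⟨min (α * δ) ε / (2 * c), by positivity, ?_⟩
    have e1 : c * (min (α * δ) ε / (2 * c)) = min (α * δ) ε / 2 := by field_simp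
    have e2 : 0 < min (α * δ) ε := by positivity
    rw [e1]
    exact ⟨by linarith [min_le_left (α * δ) ε], by linarith [min_le_right (α * δ) ε]⟩
  have hx1 : c * (-α + η) + 1 < 0 := by linarith
  have hx2 : 2 + c * (p - α + η) < p / α + ε + 1 := by
    have : p * δ < α * δ := mul_lt_mul_of_pos_right hpα hδ
    linarith
  filter_upwards [h.eventually_pos, h.eventually_sus hc (h.chi_cut_le hP hδ),
    h.eventually_sus hc (h.rs_rc hη), h.eventually_sus hc (h.rsw_rc hp.le hpα hη),
    h.eventually_sus hc (eventually_ge_atTop 1),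
    h.tendsto_sus.eventually (eventually_mul_rpow_le (4 * κ.betaC) hx1),
    h.tendsto_sus.eventually (eventually_mul_rpow_le (4 * C ^ p) hδ1),
    h.tendsto_sus.eventually (eventually_mul_rpow_le (4 * κ.betaC) hx2)]
    with β hβ hU hrs hrsw hr1 hsm ht1 ht2
  have hX := h.one_le_sus hβ.1 hβ.2
  have hA1 := h.ofReal_sus hβ.1 hβ.2
  set X := κ.sus β with hXd
  have hX0 : 0 < X := by linarith
  set r := X ^ c with hrd
  have hr : 0 < r := by linarith
  have hrp : ∀ a, r ^ a = X ^ (c * a) := fun a => by rw [hrd, ← Real.rpow_mul hX0.le]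
  have hw := κ.smul_wc_nonneg hβ.1.le r
  have hwle : β • κ.wc r ≤ κ.betaC • κ.wc r :=
    smul_le_smul_of_nonneg_right hβ.2.le (κ.wc_nonneg r)
  have hsm' : 4 * (rs (β • κ.rc r) * Am 1 (β • κ.w0)) ≤ 1 := by
    calc _ ≤ 4 * (ENNReal.ofReal (κ.betaC * r ^ (-α + η)) * ENNReal.ofReal X) := by
          rw [hA1]
          exact mul_le_mul' le_rfl (mul_le_mul' (rs_rc_le hβ.1.le hβ.2.le hrs) le_rfl)
      _ = ENNReal.ofReal (4 * (κ.betaC * r ^ (-α + η) * X)) := by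
          rw [← ENNReal.ofReal_mul (mul_nonneg hbc.le (Real.rpow_nonneg hr.le _)),
            ENNReal.ofReal_mul (p := 4) (by norm_num), ENNReal.ofReal_ofNat]
      _ ≤ ENNReal.ofReal 1 := by
          refine ENNReal.ofReal_le_ofReal ?_
          rw [Real.rpow_zero, Real.rpow_add hX0, Real.rpow_one, ← hrp] at hsm
          linarith
      _ = 1 := ENNReal.ofReal_one
  have hmain := h.gy_full_le hp hp1 hβ.1.le hβ.2 hr hsm'
  have hT1 : gy (fun x => ‖x‖ ^ p) (β • κ.wc r) ≤ ENNReal.ofReal ((C * r) ^ p * r ^ (α + δ)) := by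
    calc _ ≤ gy (ep p) (β • κ.wc r) := gy_norm_le_ep hw hp.le
      _ ≤ gy (ep p) (κ.betaC • κ.wc r) :=
          gy_mono_rate hw hwle fun x => Real.rpow_nonneg (Real.sqrt_nonneg _) _
      _ ≤ _ := hcut r hr1
      _ ≤ ENNReal.ofReal ((C * r) ^ p) * ENNReal.ofReal (r ^ (α + δ)) := mul_le_mul' le_rfl hU
      _ = _ := (ENNReal.ofReal_mul (by positivity)).symm
  have hT2 : Am 1 (β • κ.w0) * (Am 1 (β • κ.w0) * rsw (fun x => ‖x‖ ^ p) (β • κ.rc r)) ≤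
      ENNReal.ofReal (X * (X * (κ.betaC * r ^ (p - α + η)))) := by
    rw [ENNReal.ofReal_mul hX0.le, ENNReal.ofReal_mul hX0.le, hA1, rsw_smul hβ.1.le,
      ENNReal.ofReal_mul hbc.le]
    exact mul_le_mul' le_rfl (mul_le_mul' le_rfl
      (mul_le_mul' (ENNReal.ofReal_le_ofReal hβ.2.le) hrsw))
  refine hmain.trans ((mul_le_mul' le_rfl (add_le_add hT1 hT2)).trans ?_)
  rw [← ENNReal.ofReal_add (by positivity) (by positivity), hA1, ← ENNReal.ofReal_mul (by positivity),
    show (2 : ℝ≥0∞) = ENNReal.ofReal 2 by norm_num, ← ENNReal.ofReal_mul (by norm_num)]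
  refine ENNReal.ofReal_le_ofReal ?_
  have e1 : (C * r) ^ p * r ^ (α + δ) = C ^ p * X ^ (c * (p + α + δ)) := by
    rw [Real.mul_rpow (by linarith) hr.le, mul_assoc, ← Real.rpow_add hr, hrp, ← add_assoc]
  have e2 : X * (X * (κ.betaC * r ^ (p - α + η))) = κ.betaC * X ^ (2 + c * (p - α + η)) := by
    rw [hrp, Real.rpow_add hX0, Real.rpow_two]; ring
  have e3 : X ^ (p / α + ε) * X = X ^ (p / α + ε + 1) := by
    rw [Real.rpow_add hX0 (p / α + ε), Real.rpow_one]
  rw [e1, e2, e3]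
  linarith

theorem Ctx.gy_lower (h : κ.Ctx) (hP : κ.Poly) {p : ℝ} (hp : 0 < p)
    {ε : ℝ} (hε : 0 < ε) : ∀ᶠ β in nhdsWithin κ.betaC (Set.Iio κ.betaC),
      ENNReal.ofReal (κ.sus β ^ (p / α - ε)) * Am 1 (β • κ.w0) ≤
        gy (fun x => ‖x‖ ^ p) (β • κ.w0) := by
  have hs1 := h.one_lt
  have hα := h.hα
  have hbc := h.pos
  have hd : (1 : ℝ) ≤ d := by exact_mod_cast h.hd
  set s : ℝ := (d : ℝ) + α with hs
  obtain ⟨δ, hδ, hδ1, hδ2⟩ : ∃ δ : ℝ, 0 < δ ∧ p * δ < ε ∧ δ < 1 / α := by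
    refine ⟨min (ε / p) (1 / α) / 2, by positivity, ?_, ?_⟩
    · have : p * (ε / p) = ε := by field_simp
      have e1 := mul_le_mul_of_nonneg_left (min_le_left (ε / p) (1 / α)) hp.le
      nlinarith
    · have : 0 < 1 / α := by positivity
      linarith [min_le_right (ε / p) (1 / α)]
  obtain ⟨δ₂, hδ₂, hsδ, hδ₂'⟩ : ∃ δ₂ : ℝ, 0 < δ₂ ∧ s * δ₂ = d * δ / 2 ∧ δ₂ < 1 / α := by
    refine ⟨d * δ / (2 * s), by positivity, by field_simp, lt_of_le_of_lt ?_ hδ2⟩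
    rw [div_le_iff₀ (by positivity)]
    nlinarith
  have hcR : 0 < 1 / α - δ := by linarith
  have hc : 0 < 1 / α - δ₂ := by linarith
  set c := 1 / α - δ₂ with hcd
  have hcα : c * α = 1 - α * δ₂ := by rw [hcd]; field_simp
  obtain ⟨η, hη, hη1, hη2⟩ : ∃ η : ℝ, 0 < η ∧ c * η < α * δ₂ ∧ c * η < d * δ / 2 := by
    have e2 : 0 < min (α * δ₂) (d * δ / 2) := by positivity
    refine ⟨min (α * δ₂) (d * δ / 2) / (2 * c), by positivity, ?_⟩
    have e1 : c * (min (α * δ₂) (d * δ / 2) / (2 * c)) = min (α * δ₂) (d * δ / 2) / 2 := by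
      field_simp
    rw [e1]
    exact ⟨by linarith [min_le_left (α * δ₂) (d * δ / 2)],
      by linarith [min_le_right (α * δ₂) (d * δ / 2)]⟩
  have hx1 : c * (α + η) < 1 := by linarith
  have hx2 : c * (-s + η) + (1 / α - δ) * d + 2 < 1 := by
    have e1 : c * s = d / α + 1 - d * δ / 2 := by
      rw [← hsδ, hcd, hs]; field_simp
    have e2 : (1 / α - δ) * d = d / α - d * δ := by ring
    rw [e2]
    linarith
  filter_upwards [h.eventually_pos, h.eventually_sus hc (h.chi_cut_le hP hη),
    h.eventually_sus hc (h.rc_le_rpow hη),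
    h.eventually_sus hc (eventually_ge_atTop 1), h.eventually_sus hcR (eventually_ge_atTop 1),
    h.tendsto_sus.eventually (eventually_mul_rpow_le 8 hx1),
    h.tendsto_sus.eventually (eventually_mul_rpow_le (8 * (κ.betaC * 3 ^ d)) hx2),
    h.tendsto_sus.eventually (eventually_mul_rpow_le 2 (show p / α - ε < (1 / α - δ) * p by
      rw [sub_mul, one_div_mul_eq_div]; linarith))]
    with β hβ hU hrc hr1 hR1 ht1 ht2 ht3
  have hX := h.one_le_sus hβ.1 hβ.2
  have hA1 := h.ofReal_sus hβ.1 hβ.2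
  set X := κ.sus β with hXd
  have hX0 : 0 < X := by linarith
  set r := X ^ c with hrd
  set R := X ^ (1 / α - δ) with hRd
  have hr : 0 < r := by linarith
  have hR : 0 < R := by linarith
  have hrp : ∀ a, r ^ a = X ^ (c * a) := fun a => by rw [hrd, ← Real.rpow_mul hX0.le]
  have hRp : ∀ a, R ^ a = X ^ ((1 / α - δ) * a) := fun a => by rw [hRd, ← Real.rpow_mul hX0.le]
  have hw := κ.smul_wc_nonneg hβ.1.le r
  have hw0 := κ.smul_w0_nonneg hβ.1.le
  have hu : 0 ≤ β • κ.rc r := smul_nonneg hβ.1.le (κ.rc_nonneg hr)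
  have hwle : β • κ.wc r ≤ κ.betaC • κ.wc r :=
    smul_le_smul_of_nonneg_right hβ.2.le (κ.wc_nonneg r)
  have hfin := κ.Am_one_ne_top hβ.1.le hβ.2
  rcases le_total (2 * gy (fun x => ‖x‖ ^ p) (β • κ.w0))
    (ENNReal.ofReal (R ^ p) * Am 1 (β • κ.w0)) with hcase | hcase
  · exfalso
    have h1 := Am_one_le_of_gy hw0 hp hR hfin hcase
    have h2 := gy_ind_add_le hw hu ((κ.wc_TI r).smul β) ((κ.rc_TI r).smul β)
      (smul_rc_le hβ.1.le hβ.2.le hrc (Real.rpow_nonneg hr.le _)) (bx d R)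
    rw [smul_wc_add_rc] at h2
    have h3 : gy (fun x => if x ∈ bx d R then 1 else 0) (β • κ.wc r) ≤
        ENNReal.ofReal (r ^ (α + η)) := by
      refine le_trans ?_ ((Am_mono_rate hw hwle 1).trans hU)
      refine (gy_mono hw (ψ := fun _ => 1) fun x => ?_).trans (le_of_eq ?_)
      · show (if x ∈ bx d R then (1 : ℝ) else 0) ≤ 1
        split_ifs <;> norm_num
      · rw [gy_const zero_le_one, ENNReal.ofReal_one, one_mul]
    have h4 : ENNReal.ofReal (κ.betaC * r ^ (-s + η)) * (((bx d R).card : ℝ≥0∞) *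
        (Am 1 (β • κ.w0) * Am 1 (β • κ.w0))) ≤
        ENNReal.ofReal (κ.betaC * r ^ (-s + η) * ((3 * R) ^ d * (X * X))) := by
      rw [ENNReal.ofReal_mul (mul_nonneg hbc.le (Real.rpow_nonneg hr.le _)),
        ENNReal.ofReal_mul (p := (3 * R) ^ d) (by positivity), ENNReal.ofReal_mul (p := X) hX0.le, hA1]
      refine mul_le_mul' le_rfl (mul_le_mul' ?_ le_rfl)
      rw [← ENNReal.ofReal_natCast]
      exact ENNReal.ofReal_le_ofReal (card_bx_le hR1)
    have h5 := h1.trans (mul_le_mul' (le_refl 2) (h2.trans (add_le_add h3 h4)))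
    rw [← ENNReal.ofReal_add (by positivity) (by positivity), hA1,
      show (2 : ℝ≥0∞) = ENNReal.ofReal 2 by norm_num, ← ENNReal.ofReal_mul (by norm_num),
      ENNReal.ofReal_le_ofReal_iff (by positivity)] at h5
    have e1 : κ.betaC * r ^ (-s + η) * ((3 * R) ^ d * (X * X)) =
        κ.betaC * 3 ^ d * X ^ (c * (-s + η) + (1 / α - δ) * d + 2) := by
      rw [mul_pow, ← Real.rpow_natCast R, hRp, hrp, Real.rpow_add hX0 (_ + _), Real.rpow_add hX0,
        Real.rpow_two]
      ring
    rw [e1, hrp] at h5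
    rw [Real.rpow_one] at ht1 ht2
    linarith
  · have h6 : 2 * (ENNReal.ofReal (X ^ (p / α - ε)) * Am 1 (β • κ.w0)) ≤
        2 * gy (fun x => ‖x‖ ^ p) (β • κ.w0) := by
      refine le_trans ?_ hcase
      rw [← mul_assoc, show (2 : ℝ≥0∞) = ENNReal.ofReal 2 by norm_num,
        ← ENNReal.ofReal_mul (by norm_num), hRp]
      exact mul_le_mul' (ENNReal.ofReal_le_ofReal ht3) le_rfl
    exact (ENNReal.mul_le_mul_iff_right two_ne_zero (by norm_num)).1 h6

end Kernel

theorem growth_step {a x y A B q E : ℝ} (ha0 : 0 ≤ a) (ha : a < 3) (hx : 0 < x) (hxy : x ≤ y)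
    (hy2 : y ≤ 2 * x) (hA : 0 ≤ A) (hB : 0 ≤ B) (hq : 0 ≤ q) (hz : q * x ≤ (3 - a) / 114)
    (hU : y ≤ x + q * (y * y)) (hL : A + 3 * (q * (A * x)) ≤ B + 3 * E)
    (hE : E ≤ (3 - a) / 6 * (q * x) * B) : y ^ a * A ≤ x ^ a * B := by
  set z := q * x with hzd
  have hz0 : 0 ≤ z := mul_nonneg hq hx.le
  have hz1 : z ≤ 1 / 2 := by linarith
  have hy1 : y ≤ x * (1 + 4 * z) := by
    have : q * (y * y) ≤ q * ((2 * x) * (2 * x)) :=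
      mul_le_mul_of_nonneg_left (mul_self_le_mul_self (by linarith) hy2) hq
    nlinarith
  have hy3 : y ≤ x * Real.exp (z * (1 + 16 * z)) := by
    have e1 : q * (y * y) ≤ q * ((x * (1 + 4 * z)) * (x * (1 + 4 * z))) :=
      mul_le_mul_of_nonneg_left (mul_self_le_mul_self (by linarith) hy1) hq
    have e2 : q * ((x * (1 + 4 * z)) * (x * (1 + 4 * z))) = x * (z * (1 + 4 * z) ^ 2) := by
      rw [hzd]; ring
    have e3 : z * (1 + 4 * z) ^ 2 ≤ z * (1 + 16 * z) :=
      mul_le_mul_of_nonneg_left (by nlinarith) hz0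
    have e4 := Real.add_one_le_exp (z * (1 + 16 * z))
    nlinarith
  have hya : y ^ a ≤ x ^ a * Real.exp (a * (z * (1 + 16 * z))) := by
    rw [mul_comm a, Real.exp_mul, ← Real.mul_rpow hx.le (Real.exp_pos _).le]
    exact Real.rpow_le_rpow (by linarith) hy3 ha0
  have h1 : Real.exp (3 * z * (1 - 3 * z)) ≤ 1 + 3 * z := by
    rw [← Real.le_log_iff_exp_le (by linarith)]
    refine le_trans ?_ (Real.one_sub_inv_le_log_of_pos (by linarith))
    have : 1 - (1 + 3 * z)⁻¹ = 3 * z / (1 + 3 * z) := by field_simp; ring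
    rw [this, le_div_iff₀ (by linarith)]
    nlinarith [mul_nonneg hz0 hz0, mul_nonneg (mul_nonneg hz0 hz0) hz0]
  have h2 : A * (1 + 3 * z) ≤ B * Real.exp ((3 - a) / 2 * z) := by
    have e4 := Real.add_one_le_exp ((3 - a) / 2 * z)
    have e5 : B * ((3 - a) / 2 * z + 1) ≤ B * Real.exp ((3 - a) / 2 * z) :=
      mul_le_mul_of_nonneg_left e4 hB
    have e6 : q * (A * x) = A * z := by rw [hzd]; ring
    rw [e6] at hL
    nlinarith
  have h3 : A * Real.exp (3 * z * (1 - 3 * z)) ≤ B * Real.exp ((3 - a) / 2 * z) :=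
    (mul_le_mul_of_nonneg_left h1 hA).trans h2
  have h4 : Real.exp (a * (z * (1 + 16 * z))) * Real.exp ((3 - a) / 2 * z) ≤
      Real.exp (3 * z * (1 - 3 * z)) := by
    rw [← Real.exp_add]
    refine Real.exp_le_exp.2 ?_
    have : a * (1 + 16 * z) + (3 - a) / 2 ≤ 3 * (1 - 3 * z) := by nlinarith
    nlinarith
  have hxa : 0 ≤ x ^ a := Real.rpow_nonneg hx.le _
  set e := Real.exp (3 * z * (1 - 3 * z)) with he
  have he0 : 0 < e := Real.exp_pos _
  refine le_of_mul_le_mul_right ?_ he0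
  calc y ^ a * A * e = y ^ a * (A * e) := by ring
    _ ≤ (x ^ a * Real.exp (a * (z * (1 + 16 * z)))) * (B * Real.exp ((3 - a) / 2 * z)) :=
        mul_le_mul hya h3 (by positivity) (by positivity)
    _ = x ^ a * B * (Real.exp (a * (z * (1 + 16 * z))) * Real.exp ((3 - a) / 2 * z)) := by ring
    _ ≤ _ := mul_le_mul_of_nonneg_left h4 (by positivity)

section
variable {U : Type*} [DecidableEq U] [AddCommGroup U]

theorem box_moment_le {w : Sym2 U → ℝ} (hw : 0 ≤ w) (tw : TI w) (B Λ : Finset U) (m : ℕ) :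
    ENNReal.ofReal ((m : ℝ) ^ 3 * rE Λ.sym2 w (fun ω => ind (D1 B m ω))) ≤
      (B.card : ℝ≥0∞) * Am 2 w := by
  set Λ' := Λ ∪ B with hΛ'
  have h1 : (m : ℝ) ^ 3 * rE Λ.sym2 w (fun ω => ind (D1 B m ω)) ≤
      ∑ y ∈ B, rE Λ'.sym2 w (fun ω => cs Λ' ω y ^ 2) := by
    have e1 : rE Λ.sym2 w (fun ω => ind (D1 B m ω)) ≤ rE Λ'.sym2 w (fun ω => ind (D1 B m ω)) :=
      rE_mono_set hw (Finset.sym2_mono Finset.subset_union_left) (ind_monotone (D1_monotone B m))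
    refine (mul_le_mul_of_nonneg_left e1 (by positivity)).trans ?_
    rw [← rE_const_mul, ← rE_sum]
    refine rE_mono hw fun ω _ => ?_
    by_cases hD : D1 B m ω
    · rw [ind_true hD, mul_one]
      obtain ⟨x, hx⟩ := hD
      have e2 : ∀ y ∈ B.filter (Lk (↑ω) x ·), (m : ℝ) ^ 2 ≤ cs Λ' ω y ^ 2 := by
        intro y hy
        refine pow_le_pow_left₀ (Nat.cast_nonneg m) ?_ 2
        calc (m : ℝ) ≤ ((B.filter (Lk (↑ω) x ·)).card : ℝ) := by exact_mod_cast hx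
          _ = ∑ v ∈ B.filter (Lk (↑ω) x ·), (1 : ℝ) := by simp
          _ ≤ ∑ v ∈ B.filter (Lk (↑ω) x ·), ci ω y v := by
              refine Finset.sum_le_sum fun v hv => ?_
              rw [ci, ind_true (((Finset.mem_filter.1 hy).2.symm).trans (Finset.mem_filter.1 hv).2)]
          _ ≤ _ := by
              refine Finset.sum_le_sum_of_subset_of_nonneg ?_ fun _ _ _ => ci_nonneg _ _ _
              exact (Finset.filter_subset _ _).trans Finset.subset_union_right
      calc (m : ℝ) ^ 3 = (m : ℝ) * (m : ℝ) ^ 2 := by ring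
        _ ≤ ((B.filter (Lk (↑ω) x ·)).card : ℝ) * (m : ℝ) ^ 2 :=
            mul_le_mul_of_nonneg_right (by exact_mod_cast hx) (by positivity)
        _ = ∑ y ∈ B.filter (Lk (↑ω) x ·), (m : ℝ) ^ 2 := by rw [Finset.sum_const, nsmul_eq_mul]
        _ ≤ ∑ y ∈ B.filter (Lk (↑ω) x ·), cs Λ' ω y ^ 2 := Finset.sum_le_sum e2
        _ ≤ _ := Finset.sum_le_sum_of_subset_of_nonneg (Finset.filter_subset _ _)
            fun _ _ _ => sq_nonneg _
    · rw [ind_false hD, mul_zero]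
      exact Finset.sum_nonneg fun _ _ => sq_nonneg _
  refine (ENNReal.ofReal_le_ofReal h1).trans ?_
  rw [ENNReal.ofReal_sum_of_nonneg fun y _ => rE_nonneg hw fun _ _ => sq_nonneg _]
  calc _ ≤ ∑ y ∈ B, Am 2 w := Finset.sum_le_sum fun y _ =>
        (le_EV w (fun Λ ω => cs Λ ω y ^ 2) Λ').trans (EV_cs_base tw y 2).le
    _ = _ := by rw [Finset.sum_const, nsmul_eq_mul]

theorem Am_two_growth {w u : Sym2 U → ℝ} (hw : 0 ≤ w) (hu : 0 ≤ u) (tw : TI w) (tu : TI u)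
    {a M : ℝ} (ha0 : 0 ≤ a) (ha : a < 3) (hM : ∀ e, u e ≤ M) (hχ : Am 1 (w + u) ≠ ∞)
    (hrs : rs u ≠ ∞) (hz : (rs u).toReal * (Am 1 w).toReal ≤ (3 - a) / 114)
    (hE : ENNReal.ofReal M * Am 4 (w + u) ≤
      ENNReal.ofReal ((3 - a) / 6 * ((rs u).toReal * (Am 1 w).toReal)) * Am 2 (w + u)) :
    (Am 1 (w + u)).toReal ^ a * (Am 2 w).toReal ≤ (Am 1 w).toReal ^ a * (Am 2 (w + u)).toReal := by
  have hwu : 0 ≤ w + u := add_nonneg hw hu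
  have hle : w ≤ w + u := le_add_of_nonneg_right hu
  have hm := Am_mono_rate hw hle 1
  have hχ' : Am 1 w ≠ ∞ := (hm.trans_lt hχ.lt_top).ne
  have h2 : Am 2 (w + u) ≠ ∞ := ((Am_two_le hwu (tw.add tu)).trans_lt
    (ENNReal.pow_lt_top hχ.lt_top)).ne
  have h2' : Am 2 w ≠ ∞ := ((Am_mono_rate hw hle 2).trans_lt h2.lt_top).ne
  have hE' : ENNReal.ofReal M * Am 4 (w + u) ≠ ∞ :=
    (hE.trans_lt (ENNReal.mul_lt_top ENNReal.ofReal_lt_top h2.lt_top)).ne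
  have hx1 : 1 ≤ (Am 1 w).toReal := by
    rw [← ENNReal.toReal_one]; exact ENNReal.toReal_mono hχ' (one_le_Am hw 1)
  have hsm : 4 * (rs u * Am 1 w) < 1 := by
    rw [← ENNReal.ofReal_toReal hrs, ← ENNReal.ofReal_toReal hχ',
      ← ENNReal.ofReal_mul ENNReal.toReal_nonneg, show (4 : ℝ≥0∞) = ENNReal.ofReal 4 by norm_num,
      ← ENNReal.ofReal_mul (by norm_num), ENNReal.ofReal_lt_one]
    linarith
  have hy2 := Am_one_add_le_two hw hu tw tu hχ' hsm
  have hU := chi_add_le hw hu tw tu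
  have hL := Am_two_add_ge hw hu tw tu hM
  refine growth_step (q := (rs u).toReal) (E := (ENNReal.ofReal M * Am 4 (w + u)).toReal) ha0 ha
    (by linarith) (ENNReal.toReal_mono hχ hm) ?_
    ENNReal.toReal_nonneg ENNReal.toReal_nonneg ENNReal.toReal_nonneg hz ?_ ?_ ?_
  · have := ENNReal.toReal_mono (ENNReal.mul_ne_top (by norm_num) hχ') hy2
    rwa [ENNReal.toReal_mul, ENNReal.toReal_ofNat] at this
  · have h3 : rs u * (Am 1 (w + u) * Am 1 (w + u)) ≠ ∞ :=
      ENNReal.mul_ne_top hrs (ENNReal.mul_ne_top hχ hχ)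
    have := ENNReal.toReal_mono (ENNReal.add_ne_top.2 ⟨hχ', h3⟩) hU
    rwa [ENNReal.toReal_add hχ' h3, ENNReal.toReal_mul, ENNReal.toReal_mul] at this
  · have h3 : 3 * (rs u * (Am 2 w * Am 1 w)) ≠ ∞ :=
      ENNReal.mul_ne_top (by norm_num) (ENNReal.mul_ne_top hrs (ENNReal.mul_ne_top h2' hχ'))
    have h4 : 3 * (ENNReal.ofReal M * Am 4 (w + u)) ≠ ∞ := ENNReal.mul_ne_top (by norm_num) hE'
    have := ENNReal.toReal_mono (ENNReal.add_ne_top.2 ⟨h2, h4⟩) hL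
    rw [ENNReal.toReal_add h2' h3, ENNReal.toReal_add h2 h4, ENNReal.toReal_mul (a := 3),
      ENNReal.toReal_mul (a := 3), ENNReal.toReal_mul (a := rs u), ENNReal.toReal_mul (a := Am 2 w),
      ENNReal.toReal_ofNat] at this
    exact this
  · have := ENNReal.toReal_mono (ENNReal.mul_ne_top ENNReal.ofReal_ne_top h2) hE
    rwa [ENNReal.toReal_mul (a := ENNReal.ofReal ((3 - a) / 6 * _)), ENNReal.toReal_ofReal
      (mul_nonneg (by linarith) (mul_nonneg ENNReal.toReal_nonneg ENNReal.toReal_nonneg))] at this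

end

namespace Kernel
variable {d : ℕ} {α : ℝ} {κ : Kernel d α}

theorem Am_two_interp {w u : Sym2 (V d) → ℝ} (hw : 0 ≤ w) (hu : 0 ≤ u) (tw : TI w) (tu : TI u)
    {a M Y : ℝ} (ha0 : 0 ≤ a) (ha : a < 3) (hM : ∀ e, u e ≤ M) (hM0 : 0 ≤ M) (hY0 : 0 ≤ Y)
    (hχ : Am 1 (w + u) ≠ ∞)
    (hrs : rs u ≠ ∞) (hY : ∀ w' : Sym2 (V d) → ℝ, w ≤ w' → w' ≤ w + u →
      Am 4 w' ≤ ENNReal.ofReal Y * Am 2 w')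
    (hMY : M * Y ≤ (3 - a) / 6 * ((rs u).toReal * (Am 1 w).toReal)) :
    (Am 1 (w + u)).toReal ^ a * (Am 2 w).toReal ≤ (Am 1 w).toReal ^ a * (Am 2 (w + u)).toReal := by
  set q := (rs u).toReal with hq
  have hq0 : 0 ≤ q := ENNReal.toReal_nonneg
  obtain ⟨n, hn⟩ := exists_nat_gt (max 1 (q * (Am 1 (w + u)).toReal / ((3 - a) / 114)))
  have hn1 : (1 : ℝ) < n := (le_max_left _ _).trans_lt hn
  have hn0 : (0 : ℝ) < n := by linarith
  have hn2 : q * (Am 1 (w + u)).toReal ≤ n * ((3 - a) / 114) :=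
    ((div_lt_iff₀ (by linarith)).1 ((le_max_right _ _).trans_lt hn)).le
  set c := 1 / (n : ℝ) with hc
  have hc0 : 0 < c := by positivity
  have hcn : (n : ℝ) * c = 1 := by rw [hc]; field_simp
  set W : ℕ → Sym2 (V d) → ℝ := fun i => w + ((i : ℝ) * c) • u with hW
  have hcu : 0 ≤ c • u := smul_nonneg hc0.le hu
  have hWs : ∀ i, W (i + 1) = W i + c • u := fun i => by
    simp only [hW]; push_cast; rw [add_assoc, ← add_smul]; congr 2; ring
  have hwW : ∀ i, w ≤ W i := fun i => le_add_of_nonneg_right (smul_nonneg (by positivity) hu)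
  have hW0 : ∀ i, 0 ≤ W i := fun i => hw.trans (hwW i)
  have hWT : ∀ i, TI (W i) := fun i => tw.add (tu.smul _)
  have hWn : W n = w + u := by simp only [hW]; rw [hcn, one_smul]
  have hW00 : W 0 = w := by simp [hW]
  have hWle : ∀ i, i ≤ n → W i ≤ w + u := fun i hi => by
    refine add_le_add le_rfl ?_
    have : ((i : ℝ) * c) • u ≤ (1 : ℝ) • u := by
      refine smul_le_smul_of_nonneg_right ?_ hu
      rw [← hcn]
      exact mul_le_mul_of_nonneg_right (by exact_mod_cast hi) hc0.le
    rwa [one_smul] at this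
  have hfin : ∀ i, i ≤ n → Am 1 (W i) ≠ ∞ := fun i hi =>
    ((Am_mono_rate (hW0 i) (hWle i hi) 1).trans_lt hχ.lt_top).ne
  have hrsc : (rs (c • u)).toReal = c * q := by
    rw [rs_smul hc0.le, ENNReal.toReal_mul, ENNReal.toReal_ofReal hc0.le]
  have hstep : ∀ i, i + 1 ≤ n → (Am 1 (W (i + 1))).toReal ^ a * (Am 2 (W i)).toReal ≤
      (Am 1 (W i)).toReal ^ a * (Am 2 (W (i + 1))).toReal := by
    intro i hi
    have hf := hfin (i + 1) hi
    rw [hWs] at hf ⊢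
    refine Am_two_growth (hW0 i) hcu (hWT i) (tu.smul c) ha0 ha (M := c * M) (fun e => by
      rw [Pi.smul_apply, smul_eq_mul]; exact mul_le_mul_of_nonneg_left (hM e) hc0.le) hf ?_ ?_ ?_
    · rw [rs_smul hc0.le]; exact ENNReal.mul_ne_top ENNReal.ofReal_ne_top hrs
    · rw [hrsc]
      have e1 : (Am 1 (W i)).toReal ≤ (Am 1 (w + u)).toReal :=
        ENNReal.toReal_mono hχ (Am_mono_rate (hW0 i) (hWle i (by omega)) 1)
      calc c * q * (Am 1 (W i)).toReal ≤ c * (q * (Am 1 (w + u)).toReal) := by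
            rw [mul_assoc]; gcongr
        _ ≤ c * (n * ((3 - a) / 114)) := mul_le_mul_of_nonneg_left hn2 hc0.le
        _ = _ := by rw [← mul_assoc, mul_comm c, hcn, one_mul]
    · rw [← hWs, hrsc]
      refine (mul_le_mul' le_rfl (hY _ (hwW _) (hWle _ hi))).trans ?_
      rw [← mul_assoc, ← ENNReal.ofReal_mul (by positivity)]
      refine mul_le_mul' (ENNReal.ofReal_le_ofReal ?_) le_rfl
      have e1 : (Am 1 w).toReal ≤ (Am 1 (W i)).toReal :=
        ENNReal.toReal_mono (hfin i (by omega)) (Am_mono_rate hw (hwW i) 1)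
      calc c * M * Y = c * (M * Y) := by ring
        _ ≤ c * ((3 - a) / 6 * (q * (Am 1 w).toReal)) := mul_le_mul_of_nonneg_left hMY hc0.le
        _ ≤ c * ((3 - a) / 6 * (q * (Am 1 (W i)).toReal)) := by
            have : 0 ≤ (3 - a) / 6 := by linarith
            gcongr
        _ = _ := by ring
  have hpos : ∀ i, i ≤ n → 0 < (Am 1 (W i)).toReal := fun i hi =>
    ENNReal.toReal_pos (one_pos.trans_le (one_le_Am (hW0 i) 1)).ne' (hfin i hi)
  have hind : ∀ i, i ≤ n → (Am 1 (W i)).toReal ^ a * (Am 2 w).toReal ≤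
      (Am 1 w).toReal ^ a * (Am 2 (W i)).toReal := by
    intro i
    induction i with
    | zero => intro _; rw [hW00]
    | succ i ih =>
      intro hi
      have h1 := ih (by omega)
      have h2 := hstep i hi
      have hp := Real.rpow_pos_of_pos (hpos i (by omega)) a
      refine le_of_mul_le_mul_left ?_ hp
      calc (Am 1 (W i)).toReal ^ a * ((Am 1 (W (i + 1))).toReal ^ a * (Am 2 w).toReal)
          = (Am 1 (W (i + 1))).toReal ^ a * ((Am 1 (W i)).toReal ^ a * (Am 2 w).toReal) := by ring
        _ ≤ (Am 1 (W (i + 1))).toReal ^ a * ((Am 1 w).toReal ^ a * (Am 2 (W i)).toReal) :=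
            mul_le_mul_of_nonneg_left h1 (Real.rpow_nonneg ENNReal.toReal_nonneg _)
        _ = (Am 1 w).toReal ^ a * ((Am 1 (W (i + 1))).toReal ^ a * (Am 2 (W i)).toReal) := by ring
        _ ≤ (Am 1 w).toReal ^ a * ((Am 1 (W i)).toReal ^ a * (Am 2 (W (i + 1))).toReal) :=
            mul_le_mul_of_nonneg_left h2 (Real.rpow_nonneg ENNReal.toReal_nonneg _)
        _ = _ := by ring
  have := hind n le_rfl
  rwa [hWn] at this

end Kernel

namespace Kernel
variable {d : ℕ} {α : ℝ} {κ : Kernel d α}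

set_option maxHeartbeats 1000000 in
theorem Ctx.zeta_scale (h : κ.Ctx) (hP : κ.Poly) {a : ℝ} (ha0 : 0 ≤ a) (ha : a < 3)
    (haα : a * α < α + ((d : ℝ) + α) / 2) : ∃ ε : ℝ, 0 < ε ∧ ε < α ∧ ∀ᶠ r in atTop,
      ∀ β, κ.betaC / 2 ≤ β → β ≤ κ.betaC → r ^ (α - ε) ≤ (Am 1 (β • κ.wc r)).toReal →
      (Am 1 (β • κ.wc (2 * r))).toReal ^ a ≤ (Am 2 (β • κ.wc (2 * r))).toReal ∨
      (Am 1 (β • κ.wc (2 * r))).toReal ^ a * (Am 2 (β • κ.wc r)).toReal ≤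
        (Am 1 (β • κ.wc r)).toReal ^ a * (Am 2 (β • κ.wc (2 * r))).toReal := by
  have hs1 := h.one_lt
  have hα := h.hα
  have hbc := h.pos
  set s : ℝ := (d : ℝ) + α with hs
  obtain ⟨ε, hε, hε1, hε2, hε3⟩ : ∃ ε : ℝ, 0 < ε ∧ ε < α ∧ ε < s / 12 ∧
      (a + 18 + d) * ε < α + s / 2 - a * α := by
    set g := α + s / 2 - a * α with hg
    have hg0 : 0 < g := by linarith
    have hk : 0 < a + 18 + d := by positivity
    refine ⟨min (g / (a + 18 + d)) (min (s / 12) α) / 2, by positivity, ?_, ?_, ?_⟩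
    · linarith [min_le_right (g / (a + 18 + d)) (min (s / 12) α), min_le_right (s / 12) α]
    · linarith [min_le_right (g / (a + 18 + d)) (min (s / 12) α), min_le_left (s / 12) α]
    · have e1 := min_le_left (g / (a + 18 + d)) (min (s / 12) α)
      have e2 := mul_le_mul_of_nonneg_left e1 hk.le
      rw [mul_div_cancel₀ _ hk.ne'] at e2
      linarith
  refine ⟨ε, hε, hε1, ?_⟩
  set μ := s / 2 - 6 * ε with hμ
  have hμ0 : 0 < μ := by linarith
  have h2 : Tendsto (fun r : ℝ => 2 * r) atTop atTop :=
    tendsto_id.const_mul_atTop (by norm_num)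
  set c₁ := (3 - a) / 6 * (κ.betaC / 2) with hc₁
  have hc₁0 : 0 < c₁ := by
    have : 0 < (3 - a) / 6 := by linarith
    positivity
  filter_upwards [h2.eventually (h.chi_cut_le hP hε),
    h2.eventually (h.tight hP hε (k := 2) (j := 2) (by norm_num)),
    h2.eventually (eventually_le_rpow 2 hμ0),
    h2.eventually (eventually_mul_rpow_le (2 * 3 ^ d)
      (show (α + ε) * a < 3 * μ - (1 + ε) * d by rw [hμ, hs] at *; linarith)),
    h2.eventually (eventually_mul_rpow_le 2 (show -ε < 0 by linarith)),
    h.rc_le_rpow hε, h.rs_dk_ge hε, h.rs_rc hε, eventually_ge_atTop (1 : ℝ),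
    eventually_mul_rpow_le (κ.betaC * (8 * 2 ^ (s - 4 * ε)) / c₁)
      (show -(3 * ε) < -(2 * ε) by linarith)]
    with r hU htight hm2 hcmp hε2' hrc hdk hrsrc hr1 hlast β hβ hβc hlow
  have hr : 0 < r := by linarith
  set R := 2 * r with hR
  have hR0 : 0 < R := by linarith
  have hR1 : 1 ≤ R := by linarith
  have hβ0 : 0 < β := by linarith
  set m := ⌈R ^ μ⌉₊ with hm
  have hmy : R ^ μ ≤ (m : ℝ) := Nat.le_ceil _
  have hmle : (m : ℝ) ≤ 2 * R ^ μ := by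
    have := Nat.ceil_lt_add_one (show 0 ≤ R ^ μ by linarith)
    linarith
  have hm2' : 2 ≤ m := by
    have : (2 : ℝ) ≤ m := hm2.trans hmy
    exact_mod_cast this
  have hwR := κ.smul_wc_nonneg hβ0.le R
  have hwr := κ.smul_wc_nonneg hβ0.le r
  have hwle : β • κ.wc R ≤ κ.betaC • κ.wc R := smul_le_smul_of_nonneg_right hβc (κ.wc_nonneg R)
  have hχU := (Am_mono_rate hwR hwle 1).trans hU
  have hχ : Am 1 (β • κ.wc R) ≠ ∞ := (hχU.trans_lt ENNReal.ofReal_lt_top).ne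
  have h2t : Am 2 (β • κ.wc R) ≠ ∞ := ((Am_two_le hwR ((κ.wc_TI R).smul β)).trans_lt
    (ENNReal.pow_lt_top hχ.lt_top)).ne
  by_cases hbig : ∃ Λ : Finset (V d), 1 / 2 ≤
      rE Λ.sym2 (β • κ.wc R) (fun ω => ind (D1 (bx d (R ^ (1 + ε))) m ω))
  · left
    obtain ⟨Λ, hΛ⟩ := hbig
    have h3 := box_moment_le hwR ((κ.wc_TI R).smul β) (bx d (R ^ (1 + ε))) Λ m
    have h4 : (m : ℝ) ^ 3 * (1 / 2) ≤
        ((bx d (R ^ (1 + ε))).card : ℝ) * (Am 2 (β • κ.wc R)).toReal := by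
      have h5 := ENNReal.toReal_mono (ENNReal.mul_ne_top (ENNReal.natCast_ne_top _) h2t) h3
      rw [ENNReal.toReal_mul, ENNReal.toReal_natCast, ENNReal.toReal_ofReal
        (mul_nonneg (by positivity) (rE_nonneg hwR fun ω _ => ind_nonneg _))] at h5
      exact (mul_le_mul_of_nonneg_left hΛ (by positivity)).trans h5
    have h6 : ((bx d (R ^ (1 + ε))).card : ℝ) ≤ 3 ^ d * R ^ ((1 + ε) * d) := by
      have := card_bx_le (d := d) (R := R ^ (1 + ε)) (Real.one_le_rpow hR1 (by linarith))
      rwa [mul_pow, ← Real.rpow_natCast (R ^ (1 + ε)), ← Real.rpow_mul hR0.le] at this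
    have h7 : R ^ (3 * μ) ≤ (m : ℝ) ^ 3 := by
      have := pow_le_pow_left₀ (Real.rpow_nonneg hR0.le μ) hmy 3
      rwa [← Real.rpow_natCast (R ^ μ), ← Real.rpow_mul hR0.le, mul_comm μ] at this
    have h8 : (Am 1 (β • κ.wc R)).toReal ^ a ≤ R ^ ((α + ε) * a) := by
      rw [Real.rpow_mul hR0.le]
      refine Real.rpow_le_rpow ENNReal.toReal_nonneg ?_ ha0
      exact ENNReal.toReal_le_of_le_ofReal (by positivity) hχU
    refine h8.trans ?_
    have h9 : R ^ (3 * μ) = R ^ (3 * μ - (1 + ε) * d) * R ^ ((1 + ε) * d) := by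
      rw [← Real.rpow_add hR0]; congr 1; ring
    have h10 : 0 < R ^ ((1 + ε) * d) := Real.rpow_pos_of_pos hR0 _
    have h11 : (0 : ℝ) < 3 ^ d := by positivity
    refine le_of_mul_le_mul_left ?_ (mul_pos (mul_pos (two_pos : (0 : ℝ) < 2) h11) h10)
    calc 2 * 3 ^ d * R ^ ((1 + ε) * d) * R ^ ((α + ε) * a)
        = (2 * 3 ^ d * R ^ ((α + ε) * a)) * R ^ ((1 + ε) * d) := by ring
      _ ≤ R ^ (3 * μ - (1 + ε) * d) * R ^ ((1 + ε) * d) :=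
          mul_le_mul_of_nonneg_right hcmp h10.le
      _ = R ^ (3 * μ) := h9.symm
      _ ≤ 2 * ((m : ℝ) ^ 3 * (1 / 2)) := by linarith
      _ ≤ 2 * (((bx d (R ^ (1 + ε))).card : ℝ) * (Am 2 (β • κ.wc R)).toReal) := by linarith
      _ ≤ 2 * ((3 ^ d * R ^ ((1 + ε) * d)) * (Am 2 (β • κ.wc R)).toReal) := by
          have := mul_le_mul_of_nonneg_right h6 (ENNReal.toReal_nonneg (a := Am 2 (β • κ.wc R)))
          linarith
      _ = _ := by ring
  · right
    push Not at hbig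
    have hu : 0 ≤ β • κ.dk r := smul_nonneg hβ0.le (dk_nonneg hr)
    have hadd : β • κ.wc r + β • κ.dk r = β • κ.wc R := by rw [← smul_add, wc_add_dk]
    have hrsd : rs (κ.dk r) ≤ rs (κ.rc r) := ENNReal.tsum_le_tsum fun b =>
      ENNReal.ofReal_le_ofReal (dk_le_rc hr _)
    have hrsd' : rs (κ.dk r) ≠ ∞ := ((hrsd.trans hrsrc).trans_lt ENNReal.ofReal_lt_top).ne
    set X := (m : ℝ) * R ^ (4 * ε) with hX
    have hX1 : 1 ≤ X := by
      have e1 : (1 : ℝ) ≤ R ^ (4 * ε) := Real.one_le_rpow hR1 (by positivity)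
      have e2 : (1 : ℝ) ≤ m := by linarith
      nlinarith
    rw [← hadd] at hχ
    have key := Am_two_interp hwr hu ((κ.wc_TI r).smul β) ((dk_TI r).smul β) ha0 ha
      (M := κ.betaC * r ^ (-s + ε)) (Y := 2 * X ^ 2) (fun e => by
        rw [Pi.smul_apply, smul_eq_mul]
        exact mul_le_mul hβc ((dk_le_rc hr e).trans (hrc e)) (dk_nonneg hr e) hbc.le)
      (by positivity) (by positivity) hχ
      (by rw [rs_smul hβ0.le]; exact ENNReal.mul_ne_top ENNReal.ofReal_ne_top hrsd')
      (fun w' h1 h2 => by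
        rw [hadd] at h2
        have hw' := hwr.trans h1
        have h3 := htight w' hw' (h2.trans hwle) m hm2' fun Λ => by
          refine (rE_mono_rate hw' h2 (ind_monotone (D1_monotone _ _))).trans
            ((hbig Λ).le.trans ?_)
          rw [Real.rpow_zero] at hε2'
          linarith
        refine h3.trans ?_
        have h4 : (1 : ℝ≥0∞) ≤ ENNReal.ofReal (X ^ 2) * Am 2 w' := by
          have e1 : (1 : ℝ≥0∞) ≤ ENNReal.ofReal (X ^ 2) := by
            rw [← ENNReal.ofReal_one]; exact ENNReal.ofReal_le_ofReal (one_le_pow₀ hX1)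
          calc (1 : ℝ≥0∞) = 1 * 1 := (one_mul _).symm
            _ ≤ _ := mul_le_mul' e1 (one_le_Am hw' 2)
        calc _ ≤ ENNReal.ofReal (X ^ 2) * Am 2 w' + ENNReal.ofReal (X ^ 2) * Am 2 w' :=
              add_le_add le_rfl h4
          _ = _ := by
              rw [← add_mul, ← ENNReal.ofReal_add (by positivity) (by positivity), two_mul])
      (by
        have hq : κ.betaC / 2 * r ^ (-α - ε) ≤ (rs (β • κ.dk r)).toReal := by
          rw [rs_smul hβ0.le, ENNReal.toReal_mul, ENNReal.toReal_ofReal hβ0.le]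
          refine mul_le_mul hβ ?_ (by positivity) hβ0.le
          have := ENNReal.toReal_mono hrsd' hdk
          rwa [ENNReal.toReal_ofReal (by positivity)] at this
        have hqχ : κ.betaC / 2 * r ^ (-α - ε) * r ^ (α - ε) ≤
            (rs (β • κ.dk r)).toReal * (Am 1 (β • κ.wc r)).toReal :=
          mul_le_mul hq hlow (by positivity) ENNReal.toReal_nonneg
        have e1 : r ^ (-α - ε) * r ^ (α - ε) = r ^ (-(2 * ε)) := by
          rw [← Real.rpow_add hr]; congr 1; ring
        have e2 : X ^ 2 ≤ 4 * (2 ^ (s - 4 * ε) * r ^ (s - 4 * ε)) := by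
          have e3 : X ≤ 2 * R ^ (μ + 4 * ε) := by
            rw [hX, Real.rpow_add hR0, ← mul_assoc]
            exact mul_le_mul_of_nonneg_right hmle (by positivity)
          have e4 : X ^ 2 ≤ (2 * R ^ (μ + 4 * ε)) ^ 2 := pow_le_pow_left₀ (by linarith) e3 2
          refine e4.trans (le_of_eq ?_)
          rw [mul_pow, ← Real.rpow_natCast (R ^ _), ← Real.rpow_mul hR0.le,
            ← Real.mul_rpow (by norm_num) hr.le, ← hR]
          norm_num
          congr 1; rw [hμ]; ring
        have e5 : r ^ (-s + ε) * r ^ (s - 4 * ε) = r ^ (-(3 * ε)) := by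
          rw [← Real.rpow_add hr]; congr 1; ring
        have e6 : (0 : ℝ) ≤ (3 - a) / 6 := by linarith
        calc κ.betaC * r ^ (-s + ε) * (2 * X ^ 2)
            ≤ κ.betaC * r ^ (-s + ε) * (2 * (4 * (2 ^ (s - 4 * ε) * r ^ (s - 4 * ε)))) := by gcongr
          _ = κ.betaC * (8 * 2 ^ (s - 4 * ε)) * (r ^ (-s + ε) * r ^ (s - 4 * ε)) := by ring
          _ = c₁ * (κ.betaC * (8 * 2 ^ (s - 4 * ε)) / c₁ * r ^ (-(3 * ε))) := by
              rw [e5]; field_simp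
          _ ≤ c₁ * r ^ (-(2 * ε)) := mul_le_mul_of_nonneg_left hlast hc₁0.le
          _ = (3 - a) / 6 * (κ.betaC / 2 * r ^ (-α - ε) * r ^ (α - ε)) := by rw [← e1, hc₁]; ring
          _ ≤ _ := mul_le_mul_of_nonneg_left hqχ e6)
    rwa [hadd] at key

end Kernel

namespace Kernel
variable {d : ℕ} {α : ℝ} {κ : Kernel d α}

set_option maxHeartbeats 1000000 in
theorem Ctx.zeta_ge_of_lt (h : κ.Ctx) (hP : κ.Poly) {a b : ℝ} (ha0 : 0 ≤ a) (ha : a < 3)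
    (haα : a * α < α + ((d : ℝ) + α) / 2) (hb : b < a) :
    ∀ᶠ β in nhdsWithin κ.betaC (Set.Iio κ.betaC),
      ENNReal.ofReal (κ.sus β ^ b) ≤ Am 2 (β • κ.w0) := by
  have hα := h.hα
  have hbc := h.pos
  obtain ⟨ε, hε, hεα, hscale⟩ := h.zeta_scale hP ha0 ha haα
  set δ := ε / (2 * α ^ 2) with hδd
  have hδ : 0 < δ := by positivity
  set c := 1 / α + δ with hcd
  have hc : 0 < c := by positivity
  have hcα : c * (α - ε / 2) ≤ 1 := by
    have : c * (α - ε / 2) = 1 - δ * ε / 2 := by rw [hcd, hδd]; field_simp; ring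
    rw [this]; linarith [mul_pos hδ hε]
  set c' := 1 / α + δ / 2 with hcd'
  have hc' : 0 < c' := by positivity
  have hcc : c' < c := by rw [hcd, hcd']; linarith
  have hcα' : c' * α = 1 + α * δ / 2 := by rw [hcd']; field_simp
  set η := α * δ / (4 * c') with hηd
  have hη : 0 < η := by positivity
  have hηc : c' * η = α * δ / 4 := by rw [hηd]; field_simp
  have hαδ : 0 < α * δ := by positivity
  have hx : c' * (-α + η) + 1 < 0 := by linarith
  have hηα : -α + η ≤ 0 := by
    by_contra! hcon
    linarith [mul_pos hc' hcon]
  obtain ⟨r₁, hr₁⟩ := eventually_atTop.1 (hscale.and ((h.rs_rc (half_pos hε)).and ((h.rs_rc hη).and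
    ((eventually_mul_rpow_le (1 + 2 * κ.betaC) (show -α + ε / 2 < -α + ε by linarith)).and
      h.cut_finite))))
  set r₀ := max r₁ 1 with hr₀
  have hr₀1 : 1 ≤ r₀ := le_max_right _ _
  have H := fun r (hr : r₀ ≤ r) => hr₁ r ((le_max_left _ _).trans hr)
  set K := (Am 1 (κ.betaC • κ.wc r₀)).toReal with hK
  have hK1 : 1 ≤ K := by
    have := ENNReal.toReal_mono (H r₀ le_rfl).2.2.2.2 (one_le_Am (κ.smul_wc_nonneg hbc.le r₀) 1)
    simpa using this
  filter_upwards [h.eventually_pos, Ioo_mem_nhdsLT (show κ.betaC / 2 < κ.betaC by linarith),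
    h.eventually_sus hc (eventually_ge_atTop r₀),
    h.tendsto_sus.eventually (eventually_mul_rpow_le 2 hcc),
    h.tendsto_sus.eventually (eventually_mul_rpow_le (8 * κ.betaC) hx),
    h.tendsto_sus.eventually (eventually_mul_rpow_le (K ^ a * 2 ^ a) hb)]
    with β hβ hβ2 hlarge hcX hsm hlast
  have hX := h.one_le_sus hβ.1 hβ.2
  have hA1 := h.ofReal_sus hβ.1 hβ.2
  have hfin0 := κ.Am_one_ne_top hβ.1.le hβ.2
  have hXd : κ.sus β = (Am 1 (β • κ.w0)).toReal := rfl
  set X := κ.sus β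
  have hX0 : 0 < X := by linarith
  have hfin2 : Am 2 (β • κ.w0) ≠ ∞ :=
    ((Am_two_le (κ.smul_w0_nonneg hβ.1.le) (κ.w0_TI.smul β)).trans_lt
      (ENNReal.pow_lt_top hfin0.lt_top)).ne
  have hwc : ∀ r, 0 < r → β • κ.wc r ≤ β • κ.w0 := fun r hr =>
    smul_le_smul_of_nonneg_left (κ.wc_le_w0 hr) hβ.1.le
  have hle : ∀ k r, 0 < r → Am k (β • κ.wc r) ≤ Am k (β • κ.w0) := fun k r hr =>
    Am_mono_rate (κ.smul_wc_nonneg hβ.1.le r) (hwc r hr) k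
  have hone : ∀ k r, 0 < r → Am k (β • κ.w0) ≠ ∞ → 1 ≤ (Am k (β • κ.wc r)).toReal := by
    intro k r hr hk
    have := ENNReal.toReal_mono ((hle k r hr).trans_lt hk.lt_top).ne
      (one_le_Am (κ.smul_wc_nonneg hβ.1.le r) k)
    simpa using this
  have hchi : ∀ r, r₀ ≤ r → r ≤ X ^ c → r ^ (α - ε) ≤ (Am 1 (β • κ.wc r)).toReal := by
    intro r hr hrX
    have hr0 : 0 < r := by linarith
    obtain ⟨-, hrs, -, hq, -⟩ := H r hr
    have hrs' := rs_rc_le hβ.1.le hβ.2.le hrs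
    have h1 := inv_chi_le (κ.smul_wc_nonneg hβ.1.le r)
      (smul_nonneg hβ.1.le (κ.rc_nonneg hr0)) ((κ.wc_TI r).smul β) ((κ.rc_TI r).smul β)
      (by rw [smul_wc_add_rc]; exact hfin0) (hrs'.trans_lt ofReal_lt_top).ne
    rw [smul_wc_add_rc, ← hXd] at h1
    have h2 := ENNReal.toReal_le_of_le_ofReal
      (mul_nonneg hbc.le (Real.rpow_nonneg hr0.le _)) hrs'
    have h3 : X⁻¹ ≤ r ^ (-α + ε / 2) := by
      rw [show -α + ε / 2 = -(α - ε / 2) by ring, Real.rpow_neg hr0.le]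
      refine inv_anti₀ (by positivity) ?_
      calc r ^ (α - ε / 2) ≤ (X ^ c) ^ (α - ε / 2) :=
            Real.rpow_le_rpow hr0.le hrX (by linarith)
        _ = X ^ (c * (α - ε / 2)) := by rw [Real.rpow_mul hX0.le]
        _ ≤ X ^ (1 : ℝ) := Real.rpow_le_rpow_of_exponent_le hX hcα
        _ = X := Real.rpow_one X
    have h4 : (Am 1 (β • κ.wc r)).toReal⁻¹ ≤ r ^ (-(α - ε)) := by
      rw [show -(α - ε) = -α + ε by ring]; linarith
    rw [Real.rpow_neg hr0.le] at h4
    exact (inv_le_inv₀ (by linarith [hone 1 r hr0 hfin0]) (by positivity)).1 h4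
  obtain ⟨J, hJ1, hJ2⟩ := exists_nat_pow_near (show 1 ≤ X ^ c / r₀ by
    rw [le_div_iff₀ (by linarith)]; linarith) (show (1 : ℝ) < 2 by norm_num)
  rw [le_div_iff₀ (by linarith)] at hJ1
  rw [div_lt_iff₀ (by linarith)] at hJ2
  have hKa : 0 < K ^ a := by positivity
  have key : ∀ i, i ≤ J → (Am 1 (β • κ.wc (2 ^ i * r₀))).toReal ^ a ≤
      K ^ a * (Am 2 (β • κ.wc (2 ^ i * r₀))).toReal := by
    intro i
    induction i with
    | zero =>
      intro _
      rw [pow_zero, one_mul]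
      have h1 : (Am 1 (β • κ.wc r₀)).toReal ≤ K :=
        ENNReal.toReal_mono (H r₀ le_rfl).2.2.2.2 (Am_mono_rate (κ.smul_wc_nonneg hβ.1.le r₀)
          (smul_le_smul_of_nonneg_right hβ.2.le (κ.wc_nonneg r₀)) 1)
      calc _ ≤ K ^ a := Real.rpow_le_rpow ENNReal.toReal_nonneg h1 ha0
        _ = K ^ a * 1 := (mul_one _).symm
        _ ≤ _ := mul_le_mul_of_nonneg_left (hone 2 r₀ (by linarith) hfin2) hKa.le
    | succ i ih =>
      intro hi
      have ih := ih (by omega)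
      have h2i : (1 : ℝ) ≤ 2 ^ i := one_le_pow₀ (by norm_num)
      have hri : r₀ ≤ 2 ^ i * r₀ := le_mul_of_one_le_left (by linarith) h2i
      have hri' : 2 ^ i * r₀ ≤ X ^ c := by
        refine le_trans ?_ hJ1
        gcongr
        · norm_num
        · omega
      have e : (2 : ℝ) ^ (i + 1) * r₀ = 2 * (2 ^ i * r₀) := by ring
      rw [e]
      set r := 2 ^ i * r₀
      have hr0 : 0 < r := by linarith
      have hp1 := hone 1 r hr0 hfin0
      have hp2 := hone 2 r hr0 hfin2
      rcases (H r hri).1 β hβ2.1.le hβ.2.le (hchi r hri hri') with h1 | h1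
      · refine h1.trans (le_mul_of_one_le_left ENNReal.toReal_nonneg ?_)
        exact Real.one_le_rpow hK1 ha0
      · set x := (Am 1 (β • κ.wc r)).toReal ^ a
        have hx0 : 0 < x := Real.rpow_pos_of_pos (by linarith) a
        have h2 : (Am 1 (β • κ.wc (2 * r))).toReal ^ a * x ≤
            (K ^ a * (Am 2 (β • κ.wc (2 * r))).toReal) * x := by
          calc _ ≤ (Am 1 (β • κ.wc (2 * r))).toReal ^ a * (K ^ a * (Am 2 (β • κ.wc r)).toReal) :=
                mul_le_mul_of_nonneg_left ih (Real.rpow_nonneg ENNReal.toReal_nonneg _)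
            _ = K ^ a * ((Am 1 (β • κ.wc (2 * r))).toReal ^ a * (Am 2 (β • κ.wc r)).toReal) := by
                ring
            _ ≤ K ^ a * (x * (Am 2 (β • κ.wc (2 * r))).toReal) :=
                mul_le_mul_of_nonneg_left h1 hKa.le
            _ = _ := by ring
        exact le_of_mul_le_mul_right h2 hx0
  have hkey := key J le_rfl
  set r := 2 ^ J * r₀ with hr
  have hrr₀ : r₀ ≤ r := le_mul_of_one_le_left (by linarith) (one_le_pow₀ (by norm_num))
  have hr0 : 0 < r := by linarith
  have hrX : X ^ c' ≤ r := by
    have : (2 : ℝ) ^ (J + 1) * r₀ = 2 * r := by rw [hr]; ring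
    linarith
  have hrs := rs_rc_le hβ.1.le hβ.2.le (H r hrr₀).2.2.1
  have hsmall : 4 * (rs (β • κ.rc r) * Am 1 (β • κ.wc r)) < 1 := by
    calc _ ≤ 4 * (ENNReal.ofReal (κ.betaC * r ^ (-α + η)) * ENNReal.ofReal X) :=
          mul_le_mul' le_rfl (mul_le_mul' hrs ((hle 1 r hr0).trans hA1.le))
      _ = ENNReal.ofReal (4 * (κ.betaC * r ^ (-α + η) * X)) := by
          rw [← ENNReal.ofReal_mul (mul_nonneg hbc.le (Real.rpow_nonneg hr0.le _)),
            ENNReal.ofReal_mul (p := 4) (by norm_num), ENNReal.ofReal_ofNat]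
      _ ≤ ENNReal.ofReal 2⁻¹ := by
          refine ENNReal.ofReal_le_ofReal ?_
          have e1 : r ^ (-α + η) * X ≤ X ^ (c' * (-α + η) + 1) := by
            rw [Real.rpow_add hX0, Real.rpow_one, Real.rpow_mul hX0.le]
            exact mul_le_mul_of_nonneg_right
              (Real.rpow_le_rpow_of_nonpos (by positivity) hrX hηα) hX0.le
          have e2 := mul_le_mul_of_nonneg_left e1 hbc.le
          rw [Real.rpow_zero] at hsm
          linarith
      _ < 1 := by
          rw [← ENNReal.ofReal_one]
          exact (ENNReal.ofReal_lt_ofReal_iff one_pos).2 (by norm_num)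
  have hfinr : Am 1 (β • κ.wc r) ≠ ∞ := ((hle 1 r hr0).trans_lt hfin0.lt_top).ne
  have h2 := Am_one_add_le_two (κ.smul_wc_nonneg hβ.1.le r)
    (smul_nonneg hβ.1.le (κ.rc_nonneg hr0)) ((κ.wc_TI r).smul β) ((κ.rc_TI r).smul β) hfinr hsmall
  rw [smul_wc_add_rc] at h2
  have h3 : X ≤ 2 * (Am 1 (β • κ.wc r)).toReal := by
    have := ENNReal.toReal_mono (ENNReal.mul_ne_top (by norm_num) hfinr) h2
    rwa [ENNReal.toReal_mul, ENNReal.toReal_ofNat, ← hXd] at this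
  have h4 : X ^ a ≤ 2 ^ a * (K ^ a * (Am 2 (β • κ.w0)).toReal) := by
    calc X ^ a ≤ (2 * (Am 1 (β • κ.wc r)).toReal) ^ a := Real.rpow_le_rpow hX0.le h3 ha0
      _ = 2 ^ a * (Am 1 (β • κ.wc r)).toReal ^ a := Real.mul_rpow (by norm_num) ENNReal.toReal_nonneg
      _ ≤ 2 ^ a * (K ^ a * (Am 2 (β • κ.wc r)).toReal) := by gcongr
      _ ≤ _ := by
          gcongr
          exact hle 2 r hr0
  have h5 : X ^ b ≤ (Am 2 (β • κ.w0)).toReal := by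
    have h6 : 0 < K ^ a * 2 ^ a := by positivity
    have h7 := hlast.trans h4
    rw [show (2 : ℝ) ^ a * (K ^ a * (Am 2 (β • κ.w0)).toReal) =
      K ^ a * 2 ^ a * (Am 2 (β • κ.w0)).toReal by ring] at h7
    exact le_of_mul_le_mul_left h7 h6
  exact ENNReal.ofReal_le_of_le_toReal h5

theorem Ctx.zeta_ge (h : κ.Ctx) (hP : κ.Poly) {ε : ℝ} (hε : 0 < ε) :
    ∀ᶠ β in nhdsWithin κ.betaC (Set.Iio κ.betaC),
      ENNReal.ofReal (κ.sus β ^ (min 2 (((d : ℝ) + α) / 2 / α) - ε)) * Am 1 (β • κ.w0) ≤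
        Am 2 (β • κ.w0) := by
  have hα := h.hα
  have hs1 := h.one_lt
  set θ := min 2 (((d : ℝ) + α) / 2 / α) with hθ
  have hθ0 : 0 < θ := lt_min (by norm_num) (by positivity)
  have hθ2 : θ ≤ 2 := min_le_left _ _
  have hθα : θ * α ≤ ((d : ℝ) + α) / 2 := by
    have := mul_le_mul_of_nonneg_right (min_le_right 2 (((d : ℝ) + α) / 2 / α)) hα.le
    rwa [div_mul_cancel₀ _ hα.ne'] at this
  have hm : 0 < min ε 1 := lt_min hε one_pos
  have hm1 := min_le_left ε 1
  have hm2 := min_le_right ε 1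
  have h1 := h.zeta_ge_of_lt hP (a := 1 + θ - min ε 1 / 2) (b := 1 + θ - ε)
    (by linarith) (by linarith) (by nlinarith) (by linarith)
  filter_upwards [h.eventually_pos, h1] with β hβ h2
  have hX := h.one_le_sus hβ.1 hβ.2
  have hX0 : 0 < κ.sus β := by linarith
  rw [h.ofReal_sus hβ.1 hβ.2, ← ENNReal.ofReal_mul (Real.rpow_nonneg hX0.le _)]
  refine le_trans (le_of_eq ?_) h2
  rw [show 1 + θ - ε = (θ - ε) + 1 by ring, Real.rpow_add hX0, Real.rpow_one]

end Kernel

theorem tendsto_log_div_log {ι : Type*} {l : Filter ι} {X : ι → ℝ} {F : ι → ℝ≥0∞} {t : ℝ}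
    (hX : Tendsto X l atTop) (hup : ∀ ε : ℝ, 0 < ε → ∀ᶠ i in l, F i ≤ ENNReal.ofReal (X i ^ (t + ε)))
    (hlow : ∀ ε : ℝ, 0 < ε → ∀ᶠ i in l, ENNReal.ofReal (X i ^ (t - ε)) ≤ F i) :
    Tendsto (fun i => Real.log (F i).toReal / Real.log (X i)) l (nhds t) := by
  refine Metric.tendsto_nhds.2 fun ε hε => ?_
  filter_upwards [hup _ (half_pos hε), hlow _ (half_pos hε), hX.eventually_gt_atTop 1]
    with i h1 h2 h3
  have hX0 : 0 < X i := by linarith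
  have hL : 0 < Real.log (X i) := Real.log_pos h3
  have h4 := ENNReal.toReal_le_of_le_ofReal (by positivity) h1
  have h5 := (ENNReal.ofReal_le_iff_le_toReal (h1.trans_lt ofReal_lt_top).ne).1 h2
  have h6 : 0 < (F i).toReal := lt_of_lt_of_le (by positivity) h5
  have h7 := Real.log_le_log h6 h4
  have h8 := Real.log_le_log (by positivity) h5
  rw [Real.log_rpow hX0] at h7 h8
  rw [Real.dist_eq, abs_lt, lt_sub_iff_add_lt, sub_lt_iff_lt_add, lt_div_iff₀ hL, div_lt_iff₀ hL]
  constructor <;> nlinarith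

namespace Kernel
variable {d : ℕ} {α : ℝ} {κ : Kernel d α}

theorem Ctx.tendsto_log_sus (h : κ.Ctx) :
    Tendsto (fun β => Real.log (κ.sus β)) (nhdsWithin κ.betaC (Set.Iio κ.betaC)) atTop :=
  Real.tendsto_log_atTop.comp h.tendsto_sus

theorem Ctx.log_chi (h : κ.Ctx) :
    (fun β => Real.log (κ.chi β).toReal) =ᶠ[nhdsWithin κ.betaC (Set.Iio κ.betaC)]
      fun β => Real.log (κ.sus β) := by
  filter_upwards [h.eventually_pos] with β hβ
  rw [chi, κ.mom_eq hβ.1.le, sus]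

theorem Ctx.hasExp_iff (h : κ.Ctx) {F : ℝ → ℝ≥0∞} {t : ℝ} (ht : t ≠ 0)
    (hF : Tendsto (fun β => Real.log (F β).toReal / Real.log (κ.sus β))
      (nhdsWithin κ.betaC (Set.Iio κ.betaC)) (nhds t)) (c : ℝ) :
    κ.HasExp F (t * c) ↔ κ.HasExp (fun β => κ.chi β) c := by
  have hpos := h.tendsto_log_sus.eventually_ne_atTop 0
  constructor
  · intro h1
    have h2 := Tendsto.div h1 hF ht
    rw [mul_div_cancel_left₀ _ ht] at h2
    refine h2.congr' ?_
    filter_upwards [h.log_chi, hpos, hF.eventually_ne ht] with β h3 h4 h5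
    rw [h3]
    have h6 : Real.log (F β).toReal ≠ 0 := fun h6 => h5 (by rw [h6, zero_div])
    simp only [Pi.div_apply]
    field_simp
  · intro h1
    refine (hF.mul h1).congr' ?_
    filter_upwards [h.log_chi, hpos] with β h3 h4
    rw [h3]
    field_simp

theorem Ctx.log_xi (h : κ.Ctx) (hP : κ.Poly) {p : ℝ} (hp : 0 < p) (hp1 : p ≤ 1) (hpα : p < α) :
    Tendsto (fun β => Real.log (κ.xiFull β p).toReal / Real.log (κ.sus β))
      (nhdsWithin κ.betaC (Set.Iio κ.betaC)) (nhds α⁻¹) := by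
  have hα := h.hα
  have h1 : Tendsto (fun β => Real.log (gy (ep p) (β • κ.w0) / Am 1 (β • κ.w0)).toReal /
      Real.log (κ.sus β)) (nhdsWithin κ.betaC (Set.Iio κ.betaC)) (nhds (p / α)) := by
    refine tendsto_log_div_log h.tendsto_sus (fun ε hε => ?_) (fun ε hε => ?_)
    · filter_upwards [h.eventually_pos, h.gy_upper hP hp hp1 hpα (half_pos hε),
        h.tendsto_sus.eventually (eventually_mul_rpow_le ((d : ℝ) ^ p)
          (show p / α + ε / 2 < p / α + ε by linarith))] with β hβ h1 h2
      refine ENNReal.div_le_of_le_mul ?_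
      calc _ ≤ _ := gy_ep_le_norm h.hd (κ.smul_w0_nonneg hβ.1.le) hp.le
        _ ≤ _ := mul_le_mul' le_rfl h1
        _ = ENNReal.ofReal ((d : ℝ) ^ p * κ.sus β ^ (p / α + ε / 2)) * Am 1 (β • κ.w0) := by
          rw [← mul_assoc, ENNReal.ofReal_mul (by positivity)]
        _ ≤ _ := mul_le_mul' (ENNReal.ofReal_le_ofReal h2) le_rfl
    · filter_upwards [h.eventually_pos, h.gy_lower hP hp hε] with β hβ h1
      have hw := κ.smul_w0_nonneg hβ.1.le
      rw [ENNReal.le_div_iff_mul_le (Or.inl (one_pos.trans_le (one_le_Am hw 1)).ne')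
        (Or.inl (κ.Am_one_ne_top hβ.1.le hβ.2))]
      exact h1.trans (gy_norm_le_ep hw hp.le)
  have h2 := h1.const_mul (1 / p)
  rw [show 1 / p * (p / α) = α⁻¹ by field_simp] at h2
  refine h2.congr' ?_
  have hne : p / α ≠ 0 := by positivity
  filter_upwards [h.eventually_pos, h1.eventually_ne hne] with β hβ h3
  rw [κ.xiFull_eq hβ.1.le, ← ENNReal.toReal_rpow]
  have h4 : (gy (ep p) (β • κ.w0) / Am 1 (β • κ.w0)).toReal ≠ 0 := fun h4 => h3 (by
    rw [h4, Real.log_zero, zero_div])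
  rw [Real.log_rpow (lt_of_le_of_ne ENNReal.toReal_nonneg h4.symm), mul_div_assoc]

theorem Ctx.log_zeta (h : κ.Ctx) (hP : κ.Poly) :
    Tendsto (fun β => Real.log (κ.zeta β).toReal / Real.log (κ.sus β))
      (nhdsWithin κ.betaC (Set.Iio κ.betaC)) (nhds (min 2 (((d : ℝ) + α) / 2 / α))) := by
  refine tendsto_log_div_log h.tendsto_sus (fun ε hε => ?_) (fun ε hε => ?_)
  · filter_upwards [h.eventually_pos, h.zeta_le_one, h.zeta_le_two hP hε] with β hβ h1 h2
    rw [zeta, κ.mom_eq hβ.1.le, κ.mom_eq hβ.1.le]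
    refine ENNReal.div_le_of_le_mul ?_
    rcases min_cases 2 (((d : ℝ) + α) / 2 / α) with ⟨h3, -⟩ | ⟨h3, -⟩
    · rw [h3]
      exact h1.trans (mul_le_mul' (ENNReal.ofReal_le_ofReal
        (Real.rpow_le_rpow_of_exponent_le (h.one_le_sus hβ.1 hβ.2) (by linarith))) le_rfl)
    · rw [h3]; exact h2
  · filter_upwards [h.eventually_pos, h.zeta_ge hP hε] with β hβ h1
    rw [zeta, κ.mom_eq hβ.1.le, κ.mom_eq hβ.1.le,
      ENNReal.le_div_iff_mul_le (Or.inl (one_pos.trans_le (one_le_Am (κ.smul_w0_nonneg hβ.1.le) 1)).ne')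
        (Or.inl (κ.Am_one_ne_top hβ.1.le hβ.2))]
    exact h1

theorem exists_J_pos (hd : 1 ≤ d) (hα : 0 < α) : ∃ x : V d, x ≠ 0 ∧ 0 < κ.J (κ.nr x) := by
  refine ⟨Pi.single ⟨0, hd⟩ 1, fun h => by simpa using congrFun h ⟨0, hd⟩, ?_⟩
  set x : V d := Pi.single ⟨0, hd⟩ 1 with hx
  have hx0 : x ≠ 0 := fun h => by simpa [hx] using congrFun h ⟨0, hd⟩
  have ht := κ.nr_pos hx0
  obtain ⟨r₁, h1, hb⟩ := κ.exists_J'_bounds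
  by_contra! hcon
  set r := max (κ.nr x) r₁ + 1 with hr
  have hrx : κ.nr x < r := by linarith [le_max_left (κ.nr x) r₁]
  have hr1 : r₁ ≤ r := by linarith [le_max_right (κ.nr x) r₁]
  have hr0 : 0 < r := by linarith
  have hz : ∀ y, κ.nr x < y → κ.J y = 0 := fun y hy =>
    le_antisymm ((κ.J_anti ht (ht.trans hy) hy.le).trans hcon) (κ.J_nonneg y (ht.trans hy))
  have h2 : HasDerivAt κ.J 0 r := (hasDerivAt_const r (0 : ℝ)).congr_of_eventuallyEq (by
    filter_upwards [lt_mem_nhds hrx] with y hy using hz y hy)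
  have h3 := (κ.J_hasDeriv r hr0).unique h2
  have h4 := (hb r hr1).1
  have h5 := Real.rpow_pos_of_pos hr0 (-((d : ℝ) + α) - 1)
  linarith

theorem not_isPerc (hd : 1 ≤ d) (hα : 0 < α) {β : ℝ} (hβ : β < 0) (μ : Measure (Config d)) :
    ¬ IsPerc μ (κ.edgeP β) := by
  rintro ⟨h1, h2⟩
  obtain ⟨x, hx, hJ⟩ := κ.exists_J_pos hd hα
  have h3 := h2 {s(x, 0)} (fun _ => false)
  rw [Finset.prod_singleton, edgeP_eq] at h3
  have h4 : κ.w0 s(x, 0) = κ.J (κ.nr x) := by rw [w0_mk, if_neg hx, sub_zero]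
  have h5 : 1 < ENNReal.ofReal (1 - edgeProb ((β • κ.w0) s(x, 0))) := by
    rw [← ENNReal.ofReal_one, Pi.smul_apply, smul_eq_mul, h4, edgeProb, _root_.sub_sub_cancel]
    refine (ENNReal.ofReal_lt_ofReal_iff (Real.exp_pos _)).2 (Real.one_lt_exp_iff.2 ?_)
    linarith [mul_neg_of_neg_of_pos hβ hJ]
  have h6 : μ {ω | ∀ e ∈ ({s(x, 0)} : Finset (Sym2 (V d))), ω e = false} ≤ 1 := prob_le_one
  simp only [Bool.false_eq_true, if_false] at h3
  exact absurd (h3 ▸ h6) (not_le.2 h5)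

theorem hasExp_zero_of_betaC_eq_zero (hc : κ.betaC = 0) {F : ℝ → ℝ≥0∞}
    (hF : ∀ β, β < 0 → F β = 0) : κ.HasExp F 0 := by
  refine tendsto_const_nhds.congr' ?_
  filter_upwards [self_mem_nhdsWithin] with β hβ
  rw [hF β (by simpa [hc] using hβ)]
  simp

end Kernel
/-- Suppose (CL) holds.  If at least one of the critical exponents
`γ`, `ν`, `Δ` is well-defined then all three are well-defined and satisfy the scaling
relations `γ = (2-η)ν` and `Δ = ν d_f`, where `2 - η = α` and
`d_f = min {(d+α)/2, 2α}`. -/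
theorem statement7 (d : ℕ) (α : ℝ) (hd : 1 ≤ d) (hα : 0 < α) (κ : Kernel d α)
    (hCL : κ.CL)
    (hone :
      (∃ g : ℝ, κ.HasExp (fun β => κ.chi β) g) ∨
      (∃ v : ℝ, ∃ p₀ : ℝ, 0 < p₀ ∧ ∀ p : ℝ, 0 < p → p < p₀ →
        κ.HasExp (fun β => κ.xiFull β p) v) ∨
      (∃ D : ℝ, κ.HasExp (fun β => κ.zeta β) D)) :
    ∃ g v D : ℝ,
      κ.HasExp (fun β => κ.chi β) g ∧
      (∃ p₀ : ℝ, 0 < p₀ ∧ ∀ p : ℝ, 0 < p → p < p₀ →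
        κ.HasExp (fun β => κ.xiFull β p) v) ∧
      κ.HasExp (fun β => κ.zeta β) D ∧
      g = α * v ∧ D = v * min (((d : ℝ) + α) / 2) (2 * α) := by
  rcases κ.betaC_nonneg.eq_or_lt' with hc | hc
  · have hmom : ∀ k β, β < 0 → κ.mom β k = 0 := fun k β hβ => by
      refine le_antisymm (iSup₂_le fun μ hμ => ?_) (zero_le)
      exact absurd hμ (Kernel.not_isPerc hd hα hβ μ)
    refine ⟨0, 0, 0, Kernel.hasExp_zero_of_betaC_eq_zero hc (hmom 1),
      ⟨1, one_pos, fun p _ _ => Kernel.hasExp_zero_of_betaC_eq_zero hc fun β hβ => ?_⟩,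
      Kernel.hasExp_zero_of_betaC_eq_zero hc fun β hβ => ?_, (mul_zero α).symm, (zero_mul _).symm⟩
    · refine le_antisymm (iSup₂_le fun μ hμ => ?_) (zero_le)
      exact absurd hμ (Kernel.not_isPerc hd hα hβ μ)
    · rw [Kernel.zeta, hmom 2 β hβ, ENNReal.zero_div]
  have h : κ.Ctx := ⟨hd, hα, hCL, hc⟩
  have hP : κ.Poly := h.poly (h.chi_upper hone)
  set θ := min 2 (((d : ℝ) + α) / 2 / α) with hθ
  have hθ0 : θ ≠ 0 := (lt_min (by norm_num) (by positivity) : 0 < θ).ne'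
  have hα' : α⁻¹ ≠ 0 := inv_ne_zero hα.ne'
  have hzeta := h.hasExp_iff hθ0 (h.log_zeta hP)
  have hxi : ∀ {p : ℝ}, 0 < p → p < min 1 α → ∀ c,
      κ.HasExp (fun β => κ.xiFull β p) (α⁻¹ * c) ↔ κ.HasExp (fun β => κ.chi β) c := fun hp hp1 =>
    h.hasExp_iff hα' (h.log_xi hP hp (hp1.le.trans (min_le_left _ _))
      (hp1.trans_le (min_le_right _ _)))
  have hm : 0 < min 1 α := lt_min one_pos hα
  obtain ⟨g, hg⟩ : ∃ g : ℝ, κ.HasExp (fun β => κ.chi β) g := by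
    rcases hone with hg | ⟨v, p₀, hp₀, hv⟩ | ⟨D, hD⟩
    · exact hg
    · obtain ⟨p, hp, hp1⟩ := exists_between (lt_min hp₀ hm)
      refine ⟨α * v, (hxi hp (hp1.trans_le (min_le_right _ _)) _).1 ?_⟩
      rw [inv_mul_cancel_left₀ hα.ne']
      exact hv p hp (hp1.trans_le (min_le_left _ _))
    · refine ⟨θ⁻¹ * D, (hzeta _).1 ?_⟩
      rwa [mul_inv_cancel_left₀ hθ0]
  refine ⟨g, α⁻¹ * g, θ * g, hg, ⟨min 1 α, hm, fun p hp hp1 => (hxi hp hp1 g).2 hg⟩,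
    (hzeta g).2 hg, (mul_inv_cancel_left₀ hα.ne' g).symm, ?_⟩
  have hmin : min (((d : ℝ) + α) / 2) (2 * α) = θ * α := by
    rw [hθ, min_mul_of_nonneg _ _ hα.le, div_mul_cancel₀ _ hα.ne', min_comm]
  rw [hmin]
  field_simp

end LRP
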